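/- Assume Hypotheses (H). For every pair α,β ∈ [0,3] with α ≤ β there exists a constant C = C(α,β) > 0 such that for every s ∈ [0,T), every f ∈ C^α_b(ℝ^N), and the unique bounded classical solution u of D_t u = 𝒜u on (s,T]×ℝ^N with u(s,·) = f, one has ‖u(t,·)‖_{C^β_b(ℝ^N)} ≤ C (t−s)^{−(β−α)/2} ‖f‖_{C^α_b(ℝ^N)} for every t ∈ (s,T]. -/

import Mathlib

open Set Filter MeasureTheory Metric
open scoped Topology ENNReal RealInnerProductSpace Classical

noncomputable section

/-- `ℝ^N` with the Euclidean norm. -/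
abbrev ES (N : ℕ) := EuclideanSpace ℝ (Fin N)

/-- First-order partial derivative `D_i f` in the `i`-th coordinate direction. -/
def pd1 {N : ℕ} (f : ES N → ℝ) (i : Fin N) : ES N → ℝ :=
  fun x => fderiv ℝ f x (EuclideanSpace.single i 1)

/-- Second-order partial derivative `D_{ij} f`. -/
def pd2 {N : ℕ} (f : ES N → ℝ) (i j : Fin N) : ES N → ℝ := pd1 (pd1 f j) i

/-- Third-order partial derivative `D_{ijk} f`. -/
def pd3 {N : ℕ} (f : ES N → ℝ) (i j k : Fin N) : ES N → ℝ := pd1 (pd2 f j k) i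

/-- The nonautonomous elliptic operator
`(𝒜 φ)(t,x) = ∑ᵢⱼ qᵢⱼ(t,x) Dᵢⱼφ(x) + ∑ⱼ bⱼ(t,x) Dⱼφ(x) + c(t,x) φ(x)`. -/
def Aop {N : ℕ} (q : ℝ → ES N → Fin N → Fin N → ℝ) (b : ℝ → ES N → Fin N → ℝ)
    (c : ℝ → ES N → ℝ) (φ : ES N → ℝ) (t : ℝ) (x : ES N) : ℝ :=
  (∑ i, ∑ j, q t x i j * pd2 φ i j x) + (∑ j, b t x j * pd1 φ j x) + c t x * φ x

/-- Membership in the parabolic Hölder space `C^{δ/2,δ}([0,T] × B(0,R))`. -/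
def ParabolicHolderOn {N : ℕ} (T δ R : ℝ) (h : ℝ → ES N → ℝ) : Prop :=
  ∃ C : ℝ, ∀ t ∈ Icc (0:ℝ) T, ∀ s ∈ Icc (0:ℝ) T,
    ∀ x ∈ closedBall (0 : ES N) R, ∀ y ∈ closedBall (0 : ES N) R,
      |h t x - h s y| ≤ C * (|t - s| + ‖x - y‖ ^ 2) ^ (δ / 2)

/-- Hypotheses (H) of Lorenzi's paper (smooth unbounded coefficients). -/
structure Hyp (N : ℕ) (T : ℝ) (q : ℝ → ES N → Fin N → Fin N → ℝ)
    (b : ℝ → ES N → Fin N → ℝ) (c : ℝ → ES N → ℝ) where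
  T_pos : 0 < T
  N_pos : 1 ≤ N
  /- (i) smoothness in space and parabolic Hölder regularity up to third-order
     spatial derivatives on `[0,T] × B(0,R)` for every `R`. -/
  δ : ℝ
  δ_mem : δ ∈ Ioo (0:ℝ) 1
  smooth_q : ∀ t ∈ Icc (0:ℝ) T, ∀ i j, ContDiff ℝ 3 fun x => q t x i j
  smooth_b : ∀ t ∈ Icc (0:ℝ) T, ∀ j, ContDiff ℝ 3 fun x => b t x j
  smooth_c : ∀ t ∈ Icc (0:ℝ) T, ContDiff ℝ 3 fun x => c t x
  holder_q : ∀ R > 0, ∀ i j, ParabolicHolderOn T δ R fun t x => q t x i j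
  holder_q1 : ∀ R > 0, ∀ i j k, ParabolicHolderOn T δ R fun t x => pd1 (fun y => q t y i j) k x
  holder_q2 : ∀ R > 0, ∀ i j k l, ParabolicHolderOn T δ R fun t x => pd2 (fun y => q t y i j) k l x
  holder_q3 : ∀ R > 0, ∀ i j k l m, ParabolicHolderOn T δ R fun t x => pd3 (fun y => q t y i j) k l m x
  holder_b : ∀ R > 0, ∀ j, ParabolicHolderOn T δ R fun t x => b t x j
  holder_b1 : ∀ R > 0, ∀ j k, ParabolicHolderOn T δ R fun t x => pd1 (fun y => b t y j) k x
  holder_b2 : ∀ R > 0, ∀ j k l, ParabolicHolderOn T δ R fun t x => pd2 (fun y => b t y j) k l x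
  holder_b3 : ∀ R > 0, ∀ j k l m, ParabolicHolderOn T δ R fun t x => pd3 (fun y => b t y j) k l m x
  holder_c : ∀ R > 0, ParabolicHolderOn T δ R c
  holder_c1 : ∀ R > 0, ∀ k, ParabolicHolderOn T δ R fun t x => pd1 (c t) k x
  holder_c2 : ∀ R > 0, ∀ k l, ParabolicHolderOn T δ R fun t x => pd2 (c t) k l x
  holder_c3 : ∀ R > 0, ∀ k l m, ParabolicHolderOn T δ R fun t x => pd3 (c t) k l m x
  /- (ii) symmetry and (uniform) ellipticity. -/
  q_symm : ∀ t ∈ Icc (0:ℝ) T, ∀ x i j, q t x i j = q t x j i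
  ν : ℝ → ES N → ℝ
  ν₀ : ℝ
  ν₀_pos : 0 < ν₀
  ν_lb : ∀ t ∈ Icc (0:ℝ) T, ∀ x, ν₀ ≤ ν t x
  ellip : ∀ t ∈ Icc (0:ℝ) T, ∀ x, ∀ ξ : ES N, ν t x * ‖ξ‖ ^ 2 ≤ ∑ i, ∑ j, q t x i j * ξ i * ξ j
  /- (iii) growth conditions. -/
  C₁ : ℝ
  C₂ : ℝ
  C₃ : ℝ
  C₁_pos : 0 < C₁
  C₂_pos : 0 < C₂
  C₃_pos : 0 < C₃
  growth_Q : ∀ t ∈ Icc (0:ℝ) T, ∀ x,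
    ‖(EuclideanSpace.equiv (Fin N) ℝ).symm fun i => ∑ j, q t x i j * x j‖
      ≤ C₁ * (1 + ‖x‖ ^ 2) * ν t x
  growth_tr : ∀ t ∈ Icc (0:ℝ) T, ∀ x, (∑ i, q t x i i) ≤ C₂ * (1 + ‖x‖ ^ 2) * ν t x
  growth_b : ∀ t ∈ Icc (0:ℝ) T, ∀ x, (∑ j, b t x j * x j) ≤ C₃ * (1 + ‖x‖ ^ 2) * ν t x
  /- (iv) `c` is bounded from above. -/
  c₀ : ℝ
  c_ub : ∀ t ∈ Icc (0:ℝ) T, ∀ x, c t x ≤ c₀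
  /- (v) bounds on the derivatives of the diffusion coefficients. -/
  K₁ : ℝ
  K₂ : ℝ
  K₃ : ℝ
  K₁_pos : 0 < K₁
  K₂_pos : 0 < K₂
  K₃_pos : 0 < K₃
  dq1_bound : ∀ t ∈ Icc (0:ℝ) T, ∀ x i j k, |pd1 (fun y => q t y i j) k x| ≤ K₁ * ν t x
  dq3_bound : ∀ t ∈ Icc (0:ℝ) T, ∀ x i j k l m, |pd3 (fun y => q t y i j) k l m x| ≤ K₃ * ν t x
  dq2_quad : ∀ t ∈ Icc (0:ℝ) T, ∀ x, ∀ Ξ : Fin N → Fin N → ℝ, (∀ h k, Ξ h k = Ξ k h) →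
    (∑ h, ∑ k, ∑ l, ∑ m, pd2 (fun y => q t y h k) l m x * Ξ h k * Ξ l m)
      ≤ K₂ * ν t x * ∑ h, ∑ k, Ξ h k ^ 2
  /- (vi) dissipativity and bounds on the derivatives of the drift and of `c`. -/
  d : ℝ → ES N → ℝ
  r : ℝ → ES N → ℝ
  ϱ : ℝ → ES N → ℝ
  ϱ₀ : ℝ
  ϱ₀_pos : 0 < ϱ₀
  ϱ_lb : ∀ t ∈ Icc (0:ℝ) T, ∀ x, ϱ₀ ≤ ϱ t x
  L₁ : ℝ
  L₂ : ℝ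
  L₃ : ℝ
  L₁_pos : 0 < L₁
  L₂_pos : 0 < L₂
  L₃_pos : 0 < L₃
  dissip : ∀ t ∈ Icc (0:ℝ) T, ∀ x, ∀ ξ : ES N,
    (∑ i, ∑ j, pd1 (fun y => b t y i) j x * ξ j * ξ i) ≤ d t x * ‖ξ‖ ^ 2
  db2_bound : ∀ t ∈ Icc (0:ℝ) T, ∀ x j k l, |pd2 (fun y => b t y j) k l x| ≤ r t x
  db3_bound : ∀ t ∈ Icc (0:ℝ) T, ∀ x j k l m, |pd3 (fun y => b t y j) k l m x| ≤ r t x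
  dc1_bound : ∀ t ∈ Icc (0:ℝ) T, ∀ x k, |pd1 (c t) k x| ≤ ϱ t x
  dc2_bound : ∀ t ∈ Icc (0:ℝ) T, ∀ x k l, |pd2 (c t) k l x| ≤ ϱ t x
  dc3_bound : ∀ t ∈ Icc (0:ℝ) T, ∀ x k l m, |pd3 (c t) k l m x| ≤ ϱ t x
  funz : ∀ t ∈ Icc (0:ℝ) T, ∀ x, d t x + L₁ * r t x + L₂ * ϱ t x ^ 2 ≤ L₃ * ν t x
  /- (vii) existence of a Lyapunov function. -/
  liap : ∃ φ : ES N → ℝ, ∃ lam : ℝ, 0 < lam ∧ (∀ x, 0 < φ x) ∧ ContDiff ℝ 2 φ ∧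
    Tendsto φ (cocompact (ES N)) atTop ∧
    ∃ M : ℝ, ∀ t ∈ Icc (0:ℝ) T, ∀ x, Aop q b c φ t x - lam * φ x ≤ M

/-- `u` is a bounded classical solution on `[s,τ] × ℝ^N` of the homogeneous Cauchy problem
`D_t u = 𝒜 u`, `u(s,·) = f`: it is bounded and continuous on `[s,τ] × ℝ^N`, continuously
differentiable once in time and twice in space on `(s,τ] × ℝ^N`, satisfies the equation there
and attains the initial datum `f` at time `s`. -/
def IsBCSol {N : ℕ} (q : ℝ → ES N → Fin N → Fin N → ℝ) (b : ℝ → ES N → Fin N → ℝ)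
    (c : ℝ → ES N → ℝ) (s τ : ℝ) (f : ES N → ℝ) (u : ℝ → ES N → ℝ) : Prop :=
  (∃ M, ∀ t ∈ Icc s τ, ∀ x, |u t x| ≤ M) ∧
  ContinuousOn (fun p : ℝ × ES N => u p.1 p.2) (Icc s τ ×ˢ univ) ∧
  (∀ t ∈ Ioc s τ, ContDiff ℝ 2 (u t)) ∧
  (∀ x, ∀ t ∈ Ioc s τ, DifferentiableAt ℝ (fun t' => u t' x) t) ∧
  ContinuousOn (fun p : ℝ × ES N => deriv (fun t' => u t' p.2) p.1) (Ioc s τ ×ˢ univ) ∧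
  (∀ i, ContinuousOn (fun p : ℝ × ES N => pd1 (u p.1) i p.2) (Ioc s τ ×ˢ univ)) ∧
  (∀ i j, ContinuousOn (fun p : ℝ × ES N => pd2 (u p.1) i j p.2) (Ioc s τ ×ˢ univ)) ∧
  (∀ t ∈ Ioc s τ, ∀ x, deriv (fun t' => u t' x) t = Aop q b c (u t) t x) ∧
  (∀ x, u s x = f x)

/-- `u` is a bounded classical solution on `[0,T] × ℝ^N` of the nonhomogeneous Cauchy problem
`D_t u = 𝒜 u + g`, `u(0,·) = f`, continuously differentiable once in time and twice in space
on all of `[0,T] × ℝ^N`. -/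
def IsBCSolInhom {N : ℕ} (q : ℝ → ES N → Fin N → Fin N → ℝ) (b : ℝ → ES N → Fin N → ℝ)
    (c : ℝ → ES N → ℝ) (T : ℝ) (f : ES N → ℝ) (g : ℝ → ES N → ℝ) (u : ℝ → ES N → ℝ) : Prop :=
  (∃ M, ∀ t ∈ Icc (0:ℝ) T, ∀ x, |u t x| ≤ M) ∧
  (∀ t ∈ Icc (0:ℝ) T, ContDiff ℝ 2 (u t)) ∧
  (∀ x, ∀ t ∈ Icc (0:ℝ) T, DifferentiableWithinAt ℝ (fun t' => u t' x) (Icc (0:ℝ) T) t) ∧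
  ContinuousOn (fun p : ℝ × ES N => derivWithin (fun t' => u t' p.2) (Icc (0:ℝ) T) p.1)
    (Icc (0:ℝ) T ×ˢ univ) ∧
  (∀ i, ContinuousOn (fun p : ℝ × ES N => pd1 (u p.1) i p.2) (Icc (0:ℝ) T ×ˢ univ)) ∧
  (∀ i j, ContinuousOn (fun p : ℝ × ES N => pd2 (u p.1) i j p.2) (Icc (0:ℝ) T ×ˢ univ)) ∧
  (∀ t ∈ Icc (0:ℝ) T, ∀ x,
    derivWithin (fun t' => u t' x) (Icc (0:ℝ) T) t = Aop q b c (u t) t x + g t x) ∧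
  (∀ x, u 0 x = f x)

/-- Extended-real sup norm of the `k`-th derivative. -/
def supNormE {N : ℕ} (k : ℕ) (f : ES N → ℝ) : ℝ≥0∞ :=
  ⨆ x : ES N, ENNReal.ofReal ‖iteratedFDeriv ℝ k f x‖

/-- Extended-real `γ`-Hölder seminorm of the `k`-th derivative. -/
def holderSemiE {N : ℕ} (k : ℕ) (γ : ℝ) (f : ES N → ℝ) : ℝ≥0∞ :=
  ⨆ (x : ES N) (y : ES N) (_ : x ≠ y),
    ENNReal.ofReal (‖iteratedFDeriv ℝ k f x - iteratedFDeriv ℝ k f y‖ / ‖x - y‖ ^ γ)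

/-- The `C^α_b(ℝ^N)` norm (valued in `[0,∞]`): sup norms of the derivatives up to order `⌊α⌋`
plus, when `α ∉ ℕ`, the `(α-⌊α⌋)`-Hölder seminorm of the `⌊α⌋`-th order derivatives. -/
def CbNorm {N : ℕ} (α : ℝ) (f : ES N → ℝ) : ℝ≥0∞ :=
  (∑ k ∈ Finset.range (⌊α⌋₊ + 1), supNormE k f) +
    (if (⌊α⌋₊ : ℝ) = α then 0 else holderSemiE ⌊α⌋₊ (α - ⌊α⌋₊) f)

/-- Membership in `C^α_b(ℝ^N)`. -/
def MemCb {N : ℕ} (α : ℝ) (f : ES N → ℝ) : Prop :=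
  ContDiff ℝ (⌊α⌋₊ : ℕ) f ∧ CbNorm α f ≠ ⊤


/-! ### Directional derivatives of smooth functions -/

/-- Smooth functions. -/
abbrev Sm {W : Type*} [NormedAddCommGroup W] [NormedSpace ℝ W]
    {F : Type*} [NormedAddCommGroup F] [NormedSpace ℝ F] (f : W → F) : Prop :=
  ContDiff ℝ ((⊤ : ℕ∞) : WithTop ℕ∞) f

/-- Derivative in the direction `v`. -/
def dd {W : Type*} [NormedAddCommGroup W] [NormedSpace ℝ W] (v : W) (F : W → ℝ) : W → ℝ :=
  fun x => fderiv ℝ F x v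

/-- The standard basis vector. -/
abbrev bs {N : ℕ} (i : Fin N) : ES N := EuclideanSpace.single i 1

lemma pd1_eq_dd {N : ℕ} (f : ES N → ℝ) (i : Fin N) : pd1 f i = dd (bs i) f := rfl

section dd
variable {W : Type*} [NormedAddCommGroup W] [NormedSpace ℝ W]

lemma Sm.diff {F : W → ℝ} (h : Sm F) : Differentiable ℝ F :=
  ContDiff.differentiable h (by simp)

lemma Sm.dd {F : W → ℝ} (h : Sm F) (v : W) : Sm (dd v F) := by
  have : Sm (fderiv ℝ F) := ContDiff.fderiv_right h (by norm_cast)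
  exact this.clm_apply contDiff_const

lemma dd_add_of {F G : W → ℝ} (hF : Differentiable ℝ F) (hG : Differentiable ℝ G) (v : W) :
    dd v (fun x => F x + G x) = fun x => dd v F x + dd v G x := by
  funext x; simp only [dd]; rw [fderiv_fun_add (hF x) (hG x)]; rfl

lemma dd_sub_of {F G : W → ℝ} (hF : Differentiable ℝ F) (hG : Differentiable ℝ G) (v : W) :
    dd v (fun x => F x - G x) = fun x => dd v F x - dd v G x := by
  funext x; simp only [dd]; rw [fderiv_fun_sub (hF x) (hG x)]; rfl

lemma dd_mul_of {F G : W → ℝ} (hF : Differentiable ℝ F) (hG : Differentiable ℝ G) (v : W) :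
    dd v (fun x => F x * G x) = fun x => dd v F x * G x + F x * dd v G x := by
  funext x; simp only [dd]; rw [fderiv_fun_mul (hF x) (hG x)]; simp; ring

lemma dd_const (c : ℝ) (v : W) : dd v (fun _ : W => c) = fun _ => 0 := by
  funext x; simp [dd]

lemma dd_smul_of {F : W → ℝ} (hF : Differentiable ℝ F) (c : ℝ) (v : W) :
    dd v (fun x => c * F x) = fun x => c * dd v F x := by
  funext x; simp only [dd]; rw [fderiv_const_mul (hF x)]; rfl

lemma dd_sum_of {ι : Type*} (s : Finset ι) {F : ι → W → ℝ} (hF : ∀ i, Differentiable ℝ (F i))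
    (v : W) : dd v (fun x => ∑ i ∈ s, F i x) = fun x => ∑ i ∈ s, dd v (F i) x := by
  funext x; simp only [dd]; rw [fderiv_fun_sum (fun i _ => hF i x)]; simp

lemma dd_comm_of {F : W → ℝ} (h : ContDiff ℝ 2 F) (v w : W) :
    dd v (dd w F) = dd w (dd v F) := by
  funext x
  have hs : IsSymmSndFDerivAt ℝ F x := (h.contDiffAt).isSymmSndFDerivAt (by simp)
  have hd : DifferentiableAt ℝ (fderiv ℝ F) x :=
    (h.fderiv_right (m := 1) (by norm_num)).differentiable (by simp) x
  have key : ∀ v w, dd v (dd w F) x = fderiv ℝ (fderiv ℝ F) x v w := by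
    intro v w
    have h2 : HasFDerivAt (fun y => fderiv ℝ F y w) _ x :=
      hd.hasFDerivAt.clm_apply (hasFDerivAt_const w x)
    change fderiv ℝ (fun y => fderiv ℝ F y w) x v = _
    rw [h2.fderiv]
    simp
  rw [key, key]; exact hs v w

lemma Sm.two {F : W → ℝ} (h : Sm F) : ContDiff ℝ 2 F := ContDiff.of_le h (by norm_cast)

lemma dd_comm {F : W → ℝ} (h : Sm F) (v w : W) : dd v (dd w F) = dd w (dd v F) :=
  dd_comm_of h.two v w

lemma ES_sum_bs {N : ℕ} (z : ES N) : z = ∑ j, z j • bs j := by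
  ext i
  simp [Finset.sum_apply, Pi.single_apply]

lemma fderiv_eq_sum {N : ℕ} (g : ES N → ℝ) (y z : ES N) :
    fderiv ℝ g y z = ∑ j, z j * dd (bs j) g y := by
  conv_lhs => rw [ES_sum_bs z]
  simp [dd]

lemma ES_apply_hasFDerivAt {N : ℕ} {Ψ : W → ES N} {w : W} (hΨ : DifferentiableAt ℝ Ψ w) (v : W)
    (j : Fin N) : dd v (fun w => Ψ w j) w = (fderiv ℝ Ψ w v) j := by
  have h1 : HasFDerivAt (fun w => Ψ w j)
      ((EuclideanSpace.proj j : ES N →L[ℝ] ℝ).comp (fderiv ℝ Ψ w)) w :=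
    (EuclideanSpace.proj j : ES N →L[ℝ] ℝ).hasFDerivAt.comp w hΨ.hasFDerivAt
  simp only [dd]; rw [h1.fderiv]; simp

lemma dd_comp_of {N : ℕ} {g : ES N → ℝ} {Ψ : W → ES N} (hg : Differentiable ℝ g)
    (hΨ : Differentiable ℝ Ψ) (v : W) :
    dd v (fun w => g (Ψ w)) = fun w => ∑ j, dd (bs j) g (Ψ w) * dd v (fun w => Ψ w j) w := by
  funext w
  have h1 : HasFDerivAt (fun w => g (Ψ w)) ((fderiv ℝ g (Ψ w)).comp (fderiv ℝ Ψ w)) w :=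
    (hg _).hasFDerivAt.comp w (hΨ w).hasFDerivAt
  have : dd v (fun w => g (Ψ w)) w = fderiv ℝ g (Ψ w) (fderiv ℝ Ψ w v) := by
    simp only [dd]; rw [h1.fderiv]; rfl
  rw [this, fderiv_eq_sum]
  refine Finset.sum_congr rfl fun j _ => ?_
  rw [ES_apply_hasFDerivAt (hΨ w)]; ring

lemma Sm.comp_apply {N : ℕ} {Ψ : W → ES N} (h : Sm Ψ) (j : Fin N) : Sm (fun w => Ψ w j) :=
  (EuclideanSpace.proj j : ES N →L[ℝ] ℝ).contDiff.comp h

end dd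

/-! ### Functions with derivatives bounded up to a given order -/

section DB
variable {W : Type*} [NormedAddCommGroup W] [NormedSpace ℝ W] {ι : Type*}

/-- All the derivatives of `F` up to order `k`, in the directions `e i`, are bounded by `A`
on `U`. -/
def DB (e : ι → W) (U : Set W) : ℕ → ℝ → (W → ℝ) → Prop
  | 0, A, F => ∀ x ∈ U, |F x| ≤ A
  | k + 1, A, F => (∀ x ∈ U, |F x| ≤ A) ∧ ∀ i, DB e U k A (dd (e i) F)

variable {e : ι → W} {U : Set W}

lemma DB.bound {k : ℕ} {A : ℝ} {F : W → ℝ} (h : DB e U k A F) : ∀ x ∈ U, |F x| ≤ A := by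
  cases k with
  | zero => exact h
  | succ k => exact h.1

lemma DB.mono {k : ℕ} {A A' : ℝ} {F : W → ℝ} (h : DB e U k A F) (hA : A ≤ A') :
    DB e U k A' F := by
  induction k generalizing F with
  | zero => exact fun x hx => (h x hx).trans hA
  | succ k ih => exact ⟨fun x hx => (h.1 x hx).trans hA, fun i => ih (h.2 i)⟩

lemma DB.pred {k : ℕ} {A : ℝ} {F : W → ℝ} (h : DB e U (k + 1) A F) : DB e U k A F := by
  induction k generalizing F with
  | zero => exact h.1
  | succ k ih => exact ⟨h.1, fun i => ih (h.2 i)⟩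

lemma DB.of_le {k l : ℕ} {A : ℝ} {F : W → ℝ} (h : DB e U k A F) (hl : l ≤ k) : DB e U l A F := by
  induction hl with
  | refl => exact h
  | step _ ih => exact ih h.pred

lemma DB.add {k : ℕ} {A B : ℝ} {F G : W → ℝ} (hF : Sm F) (hG : Sm G) (h : DB e U k A F)
    (h' : DB e U k B G) : DB e U k (A + B) (fun x => F x + G x) := by
  induction k generalizing F G with
  | zero => exact fun x hx => (abs_add_le _ _).trans (add_le_add (h x hx) (h' x hx))
  | succ k ih =>
    refine ⟨fun x hx => (abs_add_le _ _).trans (add_le_add (h.1 x hx) (h'.1 x hx)), fun i => ?_⟩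
    rw [dd_add_of hF.diff hG.diff]
    exact ih (hF.dd _) (hG.dd _) (h.2 i) (h'.2 i)

lemma DB.zero (k : ℕ) : DB e U k 0 (fun _ => 0) := by
  induction k with
  | zero => intro x _; simp
  | succ k ih => exact ⟨fun x _ => by simp, fun i => by rw [dd_const]; exact ih⟩

lemma DB.const (k : ℕ) (c : ℝ) : DB e U k |c| (fun _ => c) := by
  cases k with
  | zero => intro x _; simp
  | succ k =>
    exact ⟨fun x _ => by simp, fun i => by
      rw [dd_const]; exact (DB.zero k).mono (abs_nonneg c)⟩

lemma DB.smul {k : ℕ} {A : ℝ} {F : W → ℝ} (hF : Sm F) (h : DB e U k A F) (c : ℝ) :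
    DB e U k (|c| * A) (fun x => c * F x) := by
  induction k generalizing F with
  | zero => intro x hx; rw [abs_mul]; exact mul_le_mul_of_nonneg_left (h x hx) (abs_nonneg c)
  | succ k ih =>
    refine ⟨fun x hx => ?_, fun i => ?_⟩
    · rw [abs_mul]; exact mul_le_mul_of_nonneg_left (h.1 x hx) (abs_nonneg c)
    · rw [dd_smul_of hF.diff]; exact ih (hF.dd _) (h.2 i)

lemma DB.mul {k : ℕ} {A B : ℝ} (hA : 0 ≤ A) (hB : 0 ≤ B) {F G : W → ℝ} (hF : Sm F) (hG : Sm G)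
    (h : DB e U k A F) (h' : DB e U k B G) : DB e U k (2 ^ k * (A * B)) (fun x => F x * G x) := by
  induction k generalizing F G with
  | zero =>
    intro x hx
    rw [abs_mul, pow_zero, one_mul]
    exact mul_le_mul (h x hx) (h' x hx) (abs_nonneg _) hA
  | succ k ih =>
    refine ⟨fun x hx => ?_, fun i => ?_⟩
    · rw [abs_mul]
      have h1 : |F x| * |G x| ≤ A * B := mul_le_mul (h.1 x hx) (h'.1 x hx) (abs_nonneg _) hA
      have h2 : (1:ℝ) ≤ 2 ^ (k + 1) := one_le_pow₀ (by norm_num)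
      nlinarith [mul_nonneg hA hB]
    · rw [dd_mul_of hF.diff hG.diff]
      have h1 := ih (hF.dd (e i)) hG (h.2 i) h'.pred
      have h2 := ih hF (hG.dd (e i)) h.pred (h'.2 i)
      refine (DB.add ((hF.dd _).mul hG) (hF.mul (hG.dd _)) h1 h2).mono (le_of_eq ?_)
      ring

lemma DB.sum {k : ℕ} {κ : Type*} (s : Finset κ) {A : κ → ℝ} {F : κ → W → ℝ}
    (hF : ∀ i, Sm (F i)) (h : ∀ i, DB e U k (A i) (F i)) :
    DB e U k (∑ i ∈ s, A i) (fun x => ∑ i ∈ s, F i x) := by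
  induction s using Finset.induction_on with
  | empty => simpa using DB.zero k
  | insert a s ha ih =>
    simp only [Finset.sum_insert ha]
    exact DB.add (hF a) (ContDiff.sum fun i _ => hF i) (h a) ih

/-- Standard bound on all partial derivatives on the whole space. -/
abbrev DBu {N : ℕ} (k : ℕ) (A : ℝ) (F : ES N → ℝ) : Prop := DB (fun i : Fin N => bs i) univ k A F

lemma DB.comp {N : ℕ} {Ψ : W → ES N} (hΨ : Sm Ψ) {L : ℝ} (hL : 0 ≤ L) (k : ℕ)
    (h : ∀ i j, DB e U k L (dd (e i) (fun w => Ψ w j))) :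
    ∃ C, 0 ≤ C ∧ ∀ (g : ES N → ℝ) (A : ℝ), 0 ≤ A → Sm g → DBu k A g →
      DB e U k (C * A) (fun w => g (Ψ w)) := by
  induction k with
  | zero => exact ⟨1, zero_le_one, fun g A _ _ hgA x _ => by simpa using hgA _ (mem_univ (Ψ x))⟩
  | succ k ih =>
    obtain ⟨C, hC, H⟩ := ih (fun i j => (h i j).pred)
    refine ⟨1 + ∑ _j : Fin N, 2 ^ k * (C * L), by positivity, fun g A hA hg hgA => ⟨?_, ?_⟩⟩
    · intro x _
      have h0 : 0 ≤ (∑ _j : Fin N, 2 ^ k * (C * L)) * A := by positivity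
      have := hgA.1 (Ψ x) (mem_univ _)
      linarith
    · intro i
      rw [dd_comp_of hg.diff (ContDiff.differentiable hΨ (by simp))]
      have h1 : ∀ j, DB e U k (2 ^ k * (C * A * L))
          (fun w => dd (bs j) g (Ψ w) * dd (e i) (fun w => Ψ w j) w) := fun j =>
        DB.mul (by positivity) hL ((hg.dd _).comp hΨ) ((hΨ.comp_apply j).dd _)
          (H _ A hA (hg.dd _) (hgA.2 j)) ((h i j).pred)
      refine (DB.sum Finset.univ (fun j => ((hg.dd _).comp hΨ).mul ((hΨ.comp_apply j).dd _))
        h1).mono ?_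
      have : (∑ _j : Fin N, 2 ^ k * (C * A * L)) = (∑ _j : Fin N, 2 ^ k * (C * L)) * A := by
        rw [Finset.sum_mul]; exact Finset.sum_congr rfl fun _ _ => by ring
      rw [this]; nlinarith

end DB

/-! ### Functions with bounded derivatives of every order -/

section BB
variable {W : Type*} [NormedAddCommGroup W] [NormedSpace ℝ W] {ι : Type*}

/-- Smooth functions with all the derivatives bounded on `U`. -/
def BB (e : ι → W) (U : Set W) (F : W → ℝ) : Prop := Sm F ∧ ∀ k, ∃ A, 0 ≤ A ∧ DB e U k A F

variable {e : ι → W} {U : Set W} {F G : W → ℝ}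

lemma DB.nonneg' {k : ℕ} {A : ℝ} (h : DB e U k A F) : DB e U k |A| F := h.mono (le_abs_self A)

lemma BB.mk' (h : Sm F) (h' : ∀ k, ∃ A, DB e U k A F) : BB e U F :=
  ⟨h, fun k => by obtain ⟨A, hA⟩ := h' k; exact ⟨|A|, abs_nonneg A, hA.nonneg'⟩⟩

lemma BB.const (c : ℝ) : BB e U (fun _ => c) :=
  ⟨contDiff_const, fun k => ⟨|c|, abs_nonneg c, DB.const k c⟩⟩

lemma BB.add (hF : BB e U F) (hG : BB e U G) : BB e U (fun x => F x + G x) :=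
  BB.mk' (hF.1.add hG.1) fun k => by
    obtain ⟨A, _, hA⟩ := hF.2 k
    obtain ⟨B, _, hB⟩ := hG.2 k
    exact ⟨_, hA.add hF.1 hG.1 hB⟩

lemma BB.mul (hF : BB e U F) (hG : BB e U G) : BB e U (fun x => F x * G x) :=
  BB.mk' (hF.1.mul hG.1) fun k => by
    obtain ⟨A, hA0, hA⟩ := hF.2 k
    obtain ⟨B, hB0, hB⟩ := hG.2 k
    exact ⟨_, hA.mul hA0 hB0 hF.1 hG.1 hB⟩

lemma BB.smul (hF : BB e U F) (c : ℝ) : BB e U (fun x => c * F x) := (BB.const c).mul hF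

lemma BB.sub (hF : BB e U F) (hG : BB e U G) : BB e U (fun x => F x - G x) := by
  simpa [sub_eq_add_neg] using hF.add (hG.smul (-1))

lemma BB.pow (hF : BB e U F) (n : ℕ) : BB e U (fun x => F x ^ n) := by
  induction n with
  | zero => simpa using BB.const 1
  | succ n ih => simpa [pow_succ] using ih.mul hF

lemma BB.sum {κ : Type*} (s : Finset κ) {F : κ → W → ℝ} (h : ∀ i, BB e U (F i)) :
    BB e U (fun x => ∑ i ∈ s, F i x) := by
  induction s using Finset.induction_on with
  | empty => simpa using BB.const 0
  | insert a s ha ih => simp only [Finset.sum_insert ha]; exact (h a).add ih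

lemma BB.dd (hF : BB e U F) (i : ι) : BB e U (dd (e i) F) :=
  ⟨hF.1.dd _, fun k => by
    obtain ⟨A, hA0, hA⟩ := hF.2 (k + 1)
    exact ⟨A, hA0, hA.2 i⟩⟩

lemma BB.of_dd (hs : Sm F) (hb : ∃ A, ∀ x ∈ U, |F x| ≤ A) (h : ∀ i, BB e U (_root_.dd (e i) F))
    [Fintype ι] : BB e U F := by
  obtain ⟨A, hA⟩ := hb
  refine BB.mk' hs fun k => ?_
  cases k with
  | zero => exact ⟨A, hA⟩
  | succ k =>
    choose B hB0 hB using fun i => (h i).2 k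
    refine ⟨|A| + ∑ i, B i, fun x hx => (hA x hx).trans ?_, fun i => (hB i).mono ?_⟩
    · have := Finset.sum_nonneg fun i (_ : i ∈ Finset.univ) => hB0 i
      have := le_abs_self A
      linarith
    · have := Finset.single_le_sum (fun i _ => hB0 i) (Finset.mem_univ i)
      have := abs_nonneg A
      linarith

lemma BB.comp {N : ℕ} {Ψ : W → ES N} (hΨ : Sm Ψ) [Fintype ι]
    (h : ∀ i j, BB e U (_root_.dd (e i) (fun w => Ψ w j))) {k : ℕ} :
    ∃ C, 0 ≤ C ∧ ∀ (g : ES N → ℝ) (A : ℝ), 0 ≤ A → Sm g → DBu k A g →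
      DB e U k (C * A) (fun w => g (Ψ w)) := by
  choose L hL0 hL using fun i j => (h i j).2 k
  refine DB.comp hΨ (L := ∑ i, ∑ j, L i j)
    (Finset.sum_nonneg fun i _ => Finset.sum_nonneg fun j _ => hL0 i j) k fun i j =>
    (hL i j).mono ?_
  have h1 := Finset.single_le_sum (f := fun j => L i j) (fun j _ => hL0 i j) (Finset.mem_univ j)
  have h2 := Finset.single_le_sum (f := fun i => ∑ j, L i j)
    (fun i _ => Finset.sum_nonneg fun j _ => hL0 i j) (Finset.mem_univ i)
  exact h1.trans h2

lemma BB.comp' {N : ℕ} {Ψ : W → ES N} (hΨ : Sm Ψ) [Fintype ι]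
    (h : ∀ i j, BB e U (_root_.dd (e i) (fun w => Ψ w j))) {g : ES N → ℝ}
    (hg : BB (fun i : Fin N => bs i) univ g) : BB e U (fun w => g (Ψ w)) :=
  BB.mk' (hg.1.comp hΨ) fun k => by
    obtain ⟨C, _, H⟩ := BB.comp hΨ h (k := k)
    obtain ⟨A, hA0, hA⟩ := hg.2 k
    exact ⟨_, H g A hA0 hg.1 hA⟩

end BB

/-- Smooth functions on `ℝ^N` with all the derivatives bounded. -/
abbrev BBu {N : ℕ} (F : ES N → ℝ) : Prop := BB (fun i : Fin N => bs i) univ F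

/-! ### The space `ℝ × ℝ^N` -/

section W
variable {N : ℕ}

/-- Coordinate directions of `ℝ × ℝ^N`. -/
def eW : Option (Fin N) → ℝ × ES N
  | none => (1, 0)
  | some i => (0, bs i)

/-- The strip `|γ| ≤ 1`. -/
def UW : Set (ℝ × ES N) := {w | |w.1| ≤ 1}

abbrev DBW (k : ℕ) (A : ℝ) (F : ℝ × ES N → ℝ) : Prop := DB (eW (N := N)) UW k A F
abbrev BBW (F : ℝ × ES N → ℝ) : Prop := BB (eW (N := N)) UW F

lemma dd_eW_snd (o : Option (Fin N)) (j : Fin N) :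
    dd (eW o) (fun w : ℝ × ES N => w.2 j) = fun _ => (eW o).2 j := by
  funext w
  have h1 : HasFDerivAt (fun w : ℝ × ES N => w.2 j)
      ((EuclideanSpace.proj j : ES N →L[ℝ] ℝ).comp (ContinuousLinearMap.snd ℝ ℝ (ES N))) w :=
    ((EuclideanSpace.proj j : ES N →L[ℝ] ℝ).comp
      (ContinuousLinearMap.snd ℝ ℝ (ES N))).hasFDerivAt
  simp only [dd]; rw [h1.fderiv]; simp

lemma dd_eW_fst (o : Option (Fin N)) :
    dd (eW o) (fun w : ℝ × ES N => w.1) = fun _ => (eW o).1 := by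
  funext w
  have h1 : HasFDerivAt (fun w : ℝ × ES N => w.1) (ContinuousLinearMap.fst ℝ ℝ (ES N)) w :=
    (ContinuousLinearMap.fst ℝ ℝ (ES N)).hasFDerivAt
  simp only [dd]; rw [h1.fderiv]; simp

lemma BBW_snd {f : ES N → ℝ} (hf : BBu f) : BBW (fun w => f w.2) :=
  BB.comp' contDiff_snd (fun i j => by rw [dd_eW_snd]; exact BB.const _) hf

lemma DBW_snd (k : ℕ) : ∃ C, 0 ≤ C ∧ ∀ (g : ES N → ℝ) (A : ℝ), 0 ≤ A → Sm g → DBu k A g →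
      DBW k (C * A) (fun w => g w.2) :=
  BB.comp contDiff_snd (fun i j => by rw [dd_eW_snd]; exact BB.const _)

lemma BBW_fst : BBW (fun w : ℝ × ES N => w.1) :=
  BB.of_dd contDiff_fst ⟨1, fun _ hx => hx⟩ fun i => by rw [dd_eW_fst]; exact BB.const _

/-- Slices in the `x` variable. -/
lemma dd_slice {F : ℝ × ES N → ℝ} (hF : Differentiable ℝ F) (γ : ℝ) (i : Fin N) :
    dd (bs i) (fun x => F (γ, x)) = fun x => dd (eW (some i)) F (γ, x) := by
  funext x
  have h1 : HasFDerivAt (fun x : ES N => F (γ, x))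
      ((fderiv ℝ F (γ, x)).comp (ContinuousLinearMap.inr ℝ ℝ (ES N))) x :=
    (hF _).hasFDerivAt.comp x (hasFDerivAt_prodMk_right γ x)
  simp only [dd]; rw [h1.fderiv]; rfl

lemma hasDerivAt_slice {F : ℝ × ES N → ℝ} (hF : Differentiable ℝ F) (γ : ℝ) (x : ES N) :
    HasDerivAt (fun γ => F (γ, x)) (dd (eW none) F (γ, x)) γ := by
  have h1 : HasFDerivAt (fun γ : ℝ => F (γ, x))
      ((fderiv ℝ F (γ, x)).comp (ContinuousLinearMap.inl ℝ ℝ (ES N))) γ :=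
    (hF _).hasFDerivAt.comp γ (hasFDerivAt_prodMk_left γ x)
  have := h1.hasDerivAt
  simpa [dd, eW] using this

lemma taylor_step {F : ℝ × ES N → ℝ} (hF : Differentiable ℝ F) {x : ES N} {A : ℝ} (hA : 0 ≤ A)
    {n : ℕ} (h0 : F (0, x) = 0) (h : ∀ γ : ℝ, |γ| ≤ 1 → |dd (eW none) F (γ, x)| ≤ A * |γ| ^ n)
    (γ : ℝ) (hγ : |γ| ≤ 1) : |F (γ, x)| ≤ A * |γ| ^ (n + 1) := by
  have key := (convex_closedBall (0:ℝ) |γ|).norm_image_sub_le_of_norm_hasDerivWithin_le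
    (f := fun γ => F (γ, x)) (f' := fun γ => dd (eW none) F (γ, x)) (C := A * |γ| ^ n)
    (x := 0) (y := γ)
    (fun s _ => (hasDerivAt_slice hF s x).hasDerivWithinAt) (fun s hs => by
      have hs' : |s| ≤ |γ| := by simpa using hs
      refine (h s (hs'.trans hγ)).trans ?_
      gcongr) (by simp) (by simp)
  rw [h0] at key
  simpa [pow_succ, mul_assoc] using key

lemma taylor_three {F : ℝ × ES N → ℝ} (hF : Sm F) {A : ℝ} (hA : 0 ≤ A)
    (h0 : ∀ x, F (0, x) = 0) (h1 : ∀ x, dd (eW none) F (0, x) = 0)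
    (h2 : ∀ x, dd (eW none) (dd (eW none) F) (0, x) = 0) (k : ℕ) (h : DBW (k + 3) A F)
    (γ : ℝ) (hγ : |γ| ≤ 1) : DBu k (A * |γ| ^ 3) (fun x => F (γ, x)) := by
  have base : ∀ G : ℝ × ES N → ℝ, Sm G → (∀ x, G (0, x) = 0) →
      (∀ x, dd (eW none) G (0, x) = 0) → (∀ x, dd (eW none) (dd (eW none) G) (0, x) = 0) →
      DBW 3 A G → ∀ x, |G (γ, x)| ≤ A * |γ| ^ 3 := by
    intro G hG h0 h1 h2 hB x
    refine taylor_step hG.diff hA (h0 x) (fun s hs => ?_) γ hγ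
    refine taylor_step (hG.dd _).diff hA (h1 x) (fun s hs => ?_) s hs
    refine taylor_step ((hG.dd _).dd _).diff hA (h2 x) (fun s hs => ?_) s hs
    simpa using ((hB.2 none).2 none).2 none (s, x) hs
  have slice0 : ∀ G : ℝ × ES N → ℝ, Sm G → (∀ x, G (0, x) = 0) → ∀ i x,
      dd (eW (some i)) G (0, x) = 0 := by
    intro G hG h0 i x
    have := congrFun (dd_slice hG.diff 0 i) x
    rw [← this]
    simp [h0, dd]
  induction k generalizing F with
  | zero => exact fun x _ => base F hF h0 h1 h2 h x
  | succ k ih =>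
    refine ⟨fun x _ => base F hF h0 h1 h2 (h.of_le (by omega)) x, fun i => ?_⟩
    rw [dd_slice hF.diff]
    refine ih (hF.dd _) (slice0 F hF h0 i) ?_ ?_ (h.2 (some i))
    · intro x
      rw [dd_comm hF]
      exact slice0 _ (hF.dd _) h1 i x
    · intro x
      rw [dd_comm hF, dd_comm (hF.dd _)]
      exact slice0 _ ((hF.dd _).dd _) h2 i x

end W

/-! ### The one-step operators of the approximating chain -/

section chain
variable {N : ℕ}

/-- The displaced point `x + γ v(x) + γ² B(x)`. -/
def Psi (v B : Fin N → ES N → ℝ) (w : ℝ × ES N) : ES N :=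
  WithLp.toLp 2 fun i => w.2 i + w.1 * v i w.2 + w.1 ^ 2 * B i w.2

/-- One term of the one-step operator. -/
def Hk (v B : Fin N → ES N → ℝ) (c g : ES N → ℝ) (w : ℝ × ES N) : ℝ :=
  (1 + w.1 ^ 2 * c w.2) * g (Psi v B w)

/-- The one-step operator. -/
def Kop (V : Fin N → Fin N → ES N → ℝ) (B : Fin N → ES N → ℝ) (c : ES N → ℝ) (γ : ℝ)
    (g : ES N → ℝ) (x : ES N) : ℝ :=
  (2 * N : ℝ)⁻¹ * ∑ k, (Hk (V k) B c g (γ, x) + Hk (V k) B c g (-γ, x))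

/-- The generator written with smooth coefficients. -/
def Ag (Q : Fin N → Fin N → ES N → ℝ) (B : Fin N → ES N → ℝ) (c g : ES N → ℝ) (x : ES N) : ℝ :=
  (∑ i, ∑ j, Q i j x * dd (bs i) (dd (bs j) g) x) + (∑ j, B j x * dd (bs j) g x) + c x * g x

lemma Psi_apply (v B : Fin N → ES N → ℝ) (w : ℝ × ES N) (i : Fin N) :
    Psi v B w i = w.2 i + w.1 * v i w.2 + w.1 ^ 2 * B i w.2 := rfl

lemma Psi_zero (v B : Fin N → ES N → ℝ) (x : ES N) : Psi v B (0, x) = x := by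
  ext i; simp [Psi_apply]

lemma dd_coord (j : Fin N) (z : ES N) : dd z (fun x : ES N => x j) = fun _ => z j := by
  funext x
  have : HasFDerivAt (fun x : ES N => x j) (EuclideanSpace.proj j : ES N →L[ℝ] ℝ) x :=
    (EuclideanSpace.proj j : ES N →L[ℝ] ℝ).hasFDerivAt
  simp only [dd]; rw [this.fderiv]; rfl

lemma Sm.comp_snd {f : ES N → ℝ} (hf : Sm f) : Sm (fun w : ℝ × ES N => f w.2) :=
  ContDiff.comp hf contDiff_snd

variable {v B : Fin N → ES N → ℝ} {c : ES N → ℝ}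

lemma Psi_smooth (hv : ∀ i, BBu (v i)) (hB : ∀ i, BBu (B i)) : Sm (Psi v B) := by
  unfold Sm
  rw [contDiff_euclidean]
  intro i
  simp only [Psi_apply]
  have h1 : Sm (fun w : ℝ × ES N => w.2 i) :=
    ((EuclideanSpace.proj i : ES N →L[ℝ] ℝ).comp (ContinuousLinearMap.snd ℝ ℝ (ES N))).contDiff
  exact (h1.add (contDiff_fst.mul (BBW_snd (hv i)).1)).add
    ((contDiff_fst.pow 2).mul (BBW_snd (hB i)).1)

lemma dd_Psi (hv : ∀ i, BBu (v i)) (hB : ∀ i, BBu (B i)) (o : Option (Fin N)) (j : Fin N) :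
    dd (eW o) (fun w => Psi v B w j) = fun w => (eW o).2 j +
      dd (eW o) (fun w : ℝ × ES N => w.1 * v j w.2 + w.1 ^ 2 * B j w.2) w := by
  have h1 : Differentiable ℝ (fun w : ℝ × ES N => w.2 j) :=
    ((EuclideanSpace.proj j : ES N →L[ℝ] ℝ).comp
      (ContinuousLinearMap.snd ℝ ℝ (ES N))).differentiable
  have h2 : Sm (fun w : ℝ × ES N => w.1 * v j w.2 + w.1 ^ 2 * B j w.2) :=
    (contDiff_fst.mul (BBW_snd (hv j)).1).add ((contDiff_fst.pow 2).mul (BBW_snd (hB j)).1)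
  simp only [Psi_apply, add_assoc]
  rw [dd_add_of h1 h2.diff, dd_eW_snd]

lemma dd_Psi_BB (hv : ∀ i, BBu (v i)) (hB : ∀ i, BBu (B i)) (o : Option (Fin N)) (j : Fin N) :
    BBW (dd (eW o) (fun w => Psi v B w j)) := by
  rw [dd_Psi hv hB]
  have : BBW (fun w : ℝ × ES N => w.1 * v j w.2 + w.1 ^ 2 * B j w.2) :=
    (BBW_fst.mul (BBW_snd (hv j))).add ((BBW_fst.pow 2).mul (BBW_snd (hB j)))
  exact (BB.const _).add (this.dd o)

lemma dd_Psi_some_zero (hv : ∀ i, BBu (v i)) (hB : ∀ i, BBu (B i)) (i j : Fin N) (x : ES N) :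
    dd (eW (some i)) (fun w => Psi v B w j) (0, x) = if i = j then 1 else 0 := by
  have h := congrFun (dd_slice (F := fun w => Psi v B w j)
    ((Psi_smooth hv hB).comp_apply j).diff 0 i) x
  rw [← h]
  simp only [Psi_zero]
  rw [dd_coord]
  simp [eq_comm]

lemma dd_Psi_none (hv : ∀ i, BBu (v i)) (hB : ∀ i, BBu (B i)) (j : Fin N) :
    dd (eW none) (fun w => Psi v B w j) = fun w => v j w.2 + 2 * w.1 * B j w.2 := by
  funext w
  have h := hasDerivAt_slice ((Psi_smooth hv hB).comp_apply j).diff w.1 w.2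
  have h2 : HasDerivAt (fun γ : ℝ => Psi v B (γ, w.2) j) (v j w.2 + 2 * w.1 * B j w.2) w.1 := by
    simp only [Psi_apply]
    have := (((hasDerivAt_id w.1).mul_const (v j w.2)).add
      (((hasDerivAt_id w.1).pow 2).mul_const (B j w.2))).const_add (w.2 j)
    simp only [id] at this
    refine (this.congr_deriv ?_).congr_of_eventuallyEq (Eventually.of_forall fun γ => ?_)
    · simp
    · simp [id]; ring
  exact h.unique h2

lemma dd_none_snd {f : ES N → ℝ} (hf : Sm f) : dd (eW none) (fun w : ℝ × ES N => f w.2)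
    = fun _ => 0 := by
  funext w
  have h := hasDerivAt_slice (F := fun w : ℝ × ES N => f w.2) hf.comp_snd.diff w.1 w.2
  exact h.unique (hasDerivAt_const w.1 (f w.2))

end chain

/-! ### Stability of the chain in spaces of smooth functions -/

section stab
variable {N : ℕ}

/-- Indices of the partial derivatives of order at most `k`. -/
def Jx (N : ℕ) : ℕ → Type
  | 0 => Unit
  | k + 1 => Option (Fin N) × Jx N k

instance instFintypeJx : ∀ k, Fintype (Jx N k)
  | 0 => (inferInstance : Fintype Unit)
  | k + 1 => @instFintypeProd _ _ _ (instFintypeJx k)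

/-- Partial derivatives of order at most `k`. -/
def GJ : ∀ k, Jx N k → (ES N → ℝ) → ES N → ℝ
  | 0, _, g => g
  | k + 1, (none, I), g => GJ k I g
  | k + 1, (some i, I), g => GJ k I (dd (bs i) g)

lemma GJ_smooth {k : ℕ} (I : Jx N k) {g : ES N → ℝ} (hg : Sm g) : Sm (GJ k I g) := by
  induction k generalizing g with
  | zero => exact hg
  | succ k ih =>
    rcases I with ⟨_ | i, I⟩
    · exact ih I hg
    · exact ih I (hg.dd _)

lemma dd_GJ {k : ℕ} (I : Jx N k) {g : ES N → ℝ} (hg : Sm g) (i : Fin N) :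
    dd (bs i) (GJ k I g) = GJ k I (dd (bs i) g) := by
  induction k generalizing g with
  | zero => rfl
  | succ k ih =>
    rcases I with ⟨_ | j, I⟩
    · exact ih I hg
    · change dd (bs i) (GJ k I (dd (bs j) g)) = GJ k I (dd (bs j) (dd (bs i) g))
      rw [ih I (hg.dd _), dd_comm hg]

lemma GJ_add {k : ℕ} (I : Jx N k) {f g : ES N → ℝ} (hf : Sm f) (hg : Sm g) :
    GJ k I (fun x => f x + g x) = fun x => GJ k I f x + GJ k I g x := by
  induction k generalizing f g with
  | zero => rfl
  | succ k ih =>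
    rcases I with ⟨_ | j, I⟩
    · exact ih I hf hg
    · simp only [GJ]
      rw [dd_add_of hf.diff hg.diff, ih I (hf.dd _) (hg.dd _)]

lemma GJ_smul {k : ℕ} (I : Jx N k) {f : ES N → ℝ} (hf : Sm f) (c : ℝ) :
    GJ k I (fun x => c * f x) = fun x => c * GJ k I f x := by
  induction k generalizing f with
  | zero => rfl
  | succ k ih =>
    rcases I with ⟨_ | j, I⟩
    · exact ih I hf
    · simp only [GJ]
      rw [dd_smul_of hf.diff, ih I (hf.dd _)]

lemma GJ_zero {k : ℕ} (I : Jx N k) : GJ k I (fun _ : ES N => 0) = fun _ => 0 := by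
  induction k with
  | zero => rfl
  | succ k ih =>
    rcases I with ⟨_ | j, I⟩
    · exact ih I
    · simp only [GJ]
      rw [dd_const, ih I]

lemma GJ_sum {k : ℕ} (I : Jx N k) {κ : Type*} (s : Finset κ) {f : κ → ES N → ℝ}
    (hf : ∀ a, Sm (f a)) :
    GJ k I (fun x => ∑ a ∈ s, f a x) = fun x => ∑ a ∈ s, GJ k I (f a) x := by
  induction s using Finset.induction_on with
  | empty => simpa using GJ_zero I
  | insert a s ha ih =>
    simp only [Finset.sum_insert ha]
    rw [GJ_add I (hf a) (ContDiff.sum fun i _ => hf i), ih]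

lemma DBu_of_GJ {k : ℕ} {g : ES N → ℝ} {A : ℝ} (h : ∀ I x, |GJ k I g x| ≤ A) : DBu k A g := by
  induction k generalizing g with
  | zero => exact fun x _ => h () x
  | succ k ih =>
    have h0 : DBu k A g := ih fun I x => h (none, I) x
    exact ⟨h0.bound, fun i => ih fun I x => h (some i, I) x⟩

lemma GJ_of_DBu {k : ℕ} {g : ES N → ℝ} {A : ℝ} (h : DBu k A g) (I : Jx N k) (x : ES N) :
    |GJ k I g x| ≤ A := by
  induction k generalizing g with
  | zero => exact h x (mem_univ x)
  | succ k ih =>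
    rcases I with ⟨_ | j, I⟩
    · exact ih h.pred I
    · exact ih (h.2 j) I

variable {v B : Fin N → ES N → ℝ} {c : ES N → ℝ}

lemma Hk_smooth (hv : ∀ i, BBu (v i)) (hB : ∀ i, BBu (B i)) (hc : BBu c) {g : ES N → ℝ}
    (hg : Sm g) : Sm (Hk v B c g) :=
  (((BB.const 1).add ((BBW_fst.pow 2).mul (BBW_snd hc))).1).mul
    (ContDiff.comp hg (Psi_smooth hv hB))

lemma slice_smooth {F : ℝ × ES N → ℝ} (hF : Sm F) (γ : ℝ) : Sm (fun x => F (γ, x)) :=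
  ContDiff.comp hF (contDiff_prodMk_right γ)

/-- The derivatives of one term of the one-step operator are obtained from the derivatives of the
argument through a matrix that reduces to the identity for `γ = 0`. -/
lemma exists_matrix (hv : ∀ i, BBu (v i)) (hB : ∀ i, BBu (B i)) (hc : BBu c) (k : ℕ) :
    ∃ M : Jx N k → Jx N k → ℝ × ES N → ℝ, (∀ I J, BBW (M I J)) ∧
      (∀ I J x, M I J (0, x) = if I = J then 1 else 0) ∧
      ∀ g, Sm g → ∀ I γ x, GJ k I (fun x => Hk v B c g (γ, x)) x =
        ∑ J, M I J (γ, x) * GJ k J g (Psi v B (γ, x)) := by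
  induction k with
  | zero =>
    refine ⟨fun _ _ w => 1 + w.1 ^ 2 * c w.2, fun _ _ =>
      (BB.const 1).add ((BBW_fst.pow 2).mul (BBW_snd hc)), fun I J x => ?_, fun g hg I γ x => ?_⟩
    · have : I = J := Subsingleton.elim (α := Unit) I J
      simp [this]
    · change _ = ∑ J : Unit, _
      rw [Fintype.sum_unique]
      rfl
  | succ k ih =>
    obtain ⟨M, hM, hM0, hMg⟩ := ih
    let M' : Jx N (k + 1) → Jx N (k + 1) → ℝ × ES N → ℝ := fun I J =>
      match I, J with
      | (none, I), (none, J) => M I J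
      | (none, _), (some _, _) => fun _ => 0
      | (some i, I), (none, J) => dd (eW (some i)) (M I J)
      | (some i, I), (some j, J) => fun w => M I J w * dd (eW (some i)) (fun w => Psi v B w j) w
    have hp : ∀ (a b : Option (Fin N)) (I J : Jx N k),
        (@ite ℝ (((a, I) : Jx N (k + 1)) = (b, J)) (Classical.propDecidable _) 1 0) = if a = b ∧ I = J then 1 else 0 :=
      fun a b I J => by
        by_cases h : a = b ∧ I = J
        · rw [if_pos h]
          exact @if_pos _ (Classical.propDecidable _) (Prod.mk_inj.2 h) _ _ _
        · rw [if_neg h]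
          exact @if_neg _ (Classical.propDecidable _) (fun h' => h (Prod.mk_inj.1 h')) _ _ _
    refine ⟨M', ?_, ?_, ?_⟩
    · rintro ⟨_ | i, I⟩ ⟨_ | j, J⟩
      · exact hM I J
      · exact BB.const 0
      · exact (hM I J).dd _
      · exact (hM I J).mul (dd_Psi_BB hv hB _ _)
    · rintro ⟨_ | i, I⟩ ⟨_ | j, J⟩ x
      · refine Eq.trans ?_ (hp _ _ _ _).symm
        simp [M', hM0]
      · refine Eq.trans ?_ (hp _ _ _ _).symm
        simp [M']
      · refine Eq.trans ?_ (hp _ _ _ _).symm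
        have := congrFun (dd_slice (hM I J).1.diff 0 i) x
        simp only [M', ← this, hM0, dd_const]
        simp
      · refine Eq.trans ?_ (hp _ _ _ _).symm
        simp only [M', hM0, dd_Psi_some_zero hv hB]
        by_cases h1 : i = j <;> by_cases h2 : I = J <;> simp [h1, h2]
    · rintro g hg ⟨_ | i, I⟩ γ x
      · have := hMg g hg I γ x
        change GJ k I (fun x => Hk v B c g (γ, x)) x = _
        rw [this]
        change _ = ∑ J : Option (Fin N) × Jx N k, M' (none, I) J (γ, x) * GJ (k + 1) J g _
        rw [Fintype.sum_prod_type, Fintype.sum_option]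
        simp [M', GJ]
      · have hH := Hk_smooth hv hB hc hg
        change GJ k I (dd (bs i) (fun x => Hk v B c g (γ, x))) x = _
        rw [← dd_GJ I (slice_smooth hH γ)]
        have e1 : GJ k I (fun x => Hk v B c g (γ, x)) =
            fun x => (fun w => ∑ J, M I J w * GJ k J g (Psi v B w)) (γ, x) := by
          funext x; exact hMg g hg I γ x
        have hs : ∀ J, Sm (fun w => GJ k J g (Psi v B w)) := fun J =>
          ContDiff.comp (GJ_smooth J hg) (Psi_smooth hv hB)
        have hs' : ∀ J, Sm (fun w => M I J w * GJ k J g (Psi v B w)) := fun J =>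
          (hM I J).1.mul (hs J)
        rw [e1, dd_slice (F := fun w => ∑ J, M I J w * GJ k J g (Psi v B w))
          (ContDiff.differentiable (ContDiff.sum fun J _ => hs' J) (by simp))]
        rw [dd_sum_of _ (fun J => (hs' J).diff)]
        change _ = ∑ J : Option (Fin N) × Jx N k, M' (some i, I) J (γ, x) * GJ (k + 1) J g _
        rw [Fintype.sum_prod_type, Fintype.sum_option, Finset.sum_comm, ← Finset.sum_add_distrib]
        refine Finset.sum_congr rfl fun J _ => ?_
        rw [dd_mul_of (hM I J).1.diff (hs J).diff,
          dd_comp_of (GJ_smooth J hg).diff (ContDiff.differentiable (Psi_smooth hv hB) (by simp))]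
        simp only [M', GJ, Finset.mul_sum]
        congr 1
        refine Finset.sum_congr rfl fun j _ => ?_
        rw [dd_GJ J hg]; ring

end stab

section stab2
variable {N : ℕ}

lemma matrix_taylor {M : ℝ × ES N → ℝ} (hM : BBW M) (m : ℝ) (h0 : ∀ x, M (0, x) = m) :
    ∃ A, 0 ≤ A ∧ ∀ x, |dd (eW none) M (0, x)| ≤ A ∧
      ∀ γ : ℝ, |γ| ≤ 1 → |M (γ, x) - m - γ * dd (eW none) M (0, x)| ≤ A * γ ^ 2 := by
  obtain ⟨A, hA0, hA⟩ := hM.2 2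
  refine ⟨A, hA0, fun x => ⟨(hA.2 none).1 (0, x) (by simp [UW]), fun γ hγ => ?_⟩⟩
  set P : ES N → ℝ := fun x => dd (eW none) M (0, x) with hP
  have hPs : Sm P := slice_smooth (hM.1.dd _) 0
  have hfst : Sm (fun w : ℝ × ES N => w.1) := contDiff_fst
  have hcst : Sm (fun _ : ℝ × ES N => m) := contDiff_const
  have hMc : Sm (fun w => M w - m) := hM.1.sub hcst
  have hL : Sm (fun w : ℝ × ES N => w.1 * P w.2) := hfst.mul hPs.comp_snd
  have hFs : Sm (fun w => (M w - m) - w.1 * P w.2) := hMc.sub hL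
  have d1 : dd (eW none) (fun w => (M w - m) - w.1 * P w.2) =
      fun w => dd (eW none) M w - P w.2 := by
    rw [dd_sub_of hMc.diff hL.diff, dd_sub_of hM.1.diff hcst.diff, dd_const,
      dd_mul_of hfst.diff hPs.comp_snd.diff, dd_eW_fst, dd_none_snd hPs]
    funext w; simp [eW]
  have d2 : dd (eW none) (fun w => dd (eW none) M w - P w.2) =
      fun w => dd (eW none) (dd (eW none) M) w := by
    rw [dd_sub_of (hM.1.dd _).diff hPs.comp_snd.diff, dd_none_snd hPs]
    funext w; simp
  have := taylor_step hFs.diff (x := x) hA0 (n := 1) (by simp [h0]) (fun s hs => by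
    rw [d1]
    refine taylor_step (F := fun w => dd (eW none) M w - P w.2)
      ((hM.1.dd _).sub hPs.comp_snd |> fun h : Sm _ => h.diff) (x := x) hA0 (n := 0)
      (by simp [hP]) (fun r hr => ?_) s hs
    rw [d2]
    simpa using (hA.2 none).2 none (r, x) hr) γ hγ
  simpa using this

lemma pair_quad {a p r r' s A γ : ℝ} (hA : 0 ≤ A) (hs : 0 ≤ s) (ha : |a| ≤ s)
    (hp : |p| ≤ A * s) (hr : |r| ≤ A * γ ^ 2 * s) (hr' : |r'| ≤ A * γ ^ 2 * s) (hγ : |γ| ≤ 1) :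
    (a + γ * p + r) ^ 2 + (a - γ * p + r') ^ 2 ≤ 2 * a ^ 2 + (4 * A + 8 * A ^ 2) * γ ^ 2 * s ^ 2 := by
  have hγ2 : γ ^ 2 ≤ 1 := by rw [← sq_abs]; exact pow_le_one₀ (abs_nonneg _) hγ
  have hX : 0 ≤ A * γ ^ 2 * s := by positivity
  have h1 : a * (r + r') ≤ s * (2 * (A * γ ^ 2 * s)) := by
    refine (le_abs_self _).trans ?_
    rw [abs_mul]
    exact mul_le_mul ha ((abs_add_le _ _).trans (by linarith)) (abs_nonneg _) hs
  have h2 : p ^ 2 ≤ (A * s) ^ 2 := sq_le_sq' (by linarith [abs_le.1 hp]) (abs_le.1 hp).2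
  have h3 : r ^ 2 ≤ (A * γ ^ 2 * s) ^ 2 := sq_le_sq' (by linarith [abs_le.1 hr]) (abs_le.1 hr).2
  have h4 : r' ^ 2 ≤ (A * γ ^ 2 * s) ^ 2 :=
    sq_le_sq' (by linarith [abs_le.1 hr']) (abs_le.1 hr').2
  have h5 : γ * p * (r - r') ≤ (A * s) * (2 * (A * γ ^ 2 * s)) := by
    refine (le_abs_self _).trans ?_
    rw [abs_mul, abs_mul]
    refine mul_le_mul ?_ ((abs_sub _ _).trans (by linarith)) (abs_nonneg _) (by positivity)
    calc |γ| * |p| ≤ 1 * (A * s) := mul_le_mul hγ hp (abs_nonneg _) zero_le_one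
      _ = A * s := one_mul _
  have h6 : (A * γ ^ 2 * s) ^ 2 ≤ A ^ 2 * γ ^ 2 * s ^ 2 := by
    have : 0 ≤ A ^ 2 * s ^ 2 * γ ^ 2 := by positivity
    nlinarith
  have h7 : γ ^ 2 * p ^ 2 ≤ γ ^ 2 * (A * s) ^ 2 := mul_le_mul_of_nonneg_left h2 (sq_nonneg _)
  nlinarith

variable {v B : Fin N → ES N → ℝ} {c : ES N → ℝ}

lemma pair_stable (hv : ∀ i, BBu (v i)) (hB : ∀ i, BBu (B i)) (hc : BBu c) (k : ℕ) :
    ∃ C, 0 ≤ C ∧ ∀ γ : ℝ, |γ| ≤ 1 → ∀ g, Sm g → ∀ Q : ℝ, (∀ x, ∑ I, GJ k I g x ^ 2 ≤ Q) →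
      ∀ x, ∀ z : Jx N k → ℝ,
        ∑ I, z I * (GJ k I (fun x => Hk v B c g (γ, x)) x +
          GJ k I (fun x => Hk v B c g (-γ, x)) x) ≤ (1 + C * γ ^ 2) * ∑ I, z I ^ 2 + Q := by
  obtain ⟨M, hM, hM0, hMg⟩ := exists_matrix hv hB hc k
  choose A' hA0' hA' using fun I J => matrix_taylor (hM I J) _ (hM0 I J)
  set A := ∑ I, ∑ J, A' I J with hA
  have hle : ∀ I J, A' I J ≤ A := fun I J =>
    (Finset.single_le_sum (f := fun J => A' I J) (fun J _ => hA0' I J) (Finset.mem_univ J)).trans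
    (Finset.single_le_sum (f := fun I => ∑ J, A' I J)
      (fun I _ => Finset.sum_nonneg fun J _ => hA0' I J) (Finset.mem_univ I))
  have hA0 : 0 ≤ A := Finset.sum_nonneg fun I _ => Finset.sum_nonneg fun J _ => hA0' I J
  set n : ℝ := (Fintype.card (Jx N k) : ℝ) with hn
  refine ⟨(4 * A + 8 * A ^ 2) * n * n, by positivity, fun γ hγ g hg Q hQ x z => ?_⟩
  set s := ∑ I, |z I| with hs
  have hs0 : 0 ≤ s := Finset.sum_nonneg fun I _ => abs_nonneg _
  have hs2 : s ^ 2 ≤ n * ∑ I, z I ^ 2 := by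
    have := sq_sum_le_card_mul_sum_sq (s := Finset.univ) (f := fun I => |z I|)
    simpa [sq_abs] using this
  set a : ℝ → Jx N k → ℝ := fun γ J => ∑ I, z I * M I J (γ, x) with ha
  set p : Jx N k → ℝ := fun J => ∑ I, z I * dd (eW none) (M I J) (0, x) with hp
  set r : ℝ → Jx N k → ℝ := fun γ J => ∑ I, z I *
    (M I J (γ, x) - (if I = J then 1 else 0) - γ * dd (eW none) (M I J) (0, x)) with hr
  have har : ∀ γ J, a γ J = z J + γ * p J + r γ J := by
    intro γ J
    simp only [ha, hp, hr, mul_sub, Finset.sum_sub_distrib]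
    simp [Finset.mul_sum, mul_left_comm]
  have hpb : ∀ J, |p J| ≤ A * s := by
    intro J
    refine (Finset.abs_sum_le_sum_abs _ _).trans ?_
    rw [hs, Finset.mul_sum]
    refine Finset.sum_le_sum fun I _ => ?_
    rw [abs_mul, mul_comm]
    exact mul_le_mul_of_nonneg_right (((hA' I J x).1).trans (hle I J)) (abs_nonneg _)
  have hrb : ∀ γ : ℝ, |γ| ≤ 1 → ∀ J, |r γ J| ≤ A * γ ^ 2 * s := by
    intro γ hγ J
    refine (Finset.abs_sum_le_sum_abs _ _).trans ?_
    rw [hs, Finset.mul_sum]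
    refine Finset.sum_le_sum fun I _ => ?_
    rw [abs_mul, mul_comm]
    refine mul_le_mul_of_nonneg_right (((hA' I J x).2 γ hγ).trans ?_) (abs_nonneg _)
    exact mul_le_mul_of_nonneg_right (hle I J) (sq_nonneg _)
  have hswap : ∀ γ, ∑ I, z I * GJ k I (fun x => Hk v B c g (γ, x)) x =
      ∑ J, a γ J * GJ k J g (Psi v B (γ, x)) := by
    intro γ
    simp only [hMg g hg, ha, Finset.mul_sum, Finset.sum_mul]
    rw [Finset.sum_comm]
    exact Finset.sum_congr rfl fun J _ => Finset.sum_congr rfl fun I _ => by ring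
  have hyoung : ∀ γ, ∑ J, a γ J * GJ k J g (Psi v B (γ, x)) ≤ (∑ J, a γ J ^ 2) / 2 + Q / 2 := by
    intro γ
    have h1 : ∑ J, a γ J * GJ k J g (Psi v B (γ, x)) ≤
        ∑ J, (a γ J ^ 2 / 2 + GJ k J g (Psi v B (γ, x)) ^ 2 / 2) :=
      Finset.sum_le_sum fun J _ => by nlinarith [sq_nonneg (a γ J - GJ k J g (Psi v B (γ, x)))]
    rw [Finset.sum_add_distrib, ← Finset.sum_div, ← Finset.sum_div] at h1
    have := hQ (Psi v B (γ, x))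
    linarith
  simp only [mul_add, Finset.sum_add_distrib]
  rw [hswap, hswap]
  have h1 := hyoung γ
  have h2 := hyoung (-γ)
  have h3 : ∑ J, a γ J ^ 2 + ∑ J, a (-γ) J ^ 2 ≤
      2 * ∑ J, z J ^ 2 + n * ((4 * A + 8 * A ^ 2) * γ ^ 2 * s ^ 2) := by
    rw [← Finset.sum_add_distrib, Finset.mul_sum]
    have : n * ((4 * A + 8 * A ^ 2) * γ ^ 2 * s ^ 2) =
        ∑ _J : Jx N k, (4 * A + 8 * A ^ 2) * γ ^ 2 * s ^ 2 := by simp [hn]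
    rw [this, ← Finset.sum_add_distrib]
    refine Finset.sum_le_sum fun J _ => ?_
    have hz : |z J| ≤ s :=
      Finset.single_le_sum (f := fun J => |z J|) (fun J _ => abs_nonneg _) (Finset.mem_univ J)
    have hr2 := hrb (-γ) (by rwa [abs_neg]) J
    rw [neg_sq] at hr2
    have := pair_quad hA0 hs0 hz (hpb J) (hrb γ hγ J) hr2 hγ
    have e : z J + -γ * p J + r (-γ) J = z J - γ * p J + r (-γ) J := by ring
    rw [har γ, har (-γ), e]
    exact this
  have hm : n * ((4 * A + 8 * A ^ 2) * γ ^ 2 * s ^ 2) ≤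
      n * ((4 * A + 8 * A ^ 2) * γ ^ 2 * (n * ∑ I, z I ^ 2)) := by gcongr
  have hZ : 0 ≤ ∑ I, z I ^ 2 := Finset.sum_nonneg fun I _ => sq_nonneg _
  have hZ' : 0 ≤ (4 * A + 8 * A ^ 2) * n * n * γ ^ 2 * ∑ I, z I ^ 2 := by positivity
  nlinarith

variable {V : Fin N → Fin N → ES N → ℝ}

lemma Kop_smooth (hV : ∀ k i, BBu (V k i)) (hB : ∀ i, BBu (B i)) (hc : BBu c) (γ : ℝ)
    {g : ES N → ℝ} (hg : Sm g) : Sm (Kop V B c γ g) :=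
  contDiff_const.mul (ContDiff.sum fun k _ =>
    (slice_smooth (Hk_smooth (hV k) hB hc hg) γ).add
      (slice_smooth (Hk_smooth (hV k) hB hc hg) (-γ)))

lemma Kop_stable (hN : 1 ≤ N) (hV : ∀ k i, BBu (V k i)) (hB : ∀ i, BBu (B i)) (hc : BBu c)
    (k : ℕ) : ∃ C, 0 ≤ C ∧ ∀ γ : ℝ, |γ| ≤ 1 → C * γ ^ 2 ≤ 1 → ∀ g, Sm g → ∀ Q : ℝ,
      (∀ x, ∑ I, GJ k I g x ^ 2 ≤ Q) →
      ∀ x, ∑ I, GJ k I (Kop V B c γ g) x ^ 2 ≤ (1 + C * γ ^ 2) * Q := by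
  choose C' hC0 hC' using fun l => pair_stable (hV l) hB hc k
  set C := ∑ l, C' l with hC
  have hC0' : 0 ≤ C := Finset.sum_nonneg fun l _ => hC0 l
  have hle : ∀ l, C' l ≤ C := fun l =>
    Finset.single_le_sum (fun l _ => hC0 l) (Finset.mem_univ l)
  refine ⟨2 * C, by positivity, fun γ hγ hCγ g hg Q hQ x => ?_⟩
  have hNpos : (0:ℝ) < N := by exact_mod_cast hN
  set z : Jx N k → ℝ := fun I => GJ k I (Kop V B c γ g) x with hz
  have hs : ∀ l γ, Sm (fun x => Hk (V l) B c g (γ, x)) := fun l γ =>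
    slice_smooth (Hk_smooth (hV l) hB hc hg) γ
  have hs2 : ∀ l, Sm (fun x => Hk (V l) B c g (γ, x) + Hk (V l) B c g (-γ, x)) := fun l =>
    (hs l γ).add (hs l (-γ))
  have hzI : ∀ I, z I = (2 * N : ℝ)⁻¹ * ∑ l, (GJ k I (fun x => Hk (V l) B c g (γ, x)) x +
      GJ k I (fun x => Hk (V l) B c g (-γ, x)) x) := by
    intro I
    have : GJ k I (Kop V B c γ g) = _ := GJ_smul I (ContDiff.sum fun l _ => hs2 l) _
    simp only [hz, this]
    rw [GJ_sum I _ hs2]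
    simp only [GJ_add I (hs _ γ) (hs _ (-γ))]
  have hQ0 : 0 ≤ Q := (Finset.sum_nonneg fun I _ => sq_nonneg _).trans (hQ x)
  set Z := ∑ I, z I ^ 2 with hZ
  have hZ0 : 0 ≤ Z := Finset.sum_nonneg fun I _ => sq_nonneg _
  have key : Z ≤ (2 * N : ℝ)⁻¹ * ∑ _l : Fin N, ((1 + C * γ ^ 2) * Z + Q) := by
    have e : Z = (2 * N : ℝ)⁻¹ * ∑ l, ∑ I, z I * (GJ k I (fun x => Hk (V l) B c g (γ, x)) x +
      GJ k I (fun x => Hk (V l) B c g (-γ, x)) x) := by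
      rw [Finset.sum_comm, Finset.mul_sum, hZ]
      refine Finset.sum_congr rfl fun I _ => ?_
      rw [← Finset.mul_sum, sq]
      conv_lhs => rw [hzI I]
      rw [← hzI I]; conv_rhs => rw [mul_left_comm, ← hzI I]
    rw [e]
    refine mul_le_mul_of_nonneg_left (Finset.sum_le_sum fun l _ => ?_) (by positivity)
    rw [← e]
    refine (hC' l γ hγ g hg Q hQ x z).trans ?_
    have := hle l
    gcongr
  have e2 : (2 * N : ℝ)⁻¹ * ∑ _l : Fin N, ((1 + C * γ ^ 2) * Z + Q) =
      ((1 + C * γ ^ 2) * Z + Q) / 2 := by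
    simp only [Finset.sum_const, Finset.card_univ, Fintype.card_fin, nsmul_eq_mul]
    field_simp
  rw [e2] at key
  have hγ2 := sq_nonneg γ
  set t := C * γ ^ 2 with ht
  have ht0 : 0 ≤ t := by positivity
  have h1 : Z * (1 - t) ≤ Q := by nlinarith
  have h2 : 2 * t ≤ 1 := by rw [ht]; linarith
  have h3 : 0 ≤ 1 + 2 * t := by linarith
  have h4 := mul_le_mul_of_nonneg_right h1 h3
  have h5 : 1 ≤ (1 - t) * (1 + 2 * t) := by nlinarith
  have h6 := mul_le_mul_of_nonneg_left h5 hZ0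
  have : 2 * C * γ ^ 2 = 2 * t := by rw [ht]; ring
  rw [this]
  nlinarith

end stab2

/-! ### Consistency of the chain -/

section consist
variable {N : ℕ} {v B : Fin N → ES N → ℝ} {c : ES N → ℝ}

lemma dd_none_comp {g : ES N → ℝ} (hg : Sm g) (hv : ∀ i, BBu (v i)) (hB : ∀ i, BBu (B i)) :
    dd (eW none) (fun w => g (Psi v B w)) =
      fun w => ∑ j, dd (bs j) g (Psi v B w) * (v j w.2 + 2 * w.1 * B j w.2) := by
  rw [dd_comp_of hg.diff (ContDiff.differentiable (Psi_smooth hv hB) (by simp))]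
  simp only [dd_Psi_none hv hB]

lemma Sm.comp_Psi {g : ES N → ℝ} (hg : Sm g) (hv : ∀ i, BBu (v i)) (hB : ∀ i, BBu (B i)) :
    Sm (fun w => g (Psi v B w)) := ContDiff.comp hg (Psi_smooth hv hB)

/-- The coefficient of `γ` in the expansion of `Hk`. -/
def L1 (v : Fin N → ES N → ℝ) (g : ES N → ℝ) (x : ES N) : ℝ := ∑ j, dd (bs j) g x * v j x

/-- The coefficient of `γ²` in the expansion of `Hk`. -/
def L2 (v B : Fin N → ES N → ℝ) (c g : ES N → ℝ) (x : ES N) : ℝ :=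
  (∑ j, ∑ i, dd (bs i) (dd (bs j) g) x * (v i x * v j x)) / 2 + (∑ j, dd (bs j) g x * B j x)
    + c x * g x

lemma L1_smooth (hv : ∀ i, BBu (v i)) {g : ES N → ℝ} (hg : Sm g) : Sm (L1 v g) :=
  ContDiff.sum fun j _ => (hg.dd _).mul (hv j).1

lemma L2_smooth (hv : ∀ i, BBu (v i)) (hB : ∀ i, BBu (B i)) (hc : BBu c) {g : ES N → ℝ}
    (hg : Sm g) : Sm (L2 v B c g) :=
  (((ContDiff.sum fun j _ => ContDiff.sum fun i _ =>
    ((hg.dd _).dd _).mul ((hv i).1.mul (hv j).1)).div_const 2).add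
    (ContDiff.sum fun j _ => (hg.dd _).mul (hB j).1)).add (hc.1.mul hg)

lemma BB.mul_bound {W : Type*} [NormedAddCommGroup W] [NormedSpace ℝ W] {ι : Type*}
    {e : ι → W} {U : Set W} {F : W → ℝ} (hF : BB e U F) (k : ℕ) :
    ∃ C, 0 ≤ C ∧ ∀ (G : W → ℝ) (A : ℝ), 0 ≤ A → Sm G → DB e U k A G →
      DB e U k (C * A) (fun x => F x * G x) := by
  obtain ⟨B, hB0, hB⟩ := hF.2 k
  exact ⟨2 ^ k * B, by positivity, fun G A hA hG hGA =>
    (hB.mul hB0 hA hF.1 hG hGA).mono (le_of_eq (by ring))⟩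

lemma DB.sum_bound {W : Type*} [NormedAddCommGroup W] [NormedSpace ℝ W] {ι κ : Type*} [Fintype κ]
    {e : ι → W} {U : Set W} {k : ℕ} {C : κ → ℝ} {A : ℝ} {F : κ → W → ℝ} (hF : ∀ i, Sm (F i))
    (h : ∀ i, DB e U k (C i * A) (F i)) :
    DB e U k ((∑ i, C i) * A) (fun x => ∑ i, F i x) := by
  rw [Finset.sum_mul]; exact DB.sum _ hF h

lemma L1_bound (hv : ∀ i, BBu (v i)) (k : ℕ) : ∃ C, 0 ≤ C ∧ ∀ (g : ES N → ℝ) (A : ℝ), 0 ≤ A →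
    Sm g → DBu (k + 1) A g → DBu k (C * A) (L1 v g) := by
  choose C hC0 hC using fun j => (hv j).mul_bound k
  refine ⟨∑ j, C j, Finset.sum_nonneg fun j _ => hC0 j, fun g A hA hg hgA => ?_⟩
  refine DB.sum_bound (fun j => (hg.dd _).mul (hv j).1) fun j => ?_
  have := hC j _ A hA (hg.dd (bs j)) (hgA.2 j)
  simpa only [mul_comm] using this

lemma L2_bound (hv : ∀ i, BBu (v i)) (hB : ∀ i, BBu (B i)) (hc : BBu c) (k : ℕ) :
    ∃ C, 0 ≤ C ∧ ∀ (g : ES N → ℝ) (A : ℝ), 0 ≤ A →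
    Sm g → DBu (k + 2) A g → DBu k (C * A) (L2 v B c g) := by
  choose C hC0 hC using fun j i => ((hv i).mul (hv j)).mul_bound k
  choose C' hC0' hC' using fun j => (hB j).mul_bound k
  obtain ⟨D, hD0, hD⟩ := hc.mul_bound k
  refine ⟨2⁻¹ * (∑ j, ∑ i, C j i) + (∑ j, C' j) + D, ?_, fun g A hA hg hgA => ?_⟩
  · have h1 := Finset.sum_nonneg fun j (_ : j ∈ Finset.univ) =>
      Finset.sum_nonneg fun i (_ : i ∈ Finset.univ) => hC0 j i
    have h2 := Finset.sum_nonneg fun j (_ : j ∈ Finset.univ) => hC0' j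
    positivity
  · have s1 : ∀ j i, Sm (fun x => dd (bs i) (dd (bs j) g) x * (v i x * v j x)) := fun j i =>
      ((hg.dd _).dd _).mul ((hv i).1.mul (hv j).1)
    have s1' : ∀ j, Sm (fun x => ∑ i, dd (bs i) (dd (bs j) g) x * (v i x * v j x)) := fun j =>
      ContDiff.sum fun i _ => s1 j i
    have s2 : ∀ j, Sm (fun x => dd (bs j) g x * B j x) := fun j => (hg.dd _).mul (hB j).1
    have b1 : DBu k ((∑ j, ∑ i, C j i) * A)
        (fun x => ∑ j, ∑ i, dd (bs i) (dd (bs j) g) x * (v i x * v j x)) :=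
      DB.sum_bound s1' fun j => DB.sum_bound (s1 j) fun i => by
        have := hC j i _ A hA ((hg.dd (bs j)).dd (bs i)) ((hgA.2 j).2 i)
        simpa only [mul_comm] using this
    have b1' := b1.smul (ContDiff.sum fun j _ => s1' j) 2⁻¹
    have b2 : DBu k ((∑ j, C' j) * A) (fun x => ∑ j, dd (bs j) g x * B j x) :=
      DB.sum_bound s2 fun j => by
        have := hC' j _ A hA (hg.dd (bs j)) (hgA.2 j).pred
        simpa only [mul_comm] using this
    have b3 := hD g A hA hg hgA.pred.pred
    have := ((b1'.add (contDiff_const.mul (ContDiff.sum fun j _ => s1' j))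
      (ContDiff.sum fun j _ => s2 j) b2).add ((contDiff_const.mul
      (ContDiff.sum fun j _ => s1' j)).add (ContDiff.sum fun j _ => s2 j)) (hc.1.mul hg) b3)
    have e : L2 v B c g = fun x => 2⁻¹ * (∑ j, ∑ i, dd (bs i) (dd (bs j) g) x * (v i x * v j x)) +
      (∑ j, dd (bs j) g x * B j x) + c x * g x := by
      funext x; simp only [L2]; ring
    rw [e]
    refine this.mono (le_of_eq ?_)
    rw [abs_of_pos (by norm_num)]; ring

lemma Hk_expand (hv : ∀ i, BBu (v i)) (hB : ∀ i, BBu (B i)) (hc : BBu c) (k : ℕ) :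
    ∃ C, 0 ≤ C ∧ ∀ (g : ES N → ℝ) (A : ℝ), 0 ≤ A → Sm g → DBu (k + 5) A g →
      ∀ γ : ℝ, |γ| ≤ 1 → DBu k (C * A * |γ| ^ 3)
        (fun x => Hk v B c g (γ, x) - g x - γ * L1 v g x - γ ^ 2 * L2 v B c g x) := by
  have hcW : BBW (fun w => 1 + w.1 ^ 2 * c w.2) :=
    (BB.const 1).add ((BBW_fst.pow 2).mul (BBW_snd hc))
  obtain ⟨C1, hC1, H1⟩ := BB.comp (Psi_smooth hv hB) (dd_Psi_BB hv hB) (k := k + 3)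
  obtain ⟨C2, hC2, H2⟩ := hcW.mul_bound (k + 3)
  obtain ⟨C3, hC3, H3⟩ := DBW_snd (N := N) (k + 3)
  obtain ⟨C4, hC4, H4⟩ := L1_bound hv (k + 3)
  obtain ⟨C5, hC5, H5⟩ := L2_bound hv hB hc (k + 3)
  obtain ⟨C6, hC6, H6⟩ := (BBW_fst (N := N)).mul_bound (k + 3)
  obtain ⟨C7, hC7, H7⟩ := ((BBW_fst (N := N)).pow 2).mul_bound (k + 3)
  refine ⟨C2 * C1 + C3 + C6 * C3 * C4 + C7 * C3 * C5, by positivity,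
    fun g A hA hg hgA γ hγ => ?_⟩
  have sH := Hk_smooth hv hB hc hg
  have sg := hg.comp_snd
  have s1 := L1_smooth hv hg
  have s2 := L2_smooth hv hB hc hg
  have sγ : Sm (fun w : ℝ × ES N => w.1) := contDiff_fst
  have sγ2 : Sm (fun w : ℝ × ES N => w.1 ^ 2) := contDiff_fst.pow 2
  have t1 : Sm (fun w : ℝ × ES N => w.1 * L1 v g w.2) := sγ.mul s1.comp_snd
  have t2 : Sm (fun w : ℝ × ES N => w.1 ^ 2 * L2 v B c g w.2) := sγ2.mul s2.comp_snd
  set F : ℝ × ES N → ℝ := fun w => Hk v B c g w - g w.2 - w.1 * L1 v g w.2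
    - w.1 ^ 2 * L2 v B c g w.2 with hF
  have sF : Sm F := ((sH.sub sg).sub t1).sub t2
  -- bounds
  have b1 : DBW (k + 3) (C2 * (C1 * A)) (Hk v B c g) :=
    H2 _ _ (by positivity) (hg.comp_Psi hv hB) (H1 g A hA hg (hgA.of_le (by omega)))
  have b2 := H3 g A hA hg (hgA.of_le (by omega))
  have b3 := H6 _ _ (by positivity) s1.comp_snd (H3 _ _ (by positivity) s1
    (H4 g A hA hg (hgA.of_le (by omega))))
  have b4 := H7 _ _ (by positivity) s2.comp_snd (H3 _ _ (by positivity) s2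
    (H5 g A hA hg hgA))
  have hneg : ∀ {G : ℝ × ES N → ℝ} {D : ℝ}, Sm G → DBW (k + 3) D G →
      DBW (k + 3) D (fun w => (-1) * G w) := fun hG h => by simpa using h.smul hG (-1)
  have bF : DBW (k + 3) ((C2 * C1 + C3 + C6 * C3 * C4 + C7 * C3 * C5) * A) F := by
    have m : ∀ {G : ℝ × ES N → ℝ}, Sm G → Sm (fun w => (-1) * G w) := fun h =>
      contDiff_const.mul h
    have := (((b1.add sH (m sg) (hneg sg b2)).add (sH.add (m sg)) (m t1) (hneg t1 b3)).add
      ((sH.add (m sg)).add (m t1)) (m t2) (hneg t2 b4))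
    have e : F = fun w => Hk v B c g w + (-1) * g w.2 + (-1) * (w.1 * L1 v g w.2) +
      (-1) * (w.1 ^ 2 * L2 v B c g w.2) := by funext w; simp only [hF]; ring
    rw [e]
    exact this.mono (le_of_eq (by ring))
  -- derivatives in `γ`
  have dγ2 : dd (eW none) (fun w : ℝ × ES N => w.1 ^ 2) = fun w => 2 * w.1 := by
    simp only [sq]
    rw [dd_mul_of sγ.diff sγ.diff, dd_eW_fst]
    funext w; simp [eW]; ring
  have d2γ : dd (eW none) (fun w : ℝ × ES N => 2 * w.1) = fun _ => 2 := by
    rw [dd_smul_of sγ.diff, dd_eW_fst]; simp [eW]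
  have sc := hc.1.comp_snd
  have s1c : Sm (fun w : ℝ × ES N => w.1 ^ 2 * c w.2) := sγ2.mul sc
  have scW := hcW.1
  have s2γ : Sm (fun w : ℝ × ES N => 2 * w.1) := contDiff_const.mul sγ
  have dcW : dd (eW none) (fun w : ℝ × ES N => 1 + w.1 ^ 2 * c w.2) =
      fun w => 2 * w.1 * c w.2 := by
    rw [dd_add_of (contDiff_const.differentiable (n := 1) (by simp)) s1c.diff, dd_const,
      dd_mul_of sγ2.diff sc.diff, dγ2, dd_none_snd hc.1]
    funext w; simp
  have d2cW : dd (eW none) (fun w : ℝ × ES N => 2 * w.1 * c w.2) = fun w => 2 * c w.2 := by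
    rw [dd_mul_of s2γ.diff sc.diff, d2γ, dd_none_snd hc.1]
    funext w; simp
  set h0 : ℝ × ES N → ℝ := fun w => g (Psi v B w) with hh0
  have sh0 : Sm h0 := hg.comp_Psi hv hB
  set h1 : ℝ × ES N → ℝ := fun w =>
    ∑ j, dd (bs j) g (Psi v B w) * (v j w.2 + 2 * w.1 * B j w.2) with hh1
  have dh0 : dd (eW none) h0 = h1 := dd_none_comp hg hv hB
  have sh1 : Sm h1 := dh0 ▸ sh0.dd _
  have dH : dd (eW none) (Hk v B c g) = fun w => 2 * w.1 * c w.2 * h0 w +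
      (1 + w.1 ^ 2 * c w.2) * h1 w := by
    change dd (eW none) (fun w => (1 + w.1 ^ 2 * c w.2) * h0 w) = _
    rw [dd_mul_of scW.diff sh0.diff, dcW, dh0]
  have s2γc : Sm (fun w : ℝ × ES N => 2 * w.1 * c w.2) := s2γ.mul sc
  have ddH : ∀ x, dd (eW none) (dd (eW none) (Hk v B c g)) (0, x) =
      2 * c x * g x + dd (eW none) h1 (0, x) := by
    intro x
    rw [dH, dd_add_of (Sm.diff (s2γc.mul sh0 : Sm _)) (Sm.diff (scW.mul sh1 : Sm _)),
      dd_mul_of s2γc.diff sh0.diff, dd_mul_of scW.diff sh1.diff, d2cW, dcW]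
    simp [hh0, Psi_zero]
  have dh1 : ∀ x, dd (eW none) h1 (0, x) =
      ∑ j, ((∑ i, dd (bs i) (dd (bs j) g) x * v i x) * v j x + dd (bs j) g x * (2 * B j x)) := by
    intro x
    have sA : ∀ j, Sm (fun w => dd (bs j) g (Psi v B w)) := fun j => (hg.dd _).comp_Psi hv hB
    have sv : ∀ j, Sm (fun w : ℝ × ES N => v j w.2) := fun j => (hv j).1.comp_snd
    have sB : ∀ j, Sm (fun w : ℝ × ES N => B j w.2) := fun j => (hB j).1.comp_snd
    have s2B : ∀ j, Sm (fun w : ℝ × ES N => 2 * w.1 * B j w.2) := fun j => s2γ.mul (sB j)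
    have sD : ∀ j, Sm (fun w : ℝ × ES N => v j w.2 + 2 * w.1 * B j w.2) := fun j =>
      (sv j).add (s2B j)
    simp only [hh1]
    rw [dd_sum_of _ (fun j => Sm.diff ((sA j).mul (sD j)))]
    refine Finset.sum_congr rfl fun j _ => ?_
    rw [dd_mul_of (sA j).diff (sD j).diff, dd_none_comp (hg.dd _) hv hB,
      dd_add_of (sv j).diff (s2B j).diff, dd_none_snd (hv j).1,
      dd_mul_of s2γ.diff (sB j).diff, d2γ, dd_none_snd (hB j).1]
    simp [Psi_zero]
  have dF : dd (eW none) F = fun w => dd (eW none) (Hk v B c g) w - L1 v g w.2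
      - 2 * w.1 * L2 v B c g w.2 := by
    simp only [hF]
    rw [dd_sub_of (Sm.diff ((sH.sub sg).sub t1)) t2.diff,
      dd_sub_of (Sm.diff (sH.sub sg : Sm _)) t1.diff, dd_sub_of sH.diff sg.diff, dd_none_snd hg,
      dd_mul_of sγ.diff s1.comp_snd.diff, dd_mul_of sγ2.diff s2.comp_snd.diff, dd_eW_fst, dγ2,
      dd_none_snd s1, dd_none_snd s2]
    funext w; simp [eW]
  have ddF : ∀ x, dd (eW none) (dd (eW none) F) (0, x) =
      dd (eW none) (dd (eW none) (Hk v B c g)) (0, x) - 2 * L2 v B c g x := by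
    intro x
    rw [dF, dd_sub_of (Sm.diff ((sH.dd _).sub s1.comp_snd)) (Sm.diff (s2γ.mul s2.comp_snd : Sm _)),
      dd_sub_of (sH.dd _).diff s1.comp_snd.diff, dd_none_snd s1,
      dd_mul_of s2γ.diff s2.comp_snd.diff, d2γ, dd_none_snd s2]
    simp
  refine taylor_three sF (by positivity) ?_ ?_ ?_ k bF γ hγ
  · intro x; simp [hF, Hk, Psi_zero]
  · intro x; rw [dF, dH]; simp [hh1, Psi_zero, L1]
  · intro x
    rw [ddF, ddH, dh1]
    simp only [L2, Finset.sum_add_distrib]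
    have e1 : ∑ j, (∑ i, dd (bs i) (dd (bs j) g) x * v i x) * v j x =
        ∑ j, ∑ i, dd (bs i) (dd (bs j) g) x * (v i x * v j x) := by
      refine Finset.sum_congr rfl fun j _ => ?_
      rw [Finset.sum_mul]
      exact Finset.sum_congr rfl fun i _ => by ring
    have e2 : ∑ j, dd (bs j) g x * (2 * B j x) = 2 * ∑ j, dd (bs j) g x * B j x := by
      rw [Finset.mul_sum]
      exact Finset.sum_congr rfl fun i _ => by ring
    rw [e1, e2]; ring

variable {V : Fin N → Fin N → ES N → ℝ} {Q : Fin N → Fin N → ES N → ℝ}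

lemma Kop_consistent (hN : 1 ≤ N) (hV : ∀ k i, BBu (V k i)) (hB : ∀ i, BBu (B i)) (hc : BBu c)
    (hQ : ∀ i j x, ∑ k, V k i x * V k j x = 2 * N * Q i j x) (k : ℕ) :
    ∃ C, 0 ≤ C ∧ ∀ (g : ES N → ℝ) (A : ℝ), 0 ≤ A → Sm g → DBu (k + 5) A g →
      ∀ γ : ℝ, |γ| ≤ 1 → DBu k (C * A * |γ| ^ 3)
        (fun x => Kop V B c γ g x - g x - γ ^ 2 * Ag Q B c g x) := by
  choose C hC0 hC using fun l => Hk_expand (hV l) hB hc k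
  have hNpos : (0:ℝ) < N := by exact_mod_cast hN
  refine ⟨(2 * N : ℝ)⁻¹ * ∑ l, 2 * C l, mul_nonneg (by positivity)
    (Finset.sum_nonneg fun l _ => by have := hC0 l; positivity), fun g A hA hg hgA γ hγ => ?_⟩
  set R : ℝ → Fin N → ES N → ℝ := fun γ l x => Hk (V l) B c g (γ, x) - g x - γ * L1 (V l) g x
    - γ ^ 2 * L2 (V l) B c g x with hR
  have sR : ∀ γ l, Sm (R γ l) := fun γ l =>
    (((slice_smooth (Hk_smooth (hV l) hB hc hg) γ).sub hg).sub
      (contDiff_const.mul (L1_smooth (hV l) hg))).sub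
      (contDiff_const.mul (L2_smooth (hV l) hB hc hg))
  have bR : ∀ l, DBu k (2 * C l * (A * |γ| ^ 3)) (fun x => R γ l x + R (-γ) l x) := fun l => by
    have h1 := hC l g A hA hg hgA γ hγ
    have h2 := hC l g A hA hg hgA (-γ) (by rwa [abs_neg])
    rw [abs_neg] at h2
    exact (DB.add (sR γ l) (sR (-γ) l) h1 h2).mono (le_of_eq (by ring))
  have sR2 : ∀ l, Sm (fun x => R γ l x + R (-γ) l x) := fun l => (sR γ l).add (sR (-γ) l)
  have := (DB.sum_bound sR2 bR).smul (ContDiff.sum fun l _ => sR2 l) (2 * N : ℝ)⁻¹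
  rw [abs_of_pos (by positivity : (0:ℝ) < (2 * N : ℝ)⁻¹)] at this
  have e : (fun x => Kop V B c γ g x - g x - γ ^ 2 * Ag Q B c g x) =
      fun x => (2 * N : ℝ)⁻¹ * ∑ l, (R γ l x + R (-γ) l x) := by
    funext x
    have e1 : ∀ l, R γ l x + R (-γ) l x = (Hk (V l) B c g (γ, x) + Hk (V l) B c g (-γ, x))
        - (2 * g x + 2 * γ ^ 2 * ((∑ j, dd (bs j) g x * B j x) + c x * g x)) - γ ^ 2 *
        (∑ j, ∑ i, dd (bs i) (dd (bs j) g) x * (V l i x * V l j x)) := by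
      intro l; simp only [hR, L2]; ring
    have e2 : ∑ l, ∑ j, ∑ i, dd (bs i) (dd (bs j) g) x * (V l i x * V l j x) =
        2 * N * ∑ i, ∑ j, Q i j x * dd (bs i) (dd (bs j) g) x := by
      rw [Finset.sum_comm]
      simp_rw [Finset.sum_comm (s := (Finset.univ : Finset (Fin N))) (t := Finset.univ)
        (f := fun l i => dd (bs i) (dd (bs _) g) x * (V l i x * V l _ x))]
      simp_rw [← Finset.mul_sum, hQ]
      rw [Finset.sum_comm, Finset.mul_sum]
      refine Finset.sum_congr rfl fun i _ => ?_
      rw [Finset.mul_sum]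
      exact Finset.sum_congr rfl fun j _ => by ring
    simp_rw [e1, Finset.sum_sub_distrib, ← Finset.mul_sum]
    rw [e2]
    simp only [Finset.sum_const, Finset.card_univ, Fintype.card_fin, nsmul_eq_mul, Kop, Ag]
    have e3 : ∑ j, dd (bs j) g x * B j x = ∑ j, B j x * dd (bs j) g x :=
      Finset.sum_congr rfl fun j _ => by ring
    rw [e3]
    field_simp
    ring
  rw [e]
  refine this.mono (le_of_eq (by ring))

end consist

/-! ### Chains of one-step operators -/

section chain
variable {N : ℕ}

/-- Smooth, bounded, time independent coefficients, with a factorization of the diffusion matrix. -/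
structure Scheme (N : ℕ) where
  Q : Fin N → Fin N → ES N → ℝ
  B : Fin N → ES N → ℝ
  c : ES N → ℝ
  V : Fin N → Fin N → ES N → ℝ
  hQB : ∀ i j, BBu (Q i j)
  hV : ∀ k i, BBu (V k i)
  hB : ∀ i, BBu (B i)
  hc : BBu c
  hQ : ∀ i j x, ∑ k, V k i x * V k j x = 2 * N * Q i j x

namespace Scheme

/-- The one-step operator of the full equation. -/
def op (S : Scheme N) (γ : ℝ) (g : ES N → ℝ) : ES N → ℝ := Kop S.V S.B S.c γ g

/-- The averaging operator, i.e. the one-step operator without the zero-order term. -/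
def av (S : Scheme N) (γ : ℝ) (g : ES N → ℝ) : ES N → ℝ := Kop S.V S.B (fun _ => 0) γ g

def A (S : Scheme N) (g : ES N → ℝ) : ES N → ℝ := Ag S.Q S.B S.c g

def A0 (S : Scheme N) (g : ES N → ℝ) : ES N → ℝ := Ag S.Q S.B (fun _ => 0) g

lemma av_le (hN : 1 ≤ N) (S : Scheme N) (γ : ℝ) {g : ES N → ℝ} {K : ℝ} (h : ∀ x, g x ≤ K)
    (x : ES N) : S.av γ g x ≤ K := by
  have hNpos : (0:ℝ) < N := by exact_mod_cast hN
  have : ∑ k : Fin N, (Hk (S.V k) S.B (fun _ => 0) g (γ, x)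
      + Hk (S.V k) S.B (fun _ => 0) g (-γ, x)) ≤ ∑ _k : Fin N, (K + K) :=
    Finset.sum_le_sum fun k _ => by
      simp only [Hk, mul_zero, add_zero, one_mul]
      exact add_le_add (h _) (h _)
  simp only [av, Kop]
  rw [inv_mul_le_iff₀ (by positivity)]
  refine this.trans (le_of_eq ?_)
  simp; ring

lemma abs_op_le (hN : 1 ≤ N) (S : Scheme N) {γ c₀ : ℝ} (hc : ∀ x, S.c x ≤ c₀)
    (hγ : ∀ x, 0 ≤ 1 + γ ^ 2 * S.c x) {g : ES N → ℝ} {K : ℝ} (h : ∀ x, |g x| ≤ K)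
    (x : ES N) : |S.op γ g x| ≤ (1 + γ ^ 2 * c₀) * K := by
  have hNpos : (0:ℝ) < N := by exact_mod_cast hN
  have h1 : ∀ y, |(1 + γ ^ 2 * S.c x) * g y| ≤ (1 + γ ^ 2 * c₀) * K := fun y => by
    rw [abs_mul, abs_of_nonneg (hγ x)]
    have := mul_le_mul_of_nonneg_left (hc x) (sq_nonneg γ)
    exact mul_le_mul (by linarith) (h y) (abs_nonneg _) (by linarith [hγ x])
  have : |∑ k : Fin N, (Hk (S.V k) S.B S.c g (γ, x)
      + Hk (S.V k) S.B S.c g (-γ, x))| ≤ ∑ _k : Fin N, (2 * ((1 + γ ^ 2 * c₀) * K)) := by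
    refine (Finset.abs_sum_le_sum_abs _ _).trans (Finset.sum_le_sum fun k _ => ?_)
    refine (abs_add_le _ _).trans ?_
    simp only [Hk, neg_sq]
    linarith [h1 (Psi (S.V k) S.B (γ, x)), h1 (Psi (S.V k) S.B (-γ, x))]
  simp only [op, Kop]
  rw [abs_mul, abs_of_pos (by positivity : (0:ℝ) < (2 * N : ℝ)⁻¹),
    inv_mul_le_iff₀ (by positivity)]
  refine this.trans (le_of_eq ?_)
  simp; ring

end Scheme

variable {ι : Type}

/-- Iteration of the one-step operators. -/
def chain (S : ι → Scheme N) (κ : ℕ → ι) (γ : ℝ) (u₀ : ES N → ℝ) : ℕ → ES N → ℝ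
  | 0 => u₀
  | m + 1 => (S (κ m)).op γ (chain S κ γ u₀ m)

lemma one_add_pow_le {C h T : ℝ} (hC : 0 ≤ C) (hh : 0 ≤ h) {m : ℕ} (hm : m * h ≤ T) :
    (1 + C * h) ^ m ≤ Real.exp (C * T) := by
  have h1 : 1 + C * h ≤ Real.exp (C * h) := by linarith [Real.add_one_le_exp (C * h)]
  calc (1 + C * h) ^ m ≤ Real.exp (C * h) ^ m := by gcongr
    _ = Real.exp (C * (m * h)) := by rw [← Real.exp_nat_mul]; ring_nf
    _ ≤ _ := by gcongr

lemma chain_smooth (S : ι → Scheme N) (κ : ℕ → ι) (γ : ℝ) {u₀ : ES N → ℝ} (hu : Sm u₀) (m : ℕ) :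
    Sm (chain S κ γ u₀ m) := by
  induction m with
  | zero => exact hu
  | succ m ih => exact Kop_smooth (S _).hV (S _).hB (S _).hc γ ih

variable [Fintype ι]

/-- Uniform bounds for the derivatives along the chains. -/
lemma chain_bounds (hN : 1 ≤ N) (S : ι → Scheme N) {u₀ : ES N → ℝ} (hu : BBu u₀) (T : ℝ) (k : ℕ) :
    ∃ A, 0 ≤ A ∧ ∃ γ₀, 0 < γ₀ ∧ γ₀ ≤ 1 ∧ ∀ γ, 0 < γ → γ ≤ γ₀ → ∀ (κ : ℕ → ι) (m : ℕ),
      m * γ ^ 2 ≤ T → DBu k A (chain S κ γ u₀ m) := by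
  choose C' hC0 hC' using fun i => Kop_stable hN (S i).hV (S i).hB (S i).hc k
  set C := ∑ i, C' i
  have hle : ∀ i, C' i ≤ C := fun i =>
    Finset.single_le_sum (f := C') (fun j _ => hC0 j) (Finset.mem_univ i)
  have hC : 0 ≤ C := Finset.sum_nonneg fun i _ => hC0 i
  obtain ⟨A₀, hA₀, hA⟩ := hu.2 k
  set Q := ∑ _I : Jx N k, A₀ ^ 2
  have hQ0 : 0 ≤ Q := Finset.sum_nonneg fun _ _ => sq_nonneg _
  refine ⟨Real.sqrt (Real.exp (C * T) * Q), Real.sqrt_nonneg _, 1 / (1 + C), by positivity,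
    by rw [div_le_one (by positivity)]; linarith, fun γ hγ hγ' κ => ?_⟩
  have hγC : γ * (1 + C) ≤ 1 := by rwa [le_div_iff₀ (by positivity)] at hγ'
  have hγ1 : γ ≤ 1 := by nlinarith
  have hCγ : C * γ ^ 2 ≤ 1 := by nlinarith [mul_nonneg hC hγ.le]
  have key : ∀ m x, ∑ I, GJ k I (chain S κ γ u₀ m) x ^ 2 ≤ (1 + C * γ ^ 2) ^ m * Q := by
    intro m
    induction m with
    | zero =>
      intro x
      rw [pow_zero, one_mul]
      exact Finset.sum_le_sum fun I _ => by
        rw [← sq_abs]; exact pow_le_pow_left₀ (abs_nonneg _) (GJ_of_DBu hA I x) 2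
    | succ m ih =>
      intro x
      refine (hC' (κ m) γ (by rw [abs_of_pos hγ]; exact hγ1)
        ((mul_le_mul_of_nonneg_right (hle _) (sq_nonneg γ)).trans hCγ) _
        (chain_smooth S κ γ hu.1 m) _ ih x).trans ?_
      rw [pow_succ' (1 + C * γ ^ 2) m, mul_assoc]
      have := mul_le_mul_of_nonneg_right (hle (κ m)) (sq_nonneg γ)
      gcongr
  intro m hm
  refine DBu_of_GJ fun I x => Real.abs_le_sqrt ?_
  calc GJ k I (chain S κ γ u₀ m) x ^ 2 ≤ ∑ I, GJ k I (chain S κ γ u₀ m) x ^ 2 :=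
        Finset.single_le_sum (f := fun I => GJ k I (chain S κ γ u₀ m) x ^ 2)
          (fun _ _ => sq_nonneg _) (Finset.mem_univ I)
    _ ≤ _ := key m x
    _ ≤ _ := by gcongr; exact one_add_pow_le hC (sq_nonneg γ) hm

/-- Consistency along the chains. -/
lemma op_consistent (hN : 1 ≤ N) (S : ι → Scheme N) (k : ℕ) :
    ∃ C, 0 ≤ C ∧ ∀ (i : ι) (g : ES N → ℝ) (A : ℝ), 0 ≤ A → Sm g → DBu (k + 5) A g →
      ∀ γ : ℝ, |γ| ≤ 1 → DBu k (C * A * |γ| ^ 3)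
        (fun x => (S i).op γ g x - g x - γ ^ 2 * (S i).A g x) := by
  choose C' hC0 hC' using fun i => Kop_consistent hN (S i).hV (S i).hB (S i).hc (S i).hQ k
  refine ⟨∑ i, C' i, Finset.sum_nonneg fun i _ => hC0 i, fun i g A hA hg hgA γ hγ => ?_⟩
  refine (hC' i g A hA hg hgA γ hγ).mono ?_
  have : C' i ≤ ∑ i, C' i :=
    Finset.single_le_sum (f := C') (fun j _ => hC0 j) (Finset.mem_univ i)
  gcongr

lemma av_consistent (hN : 1 ≤ N) (S : ι → Scheme N) (k : ℕ) :
    ∃ C, 0 ≤ C ∧ ∀ (i : ι) (g : ES N → ℝ) (A : ℝ), 0 ≤ A → Sm g → DBu (k + 5) A g →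
      ∀ γ : ℝ, |γ| ≤ 1 → DBu k (C * A * |γ| ^ 3)
        (fun x => (S i).av γ g x - g x - γ ^ 2 * (S i).A0 g x) := by
  choose C' hC0 hC' using fun i => Kop_consistent hN (S i).hV (S i).hB (BB.const 0) (S i).hQ k
  refine ⟨∑ i, C' i, Finset.sum_nonneg fun i _ => hC0 i, fun i g A hA hg hgA γ hγ => ?_⟩
  refine (hC' i g A hA hg hgA γ hγ).mono ?_
  have : C' i ≤ ∑ i, C' i :=
    Finset.single_le_sum (f := C') (fun j _ => hC0 j) (Finset.mem_univ i)
  gcongr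

/-- Sup bound along the chains. -/
lemma chain_sup (hN : 1 ≤ N) (S : ι → Scheme N) {c₀ : ℝ} (hc₀ : 0 ≤ c₀)
    (hc : ∀ i x, (S i).c x ≤ c₀) : ∃ γ₀, 0 < γ₀ ∧ ∀ γ, 0 < γ → γ ≤ γ₀ →
      ∀ (κ : ℕ → ι) (u₀ : ES N → ℝ) (M : ℝ), 0 ≤ M → (∀ x, |u₀ x| ≤ M) → ∀ (T : ℝ) (m : ℕ),
        m * γ ^ 2 ≤ T → ∀ x, |chain S κ γ u₀ m x| ≤ Real.exp (c₀ * T) * M := by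
  choose D hD0 hD using fun i => (S i).hc.2 0
  set E := ∑ i, D i
  have hle : ∀ i, D i ≤ E := fun i =>
    Finset.single_le_sum (f := D) (fun j _ => hD0 j) (Finset.mem_univ i)
  have hE : 0 ≤ E := Finset.sum_nonneg fun i _ => hD0 i
  refine ⟨1 / (1 + E), by positivity, fun γ hγ hγ' κ u₀ M hM hu T m hm x => ?_⟩
  have hγE : γ * (1 + E) ≤ 1 := by rwa [le_div_iff₀ (by positivity)] at hγ'
  have hγ1 : γ ≤ 1 := by nlinarith
  have hEγ : γ ^ 2 * E ≤ 1 := by nlinarith [mul_nonneg hE hγ.le]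
  have hnn : ∀ i y, 0 ≤ 1 + γ ^ 2 * (S i).c y := fun i y => by
    have h1 := neg_le_of_abs_le (((hD i).bound y (mem_univ y)).trans (hle i))
    nlinarith [sq_nonneg γ]
  have key : ∀ m x, |chain S κ γ u₀ m x| ≤ (1 + c₀ * γ ^ 2) ^ m * M := by
    intro m
    induction m with
    | zero => simpa [chain] using hu
    | succ m ih =>
      intro x
      have := Scheme.abs_op_le hN (S (κ m)) (hc _) (hnn _) ih x
      rw [pow_succ', mul_assoc, mul_comm c₀]
      rwa [mul_comm c₀] at this
  refine (key m x).trans ?_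
  gcongr
  exact one_add_pow_le hc₀ (sq_nonneg γ) hm

/-- Discrete maximum principle. -/
lemma discrete_max (hN : 1 ≤ N) (S : ι → Scheme N) : ∃ E, 0 ≤ E ∧
    ∀ (κ : ℕ → ι) (γ : ℝ), 0 < γ → γ ≤ 1 → ∀ (v : ℕ → ES N → ℝ) (A C D K T : ℝ), 0 ≤ A → 0 ≤ C →
      0 ≤ D → 0 ≤ K → ∀ M : ℕ, M * γ ^ 2 ≤ T →
      (∀ m < M, Sm (v m)) → (∀ m < M, DBu 5 A (v m)) → (∀ x, v 0 x ≤ K) →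
      (∀ m < M, ∀ x, v (m + 1) x ≤
        v m x + γ ^ 2 * ((S (κ m)).A0 (v m) x + C * v m x) + D * γ ^ 3) →
      ∀ x, v M x ≤ Real.exp (C * T) * (K + T * ((E * A + D) * γ)) := by
  obtain ⟨E, hE, hE'⟩ := av_consistent hN S 0
  refine ⟨E, hE, fun κ γ hγ hγ1 v A C D K T hA hC hD hK M hM hs hb h0 hstep => ?_⟩
  set G := (E * A + D) * γ with hG
  have hG0 : 0 ≤ G := by positivity
  have key : ∀ m ≤ M, ∀ x, v m x ≤ (1 + C * γ ^ 2) ^ m * (K + m * γ ^ 2 * G) := by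
    intro m
    induction m with
    | zero => intro _ x; simpa using h0 x
    | succ m ih =>
      intro hm x
      have hm' : m < M := hm
      have ih' := ih hm'.le
      set L := (1 + C * γ ^ 2) ^ m * (K + m * γ ^ 2 * G) with hL
      have hL0 : 0 ≤ L := by positivity
      have h1 := hstep m hm' x
      have h2 := neg_le_of_abs_le ((hE' (κ m) (v m) A hA (hs m hm') (hb m hm') γ
        (by rw [abs_of_pos hγ]; exact hγ1)).bound x (mem_univ x))
      rw [abs_of_pos hγ] at h2
      have h3 := Scheme.av_le hN (S (κ m)) γ ih' x
      have h4 : v (m + 1) x ≤ L + C * γ ^ 2 * L + γ ^ 2 * G := by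
        have h5 : C * γ ^ 2 * v m x ≤ C * γ ^ 2 * L := by gcongr; exact ih' x
        have h6 : γ ^ 2 * G = E * A * γ ^ 3 + D * γ ^ 3 := by rw [hG]; ring
        nlinarith
      have h7 : 1 ≤ (1 + C * γ ^ 2) ^ (m + 1) := one_le_pow₀ (by nlinarith [sq_nonneg γ])
      have h8 : γ ^ 2 * G ≤ (1 + C * γ ^ 2) ^ (m + 1) * (γ ^ 2 * G) :=
        le_mul_of_one_le_left (by positivity) h7
      refine h4.trans ?_
      have : (1 + C * γ ^ 2) ^ (m + 1) * (K + (m + 1 : ℕ) * γ ^ 2 * G)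
          = L + C * γ ^ 2 * L + (1 + C * γ ^ 2) ^ (m + 1) * (γ ^ 2 * G) := by
        rw [hL, pow_succ]; push_cast; ring
      linarith
  intro x
  refine (key M le_rfl x).trans ?_
  have := one_add_pow_le hC (sq_nonneg γ) hM
  gcongr

end chain

/-! ### Algebra of the Bernstein method -/

section bernstein
variable {N : ℕ}

/-- The carré du champ associated with the matrix `Q`. -/
def Gm (Q : Fin N → Fin N → ES N → ℝ) (f g : ES N → ℝ) (x : ES N) : ℝ :=
  ∑ i, ∑ j, Q i j x * (dd (bs i) f x * dd (bs j) g x)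

lemma dd_dd_mul {f g : ES N → ℝ} (hf : Sm f) (hg : Sm g) (v w : ES N) (x : ES N) :
    dd v (dd w (fun x => f x * g x)) x = f x * dd v (dd w g) x + dd v f x * dd w g x
      + dd w f x * dd v g x + g x * dd v (dd w f) x := by
  rw [dd_mul_of hf.diff hg.diff, dd_add_of (Sm.diff ((hf.dd w).mul hg)) (Sm.diff (hf.mul (hg.dd w))),
    dd_mul_of (hf.dd w).diff hg.diff, dd_mul_of hf.diff (hg.dd w).diff]
  ring

lemma Ag_mul (Q : Fin N → Fin N → ES N → ℝ) (B : Fin N → ES N → ℝ) {f g : ES N → ℝ}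
    (hf : Sm f) (hg : Sm g) (x : ES N) :
    Ag Q B (fun _ => 0) (fun x => f x * g x) x = f x * Ag Q B (fun _ => 0) g x
      + g x * Ag Q B (fun _ => 0) f x + (Gm Q f g x + Gm Q g f x) := by
  have h1 : ∑ i, ∑ j, Q i j x * dd (bs i) (dd (bs j) (fun x => f x * g x)) x =
      f x * (∑ i, ∑ j, Q i j x * dd (bs i) (dd (bs j) g) x)
      + g x * (∑ i, ∑ j, Q i j x * dd (bs i) (dd (bs j) f) x) + (Gm Q f g x + Gm Q g f x) := by
    simp only [Gm, Finset.mul_sum, ← Finset.sum_add_distrib]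
    exact Finset.sum_congr rfl fun i _ => Finset.sum_congr rfl fun j _ => by
      rw [dd_dd_mul hf hg]; ring
  have h2 : ∑ j, B j x * dd (bs j) (fun x => f x * g x) x =
      f x * (∑ j, B j x * dd (bs j) g x) + g x * (∑ j, B j x * dd (bs j) f x) := by
    simp only [Finset.mul_sum, ← Finset.sum_add_distrib]
    exact Finset.sum_congr rfl fun j _ => by rw [dd_mul_of hf.diff hg.diff]; ring
  simp only [Ag, h1, h2]
  ring

lemma Ag_sum (Q : Fin N → Fin N → ES N → ℝ) (B : Fin N → ES N → ℝ) (c : ES N → ℝ) {κ : Type*}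
    (s : Finset κ) {f : κ → ES N → ℝ} (hf : ∀ a, Sm (f a)) (x : ES N) :
    Ag Q B c (fun x => ∑ a ∈ s, f a x) x = ∑ a ∈ s, Ag Q B c (f a) x := by
  simp only [Ag]
  simp_rw [dd_sum_of s (fun a => (hf a).diff), dd_sum_of s (fun a => ((hf a).dd _).diff)]
  simp only [Finset.mul_sum]
  rw [Finset.sum_add_distrib, Finset.sum_add_distrib]
  congr 2
  · conv_rhs => rw [Finset.sum_comm]
    refine Finset.sum_congr rfl fun i _ => ?_
    conv_rhs => rw [Finset.sum_comm]
  · rw [Finset.sum_comm]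

lemma Ag_smul (Q : Fin N → Fin N → ES N → ℝ) (B : Fin N → ES N → ℝ) (c : ES N → ℝ)
    {f : ES N → ℝ} (hf : Sm f) (a : ℝ) (x : ES N) :
    Ag Q B c (fun x => a * f x) x = a * Ag Q B c f x := by
  simp only [Ag]
  simp_rw [dd_smul_of hf.diff a, dd_smul_of (hf.dd _).diff a]
  rw [mul_add, mul_add, Finset.mul_sum, Finset.mul_sum]
  simp only [Finset.mul_sum]
  refine congrArg₂ (· + ·) (congrArg₂ (· + ·) ?_ ?_) (by ring)
  · exact Finset.sum_congr rfl fun i _ => Finset.sum_congr rfl fun j _ => by ring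
  · exact Finset.sum_congr rfl fun j _ => by ring

lemma Ag_smooth {Q : Fin N → Fin N → ES N → ℝ} {B : Fin N → ES N → ℝ} {c : ES N → ℝ}
    (hQ : ∀ i j, Sm (Q i j)) (hB : ∀ i, Sm (B i)) (hc : Sm c) {u : ES N → ℝ} (hu : Sm u) :
    Sm (Ag Q B c u) :=
  ((ContDiff.sum fun i _ => ContDiff.sum fun j _ => (hQ i j).mul ((hu.dd _).dd _)).add
    (ContDiff.sum fun j _ => (hB j).mul (hu.dd _))).add (hc.mul hu)

/-- Differentiation of the operator. -/
lemma dd_Ag {Q : Fin N → Fin N → ES N → ℝ} {B : Fin N → ES N → ℝ} {c : ES N → ℝ}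
    (hQ : ∀ i j, Sm (Q i j)) (hB : ∀ i, Sm (B i)) (hc : Sm c) {u : ES N → ℝ} (hu : Sm u)
    (l : Fin N) : dd (bs l) (Ag Q B c u) = fun x => Ag Q B c (dd (bs l) u) x +
      Ag (fun i j => dd (bs l) (Q i j)) (fun i => dd (bs l) (B i)) (dd (bs l) c) u x := by
  have s1 : ∀ i j, Sm (fun x => Q i j x * dd (bs i) (dd (bs j) u) x) := fun i j =>
    (hQ i j).mul ((hu.dd _).dd _)
  have s1' : ∀ i, Sm (fun x => ∑ j, Q i j x * dd (bs i) (dd (bs j) u) x) := fun i =>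
    ContDiff.sum fun j _ => s1 i j
  have s1'' : Sm (fun x => ∑ i, ∑ j, Q i j x * dd (bs i) (dd (bs j) u) x) :=
    ContDiff.sum fun i _ => s1' i
  have s2 : ∀ j, Sm (fun x => B j x * dd (bs j) u x) := fun j => (hB j).mul (hu.dd _)
  have s2' : Sm (fun x => ∑ j, B j x * dd (bs j) u x) := ContDiff.sum fun j _ => s2 j
  have s3 : Sm (fun x => c x * u x) := hc.mul hu
  have : Ag Q B c u = fun x => (∑ i, ∑ j, Q i j x * dd (bs i) (dd (bs j) u) x)
    + (∑ j, B j x * dd (bs j) u x) + c x * u x := rfl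
  rw [this, dd_add_of (Sm.diff (s1''.add s2')) s3.diff, dd_add_of s1''.diff s2'.diff,
    dd_sum_of _ (fun i => (s1' i).diff), dd_sum_of _ (fun i => (s2 i).diff),
    dd_mul_of hc.diff hu.diff]
  funext x
  have h1 : ∑ i, dd (bs l) (fun x => ∑ j, Q i j x * dd (bs i) (dd (bs j) u) x) x =
      (∑ i, ∑ j, Q i j x * dd (bs i) (dd (bs j) (dd (bs l) u)) x) +
      (∑ i, ∑ j, dd (bs l) (Q i j) x * dd (bs i) (dd (bs j) u) x) := by
    rw [← Finset.sum_add_distrib]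
    refine Finset.sum_congr rfl fun i _ => ?_
    rw [dd_sum_of _ (fun j => (s1 i j).diff), ← Finset.sum_add_distrib]
    refine Finset.sum_congr rfl fun j _ => ?_
    rw [dd_mul_of (hQ i j).diff ((hu.dd _).dd _).diff, dd_comm (hu.dd _) (bs l),
      dd_comm hu (bs l)]
    ring
  have h2 : ∑ j, dd (bs l) (fun x => B j x * dd (bs j) u x) x =
      (∑ j, B j x * dd (bs j) (dd (bs l) u) x) + (∑ j, dd (bs l) (B j) x * dd (bs j) u x) := by
    rw [← Finset.sum_add_distrib]
    refine Finset.sum_congr rfl fun j _ => ?_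
    rw [dd_mul_of (hB j).diff (hu.dd _).diff, dd_comm hu (bs l)]
    ring
  simp only [Ag, h1, h2]
  ring

lemma Gm_mul_left (Q : Fin N → Fin N → ES N → ℝ) {f g h : ES N → ℝ} (hf : Sm f) (hg : Sm g)
    (x : ES N) : Gm Q (fun x => f x * g x) h x = f x * Gm Q g h x + g x * Gm Q f h x := by
  simp only [Gm, Finset.mul_sum, ← Finset.sum_add_distrib]
  exact Finset.sum_congr rfl fun i _ => Finset.sum_congr rfl fun j _ => by
    rw [dd_mul_of hf.diff hg.diff]; ring

lemma Gm_comm {Q : Fin N → Fin N → ES N → ℝ} {x : ES N} (hQ : ∀ i j, Q i j x = Q j i x)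
    (f g : ES N → ℝ) : Gm Q f g x = Gm Q g f x := by
  simp only [Gm]
  rw [Finset.sum_comm]
  exact Finset.sum_congr rfl fun i _ => Finset.sum_congr rfl fun j _ => by rw [hQ j i]; ring

/-- Cauchy-Schwarz inequality for the carré du champ, in quadratic form. -/
lemma Gm_quad {Q : Fin N → Fin N → ES N → ℝ} {x : ES N} (hQ : ∀ i j, Q i j x = Q j i x)
    (hpos : ∀ ξ : Fin N → ℝ, 0 ≤ ∑ i, ∑ j, Q i j x * (ξ i * ξ j)) (f g : ES N → ℝ) (a b : ℝ) :
    0 ≤ a ^ 2 * Gm Q f f x + 2 * (a * b) * Gm Q f g x + b ^ 2 * Gm Q g g x := by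
  have h := hpos fun i => a * dd (bs i) f x + b * dd (bs i) g x
  have e : ∑ i, ∑ j, Q i j x * ((a * dd (bs i) f x + b * dd (bs i) g x)
      * (a * dd (bs j) f x + b * dd (bs j) g x)) = a ^ 2 * Gm Q f f x +
      (a * b) * Gm Q f g x + (a * b) * Gm Q g f x + b ^ 2 * Gm Q g g x := by
    simp only [Gm, Finset.mul_sum, ← Finset.sum_add_distrib]
    exact Finset.sum_congr rfl fun i _ => Finset.sum_congr rfl fun j _ => by ring
  rw [e, Gm_comm hQ g f] at h
  linarith

/-- The basic inequality of the Bernstein method for one function. -/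
lemma bern_one {Q : Fin N → Fin N → ES N → ℝ} (B : Fin N → ES N → ℝ) {x : ES N}
    (hQ : ∀ i j, Q i j x = Q j i x)
    (hpos : ∀ ξ : Fin N → ℝ, 0 ≤ ∑ i, ∑ j, Q i j x * (ξ i * ξ j)) {θ p : ES N → ℝ}
    (hθ : Sm θ) (hp : Sm p) :
    θ x ^ 2 * (2 * p x * Ag Q B (fun _ => 0) p x + Gm Q p p x)
      - p x ^ 2 * (14 * Gm Q θ θ x - 2 * θ x * Ag Q B (fun _ => 0) θ x) ≤
    Ag Q B (fun _ => 0) (fun x => θ x ^ 2 * p x ^ 2) x := by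
  have e : (fun x => θ x ^ 2 * p x ^ 2) = fun x => (θ x * p x) * (θ x * p x) := by
    funext x; ring
  have s : Sm fun x => θ x * p x := hθ.mul hp
  have g1 := Gm_mul_left Q (h := fun x => θ x * p x) hθ hp x
  have g2 := Gm_mul_left Q (h := p) hθ hp x
  have g3 := Gm_mul_left Q (h := θ) hθ hp x
  rw [Gm_comm hQ p (fun x => θ x * p x), Gm_comm hQ θ (fun x => θ x * p x), g2, g3,
    Gm_comm hQ p θ] at g1
  rw [e, Ag_mul Q B s s, Ag_mul Q B hθ hp, g1, Gm_comm hQ p θ]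
  have h := Gm_quad hQ hpos θ p (4 * p x) (θ x)
  nlinarith

/-- The basic inequality of the Bernstein method for a family of functions. -/
lemma bern_family {Q : Fin N → Fin N → ES N → ℝ} (B : Fin N → ES N → ℝ) {x : ES N}
    (hQ : ∀ i j, Q i j x = Q j i x)
    (hpos : ∀ ξ : Fin N → ℝ, 0 ≤ ∑ i, ∑ j, Q i j x * (ξ i * ξ j)) {κ : Type*} [Fintype κ]
    {θ : ES N → ℝ} {p : κ → ES N → ℝ} (hθ : Sm θ) (hp : ∀ a, Sm (p a)) :
    θ x ^ 2 * (∑ a, (2 * p a x * Ag Q B (fun _ => 0) (p a) x + Gm Q (p a) (p a) x))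
      - (∑ a, p a x ^ 2) * (14 * Gm Q θ θ x - 2 * θ x * Ag Q B (fun _ => 0) θ x) ≤
    Ag Q B (fun _ => 0) (fun x => θ x ^ 2 * ∑ a, p a x ^ 2) x := by
  have e : (fun x => θ x ^ 2 * ∑ a, p a x ^ 2) = fun x => ∑ a, θ x ^ 2 * p a x ^ 2 := by
    funext x; rw [Finset.mul_sum]
  rw [e, Ag_sum _ _ _ _ (fun a => (hθ.pow 2).mul ((hp a).pow 2)), Finset.mul_sum, Finset.sum_mul,
    ← Finset.sum_sub_distrib]
  exact Finset.sum_le_sum fun a _ => bern_one B hQ hpos hθ (hp a)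

end bernstein

/-! ### Multi-index derivatives and estimate of the commutators -/

section multi
variable {N : ℕ}

/-- Multi-indices of length `k`. -/
def IX (N : ℕ) : ℕ → Type
  | 0 => Unit
  | k + 1 => Fin N × IX N k

instance instFintypeIX {N : ℕ} : ∀ k, Fintype (IX N k)
  | 0 => inferInstanceAs (Fintype Unit)
  | k + 1 =>
    have := instFintypeIX (N := N) k
    inferInstanceAs (Fintype (Fin N × IX N k))

/-- Iterated partial derivatives. -/
def DI : ∀ k, IX N k → (ES N → ℝ) → ES N → ℝ
  | 0, _, u => u
  | k + 1, (i, I), u => dd (bs i) (DI k I u)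

/-- The sum of the squares of the partial derivatives of order `k`. -/
def Sk (k : ℕ) (u : ES N → ℝ) (x : ES N) : ℝ := ∑ I, DI k I u x ^ 2

lemma DI_smooth {k : ℕ} (I : IX N k) {u : ES N → ℝ} (hu : Sm u) : Sm (DI k I u) := by
  induction k with
  | zero => exact hu
  | succ k ih => exact (ih I.2).dd _

lemma DI_dd {k : ℕ} (I : IX N k) {u : ES N → ℝ} (hu : Sm u) (i : Fin N) :
    DI k I (dd (bs i) u) = dd (bs i) (DI k I u) := by
  induction k with
  | zero => rfl
  | succ k ih =>
    obtain ⟨j, I⟩ := I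
    change dd (bs j) (DI k I (dd (bs i) u)) = _
    rw [ih, dd_comm (DI_smooth I hu)]; rfl

lemma DI_bound {k l : ℕ} {u : ES N → ℝ} {A : ℝ} (h : DBu (k + l) A u) (hu : Sm u) (I : IX N k) :
    DBu l A (DI k I u) := by
  induction k generalizing u with
  | zero => exact h.of_le (by omega)
  | succ k ih =>
    obtain ⟨j, I⟩ := I
    change DBu l A (dd (bs j) (DI k I u))
    rw [← DI_dd I hu]
    have h' : DBu (k + l + 1) A u := h.of_le (by omega)
    exact ih (h'.2 j) (hu.dd _) I

lemma DI_add {k : ℕ} (I : IX N k) {f g : ES N → ℝ} (hf : Sm f) (hg : Sm g) :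
    DI k I (fun x => f x + g x) = fun x => DI k I f x + DI k I g x := by
  induction k with
  | zero => rfl
  | succ k ih =>
    obtain ⟨j, I⟩ := I
    change dd (bs j) (DI k I _) = _
    rw [ih, dd_add_of (DI_smooth I hf).diff (DI_smooth I hg).diff]; rfl

lemma DI_smul {k : ℕ} (I : IX N k) {f : ES N → ℝ} (hf : Sm f) (c : ℝ) :
    DI k I (fun x => c * f x) = fun x => c * DI k I f x := by
  induction k with
  | zero => rfl
  | succ k ih =>
    obtain ⟨j, I⟩ := I
    change dd (bs j) (DI k I _) = _
    rw [ih, dd_smul_of (DI_smooth I hf).diff]; rfl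

lemma sum_IX_succ (k : ℕ) (F : IX N (k + 1) → ℝ) : ∑ I, F I = ∑ i : Fin N, ∑ I : IX N k, F (i, I) :=
  Fintype.sum_prod_type (f := fun p : Fin N × IX N k => F p)

lemma sum_IX_zero (F : IX N 0 → ℝ) : ∑ I, F I = F () :=
  Fintype.sum_unique (fun p : Unit => F p)

lemma sum_IX_one (F : IX N 1 → ℝ) : ∑ I, F I = ∑ i : Fin N, F (i, ()) := by
  rw [sum_IX_succ]; exact Finset.sum_congr rfl fun i _ => sum_IX_zero _

lemma sum_IX_two (F : IX N 2 → ℝ) : ∑ I, F I = ∑ i : Fin N, ∑ j : Fin N, F (i, (j, ())) := by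
  rw [sum_IX_succ]; exact Finset.sum_congr rfl fun i _ => sum_IX_one _

lemma sum_IX_three (F : IX N 3 → ℝ) :
    ∑ I, F I = ∑ i : Fin N, ∑ j : Fin N, ∑ k : Fin N, F (i, (j, (k, ()))) := by
  rw [sum_IX_succ]; exact Finset.sum_congr rfl fun i _ => sum_IX_two _

lemma Sk_one (u : ES N → ℝ) (x : ES N) : Sk 1 u x = ∑ i, dd (bs i) u x ^ 2 := sum_IX_one _

lemma Sk_two (u : ES N → ℝ) (x : ES N) :
    Sk 2 u x = ∑ i, ∑ j, dd (bs i) (dd (bs j) u) x ^ 2 := sum_IX_two _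

lemma Sk_nonneg (k : ℕ) (u : ES N → ℝ) (x : ES N) : 0 ≤ Sk k u x :=
  Finset.sum_nonneg fun _ _ => sq_nonneg _

lemma Sk_succ (k : ℕ) {u : ES N → ℝ} (hu : Sm u) (x : ES N) :
    ∑ i, Sk k (dd (bs i) u) x = Sk (k + 1) u x := by
  rw [Sk, sum_IX_succ]
  refine Finset.sum_congr rfl fun i _ => Finset.sum_congr rfl fun I _ => ?_
  rw [DI_dd I hu]; rfl

lemma abs_DI_le {k : ℕ} (I : IX N k) (u : ES N → ℝ) (x : ES N) :
    |DI k I u x| ≤ Real.sqrt (Sk k u x) :=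
  Real.abs_le_sqrt (Finset.single_le_sum (f := fun I => DI k I u x ^ 2)
    (fun _ _ => sq_nonneg _) (Finset.mem_univ I))

lemma sum_fin_le {F : Fin N → ℝ} {M : ℝ} (h : ∀ i, F i ≤ M) : ∑ i, F i ≤ N * M := by
  refine (Finset.sum_le_sum fun i _ => h i).trans (le_of_eq ?_); simp

lemma abs_sum_fin_le {F : Fin N → ℝ} {M : ℝ} (h : ∀ i, |F i| ≤ M) : |∑ i, F i| ≤ N * M :=
  (Finset.abs_sum_le_sum_abs _ _).trans (sum_fin_le h)

lemma abs_mul_le' {a b A B : ℝ} (ha : |a| ≤ A) (hb : |b| ≤ B) : |a * b| ≤ A * B := by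
  rw [abs_mul]
  exact mul_le_mul ha hb (abs_nonneg _) ((abs_nonneg _).trans ha)

/-- The structure of the coefficients at a point. -/
structure Loc (Q : Fin N → Fin N → ES N → ℝ) (B : Fin N → ES N → ℝ) (c : ES N → ℝ)
    (ν₀ K L₁ L₂ L₃ ν d r ϱ : ℝ) (x : ES N) : Prop where
  ν_lb : ν₀ ≤ ν
  r_nonneg : 0 ≤ r
  ellip : ∀ ξ : Fin N → ℝ, ν * ∑ i, ξ i ^ 2 ≤ ∑ i, ∑ j, Q i j x * (ξ i * ξ j)
  growth_Q : ∑ i, ∑ j, Q i j x * (x i * x j) ≤ K * (1 + ‖x‖ ^ 2) ^ 2 * ν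
  growth_tr : ∑ i, Q i i x ≤ K * (1 + ‖x‖ ^ 2) * ν
  growth_b : ∑ j, B j x * x j ≤ K * (1 + ‖x‖ ^ 2) * ν
  dq1 : ∀ i j k, |dd (bs k) (Q i j) x| ≤ K * ν
  dq3 : ∀ i j k l m, |dd (bs k) (dd (bs l) (dd (bs m) (Q i j))) x| ≤ K * ν
  dq2 : ∀ Ξ : Fin N → Fin N → ℝ, (∀ h k, Ξ h k = Ξ k h) →
    ∑ h, ∑ k, ∑ l, ∑ m, dd (bs l) (dd (bs m) (Q h k)) x * Ξ h k * Ξ l m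
      ≤ K * ν * ∑ h, ∑ k, Ξ h k ^ 2
  dissip : ∀ ξ : Fin N → ℝ, ∑ i, ∑ j, dd (bs j) (B i) x * ξ j * ξ i ≤ d * ∑ i, ξ i ^ 2
  db2 : ∀ j k l, |dd (bs k) (dd (bs l) (B j)) x| ≤ r
  db3 : ∀ j k l m, |dd (bs k) (dd (bs l) (dd (bs m) (B j))) x| ≤ r
  dc1 : ∀ k, |dd (bs k) c x| ≤ ϱ
  dc2 : ∀ k l, |dd (bs k) (dd (bs l) c) x| ≤ ϱ
  dc3 : ∀ k l m, |dd (bs k) (dd (bs l) (dd (bs m) c)) x| ≤ ϱ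
  funz : d + L₁ * r + L₂ * ϱ ^ 2 ≤ L₃ * ν

section P
variable (Q : Fin N → Fin N → ES N → ℝ) (B : Fin N → ES N → ℝ) (c : ES N → ℝ)

/-- First-order commutator term. -/
def P1 (u : ES N → ℝ) (x : ES N) : ℝ :=
  ∑ i, dd (bs i) u x *
    Ag (fun a b => dd (bs i) (Q a b)) (fun a => dd (bs i) (B a)) (dd (bs i) c) u x

/-- Second-order commutator term. -/
def P2 (u : ES N → ℝ) (x : ES N) : ℝ :=
  ∑ i, ∑ j, dd (bs i) (dd (bs j) u) x *
    Ag (fun a b => dd (bs i) (dd (bs j) (Q a b))) (fun a => dd (bs i) (dd (bs j) (B a)))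
      (dd (bs i) (dd (bs j) c)) u x

/-- Third-order commutator term. -/
def P3 (u : ES N → ℝ) (x : ES N) : ℝ :=
  ∑ i, ∑ j, ∑ k, dd (bs i) (dd (bs j) (dd (bs k) u)) x *
    Ag (fun a b => dd (bs i) (dd (bs j) (dd (bs k) (Q a b))))
      (fun a => dd (bs i) (dd (bs j) (dd (bs k) (B a))))
      (dd (bs i) (dd (bs j) (dd (bs k) c))) u x

end P

section bounds
variable {Q : Fin N → Fin N → ES N → ℝ} {B : Fin N → ES N → ℝ} {c : ES N → ℝ}
  {ν₀ K L₁ L₂ L₃ ν d r ϱ : ℝ} {x : ES N}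

lemma abs_T2 {q : Fin N → Fin N → ℝ} {κ : ℝ} (hq : ∀ i j, |q i j| ≤ κ) (u : ES N → ℝ) (x : ES N) :
    |∑ i, ∑ j, q i j * dd (bs i) (dd (bs j) u) x| ≤ N * (N * (κ * √(Sk 2 u x))) :=
  abs_sum_fin_le fun i => abs_sum_fin_le fun j =>
    abs_mul_le' (hq i j) (abs_DI_le (k := 2) (i, (j, ())) u x)

lemma abs_T1 {b : Fin N → ℝ} {κ : ℝ} (hb : ∀ j, |b j| ≤ κ) (u : ES N → ℝ) (x : ES N) :
    |∑ j, b j * dd (bs j) u x| ≤ N * (κ * √(Sk 1 u x)) :=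
  abs_sum_fin_le fun j => abs_mul_le' (hb j) (abs_DI_le (k := 1) (j, ()) u x)

lemma abs_T0 {b κ : ℝ} (hb : |b| ≤ κ) (u : ES N → ℝ) (x : ES N) :
    |b * u x| ≤ κ * √(Sk 0 u x) :=
  abs_mul_le' hb (abs_DI_le (k := 0) () u x)

lemma young {M ε a b : ℝ} (hε : 0 < ε) : 2 * (M * (a * b)) ≤ ε * a ^ 2 + M ^ 2 / ε * b ^ 2 := by
  have : ε * a ^ 2 + M ^ 2 / ε * b ^ 2 - 2 * (M * (a * b)) = (ε * a - M * b) ^ 2 / ε := by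
    field_simp; ring
  have h2 : 0 ≤ (ε * a - M * b) ^ 2 / ε := by positivity
  linarith

lemma P1_le (hν₀ : 0 < ν₀) (hL₂ : 0 < L₂) (h : Loc Q B c ν₀ K L₁ L₂ L₃ ν d r ϱ x)
    (u : ES N → ℝ) : 2 * P1 Q B c u x ≤ 1 / 8 * ν * Sk 2 u x +
      (2 * L₃ + 8 * ((N : ℝ) ^ 3 * K) ^ 2) * ν * Sk 1 u x - 2 * L₁ * r * Sk 1 u x
      - L₂ * ϱ ^ 2 * Sk 1 u x + (N : ℝ) ^ 2 / L₂ * Sk 0 u x := by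
  have hν : 0 < ν := hν₀.trans_le h.ν_lb
  have e : P1 Q B c u x = (∑ i, dd (bs i) u x * ∑ a, ∑ b, dd (bs i) (Q a b) x *
        dd (bs a) (dd (bs b) u) x) +
      (∑ i, ∑ j, dd (bs j) (B i) x * dd (bs j) u x * dd (bs i) u x) +
      ∑ i, dd (bs i) u x * (dd (bs i) c x * u x) := by
    rw [Finset.sum_comm (f := fun i j => dd (bs j) (B i) x * dd (bs j) u x * dd (bs i) u x),
      ← Finset.sum_add_distrib, ← Finset.sum_add_distrib]
    refine Finset.sum_congr rfl fun i _ => ?_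
    simp only [Ag, mul_add]
    congr 2
    rw [Finset.mul_sum]
    exact Finset.sum_congr rfl fun j _ => by ring
  set n0 := √(Sk 0 u x)
  set n1 := √(Sk 1 u x)
  set n2 := √(Sk 2 u x)
  have s0 : n0 ^ 2 = Sk 0 u x := Real.sq_sqrt (Sk_nonneg _ _ _)
  have s1 : n1 ^ 2 = Sk 1 u x := Real.sq_sqrt (Sk_nonneg _ _ _)
  have s2 : n2 ^ 2 = Sk 2 u x := Real.sq_sqrt (Sk_nonneg _ _ _)
  have b1 := le_of_abs_le (abs_sum_fin_le fun i => abs_mul_le' (abs_DI_le (k := 1) (i, ()) u x)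
    (abs_T2 (fun a b => h.dq1 a b i) u x))
  have b2 := h.dissip fun i => dd (bs i) u x
  rw [← Sk_one] at b2
  have b3 := le_of_abs_le (abs_sum_fin_le fun i => abs_mul_le' (abs_DI_le (k := 1) (i, ()) u x)
    (abs_T0 (h.dc1 i) u x))
  have b4 := mul_le_mul_of_nonneg_right h.funz (Sk_nonneg 1 u x)
  have y1 := mul_le_mul_of_nonneg_left
    (young (M := (N:ℝ) ^ 3 * K) (a := n2) (b := n1) (ε := 1 / 8) (by norm_num)) hν.le
  have y2 := young (M := (N:ℝ)) (a := ϱ * n1) (b := n0) hL₂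
  rw [mul_pow, s0, s1] at y2
  rw [s1, s2] at y1
  rw [e]
  change _ ≤ (N:ℝ) * (n1 * (N * (N * (K * ν * n2)))) at b1
  change _ ≤ (N:ℝ) * (n1 * (ϱ * n0)) at b3
  change ∑ i, dd (bs i) u x * ∑ a, ∑ b, dd (bs i) (Q a b) x *
        dd (bs a) (dd (bs b) u) x ≤ _ at b1
  change ∑ i, dd (bs i) u x * (dd (bs i) c x * u x) ≤ _ at b3
  linear_combination 2 * b1 + 2 * b2 + 2 * b3 + 2 * b4 + y1 + y2

lemma P2_le (hL₁ : 0 < L₁) (hL₂ : 0 < L₂)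
    (h : Loc Q B c ν₀ K L₁ L₂ L₃ ν d r ϱ x) {u : ES N → ℝ} (hu : Sm u) :
    2 * P2 Q B c u x ≤ 2 * K * ν * Sk 2 u x + L₁ / 2 * r * Sk 2 u x
      + 2 * (N : ℝ) ^ 6 / L₁ * r * Sk 1 u x
      + L₂ / 2 * ϱ ^ 2 * Sk 2 u x + 2 * (N : ℝ) ^ 4 / L₂ * Sk 0 u x := by
  have e : P2 Q B c u x = (∑ h, ∑ k, ∑ l, ∑ m, dd (bs l) (dd (bs m) (Q h k)) x *
        dd (bs h) (dd (bs k) u) x * dd (bs l) (dd (bs m) u) x) +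
      (∑ i, ∑ j, dd (bs i) (dd (bs j) u) x * ∑ a, dd (bs i) (dd (bs j) (B a)) x * dd (bs a) u x) +
      ∑ i, ∑ j, dd (bs i) (dd (bs j) u) x * (dd (bs i) (dd (bs j) c) x * u x) := by
    have : (∑ h, ∑ k, ∑ l, ∑ m, dd (bs l) (dd (bs m) (Q h k)) x *
        dd (bs h) (dd (bs k) u) x * dd (bs l) (dd (bs m) u) x) = ∑ l, ∑ m, ∑ h, ∑ k,
        dd (bs l) (dd (bs m) (Q h k)) x *
        dd (bs h) (dd (bs k) u) x * dd (bs l) (dd (bs m) u) x := by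
      simp only [← Finset.sum_product']
      exact Finset.sum_bij' (fun a _ => ((( a.2.2.1, a.2.2.2.1), a.1), a.2.1).1.1.1 |> fun _ =>
        (a.2.2.1, a.2.2.2, a.1, a.2.1)) (fun a _ => (a.2.2.1, a.2.2.2, a.1, a.2.1))
        (by simp) (by simp) (by simp) (by simp) (by simp)
    rw [this, ← Finset.sum_add_distrib, ← Finset.sum_add_distrib]
    refine Finset.sum_congr rfl fun i _ => ?_
    rw [← Finset.sum_add_distrib, ← Finset.sum_add_distrib]
    refine Finset.sum_congr rfl fun j _ => ?_
    simp only [Ag, mul_add]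
    congr 2
    simp only [Finset.mul_sum]
    exact Finset.sum_congr rfl fun a _ => Finset.sum_congr rfl fun b _ => by ring
  set n0 := √(Sk 0 u x)
  set n1 := √(Sk 1 u x)
  set n2 := √(Sk 2 u x)
  have s0 : n0 ^ 2 = Sk 0 u x := Real.sq_sqrt (Sk_nonneg _ _ _)
  have s1 : n1 ^ 2 = Sk 1 u x := Real.sq_sqrt (Sk_nonneg _ _ _)
  have s2 : n2 ^ 2 = Sk 2 u x := Real.sq_sqrt (Sk_nonneg _ _ _)
  have b1 := h.dq2 (fun i j => dd (bs i) (dd (bs j) u) x) fun i j => by rw [dd_comm hu]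
  rw [← Sk_two] at b1
  have b2 := le_of_abs_le (abs_sum_fin_le fun i => abs_sum_fin_le fun j =>
    abs_mul_le' (abs_DI_le (k := 2) (i, (j, ())) u x) (abs_T1 (fun a => h.db2 a i j) u x))
  have b3 := le_of_abs_le (abs_sum_fin_le fun i => abs_sum_fin_le fun j =>
    abs_mul_le' (abs_DI_le (k := 2) (i, (j, ())) u x) (abs_T0 (h.dc2 i j) u x))
  have y1 := mul_le_mul_of_nonneg_left
    (young (M := (N:ℝ) ^ 3) (a := n2) (b := n1) (half_pos hL₁)) h.r_nonneg
  have y2 := young (M := (N:ℝ) ^ 2) (a := ϱ * n2) (b := n0) (half_pos hL₂)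
  rw [mul_pow, s0, s2] at y2
  rw [s1, s2] at y1
  rw [e]
  change ∑ i, ∑ j, dd (bs i) (dd (bs j) u) x * ∑ a, dd (bs i) (dd (bs j) (B a)) x *
    dd (bs a) u x ≤ (N:ℝ) * (N * (n2 * (N * (r * n1)))) at b2
  change ∑ i, ∑ j, dd (bs i) (dd (bs j) u) x * (dd (bs i) (dd (bs j) c) x * u x)
    ≤ (N:ℝ) * (N * (n2 * (ϱ * n0))) at b3
  have c1 : ((N:ℝ) ^ 3) ^ 2 / (L₁ / 2) = 2 * (N : ℝ) ^ 6 / L₁ := by field_simp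
  have c2 : ((N:ℝ) ^ 2) ^ 2 / (L₂ / 2) = 2 * (N : ℝ) ^ 4 / L₂ := by field_simp
  rw [c1] at y1
  rw [c2] at y2
  linear_combination 2 * b1 + 2 * b2 + 2 * b3 + y1 + y2

lemma P3_le (hν₀ : 0 < ν₀) (hL₁ : 0 < L₁) (hL₂ : 0 < L₂)
    (h : Loc Q B c ν₀ K L₁ L₂ L₃ ν d r ϱ x) (u : ES N → ℝ) :
    2 * P3 Q B c u x ≤ ν * Sk 3 u x + ((N : ℝ) ^ 5 * K) ^ 2 * ν * Sk 2 u x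
      + L₁ / 2 * r * Sk 3 u x + 2 * (N : ℝ) ^ 8 / L₁ * r * Sk 1 u x
      + L₂ / 2 * ϱ ^ 2 * Sk 3 u x + 2 * (N : ℝ) ^ 6 / L₂ * Sk 0 u x := by
  have hν : 0 < ν := hν₀.trans_le h.ν_lb
  have e : P3 Q B c u x = (∑ i, ∑ j, ∑ k, dd (bs i) (dd (bs j) (dd (bs k) u)) x *
        ∑ a, ∑ b, dd (bs i) (dd (bs j) (dd (bs k) (Q a b))) x * dd (bs a) (dd (bs b) u) x) +
      (∑ i, ∑ j, ∑ k, dd (bs i) (dd (bs j) (dd (bs k) u)) x *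
        ∑ a, dd (bs i) (dd (bs j) (dd (bs k) (B a))) x * dd (bs a) u x) +
      ∑ i, ∑ j, ∑ k, dd (bs i) (dd (bs j) (dd (bs k) u)) x *
        (dd (bs i) (dd (bs j) (dd (bs k) c)) x * u x) := by
    rw [← Finset.sum_add_distrib, ← Finset.sum_add_distrib]
    refine Finset.sum_congr rfl fun i _ => ?_
    rw [← Finset.sum_add_distrib, ← Finset.sum_add_distrib]
    refine Finset.sum_congr rfl fun j _ => ?_
    rw [← Finset.sum_add_distrib, ← Finset.sum_add_distrib]
    refine Finset.sum_congr rfl fun k _ => ?_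
    simp only [Ag, mul_add]
  set n0 := √(Sk 0 u x)
  set n1 := √(Sk 1 u x)
  set n2 := √(Sk 2 u x)
  set n3 := √(Sk 3 u x)
  have s0 : n0 ^ 2 = Sk 0 u x := Real.sq_sqrt (Sk_nonneg _ _ _)
  have s1 : n1 ^ 2 = Sk 1 u x := Real.sq_sqrt (Sk_nonneg _ _ _)
  have s2 : n2 ^ 2 = Sk 2 u x := Real.sq_sqrt (Sk_nonneg _ _ _)
  have s3 : n3 ^ 2 = Sk 3 u x := Real.sq_sqrt (Sk_nonneg _ _ _)
  have b1 := le_of_abs_le (abs_sum_fin_le fun i => abs_sum_fin_le fun j => abs_sum_fin_le fun k =>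
    abs_mul_le' (abs_DI_le (k := 3) (i, (j, (k, ()))) u x)
      (abs_T2 (fun a b => h.dq3 a b i j k) u x))
  have b2 := le_of_abs_le (abs_sum_fin_le fun i => abs_sum_fin_le fun j => abs_sum_fin_le fun k =>
    abs_mul_le' (abs_DI_le (k := 3) (i, (j, (k, ()))) u x) (abs_T1 (fun a => h.db3 a i j k) u x))
  have b3 := le_of_abs_le (abs_sum_fin_le fun i => abs_sum_fin_le fun j => abs_sum_fin_le fun k =>
    abs_mul_le' (abs_DI_le (k := 3) (i, (j, (k, ()))) u x) (abs_T0 (h.dc3 i j k) u x))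
  have y0 := mul_le_mul_of_nonneg_left
    (young (M := (N:ℝ) ^ 5 * K) (a := n3) (b := n2) one_pos) hν.le
  have y1 := mul_le_mul_of_nonneg_left
    (young (M := (N:ℝ) ^ 4) (a := n3) (b := n1) (half_pos hL₁)) h.r_nonneg
  have y2 := young (M := (N:ℝ) ^ 3) (a := ϱ * n3) (b := n0) (half_pos hL₂)
  rw [mul_pow, s0, s3] at y2
  rw [s1, s3] at y1
  rw [s2, s3] at y0
  rw [e]
  change ∑ i, ∑ j, ∑ k, dd (bs i) (dd (bs j) (dd (bs k) u)) x *
    ∑ a, ∑ b, dd (bs i) (dd (bs j) (dd (bs k) (Q a b))) x * dd (bs a) (dd (bs b) u) x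
    ≤ (N:ℝ) * (N * (N * (n3 * (N * (N * (K * ν * n2)))))) at b1
  change ∑ i, ∑ j, ∑ k, dd (bs i) (dd (bs j) (dd (bs k) u)) x *
    ∑ a, dd (bs i) (dd (bs j) (dd (bs k) (B a))) x * dd (bs a) u x
    ≤ (N:ℝ) * (N * (N * (n3 * (N * (r * n1))))) at b2
  change ∑ i, ∑ j, ∑ k, dd (bs i) (dd (bs j) (dd (bs k) u)) x *
    (dd (bs i) (dd (bs j) (dd (bs k) c)) x * u x)
    ≤ (N:ℝ) * (N * (N * (n3 * (ϱ * n0)))) at b3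
  have c1 : ((N:ℝ) ^ 4) ^ 2 / (L₁ / 2) = 2 * (N : ℝ) ^ 8 / L₁ := by field_simp
  have c2 : ((N:ℝ) ^ 3) ^ 2 / (L₂ / 2) = 2 * (N : ℝ) ^ 6 / L₂ := by field_simp
  rw [c1] at y1
  rw [c2] at y2
  linear_combination 2 * b1 + 2 * b2 + 2 * b3 + y0 + y1 + y2

end bounds
end multi

/-! ### Energy inequalities -/

section energy
variable {N : ℕ} {Q : Fin N → Fin N → ES N → ℝ} {B : Fin N → ES N → ℝ} {c : ES N → ℝ}

/-- The derivative of `Sk k u` along the equation. -/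
def En (Q : Fin N → Fin N → ES N → ℝ) (B : Fin N → ES N → ℝ) (c : ES N → ℝ) (k : ℕ)
    (u : ES N → ℝ) (x : ES N) : ℝ := ∑ I, 2 * (DI k I u x * DI k I (Ag Q B c u) x)

/-- The main part of `En`. -/
def Em (Q : Fin N → Fin N → ES N → ℝ) (B : Fin N → ES N → ℝ) (c : ES N → ℝ) (k : ℕ)
    (u : ES N → ℝ) (x : ES N) : ℝ := ∑ I, 2 * (DI k I u x * Ag Q B c (DI k I u) x)

lemma En_zero (u : ES N → ℝ) (x : ES N) : En Q B c 0 u x = Em Q B c 0 u x := rfl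

lemma En_one (hQ : ∀ i j, Sm (Q i j)) (hB : ∀ i, Sm (B i)) (hc : Sm c) {u : ES N → ℝ}
    (hu : Sm u) (x : ES N) : En Q B c 1 u x = Em Q B c 1 u x + 2 * P1 Q B c u x := by
  rw [En, Em, sum_IX_one, sum_IX_one, P1, Finset.mul_sum, ← Finset.sum_add_distrib]
  refine Finset.sum_congr rfl fun i _ => ?_
  simp only [DI, dd_Ag hQ hB hc hu]
  ring

lemma dd_dd_Ag (hQ : ∀ i j, Sm (Q i j)) (hB : ∀ i, Sm (B i)) (hc : Sm c) {u : ES N → ℝ}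
    (hu : Sm u) (i j : Fin N) : dd (bs i) (dd (bs j) (Ag Q B c u)) = fun x =>
      Ag Q B c (dd (bs i) (dd (bs j) u)) x +
      Ag (fun a b => dd (bs i) (Q a b)) (fun a => dd (bs i) (B a)) (dd (bs i) c) (dd (bs j) u) x +
      Ag (fun a b => dd (bs j) (Q a b)) (fun a => dd (bs j) (B a)) (dd (bs j) c) (dd (bs i) u) x +
      Ag (fun a b => dd (bs i) (dd (bs j) (Q a b))) (fun a => dd (bs i) (dd (bs j) (B a)))
        (dd (bs i) (dd (bs j) c)) u x := by
  have s1 := Ag_smooth hQ hB hc (hu.dd (bs j))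
  have s2 := Ag_smooth (fun a b => (hQ a b).dd (bs j)) (fun a => (hB a).dd (bs j))
    (hc.dd (bs j)) hu
  rw [dd_Ag hQ hB hc hu, dd_add_of s1.diff s2.diff, dd_Ag hQ hB hc (hu.dd _),
    dd_Ag (fun a b => (hQ a b).dd (bs j)) (fun a => (hB a).dd (bs j)) (hc.dd (bs j)) hu]
  funext x
  ring

lemma dd_dd_dd_Ag (hQ : ∀ i j, Sm (Q i j)) (hB : ∀ i, Sm (B i)) (hc : Sm c) {u : ES N → ℝ}
    (hu : Sm u) (i j k : Fin N) : dd (bs i) (dd (bs j) (dd (bs k) (Ag Q B c u))) = fun x =>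
      Ag Q B c (dd (bs i) (dd (bs j) (dd (bs k) u))) x +
      Ag (fun a b => dd (bs i) (Q a b)) (fun a => dd (bs i) (B a)) (dd (bs i) c)
        (dd (bs j) (dd (bs k) u)) x +
      Ag (fun a b => dd (bs j) (Q a b)) (fun a => dd (bs j) (B a)) (dd (bs j) c)
        (dd (bs i) (dd (bs k) u)) x +
      Ag (fun a b => dd (bs k) (Q a b)) (fun a => dd (bs k) (B a)) (dd (bs k) c)
        (dd (bs i) (dd (bs j) u)) x +
      Ag (fun a b => dd (bs i) (dd (bs j) (Q a b))) (fun a => dd (bs i) (dd (bs j) (B a)))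
        (dd (bs i) (dd (bs j) c)) (dd (bs k) u) x +
      Ag (fun a b => dd (bs i) (dd (bs k) (Q a b))) (fun a => dd (bs i) (dd (bs k) (B a)))
        (dd (bs i) (dd (bs k) c)) (dd (bs j) u) x +
      Ag (fun a b => dd (bs j) (dd (bs k) (Q a b))) (fun a => dd (bs j) (dd (bs k) (B a)))
        (dd (bs j) (dd (bs k) c)) (dd (bs i) u) x +
      Ag (fun a b => dd (bs i) (dd (bs j) (dd (bs k) (Q a b))))
        (fun a => dd (bs i) (dd (bs j) (dd (bs k) (B a))))
        (dd (bs i) (dd (bs j) (dd (bs k) c))) u x := by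
  have hQ1 := fun l => fun a b => (hQ a b).dd (bs l)
  have hB1 := fun l => fun a => (hB a).dd (bs l)
  have hc1 := fun l => hc.dd (bs l)
  have hQ2 := fun m l => fun a b => (hQ1 l a b).dd (bs m)
  have hB2 := fun m l => fun a => (hB1 l a).dd (bs m)
  have hc2 := fun m l => (hc1 l).dd (bs m)
  have s1 := Ag_smooth hQ hB hc ((hu.dd (bs k)).dd (bs j))
  have s2 := Ag_smooth (hQ1 j) (hB1 j) (hc1 j) (hu.dd (bs k))
  have s3 := Ag_smooth (hQ1 k) (hB1 k) (hc1 k) (hu.dd (bs j))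
  have s4 := Ag_smooth (hQ2 j k) (hB2 j k) (hc2 j k) hu
  rw [dd_dd_Ag hQ hB hc hu, dd_add_of (Sm.diff ((s1.add s2).add s3)) s4.diff,
    dd_add_of (Sm.diff (s1.add s2)) s3.diff, dd_add_of s1.diff s2.diff,
    dd_Ag hQ hB hc ((hu.dd _).dd _), dd_Ag (hQ1 j) (hB1 j) (hc1 j) (hu.dd _),
    dd_Ag (hQ1 k) (hB1 k) (hc1 k) (hu.dd _), dd_Ag (hQ2 j k) (hB2 j k) (hc2 j k) hu]
  funext x
  ring

lemma En_two (hQ : ∀ i j, Sm (Q i j)) (hB : ∀ i, Sm (B i)) (hc : Sm c) {u : ES N → ℝ}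
    (hu : Sm u) (x : ES N) : En Q B c 2 u x = Em Q B c 2 u x +
      2 * (∑ j, 2 * P1 Q B c (dd (bs j) u) x) + 2 * P2 Q B c u x := by
  set W : Fin N → Fin N → ℝ := fun i j => dd (bs i) (dd (bs j) u) x *
    Ag (fun a b => dd (bs i) (Q a b)) (fun a => dd (bs i) (B a)) (dd (bs i) c) (dd (bs j) u) x
  have e1 : ∑ j, 2 * P1 Q B c (dd (bs j) u) x = 2 * ∑ i, ∑ j, W i j := by
    rw [Finset.sum_comm, Finset.mul_sum]; rfl
  have e2 : 2 * ∑ i, ∑ j, W i j = ∑ i, ∑ j, (W i j + W j i) := by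
    simp only [Finset.sum_add_distrib]
    rw [Finset.sum_comm (f := fun i j => W j i)]; ring
  rw [e1, e2, En, Em, P2, sum_IX_two, sum_IX_two]
  simp only [Finset.mul_sum, ← Finset.sum_add_distrib]
  refine Finset.sum_congr rfl fun i _ => Finset.sum_congr rfl fun j _ => ?_
  simp only [DI, dd_dd_Ag hQ hB hc hu, W]
  rw [dd_comm hu (bs j) (bs i)]
  ring

lemma En_three (hQ : ∀ i j, Sm (Q i j)) (hB : ∀ i, Sm (B i)) (hc : Sm c) {u : ES N → ℝ}
    (hu : Sm u) (x : ES N) : En Q B c 3 u x = Em Q B c 3 u x +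
      3 * (∑ j, ∑ k, 2 * P1 Q B c (dd (bs j) (dd (bs k) u)) x) +
      3 * (∑ k, 2 * P2 Q B c (dd (bs k) u) x) + 2 * P3 Q B c u x := by
  set W : Fin N → Fin N → Fin N → ℝ := fun i j k => dd (bs i) (dd (bs j) (dd (bs k) u)) x *
    Ag (fun a b => dd (bs i) (Q a b)) (fun a => dd (bs i) (B a)) (dd (bs i) c)
      (dd (bs j) (dd (bs k) u)) x with hW
  set Z : Fin N → Fin N → Fin N → ℝ := fun i j k => dd (bs i) (dd (bs j) (dd (bs k) u)) x *
    Ag (fun a b => dd (bs i) (dd (bs j) (Q a b))) (fun a => dd (bs i) (dd (bs j) (B a)))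
        (dd (bs i) (dd (bs j) c)) (dd (bs k) u) x with hZ
  have cyc : ∀ F : Fin N → Fin N → Fin N → ℝ, ∑ i, ∑ j, ∑ k, F i j k = ∑ j, ∑ k, ∑ i, F i j k := by
    intro F
    rw [Finset.sum_comm]
    exact Finset.sum_congr rfl fun j _ => Finset.sum_comm
  have e1 : ∑ j, ∑ k, 2 * P1 Q B c (dd (bs j) (dd (bs k) u)) x
      = 2 * ∑ i, ∑ j, ∑ k, W i j k := by
    rw [cyc]; simp only [Finset.mul_sum, P1, hW]
  have e2 : ∑ k, 2 * P2 Q B c (dd (bs k) u) x = 2 * ∑ i, ∑ j, ∑ k, Z i j k := by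
    rw [cyc, cyc]; simp only [Finset.mul_sum, P2, hZ]
  have e3 : 3 * (2 * ∑ i, ∑ j, ∑ k, W i j k)
      = ∑ i, ∑ j, ∑ k, 2 * (W i j k + W j i k + W k i j) := by
    simp only [← Finset.mul_sum, Finset.sum_add_distrib]
    rw [Finset.sum_comm (f := fun i j => ∑ k, W j i k), ← cyc (fun i j k => W i j k)]
    ring
  have e4 : 3 * (2 * ∑ i, ∑ j, ∑ k, Z i j k)
      = ∑ i, ∑ j, ∑ k, 2 * (Z i j k + Z i k j + Z j k i) := by
    simp only [← Finset.mul_sum, Finset.sum_add_distrib]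
    have h1 : ∑ i, ∑ j, ∑ k, Z i k j = ∑ i, ∑ j, ∑ k, Z i j k :=
      Finset.sum_congr rfl fun i _ => Finset.sum_comm
    have h2 : ∑ i, ∑ j, ∑ k, Z j k i = ∑ i, ∑ j, ∑ k, Z i j k := cyc (fun i j k => Z j k i)
    rw [h1, h2]; ring
  rw [e1, e2, e3, e4, En, Em, P3, sum_IX_three, sum_IX_three]
  simp only [Finset.mul_sum, ← Finset.sum_add_distrib]
  refine Finset.sum_congr rfl fun i _ => Finset.sum_congr rfl fun j _ =>
    Finset.sum_congr rfl fun k _ => ?_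
  have h1 : dd (bs j) (dd (bs i) (dd (bs k) u)) = dd (bs i) (dd (bs j) (dd (bs k) u)) :=
    dd_comm (hu.dd (bs k)) (bs j) (bs i)
  have h3 : dd (bs i) (dd (bs k) (dd (bs j) u)) = dd (bs i) (dd (bs j) (dd (bs k) u)) := by
    rw [dd_comm hu (bs k) (bs j)]
  have h4 : dd (bs j) (dd (bs k) (dd (bs i) u)) = dd (bs i) (dd (bs j) (dd (bs k) u)) := by
    rw [dd_comm hu (bs k) (bs i), h1]
  have h2 : dd (bs k) (dd (bs i) (dd (bs j) u)) = dd (bs i) (dd (bs j) (dd (bs k) u)) := by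
    rw [dd_comm (hu.dd (bs j)) (bs k) (bs i), h3]
  have g1 : dd (bs j) (dd (bs i) u) = dd (bs i) (dd (bs j) u) := dd_comm hu (bs j) (bs i)
  have g2 : dd (bs k) (dd (bs i) u) = dd (bs i) (dd (bs k) u) := dd_comm hu (bs k) (bs i)
  have g3 : dd (bs k) (dd (bs j) u) = dd (bs j) (dd (bs k) u) := dd_comm hu (bs k) (bs j)
  simp only [DI, dd_dd_dd_Ag hQ hB hc hu, hW, hZ, h1, h2, g2, g3]
  ring

end energy

/-! ### The pointwise Bernstein inequality -/

section pointwise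
variable {N : ℕ} {Q : Fin N → Fin N → ES N → ℝ} {B : Fin N → ES N → ℝ} {c : ES N → ℝ}
  {ν₀ K L₁ L₂ L₃ ν d r ϱ : ℝ} {x : ES N}

lemma Gm_family_ge (h : Loc Q B c ν₀ K L₁ L₂ L₃ ν d r ϱ x) (k : ℕ) (u : ES N → ℝ) :
    ν * Sk (k + 1) u x ≤ ∑ I, Gm Q (DI k I u) (DI k I u) x := by
  rw [Sk, sum_IX_succ, Finset.sum_comm, Finset.mul_sum]
  exact Finset.sum_le_sum fun I _ => h.ellip fun i => dd (bs i) (DI k I u) x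

/-- The cut-off term in the Bernstein inequality. -/
def Gc (Q : Fin N → Fin N → ES N → ℝ) (B : Fin N → ES N → ℝ) (θ : ES N → ℝ) (x : ES N) : ℝ :=
  14 * Gm Q θ θ x - 2 * θ x * Ag Q B (fun _ => 0) θ x

lemma level_aux (hQ : ∀ i j, Q i j x = Q j i x)
    (hpos : ∀ ξ : Fin N → ℝ, 0 ≤ ∑ i, ∑ j, Q i j x * (ξ i * ξ j)) {θ : ES N → ℝ} (hθ : Sm θ)
    {u : ES N → ℝ} (hu : Sm u) (k : ℕ) :
    θ x ^ 2 * (Em Q B c k u x - 2 * c x * Sk k u x + ∑ I, Gm Q (DI k I u) (DI k I u) x)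
      - Gc Q B θ x * Sk k u x ≤ Ag Q B (fun _ => 0) (fun x => θ x ^ 2 * Sk k u x) x := by
  have := bern_family B hQ hpos hθ (p := fun I => DI k I u) fun I => DI_smooth I hu
  have e : Em Q B c k u x - 2 * c x * Sk k u x
      = ∑ I, 2 * DI k I u x * Ag Q B (fun _ => 0) (DI k I u) x := by
    rw [Em, Sk, Finset.mul_sum, ← Finset.sum_sub_distrib]
    refine Finset.sum_congr rfl fun I _ => ?_
    simp only [Ag]; ring
  rw [e, ← Finset.sum_add_distrib, mul_comm (Gc Q B θ x)]
  exact this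

lemma level_zero (hQ : ∀ i j, Q i j x = Q j i x)
    (hpos : ∀ ξ : Fin N → ℝ, 0 ≤ ∑ i, ∑ j, Q i j x * (ξ i * ξ j)) {θ : ES N → ℝ} (hθ : Sm θ)
    {u : ES N → ℝ} (hu : Sm u) (k : ℕ) :
    θ x ^ 2 * (Em Q B c k u x - 2 * c x * Sk k u x)
      - Gc Q B θ x * Sk k u x ≤ Ag Q B (fun _ => 0) (fun x => θ x ^ 2 * Sk k u x) x := by
  refine le_trans ?_ (level_aux (c := c) hQ hpos hθ hu k)
  have : 0 ≤ ∑ I, Gm Q (DI k I u) (DI k I u) x := Finset.sum_nonneg fun I _ =>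
    hpos fun i => dd (bs i) (DI k I u) x
  nlinarith [mul_nonneg (sq_nonneg (θ x)) this]

lemma level_loc (h : Loc Q B c ν₀ K L₁ L₂ L₃ ν d r ϱ x) (hQ : ∀ i j, Q i j x = Q j i x)
    (hpos : ∀ ξ : Fin N → ℝ, 0 ≤ ∑ i, ∑ j, Q i j x * (ξ i * ξ j)) {c₀ : ℝ} (hc : c x ≤ c₀)
    {θ : ES N → ℝ} (hθ : Sm θ) {u : ES N → ℝ} (hu : Sm u) (k : ℕ) :
    θ x ^ 2 * En Q B c k u x ≤ Ag Q B (fun _ => 0) (fun x => θ x ^ 2 * Sk k u x) x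
      + Gc Q B θ x * Sk k u x + θ x ^ 2 * (En Q B c k u x - Em Q B c k u x + 2 * c₀ * Sk k u x
        - ν * Sk (k + 1) u x) := by
  have h1 := level_aux (B := B) (c := c) hQ hpos hθ hu k
  have h2 := mul_nonneg (sq_nonneg (θ x)) (sub_nonneg.2 (Gm_family_ge h k u))
  have h3 := mul_nonneg (sq_nonneg (θ x)) (mul_nonneg (sub_nonneg.2 hc) (Sk_nonneg k u x))
  nlinarith

lemma sum_Sk_succ_two (k : ℕ) {u : ES N → ℝ} (hu : Sm u) (x : ES N) :
    ∑ i, ∑ j, Sk k (dd (bs i) (dd (bs j) u)) x = Sk (k + 2) u x := by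
  rw [Finset.sum_comm]
  have : ∀ j, ∑ i, Sk k (dd (bs i) (dd (bs j) u)) x = Sk (k + 1) (dd (bs j) u) x :=
    fun j => Sk_succ k (hu.dd _) x
  simp only [this]
  exact Sk_succ (k + 1) hu x

lemma X_bounds (N : ℕ) {ν₀ L₁ L₂ : ℝ} (hν₀ : 0 < ν₀) (K : ℝ) (hL₁ : 0 < L₁) (hL₂ : 0 < L₂) (L₃ c₀ : ℝ) :
    ∃ C : ℝ, 1 ≤ C ∧ c₀ ≤ C ∧ ∀ (Q : Fin N → Fin N → ES N → ℝ) (B : Fin N → ES N → ℝ)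
      (c : ES N → ℝ) (ν d r ϱ : ℝ) (x : ES N), (∀ i j, Sm (Q i j)) → (∀ i, Sm (B i)) → Sm c →
      Loc Q B c ν₀ K L₁ L₂ L₃ ν d r ϱ x → ∀ u : ES N → ℝ, Sm u →
      (En Q B c 1 u x - Em Q B c 1 u x + 2 * c₀ * Sk 1 u x - ν * Sk 2 u x ≤
        - (1 / 2) * ν * Sk 2 u x + C * (ν * Sk 1 u x) - 2 * L₁ * (r * Sk 1 u x) + C * Sk 0 u x) ∧
      (En Q B c 2 u x - Em Q B c 2 u x + 2 * c₀ * Sk 2 u x - ν * Sk 3 u x ≤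
        - (1 / 2) * ν * Sk 3 u x + C * (ν * Sk 2 u x) - 3 * L₁ * (r * Sk 2 u x)
          + C * (r * Sk 1 u x) + C * (ν * Sk 1 u x) + C * Sk 0 u x) ∧
      (En Q B c 3 u x - Em Q B c 3 u x + 2 * c₀ * Sk 3 u x - ν * Sk 4 u x ≤
        C * (ν * Sk 3 u x) + C * (ν * Sk 2 u x) + C * (r * Sk 2 u x)
          + C * (r * Sk 1 u x) + C * (ν * Sk 1 u x) + C * Sk 0 u x) := by
  set a1 : ℝ := 2 * L₃ + 8 * ((N : ℝ) ^ 3 * K) ^ 2 with ha1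
  set a2 : ℝ := (N : ℝ) ^ 2 / L₂ with ha2
  set a3 : ℝ := 2 * (N : ℝ) ^ 6 / L₁ with ha3
  set a4 : ℝ := 2 * (N : ℝ) ^ 4 / L₂ with ha4
  set a5 : ℝ := ((N : ℝ) ^ 5 * K) ^ 2 with ha5
  set a6 : ℝ := 2 * (N : ℝ) ^ 8 / L₁ with ha6
  set a7 : ℝ := 2 * (N : ℝ) ^ 6 / L₂ with ha7
  have p2 : 0 ≤ a2 := by positivity
  have p3 : 0 ≤ a3 := by positivity
  have p4 : 0 ≤ a4 := by positivity
  have p5 : 0 ≤ a5 := by positivity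
  have p6 : 0 ≤ a6 := by positivity
  have p7 : 0 ≤ a7 := by positivity
  have p1 := abs_nonneg a1
  have pc := abs_nonneg c₀
  have pK := abs_nonneg K
  have pi : 0 ≤ 1 / ν₀ := by positivity
  set C := 1 + |c₀| + 3 * |a1| + 3 * a2 + 3 * a3 + 3 * a4 + a5 + a6 + a7 + 6 * |K| + 2
    + (2 * |c₀| + 3 * a2 + 3 * a4) * (1 / ν₀) with hC
  have pm : 0 ≤ (2 * |c₀| + 3 * a2 + 3 * a4) * (1 / ν₀) := by positivity
  refine ⟨C, by rw [hC]; linarith, by rw [hC]; linarith [le_abs_self c₀], ?_⟩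
  intro Q B c ν d r ϱ x hQ hB hc h u hu
  have hr := h.r_nonneg
  have hν : 0 < ν := hν₀.trans_le h.ν_lb
  have key : ∀ (m S : ℝ), 0 ≤ S → 0 ≤ m → m * S ≤ m * (1 / ν₀) * (ν * S) := by
    intro m S hS hm
    have : 1 ≤ 1 / ν₀ * ν := by rw [one_div, ← div_eq_inv_mul, le_div_iff₀ hν₀]; linarith [h.ν_lb]
    calc m * S = m * S * 1 := by ring
      _ ≤ m * S * (1 / ν₀ * ν) := mul_le_mul_of_nonneg_left this (by positivity)
      _ = _ := by ring
  have s0 := Sk_nonneg 0 u x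
  have s1 := Sk_nonneg 1 u x
  have s2 := Sk_nonneg 2 u x
  have s3 := Sk_nonneg 3 u x
  have s4 := Sk_nonneg 4 u x
  have n1 : 0 ≤ ν * Sk 1 u x := by positivity
  have n2 : 0 ≤ ν * Sk 2 u x := by positivity
  have n3 : 0 ≤ ν * Sk 3 u x := by positivity
  have n4 : 0 ≤ ν * Sk 4 u x := by positivity
  have r1 : 0 ≤ r * Sk 1 u x := by positivity
  have r2 : 0 ≤ r * Sk 2 u x := by positivity
  have r3 : 0 ≤ r * Sk 3 u x := by positivity
  have q1 : 0 ≤ L₂ * ϱ ^ 2 * Sk 1 u x := by positivity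
  have q2 : 0 ≤ L₂ * ϱ ^ 2 * Sk 2 u x := by positivity
  have q3 : 0 ≤ L₂ * ϱ ^ 2 * Sk 3 u x := by positivity
  have l1 : 0 ≤ L₁ * (r * Sk 1 u x) := by positivity
  have l2 : 0 ≤ L₁ * (r * Sk 2 u x) := by positivity
  have l3 : 0 ≤ L₁ * (r * Sk 3 u x) := by positivity
  have e1 := P1_le hν₀ hL₂ h u
  have f1 : ∑ j, 2 * P1 Q B c (dd (bs j) u) x ≤ 1 / 8 * ν * Sk 3 u x + a1 * ν * Sk 2 u x
      - 2 * L₁ * r * Sk 2 u x - L₂ * ϱ ^ 2 * Sk 2 u x + a2 * Sk 1 u x := by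
    rw [← Sk_succ 2 hu, ← Sk_succ 1 hu, ← Sk_succ 0 hu]
    simp only [Finset.mul_sum, ← Finset.sum_add_distrib, ← Finset.sum_sub_distrib]
    exact Finset.sum_le_sum fun j _ => P1_le hν₀ hL₂ h _
  have g1 : ∑ j, ∑ k, 2 * P1 Q B c (dd (bs j) (dd (bs k) u)) x ≤
      1 / 8 * ν * Sk 4 u x + a1 * ν * Sk 3 u x
      - 2 * L₁ * r * Sk 3 u x - L₂ * ϱ ^ 2 * Sk 3 u x + a2 * Sk 2 u x := by
    rw [← sum_Sk_succ_two 2 hu, ← sum_Sk_succ_two 1 hu, ← sum_Sk_succ_two 0 hu]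
    simp only [Finset.mul_sum, ← Finset.sum_add_distrib, ← Finset.sum_sub_distrib]
    exact Finset.sum_le_sum fun j _ => Finset.sum_le_sum fun k _ => P1_le hν₀ hL₂ h _
  have e2 := P2_le hL₁ hL₂ h hu
  have f2 : ∑ k, 2 * P2 Q B c (dd (bs k) u) x ≤ 2 * K * ν * Sk 3 u x + L₁ / 2 * r * Sk 3 u x
      + a3 * r * Sk 2 u x + L₂ / 2 * ϱ ^ 2 * Sk 3 u x + a4 * Sk 1 u x := by
    rw [← Sk_succ 2 hu, ← Sk_succ 1 hu, ← Sk_succ 0 hu]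
    simp only [Finset.mul_sum, ← Finset.sum_add_distrib]
    exact Finset.sum_le_sum fun j _ => P2_le hL₁ hL₂ h (hu.dd _)
  have e3 := P3_le hν₀ hL₁ hL₂ h u
  rw [En_one hQ hB hc hu, En_two hQ hB hc hu, En_three hQ hB hc hu]
  have m1 : a1 ≤ |a1| := le_abs_self _
  have mK : K ≤ |K| := le_abs_self _
  have mc : c₀ ≤ |c₀| := le_abs_self _
  have c1 := key _ _ s1 (by positivity : 0 ≤ 2 * |c₀|)
  have c2 := key _ _ s2 (by positivity : 0 ≤ 2 * |c₀|)
  have c3 := key _ _ s3 (by positivity : 0 ≤ 2 * |c₀|)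
  have d1 := key _ _ s1 (by positivity : 0 ≤ 2 * a2)
  have d2 := key _ _ s2 (by positivity : 0 ≤ 3 * a2)
  have d4 := key _ _ s1 (by positivity : 0 ≤ 3 * a4)
  have x1 := mul_le_mul_of_nonneg_right mc s1
  have x2 := mul_le_mul_of_nonneg_right mc s2
  have x3 := mul_le_mul_of_nonneg_right mc s3
  have y1 := mul_le_mul_of_nonneg_right m1 n1
  have y2 := mul_le_mul_of_nonneg_right m1 n2
  have y3 := mul_le_mul_of_nonneg_right m1 n3
  have z2 := mul_le_mul_of_nonneg_right mK n2
  have z3 := mul_le_mul_of_nonneg_right mK n3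
  have expand : ∀ S : ℝ, 0 ≤ S → C * S = S + |c₀| * S + 3 * (|a1| * S) + 3 * (a2 * S) + 3 * (a3 * S)
      + 3 * (a4 * S) + a5 * S + a6 * S + a7 * S + 6 * (|K| * S) + 2 * S
      + (2 * |c₀| * (1 / ν₀) * S + 3 * a2 * (1 / ν₀) * S + 3 * a4 * (1 / ν₀) * S) := by
    intro S _; rw [hC]; ring
  have nn : ∀ S : ℝ, 0 ≤ S → 0 ≤ |c₀| * S ∧ 0 ≤ |a1| * S ∧ 0 ≤ a2 * S ∧ 0 ≤ a3 * S ∧ 0 ≤ a4 * S ∧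
      0 ≤ a5 * S ∧ 0 ≤ a6 * S ∧ 0 ≤ a7 * S ∧ 0 ≤ |K| * S ∧ 0 ≤ |c₀| * (1 / ν₀) * S ∧
      0 ≤ a2 * (1 / ν₀) * S ∧ 0 ≤ a4 * (1 / ν₀) * S := fun S hS => by
    refine ⟨?_, ?_, ?_, ?_, ?_, ?_, ?_, ?_, ?_, ?_, ?_, ?_⟩ <;> positivity
  rw [expand _ s0, expand _ n1, expand _ n2, expand _ n3, expand _ r1, expand _ r2]
  obtain ⟨_, _, _, _, _, _, _, _, _, _, _, _⟩ := nn _ s0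
  obtain ⟨_, _, _, _, _, _, _, _, _, _, _, _⟩ := nn _ n1
  obtain ⟨_, _, _, _, _, _, _, _, _, _, _, _⟩ := nn _ n2
  obtain ⟨_, _, _, _, _, _, _, _, _, _, _, _⟩ := nn _ n3
  obtain ⟨_, _, _, _, _, _, _, _, _, _, _, _⟩ := nn _ r1
  obtain ⟨_, _, _, _, _, _, _, _, _, _, _, _⟩ := nn _ r2
  refine ⟨?_, ?_, ?_⟩
  · linarith
  · linarith
  · linarith

end pointwise

section pointwise
variable {N : ℕ}

lemma weight_scalar {C L₁ ε η c₀ A₀ A₁ A₂ A₃ n₁ n₂ n₃ r₁ r₂ s₀ X₁ X₂ X₃ : ℝ} (hC : 1 ≤ C) (hc₀ : c₀ ≤ C)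
    (hη : 8 * C * η ≤ 1) (hηL : 8 * C * η ≤ L₁) (hη0 : 0 ≤ η) (hε : ε ≤ 1 / 4)
    (hA₀ : 0 ≤ A₀) (hA₁ : 0 ≤ A₁) (hA₂ : 0 ≤ A₂) (hA₃ : 0 ≤ A₃)
    (h₁ : A₁ ≤ η * A₀) (h₂ : A₂ ≤ η * A₁) (h₃ : A₃ ≤ η * A₂)
    (hn₁ : 0 ≤ n₁) (hn₂ : 0 ≤ n₂) (hn₃ : 0 ≤ n₃) (hr₁ : 0 ≤ r₁) (hr₂ : 0 ≤ r₂) (hs₀ : 0 ≤ s₀)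
    (hX₁ : X₁ ≤ -(1 / 2) * n₂ + C * n₁ - 2 * L₁ * r₁ + C * s₀)
    (hX₂ : X₂ ≤ -(1 / 2) * n₃ + C * n₂ - 3 * L₁ * r₂ + C * r₁ + C * n₁ + C * s₀)
    (hX₃ : X₃ ≤ C * n₃ + C * n₂ + C * r₂ + C * r₁ + C * n₁ + C * s₀) :
    A₀ * (2 * c₀ * s₀ - n₁) + A₁ * X₁ + A₂ * X₂ + A₃ * X₃ + ε * (A₀ * n₁ + A₁ * n₂ + A₂ * n₃)
      ≤ 5 * C * (A₀ * s₀) := by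
  have hη1 : η ≤ 1 := by nlinarith
  have h2' : A₂ ≤ A₁ := by nlinarith
  have h3' : A₃ ≤ A₂ := by nlinarith
  have c1 : 8 * (C * A₁) ≤ A₀ := by nlinarith [mul_le_mul_of_nonneg_left h₁ (by linarith : 0 ≤ C)]
  have c2 : 8 * (C * A₂) ≤ A₁ := by nlinarith [mul_le_mul_of_nonneg_left h₂ (by linarith : 0 ≤ C)]
  have c3 : 8 * (C * A₃) ≤ A₂ := by nlinarith [mul_le_mul_of_nonneg_left h₃ (by linarith : 0 ≤ C)]
  have l2 : 8 * (C * A₂) ≤ L₁ * A₁ := by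
    nlinarith [mul_le_mul_of_nonneg_left h₂ (by linarith : 0 ≤ C)]
  have l3 : 8 * (C * A₃) ≤ L₁ * A₂ := by
    nlinarith [mul_le_mul_of_nonneg_left h₃ (by linarith : 0 ≤ C)]
  have d2 : C * A₂ ≤ C * A₁ := mul_le_mul_of_nonneg_left h2' (by linarith)
  have d3 : C * A₃ ≤ C * A₂ := mul_le_mul_of_nonneg_left h3' (by linarith)
  have y1 := mul_le_mul_of_nonneg_left hX₁ hA₁
  have y2 := mul_le_mul_of_nonneg_left hX₂ hA₂
  have y3 := mul_le_mul_of_nonneg_left hX₃ hA₃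
  have p1 : 0 ≤ C * A₃ := by positivity
  have ε0 := mul_le_mul_of_nonneg_right hε hA₀
  have ε1 := mul_le_mul_of_nonneg_right hε hA₁
  have ε2 := mul_le_mul_of_nonneg_right hε hA₂
  have L1 : 0 ≤ L₁ * A₁ := le_trans (by positivity) l2
  have L2 : 0 ≤ L₁ * A₂ := le_trans (by positivity) l3
  have C0 := mul_le_mul_of_nonneg_right hc₀ hA₀
  have CA : A₀ ≤ C * A₀ := le_mul_of_one_le_left hA₀ hC
  have k1 : 0 ≤ (A₀ - ε * A₀ - C * A₁ - C * A₂ - C * A₃) * n₁ := by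
    refine mul_nonneg ?_ hn₁; linarith
  have k2 : 0 ≤ (1 / 2 * A₁ - ε * A₁ - C * A₂ - C * A₃) * n₂ := by
    refine mul_nonneg ?_ hn₂; linarith
  have k3 : 0 ≤ (1 / 2 * A₂ - ε * A₂ - C * A₃) * n₃ := by
    refine mul_nonneg ?_ hn₃; linarith
  have k4 : 0 ≤ (2 * L₁ * A₁ - C * A₂ - C * A₃) * r₁ := by
    refine mul_nonneg ?_ hr₁; linarith
  have k5 : 0 ≤ (3 * L₁ * A₂ - C * A₃) * r₂ := by
    refine mul_nonneg ?_ hr₂; linarith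
  have k6 : 0 ≤ (5 * C * A₀ - 2 * c₀ * A₀ - C * A₁ - C * A₂ - C * A₃) * s₀ := by
    refine mul_nonneg ?_ hs₀; linarith
  linarith

/-- The weighted sum of squares of derivatives with cut-offs. -/
def vB (δ : ℝ) (w : ℕ → ℝ) (θ : ℕ → ES N → ℝ) (u : ES N → ℝ) (x : ES N) : ℝ :=
  ∑ i ∈ Finset.range 4, δ ^ i * w i * (θ i x ^ 2 * Sk i u x)

lemma bern_pointwise (N : ℕ) {ν₀ L₁ L₂ : ℝ} (hν₀ : 0 < ν₀) (K : ℝ) (hL₁ : 0 < L₁) (hL₂ : 0 < L₂)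
    (L₃ c₀ : ℝ) {g Kw : ℝ} (hg : 0 ≤ g) (hKw : 1 ≤ Kw) :
    ∃ δ : ℝ, 0 < δ ∧ δ ≤ 1 ∧ ∃ C : ℝ, 0 ≤ C ∧ ∀ (Q : Fin N → Fin N → ES N → ℝ)
      (B : Fin N → ES N → ℝ) (c : ES N → ℝ) (x : ES N) (θ : ℕ → ES N → ℝ) (w w' : ℕ → ℝ),
      (∀ i j, Sm (Q i j)) → (∀ i, Sm (B i)) → Sm c → (∀ i j, Q i j x = Q j i x) →
      (∀ ξ : Fin N → ℝ, 0 ≤ ∑ i, ∑ j, Q i j x * (ξ i * ξ j)) → c x ≤ c₀ →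
      (∀ i, Sm (θ i)) → θ 0 = (fun _ => 1) → (∀ i, θ (i + 1) x ^ 2 ≤ θ i x ^ 2) →
      (∀ i, 0 ≤ w i) → (∀ i, w (i + 1) ≤ Kw * w i) → w' 0 ≤ 0 → (∀ i, w' (i + 1) ≤ 3 * w i) →
      ((∃ ν d r ϱ, Loc Q B c ν₀ K L₁ L₂ L₃ ν d r ϱ x ∧
          ∀ i, Gc Q B (θ (i + 1)) x ≤ g * ν * θ i x ^ 2) ∨
        (∀ i, θ (i + 1) x = 0 ∧ Gc Q B (θ (i + 1)) x ≤ 0)) →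
      ∀ u : ES N → ℝ, Sm u →
        ∑ i ∈ Finset.range 4, δ ^ i * (w' i * (θ i x ^ 2 * Sk i u x)
            + w i * (θ i x ^ 2 * En Q B c i u x))
          ≤ Ag Q B (fun _ => 0) (vB δ w θ u) x + C * vB δ w θ u x := by
  obtain ⟨C, hC1, hc₀C, hX⟩ := X_bounds N hν₀ K hL₁ hL₂ L₃ c₀
  set M := Kw * g + 3 / ν₀ with hM
  have hM0 : 0 ≤ M := by positivity
  have hKw0 : 0 < Kw := by linarith
  set δ := min 1 (min (min 1 L₁ / (8 * C * Kw)) (1 / (4 * (M + 1)))) with hδ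
  have hmin : 0 < min 1 L₁ := lt_min one_pos hL₁
  have hδ0 : 0 < δ := lt_min one_pos (lt_min (by positivity) (by positivity))
  have hδ1 : δ ≤ 1 := min_le_left _ _
  have hδa : 8 * C * (δ * Kw) ≤ min 1 L₁ := by
    have : δ ≤ min 1 L₁ / (8 * C * Kw) := (min_le_right _ _).trans (min_le_left _ _)
    rw [le_div_iff₀ (by positivity)] at this
    linarith
  have hδb : δ * M ≤ 1 / 4 := by
    have : δ ≤ 1 / (4 * (M + 1)) := (min_le_right _ _).trans (min_le_right _ _)
    rw [le_div_iff₀ (by positivity)] at this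
    nlinarith
  refine ⟨δ, hδ0, hδ1, 5 * C, by linarith, ?_⟩
  intro Q B c x θ w w' hQ hB hc hsym hpos hcx hθ hθ0 hθm hw hwm hw'0 hw' hloc u hu
  have hθ0x : ∀ y, θ 0 y = 1 := fun y => by rw [hθ0]
  have hGc0 : Gc Q B (θ 0) x = 0 := by
    rw [hθ0, Gc, Gm, Ag]
    simp [dd_const]
  have hSs : ∀ i, Sm (fun x => θ i x ^ 2 * Sk i u x) := fun i =>
    ((hθ i).pow 2).mul (ContDiff.sum fun I _ => (DI_smooth I hu).pow 2)
  have eA : Ag Q B (fun _ => 0) (vB δ w θ u) x = ∑ i ∈ Finset.range 4,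
      δ ^ i * w i * Ag Q B (fun _ => 0) (fun x => θ i x ^ 2 * Sk i u x) x := by
    rw [show vB δ w θ u = fun x => ∑ i ∈ Finset.range 4, δ ^ i * w i * (θ i x ^ 2 * Sk i u x) from rfl,
      Ag_sum Q B _ _ (fun i => contDiff_const.mul (hSs i))]
    exact Finset.sum_congr rfl fun i _ => Ag_smul Q B _ (hSs i) _ x
  set Ac : ℕ → ℝ := fun i => δ ^ i * w i * θ i x ^ 2 with hAc
  have hA0 : ∀ i, 0 ≤ Ac i := fun i => mul_nonneg (mul_nonneg (by positivity) (hw i)) (sq_nonneg _)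
  have hS := fun i => Sk_nonneg i u x
  have hdw : ∀ i, 0 ≤ δ ^ i * w i := fun i => mul_nonneg (by positivity) (hw i)
  have hv : vB δ w θ u x = ∑ i ∈ Finset.range 4, Ac i * Sk i u x :=
    Finset.sum_congr rfl fun i _ => by simp only [hAc]; ring
  have hv0 : 5 * C * (Ac 0 * Sk 0 u x) ≤ 5 * C * vB δ w θ u x := by
    refine mul_le_mul_of_nonneg_left ?_ (by linarith)
    rw [hv]
    exact Finset.single_le_sum (f := fun i => Ac i * Sk i u x)
      (fun i _ => mul_nonneg (hA0 i) (hS i)) (Finset.mem_range.2 (by norm_num))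
  have hlev0 : δ ^ 0 * (w' 0 * (θ 0 x ^ 2 * Sk 0 u x)) ≤ 0 := by
    rw [pow_zero, one_mul]
    exact mul_nonpos_of_nonpos_of_nonneg hw'0 (mul_nonneg (sq_nonneg _) (hS 0))
  rcases hloc with ⟨ν, d, r, ϱ, hL, hG⟩ | hz
  · have hν : 0 < ν := hν₀.trans_le hL.ν_lb
    obtain ⟨X1, X2, X3⟩ := hX Q B c ν d r ϱ x hQ hB hc hL u hu
    have step : ∀ i, Ac (i + 1) ≤ δ * Kw * Ac i := fun i => by
      have h1 : w (i + 1) * θ (i + 1) x ^ 2 ≤ Kw * w i * θ i x ^ 2 :=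
        mul_le_mul (hwm i) (hθm i) (sq_nonneg _) (mul_nonneg hKw0.le (hw i))
      have := mul_le_mul_of_nonneg_left h1 (by positivity : 0 ≤ δ ^ (i + 1))
      simp only [hAc]
      calc _ = δ ^ (i + 1) * (w (i + 1) * θ (i + 1) x ^ 2) := by ring
        _ ≤ _ := this
        _ = _ := by ring
    have lev : ∀ i, δ ^ i * (w i * (θ i x ^ 2 * En Q B c i u x)) ≤
        δ ^ i * w i * Ag Q B (fun _ => 0) (fun x => θ i x ^ 2 * Sk i u x) x
        + δ ^ i * w i * (Gc Q B (θ i) x * Sk i u x)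
        + Ac i * (En Q B c i u x - Em Q B c i u x + 2 * c₀ * Sk i u x - ν * Sk (i + 1) u x) := fun i => by
      have := mul_le_mul_of_nonneg_left (level_loc hL hsym hpos hcx (hθ i) hu i) (hdw i)
      simp only [hAc]
      calc _ = δ ^ i * w i * (θ i x ^ 2 * En Q B c i u x) := by ring
        _ ≤ _ := this
        _ = _ := by ring
    have cut : ∀ i, δ ^ (i + 1) * w (i + 1) * (Gc Q B (θ (i + 1)) x * Sk (i + 1) u x)
        + δ ^ (i + 1) * (w' (i + 1) * (θ (i + 1) x ^ 2 * Sk (i + 1) u x))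
        ≤ δ * M * (Ac i * (ν * Sk (i + 1) u x)) := fun i => by
      have h1 : w (i + 1) * (Gc Q B (θ (i + 1)) x * Sk (i + 1) u x) ≤
          Kw * w i * (g * ν * θ i x ^ 2 * Sk (i + 1) u x) := by
        have a := mul_le_mul_of_nonneg_left (mul_le_mul_of_nonneg_right (hG i) (hS (i + 1))) (hw (i + 1))
        refine a.trans (mul_le_mul_of_nonneg_right (hwm i) ?_)
        exact mul_nonneg (by positivity) (hS _)
      have h2 : w' (i + 1) * (θ (i + 1) x ^ 2 * Sk (i + 1) u x) ≤
          3 * w i * (θ i x ^ 2 * Sk (i + 1) u x) :=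
        (mul_le_mul_of_nonneg_right (hw' i) (mul_nonneg (sq_nonneg _) (hS _))).trans
          (mul_le_mul_of_nonneg_left (mul_le_mul_of_nonneg_right (hθm i) (hS _))
            (mul_nonneg (by norm_num) (hw i)))
      have h3 : 3 * w i * (θ i x ^ 2 * Sk (i + 1) u x) ≤
          3 / ν₀ * (w i * (θ i x ^ 2 * (ν * Sk (i + 1) u x))) := by
        have : (1:ℝ) ≤ ν / ν₀ := (one_le_div hν₀).2 hL.ν_lb
        have p : 0 ≤ 3 * w i * (θ i x ^ 2 * Sk (i + 1) u x) :=
          mul_nonneg (mul_nonneg (by norm_num) (hw i)) (mul_nonneg (sq_nonneg _) (hS _))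
        calc _ ≤ 3 * w i * (θ i x ^ 2 * Sk (i + 1) u x) * (ν / ν₀) := le_mul_of_one_le_right p this
          _ = _ := by ring
      have h4 := mul_le_mul_of_nonneg_left (add_le_add h1 (h2.trans h3))
        (by positivity : 0 ≤ δ ^ (i + 1))
      simp only [hAc, hM]
      calc _ = δ ^ (i + 1) * (w (i + 1) * (Gc Q B (θ (i + 1)) x * Sk (i + 1) u x)
            + w' (i + 1) * (θ (i + 1) x ^ 2 * Sk (i + 1) u x)) := by ring
        _ ≤ _ := h4
        _ = _ := by ring
    have fin := weight_scalar (η := δ * Kw) (ε := δ * M) (n₁ := ν * Sk 1 u x) (n₂ := ν * Sk 2 u x)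
      (n₃ := ν * Sk 3 u x) (r₁ := r * Sk 1 u x) (r₂ := r * Sk 2 u x) (s₀ := Sk 0 u x) hC1 hc₀C
      (hδa.trans (min_le_left _ _)) (hδa.trans (min_le_right _ _)) (by positivity) hδb
      (hA0 0) (hA0 1) (hA0 2) (hA0 3) (step 0) (step 1) (step 2)
      (mul_nonneg hν.le (hS 1)) (mul_nonneg hν.le (hS 2)) (mul_nonneg hν.le (hS 3))
      (mul_nonneg hL.r_nonneg (hS 1)) (mul_nonneg hL.r_nonneg (hS 2)) (hS 0)
      (X1.trans_eq (by ring)) (X2.trans_eq (by ring)) X3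
    have l0 := lev 0
    have l1 := lev 1
    have l2 := lev 2
    have l3 := lev 3
    have c1 := cut 0
    have c2 := cut 1
    have c3 := cut 2
    have e0 : En Q B c 0 u x = Em Q B c 0 u x := En_zero u x
    rw [hGc0, e0] at l0
    simp only [zero_add, Nat.reduceAdd] at l0 l1 l2 l3 c1 c2 c3
    refine le_trans ?_ (add_le_add_right hv0 _)
    rw [eA]
    simp only [Finset.sum_range_succ, Finset.sum_range_zero, zero_add]
    rw [e0]
    simp only [mul_add] at *
    linarith
  · have lev : ∀ i, δ ^ (i + 1) * (w' (i + 1) * (θ (i + 1) x ^ 2 * Sk (i + 1) u x)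
            + w (i + 1) * (θ (i + 1) x ^ 2 * En Q B c (i + 1) u x)) ≤
        δ ^ (i + 1) * w (i + 1) *
          Ag Q B (fun _ => 0) (fun x => θ (i + 1) x ^ 2 * Sk (i + 1) u x) x := fun i => by
      have := level_zero (c := c) (B := B) hsym hpos (hθ (i + 1)) hu (i + 1)
      rw [(hz i).1]
      have h2 := mul_le_mul_of_nonneg_right (hz i).2 (hS (i + 1))
      rw [(hz i).1] at this
      have h3 : 0 ≤ Ag Q B (fun _ => 0) (fun x => θ (i + 1) x ^ 2 * Sk (i + 1) u x) x := by
        linarith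
      have := mul_nonneg (hdw (i + 1)) h3
      linarith
    have l0 := mul_le_mul_of_nonneg_left (level_zero (c := c) (B := B) hsym hpos (hθ 0) hu 0) (hdw 0)
    have l1 := lev 0
    have l2 := lev 1
    have l3 := lev 2
    rw [hGc0] at l0
    have e0 : En Q B c 0 u x = Em Q B c 0 u x := En_zero u x
    have hc5 : Ac 0 * (2 * c x * Sk 0 u x) ≤ 5 * C * (Ac 0 * Sk 0 u x) := by
      have := mul_le_mul_of_nonneg_right (hcx.trans hc₀C) (mul_nonneg (hA0 0) (hS 0))
      have := mul_nonneg (by linarith : 0 ≤ C) (mul_nonneg (hA0 0) (hS 0))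
      linarith
    refine le_trans ?_ (add_le_add_right (hc5.trans hv0) _)
    rw [eA]
    simp only [Finset.sum_range_succ, Finset.sum_range_zero, zero_add]
    rw [e0]
    simp only [zero_add, Nat.reduceAdd] at l0 l1 l2 l3
    simp only [hAc, hθ0x, mul_add, mul_sub] at *
    linarith

end pointwise

/-! ### The Bernstein method along chains -/

section chainbern
variable {N : ℕ}

namespace Scheme

lemma Q_symm (hN : 1 ≤ N) (S : Scheme N) (i j : Fin N) (x : ES N) : S.Q i j x = S.Q j i x := by
  have hNpos : (0:ℝ) < N := by exact_mod_cast hN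
  have h1 := S.hQ i j x
  have h2 := S.hQ j i x
  have : ∑ k, S.V k i x * S.V k j x = ∑ k, S.V k j x * S.V k i x :=
    Finset.sum_congr rfl fun k _ => mul_comm _ _
  rw [h1, h2] at this
  exact mul_left_cancel₀ (by positivity) this

lemma Q_pos (hN : 1 ≤ N) (S : Scheme N) (x : ES N) (ξ : Fin N → ℝ) :
    0 ≤ ∑ i, ∑ j, S.Q i j x * (ξ i * ξ j) := by
  have hNpos : (0:ℝ) < N := by exact_mod_cast hN
  have : 2 * N * ∑ i, ∑ j, S.Q i j x * (ξ i * ξ j) = ∑ k, (∑ i, S.V k i x * ξ i) ^ 2 := by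
    have e : ∑ k, (∑ i, S.V k i x * ξ i) ^ 2
        = ∑ i, ∑ j, ∑ k, (S.V k i x * ξ i) * (S.V k j x * ξ j) := by
      simp only [sq, Finset.sum_mul_sum]
      rw [Finset.sum_comm]
      exact Finset.sum_congr rfl fun i _ => Finset.sum_comm
    rw [e, Finset.mul_sum]
    refine Finset.sum_congr rfl fun i _ => ?_
    rw [Finset.mul_sum]
    refine Finset.sum_congr rfl fun j _ => ?_
    rw [← mul_assoc, ← S.hQ, Finset.sum_mul]
    exact Finset.sum_congr rfl fun k _ => by ring
  have h2 : 0 ≤ ∑ k, (∑ i, S.V k i x * ξ i) ^ 2 := Finset.sum_nonneg fun _ _ => sq_nonneg _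
  rw [← this] at h2
  exact nonneg_of_mul_nonneg_right h2 (by positivity)

lemma A_smooth (S : Scheme N) {g : ES N → ℝ} (hg : Sm g) : Sm (S.A g) :=
  Ag_smooth (fun i j => (S.hQB i j).1) (fun i => (S.hB i).1) S.hc.1 hg

lemma A_bound (S : Scheme N) (k : ℕ) : ∃ C, 0 ≤ C ∧ ∀ (g : ES N → ℝ) (A : ℝ), 0 ≤ A → Sm g →
    DBu (k + 2) A g → DBu k (C * A) (S.A g) := by
  choose C1 h1 H1 using fun i j => (S.hQB i j).mul_bound k
  choose C2 h2 H2 using fun j => (S.hB j).mul_bound k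
  obtain ⟨C3, h3, H3⟩ := S.hc.mul_bound k
  refine ⟨(∑ i, ∑ j, C1 i j) + (∑ j, C2 j) + C3, add_nonneg (add_nonneg
    (Finset.sum_nonneg fun i _ => Finset.sum_nonneg fun j _ => h1 i j)
    (Finset.sum_nonneg fun j _ => h2 j)) h3, fun g A hA hg hgA => ?_⟩
  have s1 : ∀ i j, Sm (fun x => S.Q i j x * dd (bs i) (dd (bs j) g) x) := fun i j =>
    (S.hQB i j).1.mul ((hg.dd _).dd _)
  have s2 : ∀ j, Sm (fun x => S.B j x * dd (bs j) g x) := fun j => (S.hB j).1.mul (hg.dd _)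
  rw [add_mul, add_mul]
  have t1 : DBu k ((∑ i, ∑ j, C1 i j) * A) (fun x => ∑ i, ∑ j, S.Q i j x * dd (bs i) (dd (bs j) g) x) :=
    DB.sum_bound (fun i => ContDiff.sum fun j _ => s1 i j) fun i =>
      DB.sum_bound (s1 i) fun j => H1 i j _ A hA ((hg.dd _).dd _)
        (by rw [dd_comm hg]; exact (hgA.2 i).2 j)
  have t2 : DBu k ((∑ j, C2 j) * A) (fun x => ∑ j, S.B j x * dd (bs j) g x) :=
    DB.sum_bound s2 fun j => H2 j _ A hA (hg.dd _) (hgA.2 j).pred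
  exact ((t1.add (ContDiff.sum fun i _ => ContDiff.sum fun j _ => s1 i j)
    (ContDiff.sum fun j _ => s2 j) t2)).add
    ((ContDiff.sum fun i _ => ContDiff.sum fun j _ => s1 i j).add (ContDiff.sum fun j _ => s2 j))
    (S.hc.1.mul hg) (H3 g A hA hg hgA.pred.pred)

end Scheme

lemma Sk_smooth (k : ℕ) {u : ES N → ℝ} (hu : Sm u) : Sm (Sk k u) :=
  ContDiff.sum fun I _ => (DI_smooth I hu).pow 2

lemma Sk_step (k : ℕ) {Q : Fin N → Fin N → ES N → ℝ} {B : Fin N → ES N → ℝ} {c u u' R : ES N → ℝ}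
    {γ A A' P : ℝ} {x : ES N} (hγ : 0 < γ) (hγ1 : γ ≤ 1) (hP : 0 ≤ P)
    (he : ∀ I, DI k I u' x = DI k I u x + γ ^ 2 * DI k I (Ag Q B c u) x + DI k I R x)
    (hu : ∀ I, |DI k I u x| ≤ A) (ha : ∀ I, |DI k I (Ag Q B c u) x| ≤ A')
    (hR : ∀ I, |DI k I R x| ≤ P * γ ^ 3) :
    Sk k u' x ≤ Sk k u x + γ ^ 2 * En Q B c k u x
      + Fintype.card (IX N k) * ((A' + P) ^ 2 + 2 * (A * P)) * γ ^ 3 := by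
  have : (Fintype.card (IX N k) : ℝ) * ((A' + P) ^ 2 + 2 * (A * P)) * γ ^ 3
      = ∑ _I : IX N k, ((A' + P) ^ 2 + 2 * (A * P)) * γ ^ 3 := by simp [mul_assoc]
  rw [this, En, Sk, Sk, Finset.mul_sum, ← Finset.sum_add_distrib, ← Finset.sum_add_distrib]
  refine Finset.sum_le_sum fun I _ => ?_
  rw [he I]
  set a := DI k I u x
  set b := DI k I (Ag Q B c u) x
  set r := DI k I R x
  have h1 : a * r ≤ A * (P * γ ^ 3) := (le_abs_self _).trans (by
    rw [abs_mul]; exact mul_le_mul (hu I) (hR I) (abs_nonneg _) ((abs_nonneg _).trans (hu I)))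
  have h2 : |γ ^ 2 * b + r| ≤ γ ^ 2 * (A' + P) := by
    have e1 : |γ ^ 2 * b| ≤ γ ^ 2 * A' := by
      rw [abs_mul, abs_of_nonneg (by positivity)]; exact mul_le_mul_of_nonneg_left (ha I) (by positivity)
    have e2 : P * γ ^ 3 ≤ γ ^ 2 * P := by
      have : γ ^ 3 ≤ γ ^ 2 := pow_le_pow_of_le_one hγ.le hγ1 (by norm_num)
      nlinarith
    have := abs_add_le (γ ^ 2 * b) r
    linarith [hR I]
  have h3 : (γ ^ 2 * b + r) ^ 2 ≤ (A' + P) ^ 2 * γ ^ 3 := by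
    have e := sq_le_sq' (by linarith [neg_abs_le (γ ^ 2 * b + r)]) ((le_abs_self _).trans h2)
    have : γ ^ 4 ≤ γ ^ 3 := pow_le_pow_of_le_one hγ.le hγ1 (by norm_num)
    nlinarith [sq_nonneg (A' + P)]
  nlinarith

/-- The time weights. -/
def tw (j : ℕ) (τ : ℝ) (i : ℕ) : ℝ := τ ^ (i - j)

/-- The derivatives of the time weights (for `i ≤ j + 3`). -/
def tw' (j : ℕ) (τ : ℝ) (i : ℕ) : ℝ := ((min (i - j) 3 : ℕ) : ℝ) * τ ^ (i - j - 1)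

lemma tw_nonneg (j : ℕ) {τ : ℝ} (h : 0 ≤ τ) (i : ℕ) : 0 ≤ tw j τ i := pow_nonneg h _

lemma tw'_nonneg (j : ℕ) {τ : ℝ} (h : 0 ≤ τ) (i : ℕ) : 0 ≤ tw' j τ i :=
  mul_nonneg (Nat.cast_nonneg _) (pow_nonneg h _)

lemma tw_succ_le (j : ℕ) {τ T : ℝ} (h : 0 ≤ τ) (hT : τ ≤ T) (i : ℕ) :
    tw j τ (i + 1) ≤ (1 + T) * tw j τ i := by
  have hp := pow_nonneg h (i - j)
  unfold tw
  by_cases hij : i + 1 ≤ j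
  · rw [Nat.sub_eq_zero_of_le hij, Nat.sub_eq_zero_of_le (by omega)]; simp; linarith
  · rw [show i + 1 - j = (i - j) + 1 by omega, pow_succ]
    nlinarith

lemma tw'_zero (j : ℕ) (τ : ℝ) : tw' j τ 0 ≤ 0 := by simp [tw']

lemma tw'_succ_le (j : ℕ) {τ : ℝ} (h : 0 ≤ τ) (i : ℕ) : tw' j τ (i + 1) ≤ 3 * tw j τ i := by
  have hp := pow_nonneg h (i - j)
  unfold tw tw'
  by_cases hij : i + 1 ≤ j
  · rw [Nat.sub_eq_zero_of_le hij]; simp; linarith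
  · rw [show i + 1 - j - 1 = (i - j) by omega]
    have : ((min (i + 1 - j) 3 : ℕ) : ℝ) ≤ 3 := by exact_mod_cast min_le_right _ _
    exact mul_le_mul_of_nonneg_right this hp

lemma tw_step (j : ℕ) {τ h T : ℝ} (hτ : 0 ≤ τ) (hh1 : h ≤ 1) (hT : τ ≤ T) {i : ℕ}
    (hi : i < 4) : tw j (τ + h) i ≤ tw j τ i + h * tw' j τ i + (3 * T + 1) * h ^ 2 := by
  unfold tw tw'
  have : i - j ≤ 3 := by omega
  have h2 : 0 ≤ h ^ 2 := sq_nonneg h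
  have hT0 : 0 ≤ T := hτ.trans hT
  generalize i - j = n at this
  have p1 : 0 ≤ (T - τ) * h ^ 2 := mul_nonneg (by linarith) h2
  have p2 : 0 ≤ (1 - h) * h ^ 2 := mul_nonneg (by linarith) h2
  have p3 : 0 ≤ T * h ^ 2 := mul_nonneg hT0 h2
  interval_cases n <;> norm_num <;> nlinarith

lemma tw_le (j : ℕ) {τ T : ℝ} (hτ : 0 ≤ τ) (hT : τ ≤ T) {i : ℕ} (hi : i < 4) :
    tw j τ i ≤ (1 + T) ^ 3 := by
  unfold tw
  calc τ ^ (i - j) ≤ (1 + T) ^ (i - j) := pow_le_pow_left₀ hτ (by linarith) _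
    _ ≤ _ := pow_le_pow_right₀ (by linarith) (by omega)

lemma tw'_le (j : ℕ) {τ T : ℝ} (hτ : 0 ≤ τ) (hT : τ ≤ T) {i : ℕ} (hi : i < 4) :
    tw' j τ i ≤ 3 * (1 + T) ^ 3 := by
  unfold tw'
  have : ((min (i - j) 3 : ℕ) : ℝ) ≤ 3 := by exact_mod_cast min_le_right _ _
  refine mul_le_mul this ?_ (pow_nonneg hτ _) (by norm_num)
  calc τ ^ (i - j - 1) ≤ (1 + T) ^ (i - j - 1) := pow_le_pow_left₀ hτ (by linarith) _
    _ ≤ _ := pow_le_pow_right₀ (by linarith) (by omega)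

lemma prod_step {γ W W' W₁ S S' E Ds Dw Wm Sm' Em' : ℝ} (hγ : 0 < γ) (hγ1 : γ ≤ 1) (hS' : 0 ≤ S')
    (hW' : 0 ≤ W') (hW0 : 0 ≤ W) (hW : W ≤ Wm) (hW1 : 0 ≤ W₁) (hW₁ : W₁ ≤ 3 * Wm)
    (hS0 : 0 ≤ S) (hS : S ≤ Sm') (hE : |E| ≤ Em') (hDs : 0 ≤ Ds) (hDw : 0 ≤ Dw)
    (h1 : W' ≤ W + γ ^ 2 * W₁ + Dw * (γ ^ 2) ^ 2) (h2 : S' ≤ S + γ ^ 2 * E + Ds * γ ^ 3) :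
    W' * S' ≤ W * S + γ ^ 2 * (W₁ * S + W * E)
      + (Wm * Ds + 3 * Wm * Em' + 3 * Wm * Ds + Dw * Sm' + Dw * Em' + Dw * Ds) * γ ^ 3 := by
  have a1 : W' * S' ≤ (W + γ ^ 2 * W₁ + Dw * (γ ^ 2) ^ 2) * (S + γ ^ 2 * E + Ds * γ ^ 3) :=
    mul_le_mul h1 h2 hS' (hW'.trans h1)
  have hE' : E ≤ Em' := (le_abs_self _).trans hE
  have hEm : 0 ≤ Em' := (abs_nonneg _).trans hE
  have hWm : 0 ≤ Wm := hW0.trans hW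
  have hSm : 0 ≤ Sm' := hS0.trans hS
  have g3 : 0 ≤ γ ^ 3 := by positivity
  have g4 : γ ^ 4 ≤ γ ^ 3 := pow_le_pow_of_le_one hγ.le hγ1 (by norm_num)
  have g5 : γ ^ 5 ≤ γ ^ 3 := pow_le_pow_of_le_one hγ.le hγ1 (by norm_num)
  have g6 : γ ^ 6 ≤ γ ^ 3 := pow_le_pow_of_le_one hγ.le hγ1 (by norm_num)
  have g7 : γ ^ 7 ≤ γ ^ 3 := pow_le_pow_of_le_one hγ.le hγ1 (by norm_num)
  have b1 : W * Ds * γ ^ 3 ≤ Wm * Ds * γ ^ 3 := by gcongr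
  have b2 : W₁ * E * γ ^ 4 ≤ 3 * Wm * Em' * γ ^ 3 :=
    (mul_le_mul_of_nonneg_right (mul_le_mul_of_nonneg_left hE' hW1) (by positivity)).trans (by gcongr)
  have b3 : W₁ * Ds * γ ^ 5 ≤ 3 * Wm * Ds * γ ^ 3 := by gcongr
  have b4 : Dw * S * γ ^ 4 ≤ Dw * Sm' * γ ^ 3 := by gcongr
  have b5 : Dw * E * γ ^ 6 ≤ Dw * Em' * γ ^ 3 :=
    (mul_le_mul_of_nonneg_right (mul_le_mul_of_nonneg_left hE' hDw) (by positivity)).trans (by gcongr)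
  have b6 : Dw * Ds * γ ^ 7 ≤ Dw * Ds * γ ^ 3 := by gcongr
  nlinarith

end chainbern

section chainbern
variable {N : ℕ}

lemma vB_smooth {δ : ℝ} {w : ℕ → ℝ} {θ : ℕ → ES N → ℝ} (hθ : ∀ i, Sm (θ i)) {u : ES N → ℝ}
    (hu : Sm u) : Sm (vB δ w θ u) :=
  ContDiff.sum fun i _ => contDiff_const.mul (((hθ i).pow 2).mul (Sk_smooth i hu))

lemma Sk_DB {i l : ℕ} {A : ℝ} (hA : 0 ≤ A) {u : ES N → ℝ} (hu : Sm u) (h : DBu (i + l) A u) :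
    DBu l (Fintype.card (IX N i) * (2 ^ l * (A * A))) (Sk i u) := by
  have := DB.sum (e := bs) (U := univ) (k := l) (Finset.univ : Finset (IX N i))
    (A := fun _ => 2 ^ l * (A * A)) (F := fun I x => DI i I u x * DI i I u x)
    (fun I => (DI_smooth I hu).mul (DI_smooth I hu)) fun I =>
      DB.mul hA hA (DI_smooth I hu) (DI_smooth I hu) (DI_bound h hu I) (DI_bound h hu I)
  simp only [Finset.sum_const, Finset.card_univ, nsmul_eq_mul] at this
  have e : Sk i u = fun x => ∑ I, DI i I u x * DI i I u x := by
    funext x; exact Finset.sum_congr rfl fun I _ => sq _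
  rw [e]; exact this

lemma vB_DB {l : ℕ} {δ A Wm : ℝ} (hδ : 0 ≤ δ) (hδ1 : δ ≤ 1) (hA : 0 ≤ A) {w : ℕ → ℝ}
    (hw : ∀ i < 4, |w i| ≤ Wm)
    {θ : ℕ → ES N → ℝ} (hθ : ∀ i, Sm (θ i)) {Θ : ℕ → ℝ} (hΘ0 : ∀ i, 0 ≤ Θ i)
    (hΘ : ∀ i, DBu l (Θ i) (fun x => θ i x ^ 2)) {u : ES N → ℝ} (hu : Sm u) (h : DBu (3 + l) A u) :
    DBu l (∑ i ∈ Finset.range 4, Wm * (2 ^ l * (Θ i * (Fintype.card (IX N i) * (2 ^ l * (A * A))))))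
      (vB δ w θ u) := by
  have hs : ∀ i, Sm (fun x => θ i x ^ 2 * Sk i u x) := fun i => ((hθ i).pow 2).mul (Sk_smooth i hu)
  have := DB.sum (e := bs) (U := univ) (k := l) (Finset.range 4).attach
    (A := fun i => Wm * (2 ^ l * (Θ i * (Fintype.card (IX N i) * (2 ^ l * (A * A))))))
    (F := fun i x => δ ^ i.1 * w i.1 * (θ i.1 x ^ 2 * Sk i.1 u x))
    (fun i => contDiff_const.mul (hs i)) fun i => by
      have hi := Finset.mem_range.1 i.2
      have p : 0 ≤ 2 ^ l * (Θ i * (Fintype.card (IX N i) * (2 ^ l * (A * A)))) := by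
        have := hΘ0 i
        positivity
      refine (DB.smul (hs i) (DB.mul (hΘ0 i) (by positivity) ((hθ i).pow 2) (Sk_smooth i hu) (hΘ i)
        (Sk_DB hA hu (h.of_le (by omega)))) (δ ^ i.1 * w i)).mono ?_
      refine mul_le_mul_of_nonneg_right ?_ p
      rw [abs_mul, abs_of_nonneg (by positivity : 0 ≤ δ ^ i.1)]
      calc δ ^ i.1 * |w i| ≤ 1 * |w i| :=
            mul_le_mul_of_nonneg_right (pow_le_one₀ hδ hδ1) (abs_nonneg _)
        _ ≤ Wm := by rw [one_mul]; exact hw i hi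
  have e : vB δ w θ u = fun x => ∑ i ∈ (Finset.range 4).attach, δ ^ i.1 * w i.1 *
      (θ i.1 x ^ 2 * Sk i.1 u x) := by
    funext x; exact (Finset.sum_attach (Finset.range 4) fun i => δ ^ i * w i *
      (θ i x ^ 2 * Sk i u x)).symm
  rw [e]
  rw [Finset.sum_attach (Finset.range 4) fun i =>
    Wm * (2 ^ l * (Θ i * (Fintype.card (IX N i) * (2 ^ l * (A * A)))))] at this
  exact this

/-- The conditions on the cut-off functions. -/
structure Cut (θ : ℕ → ES N → ℝ) : Prop where
  smooth : ∀ i, BBu (θ i)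
  zero : θ 0 = fun _ => 1
  anti : ∀ i x, θ (i + 1) x ^ 2 ≤ θ i x ^ 2

lemma Cut.le_one {θ : ℕ → ES N → ℝ} (h : Cut θ) (i : ℕ) (x : ES N) : θ i x ^ 2 ≤ 1 := by
  induction i with
  | zero => rw [h.zero]; norm_num
  | succ i ih => exact (h.anti i x).trans ih

lemma chain_bernstein (hN : 1 ≤ N) {ν₀ L₁ L₂ : ℝ} (hν₀ : 0 < ν₀) (K : ℝ) (hL₁ : 0 < L₁)
    (hL₂ : 0 < L₂) (L₃ c₀ : ℝ) {g T : ℝ} (hg : 0 ≤ g) (hT : 0 < T) :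
    ∃ δ : ℝ, 0 < δ ∧ ∃ C : ℝ, 0 ≤ C ∧ ∀ (ι : Type) [Fintype ι] (S : ι → Scheme N)
      (θ : ℕ → ES N → ℝ), Cut θ → (∀ i x, (S i).c x ≤ c₀) →
      (∀ a x, (∃ ν d r ϱ, Loc (S a).Q (S a).B (S a).c ν₀ K L₁ L₂ L₃ ν d r ϱ x ∧
          ∀ i, Gc (S a).Q (S a).B (θ (i + 1)) x ≤ g * ν * θ i x ^ 2) ∨
        (∀ i, θ (i + 1) x = 0 ∧ Gc (S a).Q (S a).B (θ (i + 1)) x ≤ 0)) →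
      ∀ (j : ℕ) (u₀ : ES N → ℝ), BBu u₀ → ∀ Mb, 0 ≤ Mb →
        (∀ i ≤ j, i < 4 → ∀ x, θ i x ^ 2 * Sk i u₀ x ≤ Mb) →
        ∀ ε > 0, ∃ γ₀ > 0, ∀ γ, 0 < γ → γ ≤ γ₀ → ∀ (κ : ℕ → ι) (m : ℕ), m * γ ^ 2 ≤ T → ∀ x,
          vB δ (tw j (m * γ ^ 2)) θ (chain S κ γ u₀ m) x ≤ C * Mb + ε := by
  obtain ⟨δ, hδ0, hδ1, C, hC, hP⟩ := bern_pointwise N hν₀ K hL₁ hL₂ L₃ c₀ hg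
    (by linarith : 1 ≤ 1 + T)
  refine ⟨δ, hδ0, Real.exp (C * T) * 4, by positivity, ?_⟩
  intro ι _ S θ hθ hc hloc j u₀ hu₀ Mb hMb h0 ε hε
  choose Θ hΘ0 hΘ using fun i => ((hθ.smooth i).pow 2).2 5
  obtain ⟨E, hE, hmax⟩ := discrete_max hN S
  obtain ⟨Cc, hCc, hcons⟩ := op_consistent hN S 3
  choose CA hCA0 hCA using fun a => (S a).A_bound 3
  obtain ⟨A, hA, γ₀, hγ₀, hγ₀1, hbd⟩ := chain_bounds hN S hu₀ T 8
  set P := Cc * A with hPdef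
  have hP0 : 0 ≤ P := by positivity
  set A' := (∑ a, CA a) * A with hA'def
  have hCA' : ∀ a, CA a ≤ ∑ a, CA a := fun a =>
    Finset.single_le_sum (f := CA) (fun a _ => hCA0 a) (Finset.mem_univ a)
  have hA' : 0 ≤ A' := mul_nonneg (Finset.sum_nonneg fun a _ => hCA0 a) hA
  set nn : ℝ := ∑ i ∈ Finset.range 4, (Fintype.card (IX N i) : ℝ) with hnn
  have hcard : ∀ i < 4, (Fintype.card (IX N i) : ℝ) ≤ nn := fun i hi =>
    Finset.single_le_sum (f := fun i => (Fintype.card (IX N i) : ℝ)) (fun _ _ => Nat.cast_nonneg _)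
      (Finset.mem_range.2 hi)
  have hnn0 : 0 ≤ nn := Finset.sum_nonneg fun _ _ => Nat.cast_nonneg _
  set Ds := nn * ((A' + P) ^ 2 + 2 * (A * P)) with hDs
  set Wm := (1 + T) ^ 3 with hWm
  set Dw := 3 * T + 1 with hDw
  obtain ⟨D₁, hD₁⟩ : ∃ D, D = Wm * Ds + 3 * Wm * (nn * (2 * (A * A'))) + 3 * Wm * Ds
    + Dw * (nn * A ^ 2) + Dw * (nn * (2 * (A * A'))) + Dw * Ds := ⟨_, rfl⟩
  have hDs0 : 0 ≤ Ds := by positivity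
  have hDw0 : 0 ≤ Dw := by positivity
  have hD₁0 : 0 ≤ D₁ := by rw [hD₁]; positivity
  obtain ⟨Av, hAv⟩ : ∃ Av, Av = ∑ i ∈ Finset.range 4, Wm * (2 ^ 5 * (Θ i *
    (Fintype.card (IX N i) * (2 ^ 5 * (A * A))))) := ⟨_, rfl⟩
  have hAv0 : 0 ≤ Av := hAv ▸ Finset.sum_nonneg fun i _ => by have := hΘ0 i; positivity
  obtain ⟨G, hG⟩ : ∃ G, G = Real.exp (C * T) * (T * (E * Av + 4 * D₁)) := ⟨_, rfl⟩
  have hG0 : 0 ≤ G := by rw [hG]; positivity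
  refine ⟨min γ₀ (ε / (G + 1)), lt_min hγ₀ (by positivity), ?_⟩
  intro γ hγ hγle κ m hm x
  have hγγ₀ : γ ≤ γ₀ := hγle.trans (min_le_left _ _)
  have hγ1 : γ ≤ 1 := hγγ₀.trans hγ₀1
  have hγε : G * γ ≤ ε := by
    have : γ ≤ ε / (G + 1) := hγle.trans (min_le_right _ _)
    rw [le_div_iff₀ (by positivity)] at this
    linarith [this, show γ * (G + 1) = G * γ + γ by ring]
  have hh : 0 < γ ^ 2 := by positivity
  have hh1 : γ ^ 2 ≤ 1 := pow_le_one₀ hγ.le hγ1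
  have hus := fun k => chain_smooth S κ γ hu₀.1 k
  have htime : ∀ k : ℕ, k ≤ m → (k : ℝ) * γ ^ 2 ≤ T := fun k hk =>
    (mul_le_mul_of_nonneg_right (by exact_mod_cast hk) hh.le).trans hm
  have hτ0 : ∀ k : ℕ, 0 ≤ (k : ℝ) * γ ^ 2 := fun k => by positivity
  set v : ℕ → ES N → ℝ := fun k => vB δ (tw j (k * γ ^ 2)) θ (chain S κ γ u₀ k) with hv
  have hvs : ∀ k < m, Sm (v k) := fun k _ => vB_smooth (fun i => (hθ.smooth i).1) (hus k)
  have hvD : ∀ k < m, DBu 5 Av (v k) := fun k hk => by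
    rw [hAv]
    refine vB_DB hδ0.le hδ1 hA (fun i hi => ?_) (fun i => (hθ.smooth i).1) hΘ0 hΘ (hus k)
        (hbd γ hγ hγγ₀ κ k (htime k hk.le))
    rw [abs_of_nonneg (tw_nonneg j (hτ0 k) i)]
    exact tw_le j (hτ0 k) (htime k hk.le) hi
  have hv0 : ∀ y, v 0 y ≤ 4 * Mb := by
    intro y
    have : ∀ i ∈ Finset.range 4, δ ^ i * tw j ((0 : ℕ) * γ ^ 2) i * (θ i y ^ 2 * Sk i u₀ y) ≤ Mb := by
      intro i hi
      have hn : 0 ≤ θ i y ^ 2 * Sk i u₀ y := mul_nonneg (sq_nonneg _) (Sk_nonneg i u₀ y)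
      by_cases hij : i ≤ j
      · have e : tw j ((0 : ℕ) * γ ^ 2) i = 1 := by simp [tw, Nat.sub_eq_zero_of_le hij]
        rw [e, mul_one]
        exact (mul_le_of_le_one_left hn (pow_le_one₀ hδ0.le hδ1)).trans
          (h0 i hij (Finset.mem_range.1 hi) y)
      · have e : tw j ((0 : ℕ) * γ ^ 2) i = 0 := by
          have : i - j ≠ 0 := by omega
          simp [tw, this]
        rw [e]; simpa using hMb
    calc vB δ (tw j ((0 : ℕ) * γ ^ 2)) θ u₀ y ≤ ∑ _i ∈ Finset.range 4, Mb := Finset.sum_le_sum this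
      _ = 4 * Mb := by simp
  have hvstep : ∀ k < m, ∀ y, v (k + 1) y ≤ v k y + γ ^ 2 * ((S (κ k)).A0 (v k) y + C * v k y)
      + 4 * D₁ * γ ^ 3 := by
    intro k hk y
    set u := chain S κ γ u₀ k with hu
    set u' := chain S κ γ u₀ (k + 1) with hu'
    set τ : ℝ := k * γ ^ 2 with hτ
    set s := S (κ k) with hs
    have hτT : τ ≤ T := htime k hk.le
    have hsu : Sm u := hus k
    have hsu' : Sm u' := hus (k + 1)
    have hub : DBu 8 A u := hbd γ hγ hγγ₀ κ k hτT
    set R : ES N → ℝ := fun x => u' x - u x - γ ^ 2 * s.A u x with hR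
    have hAs : Sm (s.A u) := s.A_smooth hsu
    have hAs' : Sm (fun x => γ ^ 2 * s.A u x) := contDiff_const.mul hAs
    have hsa : Sm (fun x => u x + γ ^ 2 * s.A u x) := hsu.add hAs'
    have hRs : Sm R := (hsu'.sub hsu).sub (contDiff_const.mul hAs)
    have hRb : DBu 3 (P * γ ^ 3) R := by
      have := hcons (κ k) u A hA hsu hub γ (by rw [abs_of_pos hγ]; exact hγ1)
      rw [abs_of_pos hγ] at this
      exact this
    have hAb : DBu 3 A' (s.A u) :=
      (hCA (κ k) u A hA hsu (hub.of_le (by norm_num))).mono (mul_le_mul_of_nonneg_right (hCA' _) hA)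
    have hdec : u' = fun x => (u x + γ ^ 2 * s.A u x) + R x := by funext x; simp only [hR]; ring
    have one : ∀ i ∈ Finset.range 4, δ ^ i * tw j ((k + 1 : ℕ) * γ ^ 2) i * (θ i y ^ 2 * Sk i u' y) ≤
        δ ^ i * tw j τ i * (θ i y ^ 2 * Sk i u y) + γ ^ 2 * (δ ^ i * (tw' j τ i * (θ i y ^ 2 * Sk i u y)
            + tw j τ i * (θ i y ^ 2 * En s.Q s.B s.c i u y))) + D₁ * γ ^ 3 := by
      intro i hi
      have hi4 := Finset.mem_range.1 hi
      have bu : ∀ I : IX N i, |DI i I u y| ≤ A := fun I =>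
        (DI_bound (l := 0) (hub.of_le (by omega)) hsu I).bound y (mem_univ _)
      have ba : ∀ I : IX N i, |DI i I (Ag s.Q s.B s.c u) y| ≤ A' := fun I =>
        (DI_bound (l := 0) (hAb.of_le (by omega)) hAs I).bound y (mem_univ _)
      have bR : ∀ I : IX N i, |DI i I R y| ≤ P * γ ^ 3 := fun I =>
        (DI_bound (l := 0) (hRb.of_le (by omega)) hRs I).bound y (mem_univ _)
      have st := Sk_step i (Q := s.Q) (B := s.B) (c := s.c) (u := u) (u' := u') (R := R) hγ hγ1 hP0
        (fun I => by
          rw [hdec, DI_add I hsa hRs, DI_add I hsu hAs',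
            DI_smul I hAs]
          rfl) bu ba bR
      have st' : Sk i u' y ≤ Sk i u y + γ ^ 2 * En s.Q s.B s.c i u y + Ds * γ ^ 3 := by
        refine st.trans (add_le_add_right (mul_le_mul_of_nonneg_right
          (mul_le_mul_of_nonneg_right (hcard i hi4) (by positivity)) (by positivity)) _)
      have bS : Sk i u y ≤ nn * A ^ 2 := by
        calc Sk i u y ≤ ∑ _I : IX N i, A ^ 2 := Finset.sum_le_sum fun I _ => by
              rw [← sq_abs]; exact pow_le_pow_left₀ (abs_nonneg _) (bu I) 2
          _ = Fintype.card (IX N i) * A ^ 2 := by simp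
          _ ≤ _ := mul_le_mul_of_nonneg_right (hcard i hi4) (by positivity)
      have bE : |En s.Q s.B s.c i u y| ≤ nn * (2 * (A * A')) := by
        calc |En s.Q s.B s.c i u y| ≤ ∑ _I : IX N i, 2 * (A * A') := by
              refine (Finset.abs_sum_le_sum_abs _ _).trans (Finset.sum_le_sum fun I _ => ?_)
              rw [abs_mul, abs_mul, abs_of_pos (by norm_num : (0:ℝ) < 2)]
              exact mul_le_mul_of_nonneg_left (mul_le_mul (bu I) (ba I) (abs_nonneg _) hA) (by norm_num)
          _ = Fintype.card (IX N i) * (2 * (A * A')) := by simp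
          _ ≤ _ := mul_le_mul_of_nonneg_right (hcard i hi4) (by positivity)
      have et : ((k + 1 : ℕ) : ℝ) * γ ^ 2 = τ + γ ^ 2 := by rw [hτ]; push_cast; ring
      have pr := prod_step hγ hγ1 (Sk_nonneg i u' y) (tw_nonneg j (by positivity : 0 ≤ τ + γ ^ 2) i)
        (tw_nonneg j (hτ0 k) i) (tw_le j (hτ0 k) hτT hi4) (tw'_nonneg j (hτ0 k) i)
        (tw'_le j (hτ0 k) hτT hi4) (Sk_nonneg i u y) bS bE hDs0 hDw0
        (tw_step j (hτ0 k) hh1 hτT hi4) st'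
      rw [et]
      have hδθ : 0 ≤ δ ^ i * θ i y ^ 2 := by positivity
      have hδθ1 : δ ^ i * θ i y ^ 2 ≤ 1 := mul_le_one₀ (pow_le_one₀ hδ0.le hδ1) (sq_nonneg _)
        (hθ.le_one i y)
      have m1 := mul_le_mul_of_nonneg_left pr hδθ
      have m2 := mul_le_of_le_one_left (by positivity : 0 ≤ D₁ * γ ^ 3) hδθ1
      calc _ = δ ^ i * θ i y ^ 2 * (tw j (τ + γ ^ 2) i * Sk i u' y) := by ring
        _ ≤ _ := m1
        _ = δ ^ i * tw j τ i * (θ i y ^ 2 * Sk i u y)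
            + γ ^ 2 * (δ ^ i * (tw' j τ i * (θ i y ^ 2 * Sk i u y)
            + tw j τ i * (θ i y ^ 2 * En s.Q s.B s.c i u y)))
            + δ ^ i * θ i y ^ 2 * (D₁ * γ ^ 3) := by rw [hD₁]; ring
        _ ≤ _ := by linarith
    have hsum := Finset.sum_le_sum one
    rw [Finset.sum_add_distrib, Finset.sum_add_distrib, ← Finset.mul_sum] at hsum
    have pw := hP s.Q s.B s.c y θ (tw j τ) (tw' j τ) (fun i j => (s.hQB i j).1) (fun i => (s.hB i).1)
      s.hc.1 (fun i j => s.Q_symm hN i j y) (s.Q_pos hN y) (hc (κ k) y) (fun i => (hθ.smooth i).1)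
      hθ.zero (fun i => hθ.anti i y) (tw_nonneg j (hτ0 k)) (tw_succ_le j (hτ0 k) hτT) (tw'_zero j τ)
      (tw'_succ_le j (hτ0 k)) (hloc (κ k) y) u hsu
    have := mul_le_mul_of_nonneg_left pw hh.le
    have e4 : ∑ _i ∈ Finset.range 4, D₁ * γ ^ 3 = 4 * D₁ * γ ^ 3 := by simp; ring
    rw [e4] at hsum
    refine hsum.trans ?_
    have : ∀ a b c' d' : ℝ, b ≤ c' → a + b + d' ≤ a + c' + d' := fun a b c' d' h => by linarith
    exact this _ _ _ _ (by assumption)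
  have key := hmax κ γ hγ hγ1 v Av C (4 * D₁) (4 * Mb) T hAv0 hC (by positivity) (by positivity)
    m hm hvs hvD hv0 hvstep x
  refine key.trans ?_
  calc _ = Real.exp (C * T) * 4 * Mb + G * γ := by rw [hG]; ring
      _ ≤ _ := by linarith

end chainbern

section cutoffs
variable {N : ℕ}

lemma dd_congr_open {F G : ES N → ℝ} {U : Set (ES N)} (hU : IsOpen U) (h : ∀ x ∈ U, F x = G x)
    (v : ES N) : ∀ x ∈ U, dd v F x = dd v G x := fun x hx => by
  have : F =ᶠ[𝓝 x] G := Filter.mem_of_superset (hU.mem_nhds hx) h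
  simp only [dd, this.fderiv_eq]

lemma isOpen_outside (R : ℝ) : IsOpen {x : ES N | R < ‖x‖} :=
  isOpen_lt continuous_const continuous_norm

lemma BBu.of_const_outside {F : ES N → ℝ} (hF : Sm F) {R a : ℝ} (h : ∀ x, R < ‖x‖ → F x = a) :
    BBu F := by
  refine BB.mk' hF fun k => ?_
  induction k generalizing F a with
  | zero =>
    obtain ⟨C, hC⟩ := (isCompact_closedBall (0 : ES N) R).exists_bound_of_continuousOn
      hF.continuous.continuousOn
    refine ⟨max C |a|, fun x _ => ?_⟩
    by_cases hx : ‖x‖ ≤ R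
    · exact (hC x (by simpa using hx)).trans (le_max_left _ _)
    · rw [h x (not_le.1 hx)]; exact le_max_right _ _
  | succ k ih =>
    have hd : ∀ i, ∀ x, R < ‖x‖ → dd (bs i) F x = 0 := fun i x hx => by
      rw [dd_congr_open (G := fun _ => a) (isOpen_outside R) h (bs i) x hx, dd_const]
    choose A hA using fun i : Fin N => ih (hF.dd (bs i)) (hd i)
    obtain ⟨C, hC⟩ := (isCompact_closedBall (0 : ES N) R).exists_bound_of_continuousOn
      hF.continuous.continuousOn
    have hCa : ∀ x, |F x| ≤ max C |a| := fun x => by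
      by_cases hx : ‖x‖ ≤ R
      · exact (hC x (by simpa using hx)).trans (le_max_left _ _)
      · rw [h x (not_le.1 hx)]; exact le_max_right _ _
    refine ⟨max C |a| + ∑ i, |A i|, ?_, fun i => (hA i).mono ?_⟩
    · exact fun x _ => (hCa x).trans (le_add_of_nonneg_right (Finset.sum_nonneg fun _ _ => abs_nonneg _))
    · have h1 : |A i| ≤ ∑ i, |A i| :=
        Finset.single_le_sum (f := fun i => |A i|) (fun _ _ => abs_nonneg _) (Finset.mem_univ i)
      have h2 : 0 ≤ max C |a| := (abs_nonneg a).trans (le_max_right _ _)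
      linarith [le_abs_self (A i)]

/-- The profile of the cut-off functions. -/
def zt (s : ℝ) : ℝ := Real.smoothTransition (2 - s)

lemma zt_smooth : Sm zt := Real.smoothTransition.contDiff.comp (contDiff_const.sub contDiff_id)

lemma zt_one {s : ℝ} (h : s ≤ 1) : zt s = 1 := Real.smoothTransition.one_of_one_le (by linarith)

lemma zt_zero {s : ℝ} (h : 2 ≤ s) : zt s = 0 := Real.smoothTransition.zero_of_nonpos (by linarith)

lemma zt_nonneg (s : ℝ) : 0 ≤ zt s := Real.smoothTransition.nonneg _

lemma zt_le_one (s : ℝ) : zt s ≤ 1 := Real.smoothTransition.le_one _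

lemma zt_antitone : Antitone zt := fun _ _ h => Real.smoothTransition.monotone (by linarith)

lemma zt_deriv_nonpos (s : ℝ) : deriv zt s ≤ 0 := zt_antitone.deriv_nonpos

lemma zt_smooth_deriv : Sm (deriv zt) := by
  have : Sm (fderiv ℝ zt) := ContDiff.fderiv_right zt_smooth (by norm_cast)
  exact this.clm_apply contDiff_const

lemma zt_smooth_deriv2 : Sm (deriv (deriv zt)) := by
  have : Sm (fderiv ℝ (deriv zt)) := ContDiff.fderiv_right zt_smooth_deriv (by norm_cast)
  exact this.clm_apply contDiff_const

lemma zt_deriv_outside {s : ℝ} (h : s < 1 ∨ 2 < s) : deriv zt s = 0 ∧ deriv (deriv zt) s = 0 := by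
  have key : ∀ U : Set ℝ, IsOpen U → s ∈ U → ∀ a : ℝ, (∀ y ∈ U, zt y = a) →
      deriv zt s = 0 ∧ deriv (deriv zt) s = 0 := by
    intro U hU hs a ha
    have h1 : ∀ y ∈ U, deriv zt y = 0 := fun y hy => by
      have : zt =ᶠ[𝓝 y] fun _ => a := Filter.mem_of_superset (hU.mem_nhds hy) ha
      rw [this.deriv_eq]; simp
    have : deriv zt =ᶠ[𝓝 s] fun _ => 0 := Filter.mem_of_superset (hU.mem_nhds hs) h1
    exact ⟨h1 s hs, by rw [this.deriv_eq]; simp⟩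
  rcases h with h | h
  · exact key (Iio 1) isOpen_Iio h 1 fun y hy => zt_one (le_of_lt hy)
  · exact key (Ioi 2) isOpen_Ioi h 0 fun y hy => zt_zero (le_of_lt hy)

lemma zt_bounds : ∃ M, 0 ≤ M ∧ ∀ s, |deriv zt s| ≤ M ∧ |deriv (deriv zt) s| ≤ M := by
  obtain ⟨C, hC⟩ := (isCompact_Icc (a := (1:ℝ)) (b := 2)).exists_bound_of_continuousOn
    zt_smooth_deriv.continuous.continuousOn
  obtain ⟨D, hD⟩ := (isCompact_Icc (a := (1:ℝ)) (b := 2)).exists_bound_of_continuousOn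
    zt_smooth_deriv2.continuous.continuousOn
  refine ⟨max 0 (max C D), le_max_left _ _, fun s => ?_⟩
  by_cases hs : s ∈ Icc (1:ℝ) 2
  · exact ⟨(hC s hs).trans ((le_max_left _ _).trans (le_max_right _ _)),
      (hD s hs).trans ((le_max_right _ _).trans (le_max_right _ _))⟩
  · have : s < 1 ∨ 2 < s := by
      by_contra! h
      exact hs ⟨h.1, h.2⟩
    rw [(zt_deriv_outside this).1, (zt_deriv_outside this).2]
    simp

/-- The cut-off function of radius `R`. -/
def ct (R : ℝ) (x : ES N) : ℝ := zt (‖x‖ ^ 2 / R ^ 2)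

lemma normsq_smooth : Sm (fun x : ES N => ‖x‖ ^ 2) := contDiff_norm_sq ℝ

lemma ct_smooth (R : ℝ) : Sm (ct R : ES N → ℝ) :=
  zt_smooth.comp (normsq_smooth.div_const _)

lemma ct_one {R : ℝ} (hR : 0 < R) {x : ES N} (h : ‖x‖ ≤ R) : ct R x = 1 :=
  zt_one ((div_le_one (by positivity)).2 (pow_le_pow_left₀ (norm_nonneg x) h 2))

lemma ct_zero {R : ℝ} (hR : 0 < R) {x : ES N} (h : 2 * R < ‖x‖) : ct R x = 0 :=
  zt_zero ((le_div_iff₀ (by positivity)).2 (by nlinarith))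

lemma ct_BBu {R : ℝ} (hR : 0 < R) : BBu (ct R : ES N → ℝ) :=
  BBu.of_const_outside (ct_smooth R) fun _ h => ct_zero hR h

lemma dd_normsq (i : Fin N) : dd (bs i) (fun x : ES N => ‖x‖ ^ 2) = fun x => 2 * x i := by
  have e : (fun x : ES N => ‖x‖ ^ 2) = fun x => ∑ j, x j * x j := by
    funext x; rw [EuclideanSpace.real_norm_sq_eq]; exact Finset.sum_congr rfl fun _ _ => sq _
  have hd : ∀ j, Differentiable ℝ (fun x : ES N => x j) := fun j =>
    (Sm.comp_apply (W := ES N) contDiff_id j).diff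
  have hd2 : ∀ j, Differentiable ℝ (fun x : ES N => x j * x j) := fun j => (hd j).mul (hd j)
  rw [e, dd_sum_of _ hd2]
  funext x
  simp only [dd_mul_of (hd _) (hd _), dd_coord]
  rw [Finset.sum_eq_single i]
  · simp [bs]; ring
  · intro j _ hj; simp [bs, hj]
  · simp

lemma dd_ct (R : ℝ) (i : Fin N) :
    dd (bs i) (ct R : ES N → ℝ) = fun x => deriv zt (‖x‖ ^ 2 / R ^ 2) * (2 / R ^ 2 * x i) := by
  funext x
  have h1 : HasFDerivAt (fun x : ES N => ‖x‖ ^ 2 / R ^ 2)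
      (fderiv ℝ (fun x : ES N => ‖x‖ ^ 2 / R ^ 2) x) x :=
    ((normsq_smooth.div_const (R ^ 2)).differentiable (by simp) x).hasFDerivAt
  have h2 := (zt_smooth.differentiable (by simp) (‖x‖ ^ 2 / R ^ 2)).hasDerivAt.comp_hasFDerivAt x h1
  have h3 : dd (bs i) (fun x : ES N => ‖x‖ ^ 2 / R ^ 2) x = 2 / R ^ 2 * x i := by
    have e : (fun x : ES N => ‖x‖ ^ 2 / R ^ 2) = fun x => (R ^ 2)⁻¹ * ‖x‖ ^ 2 := by
      funext x; ring
    rw [e, dd_smul_of normsq_smooth.diff, dd_normsq]; ring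
  change fderiv ℝ (zt ∘ fun x : ES N => ‖x‖ ^ 2 / R ^ 2) x (bs i) = _
  rw [h2.fderiv, ← h3]
  simp [dd]

lemma dd_dd_ct (R : ℝ) (i j : Fin N) :
    dd (bs i) (dd (bs j) (ct R : ES N → ℝ)) = fun x =>
      deriv (deriv zt) (‖x‖ ^ 2 / R ^ 2) * (4 / R ^ 4 * (x i * x j))
        + deriv zt (‖x‖ ^ 2 / R ^ 2) * (2 / R ^ 2 * bs i j) := by
  funext x
  have h1 : HasFDerivAt (fun x : ES N => ‖x‖ ^ 2 / R ^ 2)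
      (fderiv ℝ (fun x : ES N => ‖x‖ ^ 2 / R ^ 2) x) x :=
    ((normsq_smooth.div_const (R ^ 2)).differentiable (by simp) x).hasFDerivAt
  have h2 := (zt_smooth_deriv.differentiable (by simp)
    (‖x‖ ^ 2 / R ^ 2)).hasDerivAt.comp_hasFDerivAt x h1
  have h3 : dd (bs i) (fun x : ES N => ‖x‖ ^ 2 / R ^ 2) x = 2 / R ^ 2 * x i := by
    have e : (fun x : ES N => ‖x‖ ^ 2 / R ^ 2) = fun x => (R ^ 2)⁻¹ * ‖x‖ ^ 2 := by
      funext x; ring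
    rw [e, dd_smul_of normsq_smooth.diff, dd_normsq]; ring
  have h4 : dd (bs i) (fun x : ES N => deriv zt (‖x‖ ^ 2 / R ^ 2)) x =
      deriv (deriv zt) (‖x‖ ^ 2 / R ^ 2) * (2 / R ^ 2 * x i) := by
    change fderiv ℝ (deriv zt ∘ fun x : ES N => ‖x‖ ^ 2 / R ^ 2) x (bs i) = _
    rw [h2.fderiv, ← h3]
    simp [dd]
  have hd : Differentiable ℝ (fun x : ES N => x j) := (Sm.comp_apply (W := ES N) contDiff_id j).diff
  have hz : Differentiable ℝ (fun x : ES N => deriv zt (‖x‖ ^ 2 / R ^ 2)) :=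
    (zt_smooth_deriv.comp (normsq_smooth.div_const _)).differentiable (by simp)
  rw [dd_ct, dd_mul_of hz (hd.const_mul _), dd_smul_of hd, dd_coord]
  simp only [h4]
  ring

lemma ct_Gc {Q : Fin N → Fin N → ES N → ℝ} {B : Fin N → ES N → ℝ} (R : ℝ) (x : ES N) :
    Gc Q B (ct R) x = (14 * deriv zt (‖x‖ ^ 2 / R ^ 2) ^ 2
        - 2 * ct R x * deriv (deriv zt) (‖x‖ ^ 2 / R ^ 2)) *
          (4 / R ^ 4 * ∑ i, ∑ j, Q i j x * (x i * x j))
      + 2 * ct R x * (-deriv zt (‖x‖ ^ 2 / R ^ 2)) * (2 / R ^ 2 *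
          (∑ i, Q i i x + ∑ j, B j x * x j)) := by
  have e1 : Gm Q (ct R) (ct R) x = deriv zt (‖x‖ ^ 2 / R ^ 2) ^ 2 *
      (4 / R ^ 4 * ∑ i, ∑ j, Q i j x * (x i * x j)) := by
    simp only [Gm, dd_ct, Finset.mul_sum]
    exact Finset.sum_congr rfl fun i _ => Finset.sum_congr rfl fun j _ => by ring
  have e2 : ∑ i, ∑ j, Q i j x * dd (bs i) (dd (bs j) (ct R)) x =
      deriv (deriv zt) (‖x‖ ^ 2 / R ^ 2) * (4 / R ^ 4 * ∑ i, ∑ j, Q i j x * (x i * x j))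
      + deriv zt (‖x‖ ^ 2 / R ^ 2) * (2 / R ^ 2 * ∑ i, Q i i x) := by
    have : ∀ i : Fin N, ∑ j, Q i j x * bs i j = Q i i x := fun i => by
      rw [Finset.sum_eq_single i]
      · simp [bs]
      · intro j _ hj; simp [bs, hj]
      · simp
    simp_rw [← this]
    simp only [dd_dd_ct, Finset.mul_sum, ← Finset.sum_add_distrib]
    exact Finset.sum_congr rfl fun i _ => Finset.sum_congr rfl fun j _ => by ring
  have e3 : ∑ j, B j x * dd (bs j) (ct R) x =
      deriv zt (‖x‖ ^ 2 / R ^ 2) * (2 / R ^ 2 * ∑ j, B j x * x j) := by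
    simp only [dd_ct, Finset.mul_sum]
    exact Finset.sum_congr rfl fun i _ => by ring
  simp only [Gc, Ag, e1, e2, e3]
  ring

lemma ct_Gc_le {M K : ℝ} (hM : 0 ≤ M) (hMb : ∀ s, |deriv zt s| ≤ M ∧ |deriv (deriv zt) s| ≤ M)
    {Q : Fin N → Fin N → ES N → ℝ} {B : Fin N → ES N → ℝ} {c : ES N → ℝ}
    {ν₀ L₁ L₂ L₃ ν d r ϱ : ℝ} (hν₀ : 0 < ν₀) {x : ES N} (hL : Loc Q B c ν₀ K L₁ L₂ L₃ ν d r ϱ x)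
    {R : ℝ} (hR : 1 ≤ R) (hx : ‖x‖ ^ 2 ≤ 2 * R ^ 2) :
    Gc Q B (ct R) x ≤ ((14 * M ^ 2 + 2 * M) * (36 * |K|) + 24 * M * |K|) * ν := by
  rw [ct_Gc]
  have hν : 0 < ν := hν₀.trans_le hL.ν_lb
  have hR2 : 1 ≤ R ^ 2 := one_le_pow₀ hR
  set s := ‖x‖ ^ 2 / R ^ 2
  have hq0 : 0 ≤ ∑ i, ∑ j, Q i j x * (x i * x j) :=
    (mul_nonneg hν.le (Finset.sum_nonneg fun i _ => sq_nonneg (x i))).trans (hL.ellip x)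
  have hx1 : 1 + ‖x‖ ^ 2 ≤ 3 * R ^ 2 := by linarith
  have hx2 : (1 + ‖x‖ ^ 2) ^ 2 ≤ 9 * R ^ 4 := by
    calc (1 + ‖x‖ ^ 2) ^ 2 ≤ (3 * R ^ 2) ^ 2 := pow_le_pow_left₀ (by positivity) hx1 2
      _ = _ := by ring
  have hKK := le_abs_self K
  have hR4 : 0 < R ^ 4 := by positivity
  have q1 : 4 / R ^ 4 * ∑ i, ∑ j, Q i j x * (x i * x j) ≤ 36 * |K| * ν := by
    rw [div_mul_eq_mul_div, div_le_iff₀ hR4]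
    have : K * (1 + ‖x‖ ^ 2) ^ 2 * ν ≤ |K| * (9 * R ^ 4) * ν := by
      gcongr
    linarith [hL.growth_Q]
  have q2 : 2 / R ^ 2 * (∑ i, Q i i x + ∑ j, B j x * x j) ≤ 12 * |K| * ν := by
    rw [div_mul_eq_mul_div, div_le_iff₀ (by positivity)]
    have : K * (1 + ‖x‖ ^ 2) * ν ≤ |K| * (3 * R ^ 2) * ν := by
      gcongr
    linarith [hL.growth_tr, hL.growth_b]
  have hc0 : 0 ≤ ct R x := zt_nonneg _
  have hc1 : ct R x ≤ 1 := zt_le_one _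
  have a1 : 14 * deriv zt s ^ 2 - 2 * ct R x * deriv (deriv zt) s ≤ 14 * M ^ 2 + 2 * M := by
    have h1 : deriv zt s ^ 2 ≤ M ^ 2 := by
      rw [← sq_abs]; exact pow_le_pow_left₀ (abs_nonneg _) (hMb s).1 2
    have h2 : ct R x * (-deriv (deriv zt) s) ≤ 1 * M := by
      refine (mul_le_mul_of_nonneg_left ((neg_le_abs _).trans (hMb s).2) hc0).trans ?_
      exact mul_le_mul_of_nonneg_right hc1 hM
    linarith
  have a2 : 2 * ct R x * (-deriv zt s) ≤ 2 * M := by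
    have h2 : ct R x * (-deriv zt s) ≤ 1 * M := by
      refine (mul_le_mul_of_nonneg_left ((neg_le_abs _).trans (hMb s).1) hc0).trans ?_
      exact mul_le_mul_of_nonneg_right hc1 hM
    linarith
  have a20 : 0 ≤ 2 * ct R x * (-deriv zt s) := by
    have := zt_deriv_nonpos s
    have : 0 ≤ -deriv zt s := by linarith
    positivity
  have b1 : (14 * deriv zt s ^ 2 - 2 * ct R x * deriv (deriv zt) s) *
      (4 / R ^ 4 * ∑ i, ∑ j, Q i j x * (x i * x j)) ≤ (14 * M ^ 2 + 2 * M) * (36 * |K| * ν) :=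
    mul_le_mul a1 q1 (by positivity) (by positivity)
  have b2 : 2 * ct R x * (-deriv zt s) * (2 / R ^ 2 * (∑ i, Q i i x + ∑ j, B j x * x j)) ≤
      2 * M * (12 * |K| * ν) :=
    (mul_le_mul_of_nonneg_left q2 a20).trans (mul_le_mul_of_nonneg_right a2 (by positivity))
  linarith

/-- The nested family of cut-off functions. -/
def nest (ρ : ℝ) : ℕ → ES N → ℝ
  | 0 => fun _ => 1
  | 1 => ct (4 * ρ)
  | 2 => ct (2 * ρ)
  | 3 => ct ρ
  | _ => fun _ => 0

lemma ct_sq_le {R : ℝ} (x : ES N) : ct R x ^ 2 ≤ 1 := by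
  have := pow_le_pow_left₀ (zt_nonneg (‖x‖ ^ 2 / R ^ 2)) (zt_le_one (‖x‖ ^ 2 / R ^ 2)) 2
  simpa [ct] using this

lemma ct_anti {R : ℝ} (hR : 0 < R) (x : ES N) : ct R x ^ 2 ≤ ct (2 * R) x ^ 2 := by
  by_cases h : ‖x‖ ≤ 2 * R
  · rw [ct_one (by positivity) h, one_pow]; exact ct_sq_le x
  · rw [ct_zero hR (not_le.1 h), zero_pow two_ne_zero]; positivity

lemma nest_cut {ρ : ℝ} (hρ : 0 < ρ) : Cut (nest ρ : ℕ → ES N → ℝ) := by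
  refine ⟨fun i => ?_, rfl, fun i x => ?_⟩
  · match i with
    | 0 => exact BB.const _
    | 1 => exact ct_BBu (by positivity)
    | 2 => exact ct_BBu (by positivity)
    | 3 => exact ct_BBu hρ
    | _ + 4 => exact BB.const _
  · match i with
    | 0 => simpa [nest] using ct_sq_le x
    | 1 =>
      have := ct_anti (by positivity : 0 < 2 * ρ) x
      rw [show 2 * (2 * ρ) = 4 * ρ by ring] at this
      exact this
    | 2 => exact ct_anti hρ x
    | 3 => change (0:ℝ) ^ 2 ≤ _; rw [zero_pow two_ne_zero]; positivity
    | _ + 4 => exact le_rfl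

lemma nest_one {ρ : ℝ} (hρ : 0 < ρ) {x : ES N} (hx : ‖x‖ ≤ ρ) {i : ℕ} (hi : i < 4) :
    nest ρ i x = 1 := by
  match i, hi with
  | 0, _ => rfl
  | 1, _ => exact ct_one (by positivity) (by linarith)
  | 2, _ => exact ct_one (by positivity) (by linarith)
  | 3, _ => exact ct_one hρ hx

lemma Gc_zero (Q : Fin N → Fin N → ES N → ℝ) (B : Fin N → ES N → ℝ) (x : ES N) :
    Gc Q B (fun _ => 0) x = 0 := by
  simp [Gc, Gm, dd_const]

lemma ct_Gc_outside {Q : Fin N → Fin N → ES N → ℝ} {B : Fin N → ES N → ℝ} {R : ℝ} (hR : 0 < R)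
    {x : ES N} (hx : 2 * R ^ 2 < ‖x‖ ^ 2) : Gc Q B (ct R) x = 0 := by
  have h : 2 < ‖x‖ ^ 2 / R ^ 2 := by rwa [lt_div_iff₀ (by positivity)]
  rw [ct_Gc, (zt_deriv_outside (Or.inr h)).1, (zt_deriv_outside (Or.inr h)).2]
  ring

lemma nest_Gc (K : ℝ) : ∃ g, 0 ≤ g ∧ ∀ (ρ : ℝ), 1 ≤ ρ →
    ∀ (Q : Fin N → Fin N → ES N → ℝ) (B : Fin N → ES N → ℝ) (c : ES N → ℝ) (ν₀ L₁ L₂ L₃ : ℝ),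
    0 < ν₀ → ∀ x : ES N,
    (‖x‖ ≤ 8 * ρ → ∀ ν d r ϱ, Loc Q B c ν₀ K L₁ L₂ L₃ ν d r ϱ x → ∀ i,
      Gc Q B (nest ρ (i + 1)) x ≤ g * ν * nest ρ i x ^ 2) ∧
    (8 * ρ < ‖x‖ → ∀ i, nest ρ (i + 1) x = 0 ∧ Gc Q B (nest ρ (i + 1)) x ≤ 0) := by
  obtain ⟨M, hM, hMb⟩ := zt_bounds
  refine ⟨(14 * M ^ 2 + 2 * M) * (36 * |K|) + 24 * M * |K|, by positivity, ?_⟩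
  intro ρ hρ Q B c ν₀ L₁ L₂ L₃ hν₀ x
  set g := (14 * M ^ 2 + 2 * M) * (36 * |K|) + 24 * M * |K| with hg
  have hg0 : 0 ≤ g := by positivity
  constructor
  · intro _ ν d r ϱ hL
    have hν : 0 < ν := hν₀.trans_le hL.ν_lb
    have key : ∀ (R : ℝ) (ψ : ES N → ℝ), 1 ≤ R → (‖x‖ ≤ 2 * R → ψ x = 1) →
        Gc Q B (ct R) x ≤ g * ν * ψ x ^ 2 := by
      intro R ψ hR hψ
      by_cases h : ‖x‖ ^ 2 ≤ 2 * R ^ 2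
      · rw [hψ (by nlinarith [norm_nonneg x]), one_pow, mul_one]
        exact ct_Gc_le hM hMb hν₀ hL hR h
      · rw [ct_Gc_outside (by linarith) (not_le.1 h)]; positivity
    intro i
    match i with
    | 0 => exact key (4 * ρ) _ (by linarith) fun _ => rfl
    | 1 => exact key (2 * ρ) _ (by linarith) fun h => ct_one (by linarith) (by linarith)
    | 2 => exact key ρ _ hρ fun h => ct_one (by linarith) h
    | i + 3 =>
      change Gc Q B (fun _ => 0) x ≤ _
      rw [Gc_zero]; positivity
  · intro hx
    have key : ∀ R : ℝ, 1 ≤ R → R ≤ 4 * ρ → ct R x = 0 ∧ Gc Q B (ct R) x ≤ 0 := fun R hR h =>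
      ⟨ct_zero (by linarith) (by linarith), (ct_Gc_outside (by linarith) (by nlinarith)).le⟩
    intro i
    match i with
    | 0 => exact key (4 * ρ) (by linarith) le_rfl
    | 1 => exact key (2 * ρ) (by linarith) (by linarith)
    | 2 => exact key ρ hρ (by linarith)
    | i + 3 => exact ⟨rfl, (Gc_zero Q B x).le⟩

end cutoffs

section cholesky
variable {W : Type*} [NormedAddCommGroup W] [NormedSpace ℝ W]

lemma cholesky (n : ℕ) : ∀ (a : Fin n → Fin n → W → ℝ) (ν : ℝ), 0 < ν → (∀ i j, Sm (a i j)) →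
    (∀ i j x, a i j x = a j i x) →
    (∀ x (ξ : Fin n → ℝ), ν * ∑ i, ξ i ^ 2 ≤ ∑ i, ∑ j, a i j x * (ξ i * ξ j)) →
    ∃ σ : Fin n → Fin n → W → ℝ, (∀ k i, Sm (σ k i)) ∧
      (∀ i j x, ∑ k, σ k i x * σ k j x = a i j x) ∧
      ∀ x y, (∀ i j, a i j x = a i j y) → ∀ k i, σ k i x = σ k i y := by
  induction n with
  | zero => exact fun a ν _ _ _ _ => ⟨fun k => k.elim0, fun k => k.elim0, fun i => i.elim0,
      fun _ _ _ k => k.elim0⟩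
  | succ n ih =>
    intro a ν hν hs hsym hell
    have hp : ∀ x, 0 < a 0 0 x := fun x => by
      have := hell x (Fin.cons 1 fun _ => 0)
      simp only [Fin.sum_univ_succ, Fin.cons_zero, Fin.cons_succ] at this
      simp at this
      linarith
    have hps : Sm (fun x => √(a 0 0 x)) := ContDiff.sqrt (hs 0 0) fun x => (hp x).ne'
    have hsq : ∀ x, √(a 0 0 x) ≠ 0 := fun x => (Real.sqrt_pos.2 (hp x)).ne'
    obtain ⟨σ, h1, h2, h3⟩ := ih
      (fun i j x => a i.succ j.succ x - a 0 i.succ x * a 0 j.succ x / a 0 0 x) ν hν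
      (fun i j => (hs _ _).sub (((hs _ _).mul (hs _ _)).div (hs 0 0) fun x => (hp x).ne'))
      (fun i j x => by simp only [hsym i.succ j.succ x]; ring)
      (fun x η => by
        have h := hell x (Fin.cons (-(∑ j, a 0 j.succ x * η j) / a 0 0 x) η)
        simp only [Fin.sum_univ_succ, Fin.cons_zero, Fin.cons_succ, Finset.sum_add_distrib] at h
        set b := ∑ j, a 0 j.succ x * η j with hb
        set p := a 0 0 x with hpd
        have hp0 : p ≠ 0 := (hp x).ne'
        have e1 : ∑ j, a 0 j.succ x * (-b / p * η j) = -b / p * b := by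
          rw [hb, Finset.mul_sum]; exact Finset.sum_congr rfl fun _ _ => by ring
        have e2 : ∑ i, a i.succ 0 x * (η i * (-b / p)) = -b / p * b := by
          rw [hb, Finset.mul_sum]
          exact Finset.sum_congr rfl fun i _ => by rw [hsym i.succ 0 x]; ring
        have e3 : ∑ i, ∑ j, (a i.succ j.succ x - a 0 i.succ x * a 0 j.succ x / p) * (η i * η j) =
            ∑ i, ∑ j, a i.succ j.succ x * (η i * η j) - b * b / p := by
          have : b * b / p = ∑ i, ∑ j, a 0 i.succ x * a 0 j.succ x / p * (η i * η j) := by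
            rw [hb, Finset.sum_mul_sum, Finset.sum_div]
            refine Finset.sum_congr rfl fun i _ => ?_
            rw [Finset.sum_div]
            exact Finset.sum_congr rfl fun j _ => by ring
          rw [this, ← Finset.sum_sub_distrib]
          refine Finset.sum_congr rfl fun i _ => ?_
          rw [← Finset.sum_sub_distrib]
          exact Finset.sum_congr rfl fun j _ => by ring
        rw [e3]
        rw [e1, e2] at h
        have e4 : p * (-b / p * (-b / p)) + -b / p * b + (-b / p * b +
            ∑ i, ∑ j, a i.succ j.succ x * (η i * η j)) =
            ∑ i, ∑ j, a i.succ j.succ x * (η i * η j) - b * b / p := by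
          field_simp; ring
        rw [e4] at h
        have : 0 ≤ ν * (-b / p) ^ 2 := by positivity
        linarith)
    refine ⟨Fin.cons (Fin.cons (fun x => √(a 0 0 x)) fun j x => a 0 j.succ x / √(a 0 0 x))
      fun k => Fin.cons (fun _ => 0) (σ k), ?_, ?_, ?_⟩
    · intro k i
      refine Fin.cases ?_ (fun k => ?_) k <;> refine Fin.cases ?_ (fun i => ?_) i
      · exact hps
      · exact (hs 0 i.succ).div hps hsq
      · exact contDiff_const
      · exact h1 k i
    · intro i j x
      rw [Fin.sum_univ_succ]
      have hss : √(a 0 0 x) * √(a 0 0 x) = a 0 0 x := Real.mul_self_sqrt (hp x).le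
      have hne := hsq x
      refine Fin.cases ?_ (fun i => ?_) i <;> refine Fin.cases ?_ (fun j => ?_) j
      · simpa using hss
      · simp only [Fin.cons_zero, Fin.cons_succ, zero_mul, Finset.sum_const_zero, add_zero]
        field_simp
      · simp only [Fin.cons_zero, Fin.cons_succ, mul_zero, Finset.sum_const_zero, add_zero]
        rw [hsym i.succ 0 x]
        field_simp
      · simp only [Fin.cons_zero, Fin.cons_succ, h2]
        rw [div_mul_div_comm, hss]; ring
    · intro x y hxy k i
      refine Fin.cases ?_ (fun k => ?_) k <;> refine Fin.cases ?_ (fun i => ?_) i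
      · simp only [Fin.cons_zero, hxy]
      · simp only [Fin.cons_zero, Fin.cons_succ, hxy]
      · rfl
      · exact h3 x y (fun i j => by simp only [hxy]) k i

end cholesky

/-! ### Mollification -/

section mol
variable {N : ℕ}

/-- A fixed smooth bump. -/
def mbump (N : ℕ) : ContDiffBump (0 : ES N) := ⟨1/2, 1, by norm_num, by norm_num⟩

/-- The standard mollifier. -/
def mker (N : ℕ) : ES N → ℝ := (mbump N).normed volume

lemma mker_smooth : Sm (mker N) := (mbump N).contDiff_normed
lemma mker_nonneg (y : ES N) : 0 ≤ mker N y := (mbump N).nonneg_normed y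
lemma mker_integral : ∫ y, mker N y = 1 := (mbump N).integral_normed
lemma mker_compact : HasCompactSupport (mker N) := (mbump N).hasCompactSupport_normed
lemma mker_cont : Continuous (mker N) := mker_smooth.continuous
lemma mker_integrable : Integrable (mker N) := (mbump N).integrable_normed

lemma mker_eq_zero {y : ES N} (hy : 1 < ‖y‖) : mker N y = 0 := by
  by_contra h
  have : y ∈ Function.support (mker N) := h
  rw [mker, (mbump N).support_normed_eq] at this
  simp [mbump] at this
  linarith

/-- Mollification at scale `ε`. -/
def mol (ε : ℝ) (f : ES N → ℝ) (x : ES N) : ℝ := ∫ y, mker N y * f (x - ε • y)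

lemma mol_integrable {k f : ES N → ℝ} (hk : Continuous k) (hc : HasCompactSupport k)
    (hf : Continuous f) (ε : ℝ) (x : ES N) : Integrable fun y => k y * f (x - ε • y) :=
  Continuous.integrable_of_hasCompactSupport (by fun_prop) (hc.mul_right)

lemma mol_close {f : ES N → ℝ} (hf : Continuous f) {ε η a : ℝ} {x : ES N}
    (h : ∀ y : ES N, ‖y‖ ≤ 1 → |f (x - ε • y) - a| ≤ η) : |mol ε f x - a| ≤ η := by
  have h1 : mol ε f x - a = ∫ y, mker N y * (f (x - ε • y) - a) := by
    have : (fun y => mker N y * (f (x - ε • y) - a)) =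
        fun y => mker N y * f (x - ε • y) - mker N y * a := by funext y; ring
    rw [this, integral_sub (mol_integrable mker_cont mker_compact hf ε x)
      (mker_integrable.mul_const a), integral_mul_const, mker_integral, one_mul]; rfl
  rw [h1, ← Real.norm_eq_abs]
  refine (norm_integral_le_of_norm_le (mker_integrable.mul_const η)
    (Eventually.of_forall fun y => ?_)).trans (by rw [integral_mul_const, mker_integral, one_mul])
  rw [norm_mul, Real.norm_of_nonneg (mker_nonneg y)]
  rcases le_or_gt ‖y‖ 1 with hy | hy
  · exact mul_le_mul_of_nonneg_left (h y hy) (mker_nonneg y)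
  · rw [mker_eq_zero hy]; simp

lemma mol_conv (f : ES N → ℝ) {ε : ℝ} (hε : 0 < ε) (x : ES N) :
    mol ε f x = convolution (mker N) (fun z => f (ε • z)) (ContinuousLinearMap.mul ℝ ℝ) volume
      (ε⁻¹ • x) := by
  rw [mol, convolution_def]
  refine integral_congr_ae (Eventually.of_forall fun y => ?_)
  simp only [ContinuousLinearMap.mul_apply', smul_sub, smul_smul]
  rw [mul_inv_cancel₀ hε.ne', one_smul]

lemma mol_smooth {f : ES N → ℝ} (hf : Continuous f) {ε : ℝ} (hε : 0 < ε) : Sm (mol ε f) := by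
  have h : Sm (convolution (mker N) (fun z => f (ε • z)) (ContinuousLinearMap.mul ℝ ℝ) volume) :=
    mker_compact.contDiff_convolution_left _ mker_smooth
      (Continuous.locallyIntegrable (by fun_prop))
  have h2 : mol ε f = fun x => convolution (mker N) (fun z => f (ε • z))
      (ContinuousLinearMap.mul ℝ ℝ) volume (ε⁻¹ • x) := funext (mol_conv f hε)
  rw [h2]
  exact h.comp (contDiff_const_smul ε⁻¹)

lemma dd_mol {f : ES N → ℝ} (hf : ContDiff ℝ 1 f) {ε : ℝ} (hε : 0 < ε) (v : ES N) :
    dd v (mol ε f) = mol ε (dd v f) := by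
  funext x
  have hfd : Continuous (fderiv ℝ f) := hf.continuous_fderiv (by simp)
  have hddc : Continuous (dd v f) := hfd.clm_apply continuous_const
  have hdiff : Differentiable ℝ f := hf.differentiable (by simp)
  have hline : ∀ g : ES N → ℝ, Differentiable ℝ g → ∀ y t,
      HasDerivAt (fun t : ℝ => g (y + t • v)) (dd v g (y + t • v)) t := by
    intro g hg y t
    have h1 : HasDerivAt (fun t : ℝ => y + t • v) v t := by
      simpa using ((hasDerivAt_id t).smul_const v).const_add y
    exact (hg _).hasFDerivAt.comp_hasDerivAt t h1
  have hB : ∃ B, ∀ z ∈ closedBall x (ε + ‖v‖), ‖dd v f z‖ ≤ B :=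
    (isCompact_closedBall x (ε + ‖v‖)).exists_bound_of_continuousOn hddc.continuousOn
  obtain ⟨B, hB⟩ := hB
  have key := hasDerivAt_integral_of_dominated_loc_of_deriv_le (μ := (volume : Measure (ES N)))
    (F := fun (t : ℝ) y => mker N y * f (x - ε • y + t • v))
    (F' := fun (t : ℝ) y => mker N y * dd v f (x - ε • y + t • v)) (x₀ := 0)
    (bound := fun y => mker N y * B) (s := ball 0 1) (ball_mem_nhds 0 one_pos) ?_ ?_ ?_ ?_ ?_ ?_
  · have h0 := key.2
    have h1 := hline (mol ε f) (mol_smooth hf.continuous hε).diff x 0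
    have h2 : (fun t : ℝ => mol ε f (x + t • v)) =
        fun t : ℝ => ∫ y, mker N y * f (x - ε • y + t • v) := by
      funext t; rw [mol]; congr 1; funext y; congr 2; abel
    rw [h2] at h1
    have := h1.unique h0
    simpa [mol] using this
  · refine Eventually.of_forall fun t => Continuous.aestronglyMeasurable ?_
    have := hf.continuous; have := mker_cont (N := N); fun_prop
  · have := mol_integrable mker_cont mker_compact hf.continuous ε x
    simpa using this
  · refine Continuous.aestronglyMeasurable ?_
    have := mker_cont (N := N); fun_prop
  · refine Eventually.of_forall fun y t ht => ?_
    rw [norm_mul, Real.norm_of_nonneg (mker_nonneg y)]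
    rcases le_or_gt ‖y‖ 1 with hy | hy
    · refine mul_le_mul_of_nonneg_left (hB _ ?_) (mker_nonneg y)
      rw [mem_closedBall, dist_eq_norm]
      have : x - ε • y + t • v - x = t • v - ε • y := by abel
      rw [this]
      have ht' : |t| ≤ 1 := by have := mem_ball_zero_iff.1 ht; exact this.le
      calc ‖t • v - ε • y‖ ≤ ‖t • v‖ + ‖ε • y‖ := norm_sub_le _ _
        _ = |t| * ‖v‖ + ε * ‖y‖ := by
            rw [norm_smul, norm_smul, Real.norm_eq_abs, Real.norm_of_nonneg hε.le]
        _ ≤ ε + ‖v‖ := by nlinarith [norm_nonneg v]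
    · rw [mker_eq_zero hy]; simp
  · exact mker_integrable.mul_const B
  · refine Eventually.of_forall fun y t _ => ?_
    exact (hline f hdiff _ t).const_mul _

/-- `L¹` norm of a derivative of the mollifier. -/
def mkd (N : ℕ) : ℝ := ∑ i : Fin N, ∫ y, |dd (bs i) (mker N) y|

lemma mkd_nonneg : 0 ≤ mkd N :=
  Finset.sum_nonneg fun _ _ => integral_nonneg fun _ => abs_nonneg _

lemma dd_mker_compact (v : ES N) : HasCompactSupport (dd v (mker N)) :=
  (mker_compact.fderiv ℝ).comp_left (g := fun L : ES N →L[ℝ] ℝ => L v) (by simp)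

lemma dd_mol_formula {f : ES N → ℝ} (hf : Continuous f) {ε : ℝ} (hε : 0 < ε) (v x : ES N) :
    dd v (mol ε f) x = ε⁻¹ * ∫ y, dd v (mker N) y * f (x - ε • y) := by
  have h := mker_compact.hasFDerivAt_convolution_left (μ := (volume : Measure (ES N)))
    (ContinuousLinearMap.mul ℝ ℝ) (mker_smooth.of_le (by norm_cast))
    (g := fun z => f (ε • z)) (Continuous.locallyIntegrable (by fun_prop)) (ε⁻¹ • x)
  have h2 : mol ε f = fun x => convolution (mker N) (fun z => f (ε • z))
      (ContinuousLinearMap.mul ℝ ℝ) volume (ε⁻¹ • x) := funext (mol_conv f hε)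
  have h3 : HasFDerivAt (fun x : ES N => ε⁻¹ • x) (ε⁻¹ • ContinuousLinearMap.id ℝ (ES N)) x :=
    (hasFDerivAt_id x).const_smul ε⁻¹
  have h4 := h.comp x h3
  have h5 : HasFDerivAt (mol ε f) _ x := h4.congr_of_eventuallyEq (Eventually.of_forall fun z => by
    rw [mol_conv f hε]; rfl)
  rw [dd, h5.fderiv]
  simp only [ContinuousLinearMap.comp_apply, smul_apply,
    ContinuousLinearMap.id_apply, map_smul, smul_eq_mul]
  congr 1
  have hk := (mker_compact (N := N)).fderiv ℝ
  have hkc : Continuous (fderiv ℝ (mker N)) := mker_smooth.continuous_fderiv (by simp)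
  rw [convolution_def, ContinuousLinearMap.integral_apply]
  · refine integral_congr_ae (Eventually.of_forall fun y => ?_)
    simp only [ContinuousLinearMap.precompL_apply, ContinuousLinearMap.mul_apply', smul_sub,
      smul_smul]
    rw [mul_inv_cancel₀ hε.ne', one_smul]; rfl
  · have := (hk.convolutionExists_left (μ := (volume : Measure (ES N)))
      ((ContinuousLinearMap.mul ℝ ℝ).precompL (ES N)) hkc
      (g := fun z => f (ε • z)) (Continuous.locallyIntegrable (by fun_prop))) (ε⁻¹ • x)
    exact this

lemma dd_mol_le {f : ES N → ℝ} (hf : Continuous f) {ε : ℝ} (hε : 0 < ε) {x : ES N} {ω a : ℝ}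
    (h : ∀ y : ES N, ‖y‖ ≤ 1 → |f (x - ε • y) - a| ≤ ω) (i : Fin N) :
    |dd (bs i) (mol ε f) x| ≤ mkd N / ε * ω := by
  have hω : 0 ≤ ω := (abs_nonneg _).trans (h 0 (by simp))
  have hkc : Continuous (dd (bs i) (mker N)) := (mker_smooth.dd _).continuous
  have h0 : ∫ y, dd (bs i) (mker N) y * a = 0 := by
    have h1 := dd_mol_formula (f := fun _ => a) continuous_const hε (bs i) x
    have h2 : mol ε (fun _ : ES N => a) = fun _ => a := by
      funext z; simp [mol, integral_mul_const, mker_integral]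
    rw [h2, dd_const] at h1
    have := (mul_eq_zero.1 h1.symm).resolve_left (inv_ne_zero hε.ne')
    exact this
  have hi := mol_integrable hkc (dd_mker_compact _) hf ε x
  have hi0 : Integrable (dd (bs i) (mker N)) :=
    hkc.integrable_of_hasCompactSupport (dd_mker_compact _)
  have h1 : dd (bs i) (mol ε f) x =
      ε⁻¹ * ∫ y, dd (bs i) (mker N) y * (f (x - ε • y) - a) := by
    rw [dd_mol_formula hf hε]
    simp only [mul_sub]
    rw [integral_sub hi (hi0.mul_const a), h0, sub_zero]
  rw [h1, abs_mul, abs_of_pos (inv_pos.2 hε)]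
  have h2 : |∫ y, dd (bs i) (mker N) y * (f (x - ε • y) - a)| ≤
      (∫ y, |dd (bs i) (mker N) y|) * ω := by
    rw [← integral_mul_const, ← Real.norm_eq_abs]
    refine norm_integral_le_of_norm_le (hi0.abs.mul_const ω) (Eventually.of_forall fun y => ?_)
    rw [norm_mul]
    rcases le_or_gt ‖y‖ 1 with hy | hy
    · exact mul_le_mul_of_nonneg_left (h y hy) (abs_nonneg _)
    · have : dd (bs i) (mker N) y = 0 := by
        have hU : IsOpen {z : ES N | 1 < ‖z‖} := isOpen_lt continuous_const continuous_norm
        have := dd_congr_open hU (F := mker N) (G := fun _ => 0)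
          (fun z hz => mker_eq_zero hz) (bs i) y hy
        rw [this, dd_const]
      rw [this]; simp
  have h3 : (∫ y, |dd (bs i) (mker N) y|) ≤ mkd N :=
    Finset.single_le_sum (f := fun i => ∫ y, |dd (bs i) (mker N) y|)
      (fun i _ => integral_nonneg fun _ => abs_nonneg _) (Finset.mem_univ i)
  calc _ ≤ ε⁻¹ * (mkd N * ω) := by gcongr; exact h2.trans (by gcongr)
    _ = _ := by rw [div_eq_inv_mul]; ring

end mol

/-! ### Approximation of the coefficients by smooth, eventually constant ones -/

section approx
variable {N : ℕ}

lemma mol_sub_DB {k : ℕ} : ∀ {F : ES N → ℝ}, ContDiff ℝ k F → ∀ {ρ η : ℝ}, 0 < η →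
    ∃ ε₀ > 0, ∀ ε, 0 < ε → ε ≤ ε₀ → DB bs (ball (0 : ES N) ρ) k η (fun x => mol ε F x - F x) := by
  have h0 : ∀ {F : ES N → ℝ}, Continuous F → ∀ {ρ η : ℝ}, 0 < η →
      ∃ ε₀ > 0, ∀ ε, 0 < ε → ε ≤ ε₀ → ∀ x ∈ ball (0 : ES N) ρ, |mol ε F x - F x| ≤ η := by
    intro F hF ρ η hη
    have huc := (isCompact_closedBall (0 : ES N) (ρ + 1)).uniformContinuousOn_of_continuous
      hF.continuousOn
    obtain ⟨r, hr, h⟩ := Metric.uniformContinuousOn_iff.1 huc η hη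
    refine ⟨min (r / 2) 1, by positivity, fun ε hε hε0 x hx => mol_close hF fun y hy => ?_⟩
    have hx' := mem_ball_zero_iff.1 hx
    have hn : ‖ε • y‖ ≤ ε := by
      rw [norm_smul, Real.norm_of_nonneg hε.le]; nlinarith
    have h1 : ε ≤ r / 2 := hε0.trans (min_le_left _ _)
    have h2 : ε ≤ 1 := hε0.trans (min_le_right _ _)
    refine (h _ ?_ _ ?_ ?_).le
    · rw [mem_closedBall_zero_iff]
      linarith [norm_sub_le x (ε • y)]
    · rw [mem_closedBall_zero_iff]; linarith
    · rw [dist_eq_norm]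
      have : x - ε • y - x = -(ε • y) := by abel
      rw [this, norm_neg]; linarith
  induction k with
  | zero => exact fun hF ρ η hη => h0 hF.continuous hη
  | succ k ih =>
    intro F hF ρ η hη
    have hF1 : ContDiff ℝ 1 F := hF.of_le (by norm_cast; omega)
    obtain ⟨ε₀, hε₀, h⟩ := h0 hF.continuous (ρ := ρ) hη
    have hd : ∀ i : Fin N, ContDiff ℝ k (dd (bs i) F) := fun i =>
      (hF.fderiv_right (m := k) (by norm_cast)).clm_apply contDiff_const
    choose e he h' using fun i => ih (hd i) (ρ := ρ) hη
    obtain ⟨ε₁, hε₁, hle⟩ : ∃ ε₁ > 0, ∀ i, ε₁ ≤ e i := by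
      rcases isEmpty_or_nonempty (Fin N) with hN | hN
      · exact ⟨1, one_pos, fun i => hN.elim i⟩
      · obtain ⟨i, -, hi⟩ := Finset.exists_min_image Finset.univ e Finset.univ_nonempty
        exact ⟨e i, he i, fun j => hi j (Finset.mem_univ j)⟩
    refine ⟨min ε₀ ε₁, lt_min hε₀ hε₁, fun ε hε hle' =>
      ⟨h ε hε (hle'.trans (min_le_left _ _)), fun i => ?_⟩⟩
    rw [dd_sub_of (mol_smooth hF.continuous hε).diff (hF1.differentiable (by simp)),
      dd_mol hF1 hε]
    exact h' i ε hε ((hle'.trans (min_le_right _ _)).trans (hle i))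

/-- Closeness at a point of two functions together with their derivatives up to order three. -/
structure Cl3 (η : ℝ) (x : ES N) (F G : ES N → ℝ) : Prop where
  h0 : |F x - G x| ≤ η
  h1 : ∀ k, |dd (bs k) F x - dd (bs k) G x| ≤ η
  h2 : ∀ k l, |dd (bs k) (dd (bs l) F) x - dd (bs k) (dd (bs l) G) x| ≤ η
  h3 : ∀ k l m, |dd (bs k) (dd (bs l) (dd (bs m) F)) x - dd (bs k) (dd (bs l) (dd (bs m) G)) x| ≤ η

lemma Cl3.congr_open {η : ℝ} {F F' G : ES N → ℝ} {U : Set (ES N)} (hU : IsOpen U)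
    (h : ∀ x ∈ U, F x = F' x) {x : ES N} (hx : x ∈ U) (hc : Cl3 η x F' G) : Cl3 η x F G := by
  have e1 := fun v => dd_congr_open hU h v
  have e2 := fun v w => dd_congr_open hU (e1 v) w
  have e3 := fun v w z => dd_congr_open hU (e2 v w) z
  refine ⟨?_, fun k => ?_, fun k l => ?_, fun k l m => ?_⟩
  · rw [h x hx]; exact hc.h0
  · rw [e1 _ x hx]; exact hc.h1 k
  · rw [e2 _ _ x hx]; exact hc.h2 k l
  · rw [e3 _ _ _ x hx]; exact hc.h3 k l m

lemma Cl3.mono {η η' : ℝ} {F G : ES N → ℝ} {x : ES N} (hc : Cl3 η x F G) (h : η ≤ η') :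
    Cl3 η' x F G :=
  ⟨hc.h0.trans h, fun k => (hc.h1 k).trans h, fun k l => (hc.h2 k l).trans h,
    fun k l m => (hc.h3 k l m).trans h⟩

lemma contDiff_dd {k : ℕ} {F : ES N → ℝ} (hF : ContDiff ℝ (k + 1 : ℕ) F) (v : ES N) :
    ContDiff ℝ k (dd v F) :=
  (hF.fderiv_right (m := k) (by norm_cast)).clm_apply contDiff_const

lemma Cl3.of_DB {η : ℝ} {F G : ES N → ℝ} {U : Set (ES N)} (hF : ContDiff ℝ (3 : ℕ) F)
    (hG : ContDiff ℝ (3 : ℕ) G) (h : DB bs U 3 η (fun x => F x - G x)) {x : ES N} (hx : x ∈ U) :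
    Cl3 η x F G := by
  have hD : ∀ {k : ℕ} {F : ES N → ℝ}, ContDiff ℝ (k + 1 : ℕ) F → Differentiable ℝ F :=
    fun h => h.differentiable (by simp)
  obtain ⟨k0, k1⟩ := h
  simp only [dd_sub_of (hD hF) (hD hG)] at k1
  refine ⟨k0 x hx, fun k => (k1 k).bound x hx, fun k l => ?_, fun k l m => ?_⟩
  · have := (k1 l).2 k
    rw [dd_sub_of (hD (contDiff_dd hF _)) (hD (contDiff_dd hG _))] at this
    exact this.bound x hx
  · have := (k1 m).2 l
    rw [dd_sub_of (hD (contDiff_dd hF _)) (hD (contDiff_dd hG _))] at this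
    have := this.2 k
    rw [dd_sub_of (hD (contDiff_dd (contDiff_dd hF _) _))
      (hD (contDiff_dd (contDiff_dd hG _) _))] at this
    exact this x hx

lemma exists_smoothing (ρ : ℝ) {η : ℝ} (hη : 0 < η) : ∃ ap : (ES N → ℝ) → ES N → ℝ,
    ∀ F, ContDiff ℝ 3 F → Sm (ap F) ∧ ∀ x ∈ ball (0 : ES N) ρ, Cl3 η x (ap F) F := by
  have : ∀ F : ES N → ℝ, ∃ F' : ES N → ℝ, ContDiff ℝ 3 F → Sm F' ∧
      ∀ x ∈ ball (0 : ES N) ρ, Cl3 η x F' F := by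
    intro F
    by_cases hF : ContDiff ℝ 3 F
    swap
    · exact ⟨F, fun h => (hF h).elim⟩
    have hF' : ContDiff ℝ (3 : ℕ) F := hF
    obtain ⟨ε, hε, h⟩ := mol_sub_DB hF' (ρ := ρ) hη
    have hs := mol_smooth hF.continuous hε
    exact ⟨mol ε F, fun _ => ⟨hs, fun x hx =>
      Cl3.of_DB (hs.of_le (by norm_cast)) hF' (h ε hε le_rfl) hx⟩⟩
  choose ap hap using this
  exact ⟨ap, hap⟩

end approx

/-! ### The structural conditions are stable under small perturbations -/

section pert

lemma quad_pert {ι : Type*} [Fintype ι] {a b : ι → ι → ℝ} {η : ℝ} (h : ∀ i j, |a i j - b i j| ≤ η)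
    (ξ : ι → ℝ) : |∑ i, ∑ j, a i j * (ξ i * ξ j) - ∑ i, ∑ j, b i j * (ξ i * ξ j)| ≤
      η * Fintype.card ι * ∑ i, ξ i ^ 2 := by
  have e : ∑ i, ∑ j, a i j * (ξ i * ξ j) - ∑ i, ∑ j, b i j * (ξ i * ξ j) =
      ∑ i, ∑ j, (a i j - b i j) * (ξ i * ξ j) := by
    rw [← Finset.sum_sub_distrib]
    refine Finset.sum_congr rfl fun i _ => ?_
    rw [← Finset.sum_sub_distrib]
    exact Finset.sum_congr rfl fun j _ => by ring
  rw [e]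
  have h1 : ∀ i j, |(a i j - b i j) * (ξ i * ξ j)| ≤ η * ((ξ i ^ 2 + ξ j ^ 2) / 2) := by
    intro i j
    rw [abs_mul]
    refine mul_le_mul (h i j) ?_ (abs_nonneg _) ((abs_nonneg _).trans (h i j))
    rw [abs_le]; constructor <;> nlinarith [sq_nonneg (ξ i - ξ j), sq_nonneg (ξ i + ξ j)]
  calc _ ≤ ∑ i, ∑ j, |(a i j - b i j) * (ξ i * ξ j)| :=
        (Finset.abs_sum_le_sum_abs _ _).trans
          (Finset.sum_le_sum fun i _ => Finset.abs_sum_le_sum_abs _ _)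
    _ ≤ ∑ i, ∑ j, η * ((ξ i ^ 2 + ξ j ^ 2) / 2) :=
        Finset.sum_le_sum fun i _ => Finset.sum_le_sum fun j _ => h1 i j
    _ = _ := by
        simp only [← Finset.mul_sum, add_div, Finset.sum_add_distrib, Finset.sum_const,
          Finset.card_univ, nsmul_eq_mul, ← Finset.sum_div]
        ring

lemma le_of_abs_sub {a b η M : ℝ} (h : |a - b| ≤ η) (hb : |b| ≤ M) : |a| ≤ M + η := by
  have := abs_sub_abs_le_abs_sub a b; linarith

variable {N : ℕ} {T : ℝ} {q : ℝ → ES N → Fin N → Fin N → ℝ}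
    {b : ℝ → ES N → Fin N → ℝ} {c : ℝ → ES N → ℝ}

lemma Hyp.loc (H : Hyp N T q b c) : ∃ η₁, 0 < η₁ ∧ η₁ * N ≤ H.ν₀ / 2 ∧ η₁ ≤ 1 ∧ ∃ K L₃ : ℝ,
    ∀ t ∈ Icc (0 : ℝ) T, ∀ x, ∀ (Q : Fin N → Fin N → ES N → ℝ) (B : Fin N → ES N → ℝ)
      (c' : ES N → ℝ), (∀ i j, Cl3 η₁ x (Q i j) fun y => q t y i j) →
      (∀ j, Cl3 η₁ x (B j) fun y => b t y j) → Cl3 η₁ x c' (c t) →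
      ∃ ν d r ϱ, Loc Q B c' (H.ν₀ / 2) K H.L₁ (H.L₂ / 2) L₃ ν d r ϱ x := by
  have hν0 := H.ν₀_pos
  have hL1 := H.L₁_pos
  have hL2 := H.L₂_pos
  set E : ℝ := N ^ 2 + N + 1 + H.L₁ + H.L₂ with hE
  have hEpos : 0 < E := by positivity
  obtain ⟨η, hη, hη1, hηE⟩ : ∃ η > 0, η ≤ 1 ∧ η * E ≤ H.ν₀ / 2 := by
    refine ⟨min 1 (H.ν₀ / 2 / E), by positivity, min_le_left _ _, ?_⟩
    calc _ ≤ H.ν₀ / 2 / E * E := by gcongr; exact min_le_right _ _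
      _ = _ := by field_simp
  have hN2 : η * (N : ℝ) ^ 2 ≤ H.ν₀ / 2 := by
    refine le_trans ?_ hηE; gcongr; rw [hE]; nlinarith [Nat.cast_nonneg (α := ℝ) N]
  have hN1 : η * (N : ℝ) ≤ H.ν₀ / 2 := by
    refine le_trans ?_ hηE; gcongr; rw [hE]; nlinarith [Nat.cast_nonneg (α := ℝ) N]
  have h1 : η ≤ H.ν₀ / 2 := by
    refine le_trans ?_ hηE
    nlinarith [Nat.cast_nonneg (α := ℝ) N, mul_pos hη hL1, mul_pos hη hL2,
      mul_nonneg hη.le (Nat.cast_nonneg (α := ℝ) N), mul_nonneg hη.le (sq_nonneg (N : ℝ))]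
  have hNLL : η * (N + H.L₁ + H.L₂) ≤ H.ν₀ / 2 := by
    refine le_trans ?_ hηE; gcongr; rw [hE]; nlinarith [Nat.cast_nonneg (α := ℝ) N]
  refine ⟨η, hη, hN1, hη1, 2 * (H.C₁ + H.C₂ + H.C₃ + H.K₁ + H.K₂ + H.K₃) + 1, 2 * H.L₃ + 2, ?_⟩
  intro t ht x Q B c' hQ hB hc
  have hν := H.ν_lb t ht x
  set ν := H.ν t x
  have hC1 := H.C₁_pos
  have hC2 := H.C₂_pos
  have hC3 := H.C₃_pos
  have hK1 := H.K₁_pos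
  have hK2 := H.K₂_pos
  have hK3 := H.K₃_pos
  have hνp : 0 < ν := hν0.trans_le hν
  have hK : ∀ k e X : ℝ, 0 ≤ X → e ≤ ν / 2 * X →
      k ≤ H.C₁ + H.C₂ + H.C₃ + H.K₁ + H.K₂ + H.K₃ → k * ν * X + e ≤
        (2 * (H.C₁ + H.C₂ + H.C₃ + H.K₁ + H.K₂ + H.K₃) + 1) * (ν / 2) * X := by
    intro k e X hX he hk
    have : k * (ν * X) ≤ (H.C₁ + H.C₂ + H.C₃ + H.K₁ + H.K₂ + H.K₃) * (ν * X) := by gcongr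
    nlinarith
  have hη2 : η ≤ ν / 2 := by linarith
  have hsq : ∀ ξ : Fin N → ℝ, ‖(WithLp.toLp 2 ξ : ES N)‖ ^ 2 = ∑ i, ξ i ^ 2 := fun ξ => by
    rw [EuclideanSpace.norm_sq_eq]; simp
  have hx2 : ‖x‖ ^ 2 = ∑ i, x i ^ 2 := by rw [EuclideanSpace.norm_sq_eq]; simp
  refine ⟨ν / 2, H.d t x + η * N, H.r t x + η, H.ϱ t x + η, ?_⟩
  have qp := fun ξ : Fin N → ℝ => abs_le.1
    (quad_pert (a := fun i j => Q i j x) (fun i j => (hQ i j).h0) ξ)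
  simp only [Fintype.card_fin] at qp
  refine ⟨by linarith, ?_, fun ξ => ?_, ?_, ?_, ?_, ?_, ?_, ?_, fun ξ => ?_, ?_, ?_, ?_, ?_, ?_, ?_⟩
  · have := H.db2_bound t ht x ⟨0, H.N_pos⟩ ⟨0, H.N_pos⟩ ⟨0, H.N_pos⟩
    linarith [abs_nonneg (pd2 (fun y => b t y ⟨0, H.N_pos⟩) ⟨0, H.N_pos⟩ ⟨0, H.N_pos⟩ x)]
  · have he := H.ellip t ht x (WithLp.toLp 2 ξ)
    rw [hsq] at he
    simp only [mul_assoc] at he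
    have hs : 0 ≤ ∑ i, ξ i ^ 2 := Finset.sum_nonneg fun i _ => sq_nonneg _
    have := (qp ξ).1
    have : η * N * ∑ i, ξ i ^ 2 ≤ ν / 2 * ∑ i, ξ i ^ 2 := by gcongr; linarith
    linarith
  · have hg := H.growth_Q t ht x
    set y : ES N := (EuclideanSpace.equiv (Fin N) ℝ).symm fun i => ∑ j, q t x i j * x j with hy
    have hi : ∑ i, ∑ j, q t x i j * (x i * x j) ≤ ‖y‖ * ‖x‖ := by
      refine le_trans (le_of_eq ?_) (real_inner_le_norm y x)
      rw [PiLp.inner_apply]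
      refine Finset.sum_congr rfl fun i _ => ?_
      have : y i = ∑ j, q t x i j * x j := rfl
      rw [this]
      simp only [RCLike.inner_apply, conj_trivial, Finset.mul_sum]
      exact Finset.sum_congr rfl fun j _ => by ring
    have hX : ‖x‖ ≤ 1 + ‖x‖ ^ 2 := by nlinarith [sq_nonneg (‖x‖ - 1), norm_nonneg x]
    have h2 : ‖y‖ * ‖x‖ ≤ H.C₁ * ν * (1 + ‖x‖ ^ 2) ^ 2 := by
      calc ‖y‖ * ‖x‖ ≤ (H.C₁ * (1 + ‖x‖ ^ 2) * ν) * (1 + ‖x‖ ^ 2) := by gcongr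
        _ = _ := by ring
    have h3 := (qp fun i => x i).2
    rw [← hx2] at h3
    have h4 : η * N * ‖x‖ ^ 2 ≤ ν / 2 * (1 + ‖x‖ ^ 2) ^ 2 := by
      have : ‖x‖ ^ 2 ≤ (1 + ‖x‖ ^ 2) ^ 2 := by nlinarith [sq_nonneg (‖x‖)]
      gcongr; linarith
    have := hK H.C₁ _ ((1 + ‖x‖ ^ 2) ^ 2) (by positivity) h4 (by linarith)
    linarith
  · have hg := H.growth_tr t ht x
    have h3 : ∑ i, Q i i x ≤ ∑ i, q t x i i + η * N := by
      have : ∑ i, Q i i x ≤ ∑ i : Fin N, (q t x i i + η) :=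
        Finset.sum_le_sum fun i _ => by have := (abs_le.1 (hQ i i).h0).2; linarith
      rw [Finset.sum_add_distrib] at this; simp at this; linarith
    have := hK H.C₂ (η * N) (1 + ‖x‖ ^ 2) (by positivity) (by nlinarith [sq_nonneg ‖x‖])
      (by linarith)
    linarith
  · have hg := H.growth_b t ht x
    have h3 : ∑ j, B j x * x j ≤ ∑ j, b t x j * x j + η * N * (1 + ‖x‖ ^ 2) := by
      have : ∑ j, B j x * x j ≤ ∑ j : Fin N, (b t x j * x j + η * (1 + ‖x‖ ^ 2)) := by
        refine Finset.sum_le_sum fun j _ => ?_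
        have h4 : |(B j x - b t x j) * x j| ≤ η * (1 + ‖x‖ ^ 2) := by
          rw [abs_mul]
          refine mul_le_mul (hB j).h0 ?_ (abs_nonneg _) hη.le
          have h5 : ‖x j‖ ≤ ‖x‖ := PiLp.norm_apply_le x j
          rw [Real.norm_eq_abs] at h5
          nlinarith [sq_nonneg (‖x‖ - 1), norm_nonneg x]
        have := (abs_le.1 h4).2
        linarith
      rw [Finset.sum_add_distrib] at this; simp at this; linarith
    have := hK H.C₃ (η * N * (1 + ‖x‖ ^ 2)) (1 + ‖x‖ ^ 2) (by positivity)
      (by gcongr; linarith) (by linarith)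
    linarith
  · intro i j k
    have := le_of_abs_sub ((hQ i j).h1 k) (H.dq1_bound t ht x i j k)
    have := hK H.K₁ η 1 zero_le_one (by linarith) (by linarith)
    linarith
  · intro i j k l m
    have := le_of_abs_sub ((hQ i j).h3 k l m) (H.dq3_bound t ht x i j k l m)
    have := hK H.K₃ η 1 zero_le_one (by linarith) (by linarith)
    linarith
  · intro Ξ hΞ
    have hg := H.dq2_quad t ht x Ξ hΞ
    have hp := (abs_le.1 (quad_pert (ι := Fin N × Fin N)
      (a := fun i j => dd (bs j.1) (dd (bs j.2) (Q i.1 i.2)) x)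
      (b := fun i j => dd (bs j.1) (dd (bs j.2) fun y => q t y i.1 i.2) x)
      (fun i j => (hQ _ _).h2 _ _) fun i => Ξ i.1 i.2)).2
    simp only [Fintype.sum_prod_type, Fintype.card_prod, Fintype.card_fin, ← mul_assoc] at hp
    simp only [pd2, pd1_eq_dd] at hg
    have hs : 0 ≤ ∑ h, ∑ k, Ξ h k ^ 2 :=
      Finset.sum_nonneg fun i _ => Finset.sum_nonneg fun j _ => sq_nonneg _
    have := hK H.K₂ (η * N ^ 2 * ∑ h, ∑ k, Ξ h k ^ 2) (∑ h, ∑ k, Ξ h k ^ 2) hs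
      (by gcongr; linarith) (by linarith)
    push_cast at hp
    rw [show η * ((N : ℝ) * N) = η * N ^ 2 by ring] at hp
    linarith
  · have hg := H.dissip t ht x (WithLp.toLp 2 ξ)
    rw [hsq] at hg
    have hp := (abs_le.1 (quad_pert (a := fun j i => dd (bs j) (B i) x)
      (b := fun j i => dd (bs j) (fun y => b t y i) x) (fun j i => (hB _).h1 _) ξ)).2
    simp only [Fintype.card_fin] at hp
    rw [Finset.sum_comm, Finset.sum_comm (f := fun j i => dd (bs j) (fun y => b t y i) x * _)] at hp
    simp only [← mul_assoc, pd1_eq_dd] at hp hg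
    linarith
  · exact fun j k l => le_of_abs_sub ((hB j).h2 k l) (H.db2_bound t ht x j k l)
  · exact fun j k l m => le_of_abs_sub ((hB j).h3 k l m) (H.db3_bound t ht x j k l m)
  · exact fun k => le_of_abs_sub (hc.h1 k) (H.dc1_bound t ht x k)
  · exact fun k l => le_of_abs_sub (hc.h2 k l) (H.dc2_bound t ht x k l)
  · exact fun k l m => le_of_abs_sub (hc.h3 k l m) (H.dc3_bound t ht x k l m)
  · have hf := H.funz t ht x
    have : (H.ϱ t x + η) ^ 2 ≤ 2 * H.ϱ t x ^ 2 + 2 * η := by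
      nlinarith [sq_nonneg (H.ϱ t x - η)]
    have : H.L₂ / 2 * (H.ϱ t x + η) ^ 2 ≤ H.L₂ / 2 * (2 * H.ϱ t x ^ 2 + 2 * η) := by gcongr
    linarith

end pert

/-! ### Schemes attached to the coefficients -/

section scheme_exists
variable {N : ℕ} {T : ℝ} {q : ℝ → ES N → Fin N → Fin N → ℝ}
    {b : ℝ → ES N → Fin N → ℝ} {c : ℝ → ES N → ℝ}

lemma zt_ct_mem (R : ℝ) (x : ES N) : 0 ≤ ct R x ∧ ct R x ≤ 1 := ⟨zt_nonneg _, zt_le_one _⟩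

lemma Hyp.scheme (H : Hyp N T q b c) : ∃ K L₃ : ℝ, ∀ ρ > 0, ∀ η > 0, ∀ t ∈ Icc (0 : ℝ) T,
    ∃ S : Scheme N, (∀ x, S.c x ≤ |H.c₀| + 1) ∧ ∀ x, ‖x‖ ≤ ρ →
      (∃ ν d r ϱ, Loc S.Q S.B S.c (H.ν₀ / 2) K H.L₁ (H.L₂ / 2) L₃ ν d r ϱ x) ∧
      (∀ i j, |S.Q i j x - q t x i j| ≤ η) ∧ (∀ j, |S.B j x - b t x j| ≤ η) ∧
      |S.c x - c t x| ≤ η := by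
  obtain ⟨η₁, hη₁, hη₁N, hη₁1, K, L₃, hloc⟩ := H.loc
  refine ⟨K, L₃, fun ρ hρ η hη t ht => ?_⟩
  have hν0 := H.ν₀_pos
  set e := min η η₁ with he
  have hepos : 0 < e := lt_min hη hη₁
  obtain ⟨ap, hap⟩ := exists_smoothing (N := N) (2 * (ρ + 1) + 1) hepos
  have hR : 0 < ρ + 1 := by linarith
  set χ : ES N → ℝ := ct (ρ + 1) with hχ
  have hχs : Sm χ := ct_smooth _
  have hχ0 : ∀ x, 2 * (ρ + 1) < ‖x‖ → χ x = 0 := fun x hx => ct_zero hR hx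
  have hχ1 : ∀ x ∈ ball (0 : ES N) (ρ + 1), χ x = 1 := fun x hx =>
    ct_one hR (mem_ball_zero_iff.1 hx).le
  set qt : Fin N → Fin N → ES N → ℝ := fun i j => ap fun x => q t x i j with hqt
  set bt : Fin N → ES N → ℝ := fun j => ap fun x => b t x j with hbt
  set ctl : ES N → ℝ := ap (c t) with hctl
  have hq := fun i j => hap _ (H.smooth_q t ht i j)
  have hb := fun j => hap _ (H.smooth_b t ht j)
  have hc := hap _ (H.smooth_c t ht)
  have hsym : ∀ i j, qt i j = qt j i := fun i j => by
    simp only [hqt]; congr 1; funext x; exact H.q_symm t ht x i j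
  set Q : Fin N → Fin N → ES N → ℝ := fun i j x =>
    (if i = j then H.ν₀ / 2 else 0) + χ x * (qt i j x - if i = j then H.ν₀ / 2 else 0) with hQd
  have hQs : ∀ i j, Sm (Q i j) := fun i j =>
    contDiff_const.add (hχs.mul ((hq i j).1.sub contDiff_const))
  have hQout : ∀ i j x, 2 * (ρ + 1) < ‖x‖ → Q i j x = if i = j then H.ν₀ / 2 else 0 := by
    intro i j x hx; simp only [hQd]; rw [hχ0 x hx, zero_mul, add_zero]
  have hQsym : ∀ i j x, Q i j x = Q j i x := by
    intro i j x; simp only [hQd, hsym i j, eq_comm (a := i)]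
  have hQell : ∀ x (ξ : Fin N → ℝ), H.ν₀ / 2 * ∑ i, ξ i ^ 2 ≤ ∑ i, ∑ j, Q i j x * (ξ i * ξ j) := by
    intro x ξ
    have e1 : ∑ i, ∑ j, (if i = j then H.ν₀ / 2 else 0) * (ξ i * ξ j) =
        H.ν₀ / 2 * ∑ i, ξ i ^ 2 := by
      simp only [ite_mul, zero_mul, Finset.sum_ite_eq, Finset.mem_univ, if_true, Finset.mul_sum]
      exact Finset.sum_congr rfl fun i _ => by ring
    have e2 : ∑ i, ∑ j, Q i j x * (ξ i * ξ j) = (1 - χ x) * (H.ν₀ / 2 * ∑ i, ξ i ^ 2) +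
        χ x * ∑ i, ∑ j, qt i j x * (ξ i * ξ j) := by
      rw [← e1, Finset.mul_sum, Finset.mul_sum, ← Finset.sum_add_distrib]
      refine Finset.sum_congr rfl fun i _ => ?_
      rw [Finset.mul_sum, Finset.mul_sum, ← Finset.sum_add_distrib]
      refine Finset.sum_congr rfl fun j _ => ?_
      simp only [hQd]; ring
    rw [e2]
    by_cases hx : 2 * (ρ + 1) < ‖x‖
    · rw [hχ0 x hx]; simp
    · have hxb : x ∈ ball (0 : ES N) (2 * (ρ + 1) + 1) := by
        rw [mem_ball_zero_iff]; linarith [not_lt.1 hx]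
      have hp := (abs_le.1 (quad_pert (a := fun i j => qt i j x) (b := fun i j => q t x i j)
        (fun i j => (((hq i j).2 x hxb).mono (min_le_right _ _)).h0) ξ)).1
      have hel := H.ellip t ht x (WithLp.toLp 2 ξ)
      have hsq : ‖(WithLp.toLp 2 ξ : ES N)‖ ^ 2 = ∑ i, ξ i ^ 2 := by
        rw [EuclideanSpace.norm_sq_eq]; simp
      rw [hsq] at hel
      simp only [mul_assoc] at hel
      have hs : 0 ≤ ∑ i, ξ i ^ 2 := Finset.sum_nonneg fun i _ => sq_nonneg _
      have h1 : H.ν₀ * ∑ i, ξ i ^ 2 ≤ H.ν t x * ∑ i, ξ i ^ 2 := by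
        gcongr; exact H.ν_lb t ht x
      simp only [Fintype.card_fin] at hp
      have h2 : η₁ * N * ∑ i, ξ i ^ 2 ≤ H.ν₀ / 2 * ∑ i, ξ i ^ 2 := by gcongr
      have h3 : H.ν₀ / 2 * ∑ i, ξ i ^ 2 ≤ ∑ i, ∑ j, qt i j x * (ξ i * ξ j) := by linarith
      have := mul_le_mul_of_nonneg_left h3 (zt_ct_mem (ρ + 1) x).1
      simp only [hχ]; linarith
  obtain ⟨σ, hσs, hσQ, hσc⟩ := cholesky N Q (H.ν₀ / 2) (by positivity) hQs hQsym hQell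
  have hσB : ∀ k i, BBu (σ k i) := by
    intro k i
    by_cases hy : ∃ y : ES N, 2 * (ρ + 1) < ‖y‖
    · obtain ⟨y, hy⟩ := hy
      refine BBu.of_const_outside (hσs k i) (R := 2 * (ρ + 1)) (a := σ k i y) fun x hx => ?_
      exact hσc x y (fun i j => by rw [hQout i j x hx, hQout i j y hy]) k i
    · exact BBu.of_const_outside (hσs k i) (R := 2 * (ρ + 1)) (a := 0) fun x hx =>
        (hy ⟨x, hx⟩).elim
  let S : Scheme N :=
    { Q := Q
      B := fun j x => χ x * bt j x
      c := fun x => χ x * ctl x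
      V := fun k i x => √(2 * N) * σ k i x
      hQB := fun i j => BBu.of_const_outside (hQs i j) (hQout i j)
      hV := fun k i => (hσB k i).smul _
      hB := fun j => BBu.of_const_outside (hχs.mul (hb j).1) (a := 0) fun x hx => by
        rw [hχ0 x hx, zero_mul]
      hc := BBu.of_const_outside (hχs.mul hc.1) (a := 0) fun x hx => by
        rw [hχ0 x hx, zero_mul]
      hQ := fun i j x => by
        rw [← hσQ, Finset.mul_sum]
        refine Finset.sum_congr rfl fun k _ => ?_
        have := Real.mul_self_sqrt (show (0 : ℝ) ≤ 2 * N by positivity)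
        linear_combination (σ k i x * σ k j x) * this }
  refine ⟨S, fun x => ?_, fun x hx => ?_⟩
  · change χ x * ctl x ≤ _
    by_cases hx : 2 * (ρ + 1) < ‖x‖
    · rw [hχ0 x hx, zero_mul]; positivity
    · have hxb : x ∈ ball (0 : ES N) (2 * (ρ + 1) + 1) := by
        rw [mem_ball_zero_iff]; linarith [not_lt.1 hx]
      have h1 := (abs_le.1 (((hc.2 x hxb).mono (min_le_right _ _)).h0)).2
      have h2 := H.c_ub t ht x
      have h3 := le_abs_self H.c₀
      have h4 : ctl x ≤ |H.c₀| + 1 := by simp only [hctl]; linarith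
      obtain ⟨h5, h6⟩ := zt_ct_mem (ρ + 1) x
      have : χ x * ctl x ≤ χ x * (|H.c₀| + 1) := mul_le_mul_of_nonneg_left h4 h5
      have : χ x * (|H.c₀| + 1) ≤ 1 * (|H.c₀| + 1) := by gcongr
      linarith
  · have hxb : x ∈ ball (0 : ES N) (ρ + 1) := by rw [mem_ball_zero_iff]; linarith
    have hxb' : x ∈ ball (0 : ES N) (2 * (ρ + 1) + 1) := by rw [mem_ball_zero_iff]; linarith
    have cQ : ∀ i j, Cl3 e x (S.Q i j) fun y => q t y i j := fun i j =>
      Cl3.congr_open isOpen_ball (F' := qt i j) (fun y hy => by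
        change Q i j y = _; simp only [hQd]; rw [hχ1 y hy]; ring) hxb ((hq i j).2 x hxb')
    have cB : ∀ j, Cl3 e x (S.B j) fun y => b t y j := fun j =>
      Cl3.congr_open isOpen_ball (F' := bt j) (fun y hy => by
        change χ y * bt j y = _; rw [hχ1 y hy, one_mul]) hxb ((hb j).2 x hxb')
    have cc : Cl3 e x S.c (c t) :=
      Cl3.congr_open isOpen_ball (F' := ctl) (fun y hy => by
        change χ y * ctl y = _; rw [hχ1 y hy, one_mul]) hxb (hc.2 x hxb')
    refine ⟨hloc t ht x _ _ _ (fun i j => (cQ i j).mono (min_le_right _ _))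
      (fun j => (cB j).mono (min_le_right _ _)) (cc.mono (min_le_right _ _)), fun i j => ?_,
      fun j => ?_, ?_⟩
    · exact ((cQ i j).mono (min_le_left _ _)).h0
    · exact ((cB j).mono (min_le_left _ _)).h0
    · exact (cc.mono (min_le_left _ _)).h0

end scheme_exists

/-! ### Consistency of the one-step operator on functions of class `C²` -/

section taylor
variable {N : ℕ}

lemma taylor_two {w : ES N → ℝ} (hw : ContDiff ℝ 2 w) {x z : ES N} {ω : ℝ}
    (h : ∀ y, ‖y - x‖ ≤ ‖z‖ → ∀ i j,
      |dd (bs i) (dd (bs j) w) y - dd (bs i) (dd (bs j) w) x| ≤ ω) :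
    |w (x + z) - (w x + ∑ i, z i * dd (bs i) w x
      + 1 / 2 * ∑ i, ∑ j, z i * z j * dd (bs i) (dd (bs j) w) x)| ≤ ω * (∑ i, |z i|) ^ 2 := by
  have hline : ∀ {g : ES N → ℝ}, Differentiable ℝ g → ∀ s : ℝ,
      HasDerivAt (fun s : ℝ => g (x + s • z)) (∑ i, z i * dd (bs i) g (x + s • z)) s := by
    intro g hg s
    have h1 : HasDerivAt (fun s : ℝ => x + s • z) z s := by
      simpa using ((hasDerivAt_id s).smul_const z).const_add x
    have := (hg (x + s • z)).hasFDerivAt.comp_hasDerivAt s h1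
    rwa [fderiv_eq_sum] at this
  have hd1 : ∀ j, Differentiable ℝ (dd (bs j) w) := fun j =>
    (contDiff_dd (k := 1) hw _).differentiable (by simp)
  have hωz : ∀ s ∈ Icc (0 : ℝ) 1, ∀ i j, |dd (bs i) (dd (bs j) w) (x + s • z)
      - dd (bs i) (dd (bs j) w) x| ≤ ω := fun s hs => h _ (by
    rw [add_sub_cancel_left, norm_smul, Real.norm_of_nonneg hs.1]
    nlinarith [hs.2, norm_nonneg z])
  set M := ω * (∑ i, |z i|) ^ 2 with hM
  set p : ℝ := ∑ i, z i * dd (bs i) w x with hp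
  set P : ℝ := ∑ i, ∑ j, z i * z j * dd (bs i) (dd (bs j) w) x with hP
  have hg1 : ∀ s : ℝ, HasDerivAt (fun s : ℝ => (∑ j, z j * dd (bs j) w (x + s • z)) - p - s * P)
      ((∑ j, z j * ∑ i, z i * dd (bs i) (dd (bs j) w) (x + s • z)) - P) s := by
    intro s
    have := (HasDerivAt.fun_sum fun j (_ : j ∈ Finset.univ) =>
      (hline (hd1 j) s).const_mul (z j)).sub_const p |>.fun_sub ((hasDerivAt_id s).mul_const P)
    simpa using this
  have hg0 : ∀ s : ℝ, HasDerivAt (fun s : ℝ => w (x + s • z) - s * p - 1 / 2 * s ^ 2 * P)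
      ((∑ j, z j * dd (bs j) w (x + s • z)) - p - s * P) s := by
    intro s
    have h1 := ((hline (hw.differentiable (by simp)) s).fun_sub ((hasDerivAt_id s).mul_const p)).fun_sub
      (((hasDerivAt_pow 2 s).const_mul (1 / 2)).mul_const P)
    refine h1.congr_deriv ?_
    push_cast; ring
  have b1 : ∀ s ∈ Icc (0 : ℝ) 1, ‖(∑ j, z j * ∑ i, z i * dd (bs i) (dd (bs j) w) (x + s • z)) - P‖
      ≤ M := by
    intro s hs
    have e : (∑ j, z j * ∑ i, z i * dd (bs i) (dd (bs j) w) (x + s • z)) - P =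
        ∑ j, ∑ i, z j * z i * (dd (bs i) (dd (bs j) w) (x + s • z)
          - dd (bs i) (dd (bs j) w) x) := by
      rw [hP, Finset.sum_comm, ← Finset.sum_sub_distrib]
      refine Finset.sum_congr rfl fun j _ => ?_
      rw [Finset.mul_sum, ← Finset.sum_sub_distrib]
      exact Finset.sum_congr rfl fun i _ => by ring
    rw [e, Real.norm_eq_abs]
    calc _ ≤ ∑ j, ∑ i, |z j * z i * (dd (bs i) (dd (bs j) w) (x + s • z)
          - dd (bs i) (dd (bs j) w) x)| := (Finset.abs_sum_le_sum_abs _ _).trans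
          (Finset.sum_le_sum fun i _ => Finset.abs_sum_le_sum_abs _ _)
      _ ≤ ∑ j, ∑ i, |z j| * |z i| * ω := by
          refine Finset.sum_le_sum fun j _ => Finset.sum_le_sum fun i _ => ?_
          rw [abs_mul, abs_mul]
          exact mul_le_mul_of_nonneg_left (hωz s hs i j) (by positivity)
      _ = M := by
          rw [hM, sq, Finset.sum_mul_sum, Finset.mul_sum]
          refine Finset.sum_congr rfl fun j _ => ?_
          rw [Finset.mul_sum]
          exact Finset.sum_congr rfl fun i _ => by ring
  have hM0 : 0 ≤ M := (norm_nonneg _).trans (b1 0 (by simp))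
  have b0 : ∀ s ∈ Icc (0 : ℝ) 1, ‖(∑ j, z j * dd (bs j) w (x + s • z)) - p - s * P‖ ≤ M := by
    intro s hs
    have := norm_image_sub_le_of_norm_deriv_le_segment' (f := fun s : ℝ =>
      (∑ j, z j * dd (bs j) w (x + s • z)) - p - s * P) (a := 0) (b := 1)
      (fun s _ => (hg1 s).hasDerivWithinAt) (fun s hs => b1 s ⟨hs.1, hs.2.le⟩) s hs
    have e0 : (∑ j, z j * dd (bs j) w (x + (0 : ℝ) • z)) - p - 0 * P = 0 := by simp [hp]
    rw [e0, sub_zero, sub_zero] at this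
    exact this.trans (by nlinarith [hs.2])
  have := norm_image_sub_le_of_norm_deriv_le_segment' (f := fun s : ℝ =>
      w (x + s • z) - s * p - 1 / 2 * s ^ 2 * P) (a := 0) (b := 1)
      (fun s _ => (hg0 s).hasDerivWithinAt) (fun s hs => b0 s ⟨hs.1, hs.2.le⟩) 1 (by simp)
  simp only [one_smul, zero_smul, add_zero, sub_zero, mul_one, Real.norm_eq_abs] at this
  convert this using 2
  ring

lemma op_taylor (hN : 1 ≤ N) (S : Scheme N) {w : ES N → ℝ} (hw : ContDiff ℝ 2 w) {x : ES N}
    {G D ω γ : ℝ} (hγ : 0 ≤ γ) (hγ1 : γ ≤ 1) (hV : ∀ k i, |S.V k i x| ≤ G)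
    (hB : ∀ j, |S.B j x| ≤ G) (hc : |S.c x| ≤ G) (hp : ∀ i, |dd (bs i) w x| ≤ D)
    (hP : ∀ i j, |dd (bs i) (dd (bs j) w) x| ≤ D)
    (h : ∀ y, ‖y - x‖ ≤ γ * (2 * N * G) → ∀ i j,
      |dd (bs i) (dd (bs j) w) y - dd (bs i) (dd (bs j) w) x| ≤ ω) :
    |S.op γ w x - w x - γ ^ 2 * Ag S.Q S.B S.c w x| ≤ γ ^ 2 * ((1 + G) * (2 * N * G) ^ 2 * ω
      + γ ^ 2 * (G * (N * G * D + N ^ 2 * G ^ 2 * D) + (1 + G) * (N ^ 2 * G ^ 2 * D))) := by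
  have hNp : (0 : ℝ) < N := by exact_mod_cast hN
  have hG : 0 ≤ G := (abs_nonneg _).trans hc
  have hD : 0 ≤ D := (abs_nonneg _).trans (hp ⟨0, hN⟩)
  have hω : 0 ≤ ω := (abs_nonneg _).trans (h x (by simp; positivity) ⟨0, hN⟩ ⟨0, hN⟩)
  set p := fun i => dd (bs i) w x with hpd
  set P := fun i j => dd (bs i) (dd (bs j) w) x with hPd
  set z : ℝ → Fin N → ES N := fun g k => WithLp.toLp 2 fun i => g * S.V k i x + g ^ 2 * S.B i x
  have hPsi : ∀ g k, Psi (S.V k) S.B (g, x) = x + z g k := by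
    intro g k; ext i; simp [Psi_apply, z]; ring
  set Tz : ℝ → Fin N → ℝ := fun g k => w x + ∑ i, z g k i * p i
      + 1 / 2 * ∑ i, ∑ j, z g k i * z g k j * P i j with hTz
  have hz1 : ∀ g k, |g| = γ → ∑ i, |z g k i| ≤ γ * (2 * N * G) := by
    intro g k hg
    have h1 : ∀ i, |z g k i| ≤ γ * (2 * G) := by
      intro i
      calc |z g k i| ≤ |g * S.V k i x| + |g ^ 2 * S.B i x| := abs_add_le _ _
        _ = γ * |S.V k i x| + γ ^ 2 * |S.B i x| := by
            rw [abs_mul, abs_mul, abs_pow, hg]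
        _ ≤ γ * G + γ ^ 2 * G := by gcongr; exacts [hV k i, hB i]
        _ ≤ γ * (2 * G) := by nlinarith [mul_nonneg hγ hG]
    calc _ ≤ ∑ _i : Fin N, γ * (2 * G) := Finset.sum_le_sum fun i _ => h1 i
      _ = _ := by simp; ring
  have hzn : ∀ g k, |g| = γ → ‖z g k‖ ≤ γ * (2 * N * G) := by
    intro g k hg
    refine le_trans ?_ (hz1 g k hg)
    rw [EuclideanSpace.norm_eq]
    refine Real.sqrt_le_iff.2 ⟨Finset.sum_nonneg fun i _ => abs_nonneg _, ?_⟩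
    simp only [Real.norm_eq_abs]
    exact Finset.sum_sq_le_sq_sum_of_nonneg fun i _ => abs_nonneg _
  have hR : ∀ g k, |g| = γ → |w (x + z g k) - Tz g k| ≤ ω * (γ * (2 * N * G)) ^ 2 := by
    intro g k hg
    refine (taylor_two hw fun y hy => h y (hy.trans (hzn g k hg))).trans ?_
    have : 0 ≤ ∑ i, |z g k i| := Finset.sum_nonneg fun i _ => abs_nonneg _
    gcongr
    exact hz1 g k hg
  set BB : ℝ := ∑ i, ∑ j, S.B i x * S.B j x * P i j
  set bp : ℝ := ∑ j, S.B j x * p j with hbp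
  set QP : ℝ := ∑ i, ∑ j, S.Q i j x * P i j with hQP
  have hT : ∀ k, Tz γ k + Tz (-γ) k = 2 * w x + 2 * γ ^ 2 * bp +
      γ ^ 2 * ∑ i, ∑ j, S.V k i x * S.V k j x * P i j + γ ^ 4 * BB := by
    intro k
    have e1 : ∑ i, z γ k i * p i + ∑ i, z (-γ) k i * p i = 2 * γ ^ 2 * bp := by
      rw [hbp, Finset.mul_sum, ← Finset.sum_add_distrib]
      exact Finset.sum_congr rfl fun i _ => by simp only [z]; ring
    have e2 : 1 / 2 * ∑ i, ∑ j, z γ k i * z γ k j * P i j +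
        1 / 2 * ∑ i, ∑ j, z (-γ) k i * z (-γ) k j * P i j =
        γ ^ 2 * ∑ i, ∑ j, S.V k i x * S.V k j x * P i j + γ ^ 4 * BB := by
      simp only [BB, Finset.mul_sum, ← Finset.sum_add_distrib]
      exact Finset.sum_congr rfl fun i _ => Finset.sum_congr rfl fun j _ => by
        simp only [z]; ring
    simp only [hTz]; linarith
  have hsumT : (2 * N : ℝ)⁻¹ * ∑ k, (Tz γ k + Tz (-γ) k) =
      w x + γ ^ 2 * (bp + QP) + γ ^ 4 / 2 * BB := by
    have e3 : ∑ k, ∑ i, ∑ j, S.V k i x * S.V k j x * P i j = 2 * N * QP := by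
      rw [Finset.sum_comm, hQP, Finset.mul_sum]
      refine Finset.sum_congr rfl fun i _ => ?_
      rw [Finset.sum_comm, Finset.mul_sum]
      refine Finset.sum_congr rfl fun j _ => ?_
      rw [← Finset.sum_mul, S.hQ]; ring
    simp only [hT, Finset.sum_add_distrib, Finset.sum_const, Finset.card_univ, Fintype.card_fin,
      nsmul_eq_mul, ← Finset.mul_sum, e3]
    field_simp
    ring
  set Rb : ℝ := (2 * N : ℝ)⁻¹ * ∑ k, ((w (x + z γ k) - Tz γ k) + (w (x + z (-γ) k) - Tz (-γ) k))
    with hRb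
  have hRbb : |Rb| ≤ ω * (γ * (2 * N * G)) ^ 2 := by
    rw [hRb, abs_mul, abs_of_pos (by positivity : (0 : ℝ) < (2 * N : ℝ)⁻¹),
      inv_mul_le_iff₀ (by positivity)]
    refine (Finset.abs_sum_le_sum_abs _ _).trans ?_
    calc _ ≤ ∑ _k : Fin N, 2 * (ω * (γ * (2 * N * G)) ^ 2) := by
          refine Finset.sum_le_sum fun k _ => (abs_add_le _ _).trans ?_
          have h1 := hR γ k (abs_of_nonneg hγ)
          have h2 := hR (-γ) k (by rw [abs_neg, abs_of_nonneg hγ])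
          linarith
      _ = _ := by simp; ring
  have hop : S.op γ w x = (1 + γ ^ 2 * S.c x) * (w x + γ ^ 2 * (bp + QP) + γ ^ 4 / 2 * BB + Rb) := by
    rw [← hsumT, hRb, ← mul_add, ← Finset.sum_add_distrib, Scheme.op, Kop]
    simp only [Hk, hPsi, neg_sq]
    rw [mul_left_comm]
    congr 1
    rw [Finset.mul_sum]
    exact Finset.sum_congr rfl fun k _ => by ring
  have hAg : Ag S.Q S.B S.c w x = QP + bp + S.c x * w x := rfl
  have e : S.op γ w x - w x - γ ^ 2 * Ag S.Q S.B S.c w x =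
      γ ^ 4 * S.c x * (bp + QP) + (1 + γ ^ 2 * S.c x) * (γ ^ 4 / 2 * BB + Rb) := by
    rw [hop, hAg]; ring
  have hbpb : |bp| ≤ N * G * D := by
    refine (Finset.abs_sum_le_sum_abs _ _).trans ?_
    calc _ ≤ ∑ _k : Fin N, G * D := Finset.sum_le_sum fun k _ => by
          rw [abs_mul]; exact mul_le_mul (hB k) (hp k) (abs_nonneg _) hG
      _ = _ := by simp; ring
  have hQb : ∀ i j, |S.Q i j x| ≤ G ^ 2 := by
    intro i j
    have h1 : |2 * N * S.Q i j x| ≤ N * G ^ 2 := by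
      rw [← S.hQ]
      refine (Finset.abs_sum_le_sum_abs _ _).trans ?_
      calc _ ≤ ∑ _k : Fin N, G * G := Finset.sum_le_sum fun k _ => by
            rw [abs_mul]; exact mul_le_mul (hV k i) (hV k j) (abs_nonneg _) hG
        _ = _ := by simp [sq]
    rw [abs_mul, abs_of_pos (by positivity : (0 : ℝ) < 2 * N)] at h1
    nlinarith [abs_nonneg (S.Q i j x), mul_nonneg hNp.le (abs_nonneg (S.Q i j x))]
  have hdbl : ∀ a : Fin N → Fin N → ℝ, (∀ i j, |a i j| ≤ G ^ 2) →
      |∑ i, ∑ j, a i j * P i j| ≤ N ^ 2 * G ^ 2 * D := by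
    intro a ha
    calc _ ≤ ∑ i, ∑ j, |a i j * P i j| := (Finset.abs_sum_le_sum_abs _ _).trans
          (Finset.sum_le_sum fun i _ => Finset.abs_sum_le_sum_abs _ _)
      _ ≤ ∑ _i : Fin N, ∑ _j : Fin N, G ^ 2 * D := by
          refine Finset.sum_le_sum fun i _ => Finset.sum_le_sum fun j _ => ?_
          rw [abs_mul]; exact mul_le_mul (ha i j) (hP i j) (abs_nonneg _) (by positivity)
      _ = _ := by simp; ring
  have hQPb : |QP| ≤ N ^ 2 * G ^ 2 * D := hdbl _ hQb
  have hBBb : |BB| ≤ N ^ 2 * G ^ 2 * D := hdbl (fun i j => S.B i x * S.B j x) fun i j => by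
    rw [abs_mul, sq]; exact mul_le_mul (hB i) (hB j) (abs_nonneg _) hG
  rw [e]
  have hγ2 : γ ^ 2 ≤ 1 := pow_le_one₀ hγ hγ1
  have hc1 : |1 + γ ^ 2 * S.c x| ≤ 1 + G := by
    refine (abs_add_le _ _).trans ?_
    rw [abs_one, abs_mul, abs_of_nonneg (sq_nonneg γ)]
    nlinarith [abs_nonneg (S.c x)]
  calc _ ≤ |γ ^ 4 * S.c x * (bp + QP)| + |(1 + γ ^ 2 * S.c x) * (γ ^ 4 / 2 * BB + Rb)| :=
        abs_add_le _ _
    _ ≤ γ ^ 4 * G * (N * G * D + N ^ 2 * G ^ 2 * D) + (1 + G) *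
        (γ ^ 4 * (N ^ 2 * G ^ 2 * D) + ω * (γ * (2 * N * G)) ^ 2) := by
        have hγ4 : 0 ≤ γ ^ 4 := by positivity
        rw [abs_mul, abs_mul, abs_mul, abs_of_nonneg hγ4]
        have h1 : |bp + QP| ≤ N * G * D + N ^ 2 * G ^ 2 * D := (abs_add_le _ _).trans (by gcongr)
        have h2 : |γ ^ 4 / 2 * BB + Rb| ≤
            γ ^ 4 * (N ^ 2 * G ^ 2 * D) + ω * (γ * (2 * N * G)) ^ 2 := by
          refine (abs_add_le _ _).trans (add_le_add ?_ hRbb)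
          rw [abs_mul, abs_of_nonneg (by positivity : 0 ≤ γ ^ 4 / 2)]
          refine mul_le_mul (by linarith) hBBb (abs_nonneg _) hγ4
        gcongr
    _ = _ := by ring

end taylor

/-! ### Comparison of chains with approximate solutions -/

section compare
variable {N : ℕ}

lemma Scheme.op_add (S : Scheme N) (γ : ℝ) (f g : ES N → ℝ) :
    S.op γ (fun x => f x + g x) = fun x => S.op γ f x + S.op γ g x := by
  funext x
  simp only [Scheme.op, Kop, Hk]
  rw [← mul_add, ← Finset.sum_add_distrib]
  congr 1
  exact Finset.sum_congr rfl fun k _ => by ring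

lemma chain_add {ι : Type} (S : ι → Scheme N) (κ : ℕ → ι) (γ : ℝ) (f g : ES N → ℝ) (m : ℕ) :
    chain S κ γ (fun x => f x + g x) m = fun x => chain S κ γ f m x + chain S κ γ g m x := by
  induction m with
  | zero => rfl
  | succ m ih => simp only [chain]; rw [ih, Scheme.op_add]

lemma Scheme.abs_op_sub_le (S : Scheme N) {γ : ℝ} (hpos : ∀ x, 0 ≤ 1 + γ ^ 2 * S.c x)
    {f g Φ : ES N → ℝ} {C : ℝ} (h : ∀ x, |f x - g x| ≤ C * Φ x) (x : ES N) :
    |S.op γ f x - S.op γ g x| ≤ C * S.op γ Φ x := by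
  have hn : (0:ℝ) ≤ (2 * N : ℝ)⁻¹ := by positivity
  have h1 : ∀ y, |(1 + γ ^ 2 * S.c x) * f y - (1 + γ ^ 2 * S.c x) * g y|
      ≤ C * ((1 + γ ^ 2 * S.c x) * Φ y) := fun y => by
    rw [← mul_sub, abs_mul, abs_of_nonneg (hpos x)]
    exact (mul_le_mul_of_nonneg_left (h y) (hpos x)).trans (le_of_eq (by ring))
  simp only [Scheme.op, Kop, Hk]
  rw [← mul_sub, ← Finset.sum_sub_distrib, abs_mul, abs_of_nonneg hn, mul_left_comm,
    Finset.mul_sum]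
  refine mul_le_mul_of_nonneg_left ((Finset.abs_sum_le_sum_abs _ _).trans
    (Finset.sum_le_sum fun k _ => ?_)) hn
  simp only [neg_sq]
  rw [add_sub_add_comm, mul_add]
  exact (abs_add_le _ _).trans (add_le_add (h1 _) (h1 _))

/-- Discrete comparison with a Lyapunov function `Φ`. -/
lemma chain_compare {ι : Type} (S : ι → Scheme N) (κ : ℕ → ι) {γ κ₀ Λ ρ : ℝ} (u₀ : ES N → ℝ)
    (v : ℕ → ES N → ℝ) {Φ : ES N → ℝ} (hΦ : ∀ x, 1 ≤ Φ x) (hκ₀ : 0 ≤ κ₀) (hΛ : 0 ≤ Λ) {n : ℕ}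
    (hpos : ∀ a x, 0 ≤ 1 + γ ^ 2 * (S a).c x)
    (hout : ∀ k ≤ n, ∀ x, ρ < ‖x‖ → |chain S κ γ u₀ k x - v k x| ≤ κ₀ * Φ x)
    (hbase : ∀ x, ‖x‖ ≤ ρ → |u₀ x - v 0 x| ≤ κ₀ * Φ x)
    (hstep : ∀ k < n, ∀ x, ‖x‖ ≤ ρ → |(S (κ k)).op γ (v k) x - v (k + 1) x| ≤ γ ^ 2 * κ₀)
    (hop : ∀ k < n, ∀ x, ‖x‖ ≤ ρ → (S (κ k)).op γ Φ x ≤ (1 + γ ^ 2 * Λ) * Φ x) :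
    ∀ k ≤ n, ∀ x, |chain S κ γ u₀ k x - v k x| ≤ κ₀ * (1 + (Λ + 1) * γ ^ 2) ^ k * Φ x := by
  have ha : 1 ≤ 1 + (Λ + 1) * γ ^ 2 := by nlinarith [sq_nonneg γ, mul_nonneg hΛ (sq_nonneg γ)]
  have ho : ∀ k ≤ n, ∀ x, ρ < ‖x‖ →
      |chain S κ γ u₀ k x - v k x| ≤ κ₀ * (1 + (Λ + 1) * γ ^ 2) ^ k * Φ x := fun k hk x hx => by
    refine (hout k hk x hx).trans (mul_le_mul_of_nonneg_right ?_ (by linarith [hΦ x]))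
    exact le_mul_of_one_le_right hκ₀ (one_le_pow₀ ha)
  intro k
  induction k with
  | zero =>
    intro hk x
    rcases le_or_gt ‖x‖ ρ with hx | hx
    · simpa [chain] using hbase x hx
    · exact ho 0 hk x hx
  | succ k ih =>
    intro hk x
    rcases le_or_gt ‖x‖ ρ with hx | hx
    · set a := (1 + (Λ + 1) * γ ^ 2) ^ k with ha'
      have ha1 : 1 ≤ a := one_le_pow₀ ha
      have hκa : κ₀ ≤ κ₀ * a := le_mul_of_one_le_right hκ₀ ha1
      have h1 := (S (κ k)).abs_op_sub_le (hpos (κ k)) (ih (by omega)) x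
      have h2 := mul_le_mul_of_nonneg_left (hop k hk x hx) (hκ₀.trans hκa)
      have h3 := hstep k hk x hx
      have h4 : γ ^ 2 * κ₀ ≤ γ ^ 2 * (κ₀ * a * Φ x) :=
        mul_le_mul_of_nonneg_left (hκa.trans
          (le_mul_of_one_le_right (hκ₀.trans hκa) (hΦ x))) (sq_nonneg γ)
      have h5 : chain S κ γ u₀ (k + 1) x = (S (κ k)).op γ (chain S κ γ u₀ k) x := rfl
      rw [h5, pow_succ, ← ha']
      have h6 := abs_sub_le ((S (κ k)).op γ (chain S κ γ u₀ k) x) ((S (κ k)).op γ (v k) x)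
        (v (k + 1) x)
      refine (h6.trans (add_le_add (h1.trans h2) (h3.trans h4))).trans (le_of_eq ?_)
      ring
    · exact ho _ hk x hx

end compare

/-! ### Uniform consistency and families of schemes -/

section family
variable {N : ℕ}

lemma Scheme.exists_bound {ι : Type} [Fintype ι] (S : ι → Scheme N) :
    ∃ G, 0 ≤ G ∧ ∀ a x, (∀ k i, |(S a).V k i x| ≤ G) ∧ (∀ i, |(S a).B i x| ≤ G) ∧
      |(S a).c x| ≤ G := by
  choose g1 h10 h1 using fun (a : ι) (k i : Fin N) => ((S a).hV k i).2 0
  choose g2 h20 h2 using fun (a : ι) (i : Fin N) => ((S a).hB i).2 0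
  choose g3 h30 h3 using fun (a : ι) => (S a).hc.2 0
  have e1 : 0 ≤ ∑ a, ∑ k, ∑ i, g1 a k i :=
    Finset.sum_nonneg fun a _ => Finset.sum_nonneg fun k _ => Finset.sum_nonneg fun i _ => h10 a k i
  have e2 : 0 ≤ ∑ a, ∑ i, g2 a i :=
    Finset.sum_nonneg fun a _ => Finset.sum_nonneg fun i _ => h20 a i
  have e3 : 0 ≤ ∑ a, g3 a := Finset.sum_nonneg fun a _ => h30 a
  refine ⟨(∑ a, ∑ k, ∑ i, g1 a k i) + (∑ a, ∑ i, g2 a i) + ∑ a, g3 a, by positivity,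
    fun a x => ⟨fun k i => ?_, fun i => ?_, ?_⟩⟩
  · have t1 := (h1 a k i).bound x (mem_univ x)
    have t2 := Finset.single_le_sum (f := fun i => g1 a k i) (fun i _ => h10 a k i)
      (Finset.mem_univ i)
    have t3 := Finset.single_le_sum (f := fun k => ∑ i, g1 a k i)
      (fun k _ => Finset.sum_nonneg fun i _ => h10 a k i) (Finset.mem_univ k)
    have t4 := Finset.single_le_sum (f := fun a => ∑ k, ∑ i, g1 a k i)
      (fun a _ => Finset.sum_nonneg fun k _ => Finset.sum_nonneg fun i _ => h10 a k i)
      (Finset.mem_univ a)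
    linarith
  · have t1 := (h2 a i).bound x (mem_univ x)
    have t2 := Finset.single_le_sum (f := fun i => g2 a i) (fun i _ => h20 a i)
      (Finset.mem_univ i)
    have t3 := Finset.single_le_sum (f := fun a => ∑ i, g2 a i)
      (fun a _ => Finset.sum_nonneg fun i _ => h20 a i) (Finset.mem_univ a)
    linarith
  · have t1 := (h3 a).bound x (mem_univ x)
    have t2 := Finset.single_le_sum (f := fun a => g3 a) (fun a _ => h30 a) (Finset.mem_univ a)
    linarith

/-- Consistency of the one-step operators, uniformly on compact sets. -/
lemma op_unif (hN : 1 ≤ N) {ι : Type} [Fintype ι] (S : ι → Scheme N) {F : ℝ → ES N → ℝ}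
    {a b ρ : ℝ} (hF : ∀ τ ∈ Icc a b, ContDiff ℝ 2 (F τ))
    (h1 : ∀ i, ContinuousOn (fun p : ℝ × ES N => dd (bs i) (F p.1) p.2) (Icc a b ×ˢ univ))
    (h2 : ∀ i j, ContinuousOn (fun p : ℝ × ES N => dd (bs i) (dd (bs j) (F p.1)) p.2)
      (Icc a b ×ˢ univ)) {κ : ℝ} (hκ : 0 < κ) :
    ∃ γ₁, 0 < γ₁ ∧ ∀ γ, 0 < γ → γ ≤ γ₁ → ∀ τ ∈ Icc a b, ∀ x, ‖x‖ ≤ ρ → ∀ e,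
      |(S e).op γ (F τ) x - F τ x - γ ^ 2 * Ag (S e).Q (S e).B (S e).c (F τ) x| ≤ γ ^ 2 * κ := by
  obtain ⟨G, hG0, hG⟩ := Scheme.exists_bound S
  set Kc : Set (ℝ × ES N) := Icc a b ×ˢ closedBall 0 (ρ + 1) with hKc
  have hcomp : IsCompact Kc := isCompact_Icc.prod (isCompact_closedBall _ _)
  have hsub : Kc ⊆ Icc a b ×ˢ univ := prod_mono le_rfl (subset_univ _)
  have c1 : ContinuousOn (fun p : ℝ × ES N => fun i => dd (bs i) (F p.1) p.2) Kc :=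
    (continuousOn_pi.2 h1).mono hsub
  have c2 : ContinuousOn (fun p : ℝ × ES N => fun i j => dd (bs i) (dd (bs j) (F p.1)) p.2) Kc :=
    (continuousOn_pi.2 fun i => continuousOn_pi.2 (h2 i)).mono hsub
  obtain ⟨D1, hD1⟩ := hcomp.exists_bound_of_continuousOn c1
  obtain ⟨D2, hD2⟩ := hcomp.exists_bound_of_continuousOn c2
  set D := |D1| + |D2| with hD
  have hD0 : 0 ≤ D := by positivity
  set ω := κ / (2 * ((1 + G) * (2 * N * G) ^ 2 + 1)) with hω
  have hω0 : 0 < ω := by positivity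
  obtain ⟨δ, hδ, hmod⟩ := Metric.uniformContinuousOn_iff.1
    (hcomp.uniformContinuousOn_of_continuous c2) ω hω0
  set P := G * (N * G * D + N ^ 2 * G ^ 2 * D) + (1 + G) * (N ^ 2 * G ^ 2 * D) with hP
  have hP0 : 0 ≤ P := by positivity
  refine ⟨min 1 (min (min (δ / 2) 1 / (2 * N * G + 1)) (κ / (2 * (P + 1)))), by positivity,
    fun γ hγ hγ1 τ hτ x hx e => ?_⟩
  have g1 : γ ≤ 1 := hγ1.trans (min_le_left _ _)
  have g2 : γ ≤ min (δ / 2) 1 / (2 * N * G + 1) :=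
    hγ1.trans ((min_le_right _ _).trans (min_le_left _ _))
  have g3 : γ ≤ κ / (2 * (P + 1)) := hγ1.trans ((min_le_right _ _).trans (min_le_right _ _))
  rw [le_div_iff₀ (by positivity)] at g2 g3
  have g4 : γ * (2 * N * G) ≤ min (δ / 2) 1 := by nlinarith
  have hmem : ∀ y : ES N, ‖y - x‖ ≤ γ * (2 * N * G) → (τ, y) ∈ Kc := fun y hy => by
    refine ⟨hτ, ?_⟩
    rw [mem_closedBall_zero_iff]
    have := norm_add_le (y - x) x
    rw [sub_add_cancel] at this
    linarith [g4.trans (min_le_right _ _)]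
  have hxm : (τ, x) ∈ Kc := hmem x (by rw [sub_self, norm_zero]; positivity)
  have hV := (hG e x).1
  refine (op_taylor hN (S e) (hF τ hτ) (D := D) (ω := ω) hγ.le g1 hV (hG e x).2.1 (hG e x).2.2
    (fun i => ?_) (fun i j => ?_) (fun y hy i j => ?_)).trans ?_
  · exact (norm_le_pi_norm (fun i => dd (bs i) (F τ) x) i).trans
      ((hD1 _ hxm).trans ((le_abs_self _).trans (by rw [hD]; linarith [abs_nonneg D2])))
  · exact (norm_le_pi_norm (fun j => dd (bs i) (dd (bs j) (F τ)) x) j).trans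
      ((norm_le_pi_norm (fun i j => dd (bs i) (dd (bs j) (F τ)) x) i).trans
      ((hD2 _ hxm).trans ((le_abs_self _).trans (by rw [hD]; linarith [abs_nonneg D1]))))
  · have hd : dist (τ, y) (τ, x) < δ := by
      rw [Prod.dist_eq, dist_self, dist_eq_norm, max_lt_iff]
      exact ⟨hδ, by linarith [g4.trans (min_le_left _ _)]⟩
    have := hmod _ (hmem y hy) _ hxm hd
    exact ((dist_le_pi_dist (fun j => dd (bs i) (dd (bs j) (F τ)) y)
      (fun j => dd (bs i) (dd (bs j) (F τ)) x) j).trans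
      (dist_le_pi_dist (fun i j => dd (bs i) (dd (bs j) (F τ)) y)
      (fun i j => dd (bs i) (dd (bs j) (F τ)) x) i)).trans this.le
  · refine mul_le_mul_of_nonneg_left ?_ (sq_nonneg γ)
    have e1 : (1 + G) * (2 * N * G) ^ 2 * ω ≤ κ / 2 := by
      have : ((1 + G) * (2 * N * G) ^ 2 + 1) * ω = κ / 2 := by
        rw [hω]; field_simp
      nlinarith
    have e2 : γ ^ 2 * P ≤ κ / 2 := by
      have : γ ^ 2 ≤ γ := by nlinarith
      nlinarith
    linarith

lemma Ag_sub_Aop_le {q : ℝ → ES N → Fin N → Fin N → ℝ} {b : ℝ → ES N → Fin N → ℝ}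
    {c : ℝ → ES N → ℝ} (S : Scheme N) {t η D : ℝ} {x : ES N} {w : ES N → ℝ}
    (hη : 0 ≤ η) (hQ : ∀ i j, |S.Q i j x - q t x i j| ≤ η) (hB : ∀ j, |S.B j x - b t x j| ≤ η)
    (hc : |S.c x - c t x| ≤ η) (h0 : |w x| ≤ D) (h1 : ∀ i, |dd (bs i) w x| ≤ D)
    (h2 : ∀ i j, |dd (bs i) (dd (bs j) w) x| ≤ D) :
    |Ag S.Q S.B S.c w x - Aop q b c w t x| ≤ (N ^ 2 + N + 1) * (η * D) := by
  have e : Ag S.Q S.B S.c w x - Aop q b c w t x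
      = (∑ i, ∑ j, (S.Q i j x - q t x i j) * dd (bs i) (dd (bs j) w) x)
        + (∑ j, (S.B j x - b t x j) * dd (bs j) w x) + (S.c x - c t x) * w x := by
    simp only [Ag, Aop, sub_mul, Finset.sum_sub_distrib]
    simp only [pd2, pd1_eq_dd]
    ring
  have m : ∀ {p r : ℝ}, |p| ≤ η → |r| ≤ D → |p * r| ≤ η * D := fun hp hr => by
    rw [abs_mul]; exact mul_le_mul hp hr (abs_nonneg _) hη
  rw [e]
  refine (abs_add_le _ _).trans ((add_le_add (abs_add_le _ _) le_rfl).trans ?_)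
  have s1 : |∑ i, ∑ j, (S.Q i j x - q t x i j) * dd (bs i) (dd (bs j) w) x|
      ≤ ∑ _i : Fin N, ∑ _j : Fin N, η * D :=
    (Finset.abs_sum_le_sum_abs _ _).trans (Finset.sum_le_sum fun i _ =>
      (Finset.abs_sum_le_sum_abs _ _).trans (Finset.sum_le_sum fun j _ => m (hQ i j) (h2 i j)))
  have s2 : |∑ j, (S.B j x - b t x j) * dd (bs j) w x| ≤ ∑ _j : Fin N, η * D :=
    (Finset.abs_sum_le_sum_abs _ _).trans (Finset.sum_le_sum fun j _ => m (hB j) (h1 j))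
  have s3 := m hc h0
  simp at s1 s2
  nlinarith

lemma ParabolicHolderOn.eventually {T δ R : ℝ} {h : ℝ → ES N → ℝ} (hδ : 0 < δ)
    (hh : ParabolicHolderOn T δ R h) {η : ℝ} (hη : 0 < η) :
    ∀ᶠ z in 𝓝[>] (0:ℝ), ∀ t ∈ Icc (0:ℝ) T, ∀ s ∈ Icc (0:ℝ) T, |t - s| ≤ z →
      ∀ x ∈ closedBall (0 : ES N) R, |h t x - h s x| ≤ η := by
  obtain ⟨C, hC⟩ := hh
  have ht : Tendsto (fun z : ℝ => |C| * z ^ (δ / 2)) (𝓝[>] 0) (𝓝 0) := by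
    have : Tendsto (fun z : ℝ => |C| * z ^ (δ / 2)) (𝓝 0) (𝓝 (|C| * 0 ^ (δ / 2))) :=
      ((Real.continuousAt_rpow_const _ _ (Or.inr (by positivity))).tendsto).const_mul _
    rw [Real.zero_rpow (by positivity), mul_zero] at this
    exact this.mono_left nhdsWithin_le_nhds
  filter_upwards [ht.eventually (gt_mem_nhds hη), self_mem_nhdsWithin] with z hz hz0 t hts s hs
    hd x hx
  refine (hC t hts s hs x hx x hx).trans ?_
  rw [sub_self, norm_zero, zero_pow two_ne_zero, add_zero]
  refine (mul_le_mul_of_nonneg_right (le_abs_self C) (by positivity)).trans (le_trans ?_ hz.le)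
  gcongr

/-- Finite families of schemes approximating the nonautonomous operator. -/
lemma Hyp.family {T : ℝ} {q : ℝ → ES N → Fin N → Fin N → ℝ} {b : ℝ → ES N → Fin N → ℝ}
    {c : ℝ → ES N → ℝ} (H : Hyp N T q b c) : ∃ K L₃ : ℝ, ∀ ρ > 0, ∀ η > 0,
      ∃ (ι : Type) (_ : Fintype ι) (S : ι → Scheme N) (cell : ℝ → ι),
        (∀ a x, (S a).c x ≤ |H.c₀| + 1) ∧
        (∀ a x, ‖x‖ ≤ ρ → ∃ ν d r ϱ, Loc (S a).Q (S a).B (S a).c (H.ν₀ / 2) K H.L₁ (H.L₂ / 2) L₃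
          ν d r ϱ x) ∧
        ∀ t ∈ Icc 0 T, ∀ x, ‖x‖ ≤ ρ → (∀ i j, |(S (cell t)).Q i j x - q t x i j| ≤ η) ∧
          (∀ j, |(S (cell t)).B j x - b t x j| ≤ η) ∧ |(S (cell t)).c x - c t x| ≤ η := by
  obtain ⟨K, L₃, hS⟩ := H.scheme
  refine ⟨K, L₃, fun ρ hρ η hη => ?_⟩
  have hη2 : 0 < η / 2 := by positivity
  have q1 := Filter.eventually_all.2 fun i => Filter.eventually_all.2 fun j =>
    (H.holder_q ρ hρ i j).eventually H.δ_mem.1 hη2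
  have b1 := Filter.eventually_all.2 fun j => (H.holder_b ρ hρ j).eventually H.δ_mem.1 hη2
  have c1 := (H.holder_c ρ hρ).eventually H.δ_mem.1 hη2
  obtain ⟨z, ⟨⟨⟨hzq, hzb⟩, hzc⟩, hz⟩⟩ :=
    (((q1.and b1).and c1).and (self_mem_nhdsWithin (a := (0:ℝ)) (s := Ioi 0))).exists
  obtain ⟨F, hFsub, hFfin, hF⟩ :=
    (isCompact_Icc (a := (0:ℝ)) (b := T)).finite_cover_balls (e := z) hz
  choose S hSc hSl using fun t : Icc (0:ℝ) T => hS ρ hρ (η / 2) hη2 t t.2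
  have : Fintype F := hFfin.fintype
  have hT : (0:ℝ) ∈ Icc (0:ℝ) T := ⟨le_rfl, H.T_pos.le⟩
  have hcell : ∀ t : ℝ, ∃ a : F, t ∈ Icc (0:ℝ) T → |t - a| ≤ z := fun t => by
    by_cases ht : t ∈ Icc (0:ℝ) T
    · obtain ⟨a, ha, hta⟩ := mem_iUnion₂.1 (hF ht)
      exact ⟨⟨a, ha⟩, fun _ => (mem_ball.1 hta).le⟩
    · obtain ⟨a, ha, _⟩ := mem_iUnion₂.1 (hF hT)
      exact ⟨⟨a, ha⟩, fun h => (ht h).elim⟩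
  choose cell hcell using hcell
  refine ⟨F, inferInstance, fun a => S ⟨a, hFsub a.2⟩, cell, fun a x => hSc _ x,
    fun a x hx => (hSl _ x hx).1, fun t ht x hx => ?_⟩
  obtain ⟨-, h1, h2, h3⟩ := hSl ⟨cell t, hFsub (cell t).2⟩ x hx
  have hx' : x ∈ closedBall (0 : ES N) ρ := mem_closedBall_zero_iff.2 hx
  have hd : |((cell t : F) : ℝ) - t| ≤ z := by rw [abs_sub_comm]; exact hcell t ht
  have hm := hFsub (cell t).2
  refine ⟨fun i j => ?_, fun j => ?_, ?_⟩
  · exact (abs_sub_le _ _ _).trans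
      ((add_le_add (h1 i j) (hzq i j _ hm t ht hd x hx')).trans (add_halves η).le)
  · exact (abs_sub_le _ _ _).trans
      ((add_le_add (h2 j) (hzb j _ hm t ht hd x hx')).trans (add_halves η).le)
  · exact (abs_sub_le _ _ _).trans
      ((add_le_add h3 (hzc _ hm t ht hd x hx')).trans (add_halves η).le)

end family

/-! ### Approximation of bounded classical solutions by chains -/

section approx
variable {N : ℕ} {T : ℝ} {q : ℝ → ES N → Fin N → Fin N → ℝ} {b : ℝ → ES N → Fin N → ℝ}
  {c : ℝ → ES N → ℝ}

lemma Hyp.lyapunov (H : Hyp N T q b c) : ∃ (Φ : ES N → ℝ) (Λ : ℝ), 0 ≤ Λ ∧ (∀ x, 1 ≤ Φ x) ∧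
    ContDiff ℝ 2 Φ ∧ Tendsto Φ (cocompact (ES N)) atTop ∧
    ∀ t ∈ Icc 0 T, ∀ x, Aop q b c Φ t x ≤ Λ * Φ x := by
  obtain ⟨φ, lam, hlam, hpos, hC, htend, M, hM⟩ := H.liap
  refine ⟨fun x => φ x + 1, lam + |M| + |H.c₀|, by positivity, fun x => by linarith [hpos x],
    hC.add contDiff_const, tendsto_atTop_add_const_right _ _ htend, fun t ht x => ?_⟩
  have e1 : ∀ i, pd1 (fun x => φ x + 1) i = pd1 φ i := fun i => by
    funext y; simp [pd1]
  have e : Aop q b c (fun x => φ x + 1) t x = Aop q b c φ t x + c t x := by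
    simp only [Aop, pd2, e1]; ring
  rw [e]
  have h1 := hM t ht x
  have h2 := H.c_ub t ht x
  have h3 := mul_nonneg (add_nonneg (abs_nonneg M) (abs_nonneg H.c₀)) (hpos x).le
  nlinarith [le_abs_self M, le_abs_self H.c₀]

set_option maxHeartbeats 1000000 in
lemma exists_deriv_bound {F : ℝ → ES N → ℝ} {a b ρ : ℝ}
    (h0 : ContinuousOn (fun p : ℝ × ES N => F p.1 p.2) (Icc a b ×ˢ univ))
    (h1 : ∀ i, ContinuousOn (fun p : ℝ × ES N => dd (bs i) (F p.1) p.2) (Icc a b ×ˢ univ))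
    (h2 : ∀ i j, ContinuousOn (fun p : ℝ × ES N => dd (bs i) (dd (bs j) (F p.1)) p.2)
      (Icc a b ×ˢ univ)) :
    ∃ D, 0 ≤ D ∧ ∀ τ ∈ Icc a b, ∀ x, ‖x‖ ≤ ρ → |F τ x| ≤ D ∧ (∀ i, |dd (bs i) (F τ) x| ≤ D) ∧
      ∀ i j, |dd (bs i) (dd (bs j) (F τ)) x| ≤ D := by
  set Kc : Set (ℝ × ES N) := Icc a b ×ˢ closedBall 0 ρ with hKc
  have hcomp : IsCompact Kc := isCompact_Icc.prod (isCompact_closedBall _ _)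
  have hsub : Kc ⊆ Icc a b ×ˢ univ := prod_mono le_rfl (subset_univ _)
  have hc := (h0.abs.add (continuousOn_finsetSum Finset.univ fun i _ => (h1 i).abs)).add
    (continuousOn_finsetSum Finset.univ fun i _ => continuousOn_finsetSum Finset.univ
      fun j _ => (h2 i j).abs)
  obtain ⟨D, hD⟩ := hcomp.bddAbove_image (hc.mono hsub)
  have hD' : ∀ τ ∈ Icc a b, ∀ x, ‖x‖ ≤ ρ → |F τ x| + ∑ i, |dd (bs i) (F τ) x|
      + ∑ i, ∑ j, |dd (bs i) (dd (bs j) (F τ)) x| ≤ D := fun τ hτ x hx =>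
    hD ⟨(τ, x), ⟨hτ, mem_closedBall_zero_iff.2 hx⟩, rfl⟩
  refine ⟨|D|, abs_nonneg D, fun τ hτ x hx => ?_⟩
  have h := (hD' τ hτ x hx).trans (le_abs_self D)
  have p1 : 0 ≤ ∑ i, |dd (bs i) (F τ) x| := Finset.sum_nonneg fun i _ => abs_nonneg _
  have p2 : 0 ≤ ∑ i, ∑ j, |dd (bs i) (dd (bs j) (F τ)) x| :=
    Finset.sum_nonneg fun i _ => Finset.sum_nonneg fun j _ => abs_nonneg _
  have p0 := abs_nonneg (F τ x)
  refine ⟨by linarith, fun i => ?_, fun i j => ?_⟩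
  · have := Finset.single_le_sum (f := fun i => |dd (bs i) (F τ) x|) (fun i _ => abs_nonneg _)
      (Finset.mem_univ i)
    linarith
  · have t1 := Finset.single_le_sum (f := fun j => |dd (bs i) (dd (bs j) (F τ)) x|)
      (fun j _ => abs_nonneg _) (Finset.mem_univ j)
    have t2 := Finset.single_le_sum (f := fun i => ∑ j, |dd (bs i) (dd (bs j) (F τ)) x|)
      (fun i _ => Finset.sum_nonneg fun j _ => abs_nonneg _) (Finset.mem_univ i)
    linarith

set_option maxHeartbeats 1600000 in
lemma Hyp.compare (H : Hyp N T q b c) : ∃ K L₃ : ℝ, ∀ s f u, IsBCSol q b c s T f u → 0 ≤ s →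
    ∀ t, s < t → t ≤ T → ∀ M₀, 0 ≤ M₀ → ∀ R, ∀ ε > 0, ∃ ρ, 1 ≤ ρ ∧ R ≤ ρ ∧ ∃ η > 0,
      ∃ (ι : Type) (_ : Fintype ι) (S : ι → Scheme N) (τ : ℝ), (t - s) / 2 ≤ τ ∧ τ ≤ t - s ∧
        (∀ a x, (S a).c x ≤ |H.c₀| + 1) ∧
        (∀ a x, ‖x‖ ≤ 8 * ρ → ∃ ν d r ϱ, Loc (S a).Q (S a).B (S a).c (H.ν₀ / 2) K H.L₁
          (H.L₂ / 2) L₃ ν d r ϱ x) ∧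
        ∀ u₀, (∀ x, |u₀ x| ≤ M₀) → (∀ x, ‖x‖ ≤ ρ → |u₀ x - f x| ≤ η) →
          ∃ γ₁ > 0, ∀ γ, 0 < γ → γ ≤ γ₁ → ∀ m : ℕ, m * γ ^ 2 = τ →
            ∃ κ : ℕ → ι, ∀ x, ‖x‖ ≤ R → |chain S κ γ u₀ m x - u t x| ≤ ε := by
  obtain ⟨K, L₃, hfam⟩ := H.family
  refine ⟨K, L₃, ?_⟩
  rintro s f u ⟨⟨M₁, hM₁⟩, ucont, uC2, udt, udtc, ud1, ud2, ueq, uini⟩ hs t hst htT M₀ hM₀ R ε hε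
  obtain ⟨Φ, Λ, hΛ, hΦ1, hΦC, hΦt, hΦA⟩ := H.lyapunov
  have hN := H.N_pos
  set c₁ := |H.c₀| + 1 with hc₁
  -- the size of the admissible error
  obtain ⟨ΦR, hΦR⟩ := (isCompact_closedBall (0 : ES N) R).exists_bound_of_continuousOn
    hΦC.continuous.continuousOn
  set E := Real.exp ((Λ + 2 + 1) * T) with hE
  set κ₀ := ε / (E * (|ΦR| + 1)) with hκ₀
  have hκ₀p : 0 < κ₀ := by positivity
  -- the radius
  have hev := hΦt.eventually_ge_atTop ((Real.exp (c₁ * T) * M₀ + |M₁|) / κ₀)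
  obtain ⟨ρ₁, hρ₁⟩ : ∃ ρ₁, ∀ x : ES N, ρ₁ < ‖x‖ →
      (Real.exp (c₁ * T) * M₀ + |M₁|) / κ₀ ≤ Φ x := by
    obtain ⟨Kc, hKc, hsub⟩ := mem_cocompact.1 hev
    obtain ⟨r, hr⟩ := hKc.isBounded.subset_closedBall 0
    refine ⟨r, fun x hx => hsub fun hxK => ?_⟩
    have := mem_closedBall_zero_iff.1 (hr hxK)
    linarith
  set ρ := max (max 1 R) ρ₁ with hρ
  have hρ1 : 1 ≤ ρ := (le_max_left _ _).trans (le_max_left _ _)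
  have hρR : R ≤ ρ := (le_max_right _ _).trans (le_max_left _ _)
  have hΦout : ∀ x : ES N, ρ < ‖x‖ → Real.exp (c₁ * T) * M₀ + |M₁| ≤ κ₀ * Φ x := fun x hx => by
    have := hρ₁ x ((le_max_right _ _).trans_lt hx)
    rw [div_le_iff₀ hκ₀p] at this
    linarith
  -- the starting time
  have hcompS : IsCompact (Icc s T ×ˢ closedBall (0 : ES N) ρ) :=
    isCompact_Icc.prod (isCompact_closedBall _ _)
  obtain ⟨δ, hδ, hδu⟩ := Metric.uniformContinuousOn_iff.1
    (hcompS.uniformContinuousOn_of_continuous (ucont.mono (prod_mono le_rfl (subset_univ _))))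
    (κ₀ / 2) (by positivity)
  set σ := min ((t - s) / 2) (δ / 2) with hσ
  have hσ0 : 0 < σ := lt_min (by linarith) (by positivity)
  have hσ1 : σ ≤ (t - s) / 2 := min_le_left _ _
  have hσ2 : σ ≤ δ / 2 := min_le_right _ _
  set s' := s + σ with hs'
  have hstart : ∀ x, ‖x‖ ≤ ρ → |f x - u s' x| ≤ κ₀ / 2 := fun x hx => by
    have hxm := mem_closedBall_zero_iff.2 hx
    have := hδu (s, x) ⟨⟨le_rfl, by linarith⟩, hxm⟩ (s', x)
      ⟨⟨by linarith, by linarith⟩, hxm⟩ (by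
        rw [Prod.dist_eq, dist_self, Real.dist_eq, max_lt_iff, abs_sub_comm]
        exact ⟨by rw [hs', add_sub_cancel_left, abs_of_pos hσ0]; linarith, hδ⟩)
    rw [Real.dist_eq] at this
    simp only [uini] at this
    exact this.le
  have hIsub : Icc s' t ⊆ Ioc s T := fun z hz => ⟨by linarith [hz.1], hz.2.trans htT⟩
  have hI0 : ∀ z ∈ Icc s' t, z ∈ Icc 0 T := fun z hz => ⟨by linarith [hz.1], hz.2.trans htT⟩
  have pm : Icc s' t ×ˢ (univ : Set (ES N)) ⊆ Ioc s T ×ˢ univ := prod_mono hIsub le_rfl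
  have u1' : ∀ i, ContinuousOn (fun p : ℝ × ES N => dd (bs i) (u p.1) p.2) (Icc s' t ×ˢ univ) :=
    fun i => (ud1 i).mono pm
  have u2' : ∀ i j, ContinuousOn (fun p : ℝ × ES N => dd (bs i) (dd (bs j) (u p.1)) p.2)
      (Icc s' t ×ˢ univ) := fun i j => (ud2 i j).mono pm
  have hΦd : ∀ i, ContDiff ℝ 1 (dd (bs i) Φ) := fun i => contDiff_dd (k := 1) hΦC _
  have Φ1' : ∀ i, ContinuousOn (fun p : ℝ × ES N => dd (bs i) ((fun _ : ℝ => Φ) p.1) p.2)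
      (Icc s' t ×ˢ univ) := fun i =>
    ((hΦd i).continuous.comp continuous_snd).continuousOn
  have Φ2' : ∀ i j, ContinuousOn
      (fun p : ℝ × ES N => dd (bs i) (dd (bs j) ((fun _ : ℝ => Φ) p.1)) p.2)
      (Icc s' t ×ˢ univ) := fun i j =>
    ((contDiff_dd (k := 0) (hΦd j) _).continuous.comp continuous_snd).continuousOn
  obtain ⟨D₁, hD₁0, hD₁⟩ := exists_deriv_bound (ρ := ρ)
    (ucont.mono (prod_mono (hIsub.trans Ioc_subset_Icc_self) le_rfl)) u1' u2'
  obtain ⟨D₂, hD₂0, hD₂⟩ := exists_deriv_bound (F := fun _ => Φ) (ρ := ρ)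
    ((hΦC.continuous.comp continuous_snd).continuousOn) Φ1' Φ2'
  set D := D₁ + D₂ with hD
  have hD0 : 0 ≤ D := add_nonneg hD₁0 hD₂0
  set η := min (κ₀ / 4) 1 / ((N ^ 2 + N + 1) * (D + 1)) with hη
  have hη0 : 0 < η := by positivity
  have hηD : ((N:ℝ) ^ 2 + N + 1) * (η * D) ≤ min (κ₀ / 4) 1 := by
    have e : ((N:ℝ) ^ 2 + N + 1) * (η * (D + 1)) = min (κ₀ / 4) 1 := by
      rw [hη]
      generalize min (κ₀ / 4) 1 = y
      field_simp
    rw [← e]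
    gcongr
    linarith
  obtain ⟨ι, _, S, cell, hSc, hSl, hSa⟩ := hfam (8 * ρ) (by linarith) η hη0
  refine ⟨ρ, hρ1, hρR, κ₀ / 2, by positivity, ι, inferInstance, S, t - s', by linarith,
    by linarith, hSc, hSl, fun u₀ hu₀ hu₀f => ?_⟩
  obtain ⟨G, hG0, hG⟩ := Scheme.exists_bound S
  obtain ⟨γa, hγa0, hγa⟩ := op_unif hN S (ρ := ρ) (fun z hz => uC2 z (hIsub hz)) u1' u2'
    (κ := κ₀ / 4) (by positivity)
  obtain ⟨γb, hγb0, hγb⟩ := op_unif hN S (F := fun _ => Φ) (ρ := ρ) (fun _ _ => hΦC) Φ1' Φ2'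
    one_pos
  obtain ⟨γc, hγc0, hγc⟩ := chain_sup hN S (by positivity : 0 ≤ c₁) hSc
  have hcompI : IsCompact (Icc s' t ×ˢ closedBall (0 : ES N) ρ) :=
    isCompact_Icc.prod (isCompact_closedBall _ _)
  obtain ⟨δ₂, hδ₂, hδ₂u⟩ := Metric.uniformContinuousOn_iff.1
    (hcompI.uniformContinuousOn_of_continuous
      (udtc.mono (prod_mono hIsub (subset_univ _)))) (κ₀ / 4) (by positivity)
  refine ⟨min (min γa γb) (min γc (min (1 / (G + 1)) (min 1 (δ₂ / 2)))), by positivity,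
    fun γ hγ hγ1 m hm => ?_⟩
  have ga : γ ≤ γa := hγ1.trans ((min_le_left _ _).trans (min_le_left _ _))
  have gb : γ ≤ γb := hγ1.trans ((min_le_left _ _).trans (min_le_right _ _))
  have gr := hγ1.trans (min_le_right _ _)
  have gc : γ ≤ γc := gr.trans (min_le_left _ _)
  have gr2 := gr.trans (min_le_right _ _)
  have gG : γ ≤ 1 / (G + 1) := gr2.trans (min_le_left _ _)
  have g1 : γ ≤ 1 := gr2.trans ((min_le_right _ _).trans (min_le_left _ _))
  have gδ : γ ≤ δ₂ / 2 := gr2.trans ((min_le_right _ _).trans (min_le_right _ _))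
  rw [le_div_iff₀ (by positivity)] at gG
  have hγγ : γ ^ 2 ≤ γ := by nlinarith
  have hγ2 : 0 < γ ^ 2 := by positivity
  have hmT : m * γ ^ 2 ≤ T := by linarith
  have htk : ∀ k : ℕ, k ≤ m → s' + k * γ ^ 2 ∈ Icc s' t := fun k hk => by
    have : (k:ℝ) * γ ^ 2 ≤ m * γ ^ 2 := by gcongr
    exact ⟨by linarith [mul_nonneg k.cast_nonneg hγ2.le], by linarith⟩
  set κ : ℕ → ι := fun k => cell (s' + k * γ ^ 2) with hκ
  refine ⟨κ, fun x hx => ?_⟩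
  have key := chain_compare S κ (γ := γ) (κ₀ := κ₀) (Λ := Λ + 2) (ρ := ρ) u₀
    (fun k => u (s' + k * γ ^ 2)) hΦ1 hκ₀p.le (by linarith) (n := m)
    (fun a x => by
      have := (abs_le.1 (hG a x).2.2).1
      nlinarith)
    (fun k hk x hx => by
      have h1 := hγc γ hγ gc κ u₀ M₀ hM₀ hu₀ T k
        ((mul_le_mul_of_nonneg_right (Nat.cast_le.2 hk) hγ2.le).trans hmT) x
      have h2 := hM₁ _ (Ioc_subset_Icc_self (hIsub (htk k hk))) x
      have h3 := abs_sub (chain S κ γ u₀ k x) (u (s' + k * γ ^ 2) x)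
      linarith [hΦout x hx, le_abs_self M₁])
    (fun x hx => by
      have h1 := hu₀f x hx
      have h2 := hstart x hx
      have h3 := abs_sub_le (u₀ x) (f x) (u s' x)
      have h4 : κ₀ ≤ κ₀ * Φ x := le_mul_of_one_le_right hκ₀p.le (hΦ1 x)
      simp only [Nat.cast_zero, zero_mul, add_zero]
      linarith)
    (fun k hk x hx => by
      have hk1 := htk k hk.le
      have hk2 := htk (k + 1) hk
      set tk := s' + k * γ ^ 2 with htk'
      have htk1 : s' + ((k + 1 : ℕ) : ℝ) * γ ^ 2 = tk + γ ^ 2 := by push_cast; rw [htk']; ring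
      rw [htk1] at hk2 ⊢
      have a1 := hγa γ hγ ga tk hk1 x hx (κ k)
      obtain ⟨hQ', hB', hc'⟩ := hSa tk (hI0 _ hk1) x (by linarith)
      obtain ⟨w0, w1, w2⟩ := hD₁ tk hk1 x hx
      have hDD : D₁ ≤ D := by rw [hD]; linarith
      have a2 := Ag_sub_Aop_le (S (cell tk)) hη0.le hQ' hB' hc' (w0.trans hDD)
        (fun i => (w1 i).trans hDD) (fun i j => (w2 i j).trans hDD)
      have a3 : |u (tk + γ ^ 2) x - u tk x - γ ^ 2 * Aop q b c (u tk) tk x| ≤ γ ^ 2 * (κ₀ / 4) := by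
        have hsubk : Icc tk (tk + γ ^ 2) ⊆ Icc s' t := Icc_subset_Icc hk1.1 hk2.2
        obtain ⟨ξ, hξ, hξe⟩ := exists_deriv_eq_slope (fun z => u z x) (by linarith : tk < tk + γ ^ 2)
          (fun z hz => (udt x z (hIsub (hsubk hz))).continuousAt.continuousWithinAt)
          (fun z hz => (udt x z (hIsub (hsubk (Ioo_subset_Icc_self hz)))).differentiableWithinAt)
        have hxm := mem_closedBall_zero_iff.2 hx
        have := hδ₂u (ξ, x) ⟨hsubk (Ioo_subset_Icc_self hξ), hxm⟩ (tk, x) ⟨hk1, hxm⟩ (by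
          rw [Prod.dist_eq, dist_self, Real.dist_eq, max_lt_iff]
          exact ⟨by rw [abs_of_pos (by linarith [hξ.1])]; linarith [hξ.2], hδ₂⟩)
        rw [Real.dist_eq] at this
        simp only at this
        rw [hξe, ueq tk (hIsub hk1) x, add_sub_cancel_left] at this
        have e : u (tk + γ ^ 2) x - u tk x - γ ^ 2 * Aop q b c (u tk) tk x
            = γ ^ 2 * ((u (tk + γ ^ 2) x - u tk x) / γ ^ 2 - Aop q b c (u tk) tk x) := by
          field_simp
        rw [e, abs_mul, abs_of_pos hγ2]
        gcongr
      have a2' : |γ ^ 2 * (Ag (S (cell tk)).Q (S (cell tk)).B (S (cell tk)).c (u tk) x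
          - Aop q b c (u tk) tk x)| ≤ γ ^ 2 * (κ₀ / 4) := by
        rw [abs_mul, abs_of_pos hγ2]
        exact mul_le_mul_of_nonneg_left (a2.trans (hηD.trans (min_le_left _ _))) hγ2.le
      change |(S (cell tk)).op γ (u tk) x - u (tk + γ ^ 2) x| ≤ _
      change |(S (cell tk)).op γ (u tk) x - _ - _| ≤ _ at a1
      rw [abs_le] at a1 a2' a3 ⊢
      have := mul_pos hγ2 hκ₀p
      constructor <;> linarith)
    (fun k hk x hx => by
      have hk1 := htk k hk.le
      set tk := s' + k * γ ^ 2 with htk'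
      have a1 := hγb γ hγ gb tk hk1 x hx (κ k)
      obtain ⟨hQ', hB', hc'⟩ := hSa tk (hI0 _ hk1) x (by linarith)
      obtain ⟨w0, w1, w2⟩ := hD₂ tk hk1 x hx
      have hDD : D₂ ≤ D := by rw [hD]; linarith
      have a2 := (Ag_sub_Aop_le (S (cell tk)) hη0.le hQ' hB' hc' (w0.trans hDD)
        (fun i => (w1 i).trans hDD) (fun i j => (w2 i j).trans hDD)).trans
        (hηD.trans (min_le_right _ _))
      have a3 := hΦA tk (hI0 _ hk1) x
      change |(S (cell tk)).op γ Φ x - _ - _| ≤ _ at a1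
      change (S (cell tk)).op γ Φ x ≤ _
      have a2' := mul_le_mul_of_nonneg_left (abs_le.1 a2).2 hγ2.le
      have a3' := mul_le_mul_of_nonneg_left a3 hγ2.le
      have a4 := mul_le_mul_of_nonneg_left (hΦ1 x) hγ2.le
      have := (abs_le.1 a1).2
      linarith) m le_rfl x
  have hvm : s' + (m:ℝ) * γ ^ 2 = t := by rw [hm]; ring
  simp only [hvm] at key
  refine key.trans ?_
  have h1 : (1 + (Λ + 2 + 1) * γ ^ 2) ^ m ≤ E := one_add_pow_le (by linarith) hγ2.le hmT
  have h2 : Φ x ≤ |ΦR| + 1 := by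
    have := hΦR x (mem_closedBall_zero_iff.2 hx)
    rw [Real.norm_eq_abs] at this
    linarith [le_abs_self (Φ x), le_abs_self ΦR]
  calc κ₀ * (1 + (Λ + 2 + 1) * γ ^ 2) ^ m * Φ x ≤ κ₀ * E * (|ΦR| + 1) := by
        have := hΦ1 x
        gcongr
    _ = ε := by
      have hE0 : 0 < E := Real.exp_pos _
      rw [hκ₀]
      field_simp

end approx

/-! ### Smooth approximations of the initial data -/

section apx
variable {N : ℕ}

/-- `f` is a locally uniform limit of smooth functions with derivatives up to order `j` bounded by
`A`. -/
def Apx (j : ℕ) (A : ℝ) (f : ES N → ℝ) : Prop :=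
  ∀ ε > 0, ∀ R : ℝ, ∃ w, BBu w ∧ (∀ x, ‖x‖ ≤ R → |w x - f x| ≤ ε) ∧ DBu j A w

lemma DBu.mol {j : ℕ} {A ε : ℝ} (hε : 0 < ε) : ∀ {F : ES N → ℝ}, ContDiff ℝ j F → DBu j A F →
    DBu j A (mol ε F) := by
  have h0 : ∀ {F : ES N → ℝ}, Continuous F → (∀ x, |F x| ≤ A) → ∀ x, |_root_.mol ε F x| ≤ A :=
    fun hF hb x => by
      have := mol_close (ε := ε) (x := x) (a := 0) hF (η := A) (fun y _ => by
        rw [sub_zero]; exact hb _)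
      rwa [sub_zero] at this
  induction j with
  | zero => exact fun hF h x _ => h0 hF.continuous (fun x => h x (mem_univ x)) x
  | succ j ih =>
    intro F hF h
    refine ⟨fun x _ => h0 hF.continuous (fun x => h.1 x (mem_univ x)) x, fun i => ?_⟩
    rw [dd_mol (hF.of_le (by norm_cast; omega)) hε]
    exact ih (contDiff_dd hF _) (h.2 i)

lemma dd_scale {F : ES N → ℝ} (hF : Sm F) (c : ℝ) (v : ES N) :
    dd v (fun x => F (c • x)) = fun x => c * dd v F (c • x) := by
  funext x
  have h1 : HasFDerivAt (fun x : ES N => c • x) (c • ContinuousLinearMap.id ℝ (ES N)) x :=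
    (hasFDerivAt_id x).const_smul c
  have h2 := (Sm.diff hF (c • x)).hasFDerivAt.comp x h1
  have h3 : fderiv ℝ (fun x => F (c • x)) x = _ := h2.fderiv
  simp only [dd, h3]
  simp

lemma DBu.scale {j : ℕ} {A c : ℝ} (hc : |c| ≤ 1) : ∀ {F : ES N → ℝ}, Sm F → DBu j A F →
    DBu j A (fun x => F (c • x)) := by
  induction j with
  | zero => exact fun _ h x _ => h _ (mem_univ _)
  | succ j ih =>
    intro F hF h
    refine ⟨fun x _ => h.1 _ (mem_univ _), fun i => ?_⟩
    have hA : 0 ≤ A := (abs_nonneg _).trans (h.1 0 (mem_univ _))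
    rw [dd_scale hF]
    have hs : Sm (fun x : ES N => dd (bs i) F (c • x)) :=
      (hF.dd _).comp (contDiff_id.const_smul c)
    exact ((ih (hF.dd _) (h.2 i)).smul hs c).mono (mul_le_of_le_one_left hA hc)

lemma exists_apx (N j : ℕ) : ∃ C : ℝ, 0 ≤ C ∧ ∀ (F : ES N → ℝ) (A : ℝ), ContDiff ℝ j F →
    DBu j A F → Apx j (C * A) F := by
  obtain ⟨A₁, hA₁, hb⟩ := (ct_BBu (N := N) one_pos).2 j
  refine ⟨2 ^ j * A₁, by positivity, fun F A hF h ε hε R => ?_⟩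
  have hA : 0 ≤ A := (abs_nonneg _).trans (h.bound 0 (mem_univ _))
  set r := max R 1 with hr
  have hr1 : 1 ≤ r := le_max_right _ _
  have hF0 : ContDiff ℝ (0 : ℕ) F := hF.of_le (by norm_cast; omega)
  obtain ⟨ε₀, hε₀, hm⟩ := mol_sub_DB hF0 (ρ := r + 1) hε
  have hm := hm ε₀ hε₀ le_rfl
  have hs : Sm (fun x : ES N => ct 1 (r⁻¹ • x)) := (ct_smooth 1).comp (contDiff_id.const_smul _)
  have hms : Sm (mol ε₀ F) := mol_smooth hF.continuous hε₀
  have hn : ∀ x : ES N, ‖r⁻¹ • x‖ = ‖x‖ / r := fun x => by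
    rw [norm_smul, norm_inv, Real.norm_of_nonneg (by linarith), inv_mul_eq_div]
  refine ⟨fun x => ct 1 (r⁻¹ • x) * mol ε₀ F x, BBu.of_const_outside (R := 2 * r) (a := 0)
    (hs.mul hms) (fun x hx => ?_), fun x hx => ?_, ?_⟩
  · rw [ct_zero one_pos, zero_mul]
    rw [hn, mul_one, lt_div_iff₀ (by linarith)]
    linarith
  · have hxr : ‖x‖ ≤ r := hx.trans (le_max_left _ _)
    beta_reduce
    rw [ct_one one_pos (by rw [hn, div_le_one (by linarith)]; exact hxr), one_mul]
    exact hm x (by rw [mem_ball_zero_iff]; linarith)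
  · have hr' : |r⁻¹| ≤ 1 := by
      rw [abs_of_pos (by positivity)]
      exact inv_le_one_of_one_le₀ hr1
    have h1 := DBu.scale hr' (ct_smooth 1) hb
    exact (DB.mul hA₁ hA hs hms h1 (DBu.mol hε₀ hF h)).mono (by rw [mul_assoc])

lemma Sk_le_of_DBu (i : ℕ) {j : ℕ} (hij : i ≤ j) {A : ℝ} {w : ES N → ℝ} (hw : Sm w)
    (h : DBu j A w) (x : ES N) : Sk i w x ≤ Fintype.card (IX N i) * A ^ 2 := by
  have h' : DBu (i + 0) A w := h.of_le (by omega)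
  have : ∀ I : IX N i, DI i I w x ^ 2 ≤ A ^ 2 := fun I => by
    have := (DI_bound h' hw I).bound x (mem_univ x)
    rw [← sq_abs]
    exact pow_le_pow_left₀ (abs_nonneg _) this 2
  refine (Finset.sum_le_sum fun I _ => this I).trans (le_of_eq ?_)
  simp

end apx

/-! ### Splitting of the solution -/

section split
variable {N : ℕ} {T : ℝ} {q : ℝ → ES N → Fin N → Fin N → ℝ} {b : ℝ → ES N → Fin N → ℝ}
  {c : ℝ → ES N → ℝ}

lemma exists_step {τ γ₀ : ℝ} (hτ : 0 < τ) (hγ₀ : 0 < γ₀) :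
    ∃ (m : ℕ) (γ : ℝ), 0 < γ ∧ γ ≤ γ₀ ∧ m * γ ^ 2 = τ := by
  obtain ⟨n, hn⟩ := exists_nat_gt (τ / γ₀ ^ 2)
  have hn0 : (0:ℝ) < n := lt_of_le_of_lt (by positivity) hn
  refine ⟨n, Real.sqrt (τ / n), by positivity, ?_, ?_⟩
  · rw [Real.sqrt_le_left hγ₀.le, div_le_iff₀ hn0]
    rw [div_lt_iff₀ (by positivity)] at hn
    linarith
  · rw [Real.sq_sqrt (by positivity)]; field_simp

lemma Sk_le_of_vB {δ : ℝ} (hδ : 0 < δ) {w : ℕ → ℝ} (hw : ∀ i, 0 ≤ w i) {θ : ℕ → ES N → ℝ}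
    {U : ES N → ℝ} {x : ES N} (hθ : ∀ i < 4, θ i x = 1) {M : ℝ} (h : vB δ w θ U x ≤ M) {i : ℕ}
    (hi : i ≤ 3) : w i * Sk i U x ≤ M / min δ 1 ^ 3 := by
  have hm : 0 < min δ 1 := by positivity
  have h1 : δ ^ i * w i * (θ i x ^ 2 * Sk i U x) ≤ vB δ w θ U x :=
    Finset.single_le_sum (f := fun i => δ ^ i * w i * (θ i x ^ 2 * Sk i U x))
      (fun i _ => mul_nonneg (mul_nonneg (by positivity) (hw i))
        (mul_nonneg (sq_nonneg _) (Sk_nonneg i U x))) (Finset.mem_range.2 (by omega))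
  rw [hθ i (by omega), one_pow, one_mul, mul_assoc] at h1
  have h2 : min δ 1 ^ 3 ≤ δ ^ i :=
    (pow_le_pow_of_le_one hm.le (min_le_right _ _) hi).trans
      (pow_le_pow_left₀ hm.le (min_le_left _ _) i)
  rw [le_div_iff₀ (by positivity), mul_comm]
  exact (mul_le_mul_of_nonneg_right h2 (mul_nonneg (hw i) (Sk_nonneg i U x))).trans (h1.trans h)

/-- Splitting of a solution according to a splitting of the initial datum, up to small errors. -/
lemma Hyp.split (H : Hyp N T q b c) : ∃ C : ℝ, 0 ≤ C ∧ ∀ s f u, IsBCSol q b c s T f u → 0 ≤ s →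
    ∀ t, s < t → t ≤ T → ∀ (j l : ℕ) (g h : ES N → ℝ) (A B : ℝ), 0 ≤ A → 0 ≤ B →
      (∀ x, f x = g x + h x) → Apx j A g → Apx l B h → ∀ R, ∀ ε > 0,
      ∃ U V, Sm U ∧ Sm V ∧ (∀ x, ‖x‖ ≤ R → |U x + V x - u t x| ≤ ε) ∧
        ∀ x, ‖x‖ ≤ R → ∀ i ≤ 3, (t - s) ^ (i - j) * Sk i U x ≤ C * A ^ 2 + ε ∧
          (t - s) ^ (i - l) * Sk i V x ≤ C * B ^ 2 + ε := by
  obtain ⟨K, L₃, hcomp⟩ := H.compare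
  obtain ⟨g₀, hg₀, hnest⟩ := nest_Gc (N := N) K
  obtain ⟨δ, hδ, C, hC, hbern⟩ := chain_bernstein H.N_pos (half_pos H.ν₀_pos) K H.L₁_pos
    (half_pos H.L₂_pos) L₃ (|H.c₀| + 1) hg₀ H.T_pos
  set Z : ℝ := ∑ i ∈ Finset.range 4, (Fintype.card (IX N i) : ℝ) with hZ
  have hZi : ∀ i < 4, (Fintype.card (IX N i) : ℝ) ≤ Z := fun i hi =>
    Finset.single_le_sum (f := fun i => (Fintype.card (IX N i) : ℝ)) (fun _ _ => by positivity)
      (Finset.mem_range.2 hi)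
  have hZ0 : 0 ≤ Z := Finset.sum_nonneg fun _ _ => by positivity
  set d₃ := min δ 1 ^ 3 with hd₃
  have hd₃0 : 0 < d₃ := by positivity
  refine ⟨8 * (C * Z / d₃), by positivity, ?_⟩
  intro s f u hu hs t hst htT j l g h A B hA hB hfgh hg hh R ε hε
  obtain ⟨ρ, hρ1, hρR, η, hη, ι, _, S, τ, hτ1, hτ2, hSc, hSl, hcmp⟩ :=
    hcomp s f u hu hs t hst htT (A + B) (by linarith) R ε hε
  have hτ0 : 0 < τ := by linarith
  obtain ⟨gn, gB, gc, gA⟩ := hg (η / 2) (by linarith) ρ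
  obtain ⟨hn, hB', hc', hA'⟩ := hh (η / 2) (by linarith) ρ
  obtain ⟨γ₁, hγ₁, hcmp⟩ := hcmp (fun x => gn x + hn x)
    (fun x => (abs_add_le _ _).trans (add_le_add (gA.bound x (mem_univ x))
      (hA'.bound x (mem_univ x))))
    (fun x hx => by
      rw [hfgh, add_sub_add_comm]
      exact (abs_add_le _ _).trans ((add_le_add (gc x hx) (hc' x hx)).trans (add_halves η).le))
  have hloc : ∀ a x, (∃ ν d r ϱ, Loc (S a).Q (S a).B (S a).c (H.ν₀ / 2) K H.L₁ (H.L₂ / 2) L₃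
      ν d r ϱ x ∧ ∀ i, Gc (S a).Q (S a).B (nest ρ (i + 1)) x ≤ g₀ * ν * nest ρ i x ^ 2) ∨
      (∀ i, nest ρ (i + 1) x = 0 ∧ Gc (S a).Q (S a).B (nest ρ (i + 1)) x ≤ 0) := fun a x => by
    have hx := hnest ρ hρ1 (S a).Q (S a).B (S a).c (H.ν₀ / 2) H.L₁ (H.L₂ / 2) L₃
      (half_pos H.ν₀_pos) x
    rcases le_or_gt ‖x‖ (8 * ρ) with h8 | h8
    · obtain ⟨ν, d, r, ϱ, hL⟩ := hSl a x h8
      exact Or.inl ⟨ν, d, r, ϱ, hL, hx.1 h8 ν d r ϱ hL⟩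
    · exact Or.inr (hx.2 h8)
  have hcut := nest_cut (N := N) (by linarith : 0 < ρ)
  have hbase : ∀ {k : ℕ} {E : ℝ} {w : ES N → ℝ}, Sm w → DBu k E w → ∀ i ≤ k, i < 4 → ∀ x,
      nest ρ i x ^ 2 * Sk i w x ≤ Z * E ^ 2 := fun hw hE i hik hi x =>
    (mul_le_of_le_one_left (Sk_nonneg _ _ _) (hcut.le_one i x)).trans
      ((Sk_le_of_DBu i hik hw hE x).trans
        (mul_le_mul_of_nonneg_right (hZi i hi) (sq_nonneg _)))
  have hε' : 0 < ε / 8 * d₃ := by positivity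
  obtain ⟨γ₂, hγ₂, hU⟩ := hbern ι S (nest ρ) hcut hSc hloc j gn gB (Z * A ^ 2) (by positivity)
    (hbase gB.1 gA) _ hε'
  obtain ⟨γ₃, hγ₃, hV⟩ := hbern ι S (nest ρ) hcut hSc hloc l hn hB' (Z * B ^ 2) (by positivity)
    (hbase hB'.1 hA') _ hε'
  obtain ⟨m, γ, hγ, hγm, hmτ⟩ := exists_step hτ0 (by positivity : 0 < min γ₁ (min γ₂ γ₃))
  obtain ⟨κ, hκ⟩ := hcmp γ hγ (hγm.trans (min_le_left _ _)) m hmτ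
  have hmT : m * γ ^ 2 ≤ T := by linarith
  have hfin : ∀ {k : ℕ} {E : ℝ} {W : ES N → ℝ} {x : ES N}, ‖x‖ ≤ R →
      vB δ (tw k (m * γ ^ 2)) (nest ρ) W x ≤ C * (Z * E ^ 2) + ε / 8 * d₃ → ∀ i ≤ 3,
      (t - s) ^ (i - k) * Sk i W x ≤ 8 * (C * Z / d₃) * E ^ 2 + ε := fun {k E W x} hx hW i hi => by
    rw [hmτ] at hW
    have h1 := Sk_le_of_vB hδ (tw_nonneg k hτ0.le)
      (fun i hi => nest_one (by linarith) (hx.trans hρR) hi) hW hi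
    have h2 : (t - s) ^ (i - k) ≤ 8 * τ ^ (i - k) := by
      have e1 : (t - s) ^ (i - k) ≤ (2 * τ) ^ (i - k) :=
        pow_le_pow_left₀ (by linarith) (by linarith) _
      have e2 : (2:ℝ) ^ (i - k) ≤ 2 ^ 3 := pow_le_pow_right₀ (by norm_num) (by omega)
      rw [mul_pow] at e1
      have := mul_le_mul_of_nonneg_right e2 (pow_nonneg hτ0.le (i - k))
      linarith
    have h3 := mul_le_mul_of_nonneg_right h2 (Sk_nonneg i W x)
    have h4 : (C * (Z * E ^ 2) + ε / 8 * d₃) / d₃ = C * Z / d₃ * E ^ 2 + ε / 8 := by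
      field_simp
    rw [← hd₃, h4] at h1
    simp only [tw] at h1
    linarith
  refine ⟨chain S κ γ gn m, chain S κ γ hn m, chain_smooth S κ γ gB.1 m, chain_smooth S κ γ hB'.1 m,
    fun x hx => ?_, fun x hx i hi => ⟨?_, ?_⟩⟩
  · have := hκ x hx
    rwa [chain_add] at this
  · exact hfin hx (hU γ hγ (hγm.trans ((min_le_right _ _).trans (min_le_left _ _))) κ m hmT x) i hi
  · exact hfin hx (hV γ hγ (hγm.trans ((min_le_right _ _).trans (min_le_right _ _))) κ m hmT x) i hi

end split

section limits
variable {N : ℕ}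

lemma taylor_one {w : ES N → ℝ} (hw : Sm w) {v x : ES N} {M h : ℝ} (hh : 0 ≤ h)
    (hM : ∀ σ ∈ Icc 0 h, |dd v (dd v w) (x + σ • v)| ≤ M) :
    |w (x + h • v) - w x - h * dd v w x| ≤ M * h * h := by
  have hline : ∀ {g : ES N → ℝ}, Differentiable ℝ g → ∀ s : ℝ,
      HasDerivAt (fun s : ℝ => g (x + s • v)) (dd v g (x + s • v)) s := by
    intro g hg s
    have h1 : HasDerivAt (fun s : ℝ => x + s • v) v s := by
      simpa using ((hasDerivAt_id s).smul_const v).const_add x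
    exact (hg (x + s • v)).hasFDerivAt.comp_hasDerivAt s h1
  have h1 : ∀ σ ∈ Icc 0 h, |dd v w (x + σ • v) - dd v w x| ≤ M * h := fun σ hσ => by
    have := norm_image_sub_le_of_norm_deriv_le_segment'
      (fun s _ => (hline (hw.dd v).diff s).hasDerivWithinAt)
      (fun s hs => hM s (Ico_subset_Icc_self hs)) σ hσ
    simp only [zero_smul, add_zero, sub_zero, Real.norm_eq_abs] at this
    exact this.trans (mul_le_mul_of_nonneg_left hσ.2
      ((abs_nonneg _).trans (hM 0 (left_mem_Icc.2 hh))))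
  have := norm_image_sub_le_of_norm_deriv_le_segment' (C := M * h)
      (f := fun s => w (x + s • v) - s * dd v w x)
      (fun s _ => ((hline hw.diff s).sub ((hasDerivAt_id s).mul_const _)).hasDerivWithinAt)
      (fun s hs => by simpa using h1 s (Ico_subset_Icc_self hs)) h (right_mem_Icc.2 hh)
  simp only [zero_smul, add_zero, zero_mul, sub_zero, Real.norm_eq_abs] at this
  rwa [sub_right_comm] at this

lemma dd_tendsto {W : ℕ → ES N → ℝ} {w : ES N → ℝ} {M ρ : ℝ} {v : ES N} (hW : ∀ n, Sm (W n))
    (hlim : ∀ x, ‖x‖ < ρ → Tendsto (fun n => W n x) atTop (𝓝 (w x)))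
    (hM : ∀ n x, ‖x‖ < ρ → |dd v (dd v (W n)) x| ≤ M) {x : ES N}
    (hw : DifferentiableAt ℝ w x) (hx : ‖x‖ < ρ) :
    Tendsto (fun n => dd v (W n) x) atTop (𝓝 (dd v w x)) := by
  have hder : HasDerivAt (fun s : ℝ => w (x + s • v)) (dd v w x) 0 := by
    have h1 : HasDerivAt (fun s : ℝ => x + s • v) v 0 := by
      simpa using ((hasDerivAt_id (0 : ℝ)).smul_const v).const_add x
    have h2 : HasFDerivAt w (fderiv ℝ w x) (x + (0 : ℝ) • v) := by simpa using hw.hasFDerivAt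
    exact h2.comp_hasDerivAt 0 h1
  have hM0 : 0 ≤ M := (abs_nonneg _).trans (hM 0 x hx)
  rw [Metric.tendsto_atTop]
  intro η hη
  have hsl := hder.tendsto_slope_zero_right
  have e1 : ∀ᶠ h : ℝ in 𝓝[>] 0, |h⁻¹ * (w (x + h • v) - w x) - dd v w x| < η / 4 := by
    have := (Metric.tendsto_nhds.1 hsl) (η / 4) (by linarith)
    filter_upwards [this] with h hh
    simpa [Real.dist_eq] using hh
  have e2 : ∀ᶠ h : ℝ in 𝓝[>] 0, M * h < η / 4 := by
    have : Tendsto (fun h : ℝ => M * h) (𝓝[>] 0) (𝓝 (M * 0)) :=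
      ((continuous_const.mul continuous_id).tendsto 0).mono_left nhdsWithin_le_nhds
    exact this.eventually_lt_const (by linarith)
  have e3 : ∀ᶠ h : ℝ in 𝓝[>] 0, ‖x‖ + h * ‖v‖ < ρ := by
    have : Tendsto (fun h : ℝ => ‖x‖ + h * ‖v‖) (𝓝[>] 0) (𝓝 (‖x‖ + 0 * ‖v‖)) :=
      ((by fun_prop : Continuous fun h : ℝ => ‖x‖ + h * ‖v‖).tendsto 0).mono_left nhdsWithin_le_nhds
    exact this.eventually_lt_const (by simpa)
  obtain ⟨h, ⟨⟨h1, h2⟩, h3⟩, h0⟩ :=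
    (((e1.and e2).and e3).and self_mem_nhdsWithin).exists
  have h0 : 0 < h := h0
  have hin : ∀ σ ∈ Icc 0 h, ‖x + σ • v‖ < ρ := fun σ hσ =>
    (norm_add_le _ _).trans_lt ((by
      rw [norm_smul, Real.norm_of_nonneg hσ.1]
      have := mul_le_mul_of_nonneg_right hσ.2 (norm_nonneg v)
      linarith : ‖x‖ + ‖σ • v‖ ≤ ‖x‖ + h * ‖v‖).trans_lt h3)
  have e4 : ∀ᶠ n in atTop, |h⁻¹ * (W n (x + h • v) - W n x) - h⁻¹ * (w (x + h • v) - w x)| < η / 4 := by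
    have := ((hlim _ (hin h (right_mem_Icc.2 h0.le))).sub (hlim x hx)).const_mul h⁻¹
    exact (Metric.tendsto_nhds.1 this) (η / 4) (by linarith)
  obtain ⟨n₀, hn₀⟩ := eventually_atTop.1 e4
  refine ⟨n₀, fun n hn => ?_⟩
  have h4 := hn₀ n hn
  have h5 := taylor_one (hW n) h0.le (fun σ hσ => hM n _ (hin σ hσ))
  have h6 : |h⁻¹ * (W n (x + h • v) - W n x) - dd v (W n) x| ≤ M * h := by
    have : h⁻¹ * (W n (x + h • v) - W n x) - dd v (W n) x
        = h⁻¹ * (W n (x + h • v) - W n x - h * dd v (W n) x) := by field_simp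
    rw [this, abs_mul, abs_of_pos (inv_pos.2 h0), inv_mul_le_iff₀ h0]
    linarith
  rw [Real.dist_eq, abs_lt]
  rw [abs_lt] at h1 h4
  rw [abs_le] at h6
  constructor <;> linarith [h1.1, h1.2, h4.1, h4.2, h6.1, h6.2]

/-- Pointwise convergence with bounds on the derivatives of order at most three gives convergence
of the derivatives of order at most two. -/
lemma DI_tendsto {W : ℕ → ES N → ℝ} {w : ES N → ℝ} {M ρ : ℝ} (hW : ∀ n, Sm (W n))
    (hlim : ∀ x, ‖x‖ < ρ → Tendsto (fun n => W n x) atTop (𝓝 (w x)))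
    (hM : ∀ n x, ‖x‖ < ρ → ∀ k ≤ 3, ∀ I : IX N k, |DI k I (W n) x| ≤ M) (hw : ContDiff ℝ 2 w)
    {k : ℕ} (hk : k ≤ 2) (I : IX N k) :
    ∀ x, ‖x‖ < ρ → Tendsto (fun n => DI k I (W n) x) atTop (𝓝 (DI k I w x)) := by
  have key : ∀ k ≤ 2, ∀ I : IX N k, ContDiff ℝ (2 - k : ℕ) (DI k I w) ∧
      ∀ x, ‖x‖ < ρ → Tendsto (fun n => DI k I (W n) x) atTop (𝓝 (DI k I w x)) := by
    intro k
    induction k with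
    | zero => exact fun _ I => ⟨hw, hlim⟩
    | succ k ih =>
      rintro hk ⟨i, I⟩
      obtain ⟨h1, h2⟩ := ih (by omega) I
      have h1' : ContDiff ℝ ((2 - (k + 1) : ℕ) + 1 : ℕ) (DI k I w) := by
        rwa [show 2 - (k + 1) + 1 = 2 - k by omega]
      refine ⟨contDiff_dd h1' _, fun x hx => ?_⟩
      exact dd_tendsto (M := M) (fun n => DI_smooth I (hW n)) h2
        (fun n x hx => hM n x hx (k + 2) (by omega) (i, (i, I)))
        ((h1'.differentiable (by simp)) x) hx
  exact (key k hk I).2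

lemma abs_DI_sub_le {k : ℕ} (I : IX N k) {u : ES N → ℝ} (hu : Sm u) {R m : ℝ} 
    (hm : ∀ x, ‖x‖ ≤ R → √(Sk (k + 1) u x) ≤ m) {x y : ES N} (hx : ‖x‖ ≤ R) (hy : ‖y‖ ≤ R) :
    |DI k I u x - DI k I u y| ≤ N * m * ‖x - y‖ := by
  refine (convex_closedBall (0 : ES N) R).norm_image_sub_le_of_norm_fderiv_le (𝕜 := ℝ)
    (fun z _ => (DI_smooth I hu).diff z) (fun z hz => ?_) (mem_closedBall_zero_iff.2 hy)
    (mem_closedBall_zero_iff.2 hx)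
  have hz := mem_closedBall_zero_iff.1 hz
  have hm0 : 0 ≤ m := (Real.sqrt_nonneg _).trans (hm z hz)
  refine ContinuousLinearMap.opNorm_le_bound _ (by positivity) fun v => ?_
  rw [fderiv_eq_sum]
  refine (Finset.abs_sum_le_sum_abs _ _).trans ?_
  calc ∑ j, |v j * dd (bs j) (DI k I u) z| ≤ ∑ _j : Fin N, ‖v‖ * m := by
        refine Finset.sum_le_sum fun j _ => ?_
        rw [abs_mul]
        exact mul_le_mul (PiLp.norm_apply_le v j)
          ((abs_DI_le (k := k + 1) (j, I) u z).trans (hm z hz)) (abs_nonneg _) (norm_nonneg _)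
    _ = _ := by simp; ring

end limits

section estimates
variable {N : ℕ} {T : ℝ} {q : ℝ → ES N → Fin N → Fin N → ℝ} {b : ℝ → ES N → Fin N → ℝ}
  {c : ℝ → ES N → ℝ}

lemma sqrt_Sk_le {τ D : ℝ} (hτ : 0 < τ) {m i : ℕ} {U : ES N → ℝ} {x : ES N}
    (h : τ ^ m * Sk i U x ≤ D) : √(Sk i U x) ≤ √D * (√τ)⁻¹ ^ m := by
  have hr : 0 < √τ := Real.sqrt_pos.2 hτ
  rw [inv_pow, ← div_eq_mul_inv, le_div_iff₀ (by positivity)]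
  refine Real.le_sqrt_of_sq_le ?_
  rw [mul_pow, Real.sq_sqrt (Sk_nonneg _ _ _), ← pow_mul, mul_comm m, pow_mul,
    Real.sq_sqrt hτ.le, mul_comm]
  exact h

lemma Hyp.estimates (H : Hyp N T q b c) : ∃ C : ℝ, 0 ≤ C ∧ ∀ s f u, IsBCSol q b c s T f u → 0 ≤ s →
    ∀ t, s < t → t ≤ T → ∀ (j l : ℕ) (g h : ES N → ℝ) (A B : ℝ), 0 ≤ A → 0 ≤ B →
      (∀ x, f x = g x + h x) → Apx j A g → Apx l B h → ∀ k ≤ 2, ∀ I : IX N k,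
      (∀ x, |DI k I (u t) x| ≤ C * (A * (√(t - s))⁻¹ ^ (k - j) + B * (√(t - s))⁻¹ ^ (k - l))) ∧
      ∀ x y, |DI k I (u t) x - DI k I (u t) y| ≤
        C * (A * min ((√(t - s))⁻¹ ^ (k - j)) ((√(t - s))⁻¹ ^ (k + 1 - j) * ‖x - y‖)
          + B * min ((√(t - s))⁻¹ ^ (k - l)) ((√(t - s))⁻¹ ^ (k + 1 - l) * ‖x - y‖)) := by
  obtain ⟨C, hC, hsplit⟩ := H.split
  refine ⟨(2 + N) * √C, by positivity, ?_⟩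
  intro s f u hu hs t hst htT j l g h A B hA hB hf hg hh k hk I
  have hτ : 0 < t - s := sub_pos.2 hst
  set ρ : ℝ := (√(t - s))⁻¹ with hρ
  have hρ0 : 0 < ρ := inv_pos.2 (Real.sqrt_pos.2 hτ)
  have hut : ContDiff ℝ 2 (u t) := hu.2.2.1 t ⟨hst, htT⟩
  have key : ∀ R : ℝ, ∃ (U V : ℕ → ES N → ℝ) (a e : ℕ → ℝ), (∀ n, Sm (U n)) ∧ (∀ n, Sm (V n)) ∧
      Tendsto a atTop (𝓝 (√C * A)) ∧ Tendsto e atTop (𝓝 (√C * B)) ∧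
      (∀ n x, ‖x‖ ≤ R → ∀ i ≤ 3, √(Sk i (U n) x) ≤ a n * ρ ^ (i - j) ∧
        √(Sk i (V n) x) ≤ e n * ρ ^ (i - l)) ∧
      ∀ x, ‖x‖ < R → ∀ k ≤ 2, ∀ I : IX N k,
        Tendsto (fun n => DI k I (U n) x + DI k I (V n) x) atTop (𝓝 (DI k I (u t) x)) := by
    intro R
    have hε : ∀ n : ℕ, 0 < 1 / ((n : ℝ) + 1) := fun n => Nat.one_div_pos_of_nat
    have hlim : Tendsto (fun n : ℕ => 1 / ((n : ℝ) + 1)) atTop (𝓝 0) :=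
      tendsto_one_div_add_atTop_nhds_zero_nat
    choose U V hU hV hUV hb using fun n : ℕ =>
      hsplit s f u hu hs t hst htT j l g h A B hA hB hf hg hh R (1 / ((n : ℝ) + 1)) (hε n)
    have hsq : ∀ {D : ℝ}, 0 ≤ D →
        Tendsto (fun n : ℕ => √(C * D ^ 2 + 1 / ((n : ℝ) + 1))) atTop (𝓝 (√C * D)) := by
      intro D hD
      have h1 := (Real.continuous_sqrt.tendsto (C * D ^ 2 + 0)).comp (hlim.const_add (C * D ^ 2))
      rwa [add_zero, Real.sqrt_mul hC, Real.sqrt_sq hD] at h1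
    have hbd : ∀ n x, ‖x‖ ≤ R → ∀ i ≤ 3,
        √(Sk i (U n) x) ≤ √(C * A ^ 2 + 1 / ((n : ℝ) + 1)) * ρ ^ (i - j) ∧
        √(Sk i (V n) x) ≤ √(C * B ^ 2 + 1 / ((n : ℝ) + 1)) * ρ ^ (i - l) := fun n x hx i hi =>
      ⟨sqrt_Sk_le hτ (hb n x hx i hi).1, sqrt_Sk_le hτ (hb n x hx i hi).2⟩
    refine ⟨U, V, _, _, hU, hV, hsq hA, hsq hB, hbd, fun x hx k hk I => ?_⟩
    have hDI : ∀ n k (I : IX N k), DI k I (fun x => U n x + V n x)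
        = fun x => DI k I (U n) x + DI k I (V n) x := fun n k I => DI_add I (hU n) (hV n)
    have hle : ∀ (n : ℕ) (D : ℝ), √(C * D ^ 2 + 1 / ((n : ℝ) + 1)) ≤ √(C * D ^ 2 + 1) := by
      intro n D
      refine Real.sqrt_le_sqrt ?_
      have : 1 / ((n : ℝ) + 1) ≤ 1 := by
        rw [div_le_one (by positivity)]
        linarith [(Nat.cast_nonneg n : (0 : ℝ) ≤ n)]
      linarith
    have := DI_tendsto (W := fun n x => U n x + V n x) (w := u t) (ρ := R)
      (M := ∑ k ∈ Finset.range 4,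
        (√(C * A ^ 2 + 1) * ρ ^ (k - j) + √(C * B ^ 2 + 1) * ρ ^ (k - l)))
      (fun n => (hU n).add (hV n)) (fun x hx => ?_) (fun n x hx k hk I => ?_) hut hk I x hx
    · simpa only [hDI] using this
    · rw [tendsto_iff_dist_tendsto_zero]
      exact squeeze_zero (fun _ => dist_nonneg) (fun n => hUV n x hx.le) hlim
    · rw [hDI]
      refine (abs_add_le _ _).trans (le_trans (add_le_add
        ((abs_DI_le I _ _).trans ((hbd n x hx.le k hk).1.trans
          (mul_le_mul_of_nonneg_right (hle n A) (by positivity))))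
        ((abs_DI_le I _ _).trans ((hbd n x hx.le k hk).2.trans
          (mul_le_mul_of_nonneg_right (hle n B) (by positivity))))) ?_)
      exact Finset.single_le_sum
        (f := fun k => √(C * A ^ 2 + 1) * ρ ^ (k - j) + √(C * B ^ 2 + 1) * ρ ^ (k - l))
        (fun _ _ => by positivity) (Finset.mem_range.2 (by omega))
  constructor
  · intro x
    obtain ⟨U, V, a, e, hU, hV, ha, he, hb, hl⟩ := key (‖x‖ + 1)
    have hx : ‖x‖ < ‖x‖ + 1 := lt_add_one _
    have h1 := le_of_tendsto_of_tendsto' (hl x hx k hk I).abs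
      ((ha.mul_const (ρ ^ (k - j))).add (he.mul_const (ρ ^ (k - l)))) fun n =>
        (abs_add_le _ _).trans (add_le_add
          ((abs_DI_le I _ _).trans (hb n x hx.le k (by omega)).1)
          ((abs_DI_le I _ _).trans (hb n x hx.le k (by omega)).2))
    refine h1.trans ?_
    have : 0 ≤ (1 + N) * (√C * (A * ρ ^ (k - j) + B * ρ ^ (k - l))) := by positivity
    linarith
  · intro x y
    obtain ⟨U, V, a, e, hU, hV, ha, he, hb, hl⟩ := key (‖x‖ + ‖y‖ + 1)
    have hx : ‖x‖ < ‖x‖ + ‖y‖ + 1 := by linarith [norm_nonneg y]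
    have hy : ‖y‖ < ‖x‖ + ‖y‖ + 1 := by linarith [norm_nonneg x]
    have hosc : ∀ {w : ES N → ℝ} {a : ℝ} {m m' : ℕ}, Sm w →
        (∀ z, ‖z‖ ≤ ‖x‖ + ‖y‖ + 1 → √(Sk k w z) ≤ a * ρ ^ m) →
        (∀ z, ‖z‖ ≤ ‖x‖ + ‖y‖ + 1 → √(Sk (k + 1) w z) ≤ a * ρ ^ m') →
        |DI k I w x - DI k I w y| ≤ (2 + N) * a * min (ρ ^ m) (ρ ^ m' * ‖x - y‖) := by
      intro w a m m' hw h0 h1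
      have ha0 : 0 ≤ a := by
        by_contra! hneg
        have := (Real.sqrt_nonneg _).trans (h0 x hx.le)
        linarith [mul_neg_of_neg_of_pos hneg (pow_pos hρ0 m)]
      rw [mul_min_of_nonneg _ _ (by positivity)]
      refine le_min ?_ ?_
      · have e1 := (abs_sub _ _).trans (add_le_add ((abs_DI_le I w x).trans (h0 x hx.le))
          ((abs_DI_le I w y).trans (h0 y hy.le)))
        have : 0 ≤ N * (a * ρ ^ m) := by positivity
        linarith
      · have e1 := abs_DI_sub_le I hw h1 hx.le hy.le
        have : 0 ≤ 2 * (a * ρ ^ m' * ‖x - y‖) := by positivity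
        linarith
    have h1 := le_of_tendsto_of_tendsto' ((hl x hx k hk I).sub (hl y hy k hk I)).abs
      (((ha.const_mul (2 + N : ℝ)).mul_const (min (ρ ^ (k - j)) (ρ ^ (k + 1 - j) * ‖x - y‖))).add
        ((he.const_mul (2 + N : ℝ)).mul_const (min (ρ ^ (k - l)) (ρ ^ (k + 1 - l) * ‖x - y‖))))
        fun n => by
          rw [add_sub_add_comm]
          exact (abs_add_le _ _).trans (add_le_add
            (hosc (hU n) (fun z hz => (hb n z hz k (by omega)).1)
              (fun z hz => (hb n z hz (k + 1) (by omega)).1))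
            (hosc (hV n) (fun z hz => (hb n z hz k (by omega)).2)
              (fun z hz => (hb n z hz (k + 1) (by omega)).2)))
    refine h1.trans (le_of_eq ?_)
    ring

end estimates

/-! ### Coordinate derivatives and iterated Fréchet derivatives -/

section coordinates
variable {N : ℕ}

lemma opNorm_le_of_basis {k : ℕ} (M : ContinuousMultilinearMap ℝ (fun _ : Fin k => ES N) ℝ)
    {B : ℝ} (hB : 0 ≤ B) (h : ∀ σ : Fin k → Fin N, |M fun i => bs (σ i)| ≤ B) :
    ‖M‖ ≤ (N : ℝ) ^ k * B := by
  refine ContinuousMultilinearMap.opNorm_le_bound (by positivity) fun m => ?_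
  have hm : M m = ∑ σ : Fin k → Fin N, (∏ i, m i (σ i)) * M fun i => bs (σ i) := by
    have h1 : m = fun i => ∑ j, m i j • bs j := funext fun i => ES_sum_bs (m i)
    conv_lhs => rw [h1]
    rw [M.map_sum]
    refine Finset.sum_congr rfl fun σ _ => ?_
    rw [M.map_smul_univ (fun i => m i (σ i)) fun i => bs (σ i), smul_eq_mul]
  rw [hm, Real.norm_eq_abs]
  refine (Finset.abs_sum_le_sum_abs _ _).trans ?_
  calc ∑ σ : Fin k → Fin N, |(∏ i, m i (σ i)) * M fun i => bs (σ i)|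
      ≤ ∑ _σ : Fin k → Fin N, (∏ i, ‖m i‖) * B := by
        refine Finset.sum_le_sum fun σ _ => ?_
        rw [abs_mul, Finset.abs_prod]
        exact mul_le_mul (Finset.prod_le_prod (fun _ _ => abs_nonneg _)
          fun i _ => PiLp.norm_apply_le (m i) (σ i)) (h σ) (abs_nonneg _)
          (Finset.prod_nonneg fun _ _ => norm_nonneg _)
    _ = _ := by simp; ring

lemma iteratedFDeriv_basis {k : ℕ} {u : ES N → ℝ} (hu : ContDiff ℝ k u) (σ : Fin k → Fin N) :
    ∃ I : IX N k, ∀ x, iteratedFDeriv ℝ k u x (fun i => bs (σ i)) = DI k I u x := by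
  induction k with
  | zero => exact ⟨(), fun x => rfl⟩
  | succ k ih =>
    obtain ⟨I, hI⟩ := ih (hu.of_le (by norm_cast; omega)) (fun i => σ i.succ)
    refine ⟨(σ 0, I), fun x => ?_⟩
    change _ = fderiv ℝ (DI k I u) x (bs (σ 0))
    rw [← funext hI, iteratedFDeriv_succ_apply_left]
    have hd : DifferentiableAt ℝ (iteratedFDeriv ℝ k u) x :=
      (hu.differentiable_iteratedFDeriv (by norm_cast; omega)) x
    have := (hd.hasFDerivAt.continuousMultilinear_apply_const (fun i => bs (σ i.succ))).fderiv
    rw [this]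
    rfl

lemma norm_iteratedFDeriv_le {k : ℕ} {u : ES N → ℝ} (hu : ContDiff ℝ k u) {B : ℝ} {x : ES N}
    (hB : 0 ≤ B) (h : ∀ I : IX N k, |DI k I u x| ≤ B) :
    ‖iteratedFDeriv ℝ k u x‖ ≤ (N : ℝ) ^ k * B :=
  opNorm_le_of_basis _ hB fun σ => by
    obtain ⟨I, hI⟩ := iteratedFDeriv_basis hu σ
    rw [hI]
    exact h I

lemma norm_iteratedFDeriv_sub_le {k : ℕ} {u : ES N → ℝ} (hu : ContDiff ℝ k u) {B : ℝ} {x y : ES N}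
    (hB : 0 ≤ B) (h : ∀ I : IX N k, |DI k I u x - DI k I u y| ≤ B) :
    ‖iteratedFDeriv ℝ k u x - iteratedFDeriv ℝ k u y‖ ≤ (N : ℝ) ^ k * B :=
  opNorm_le_of_basis _ hB fun σ => by
    obtain ⟨I, hI⟩ := iteratedFDeriv_basis hu σ
    rw [sub_apply, hI, hI]
    exact h I

lemma iteratedFDeriv_dd {k : ℕ} {f : ES N → ℝ} (hf : ContDiff ℝ (k + 1 : ℕ) f) (v x : ES N)
    (m : Fin k → ES N) : iteratedFDeriv ℝ k (dd v f) x m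
      = iteratedFDeriv ℝ (k + 1) f x (Fin.snoc (α := fun _ => ES N) m v) := by
  rw [iteratedFDeriv_succ_apply_right, Fin.init_snoc, Fin.snoc_last]
  have h1 : dd v f = ContinuousLinearMap.apply ℝ ℝ v ∘ fun y => fderiv ℝ f y := rfl
  rw [h1, ContinuousLinearMap.iteratedFDeriv_comp_left (n := k) _
    (hf.fderiv_right (m := k) (by norm_cast)).contDiffAt le_rfl]
  rfl

lemma norm_le_of_snoc {k : ℕ} {M : ContinuousMultilinearMap ℝ (fun _ : Fin k => ES N) ℝ}
    {M' : ContinuousMultilinearMap ℝ (fun _ : Fin (k + 1) => ES N) ℝ} {i : Fin N}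
    (h : ∀ m, M m = M' (Fin.snoc (α := fun _ => ES N) m (bs i))) : ‖M‖ ≤ ‖M'‖ := by
  refine ContinuousMultilinearMap.opNorm_le_bound (norm_nonneg _) fun m => ?_
  rw [h]
  refine (M'.le_opNorm _).trans (le_of_eq ?_)
  rw [Fin.prod_univ_castSucc]
  simp

/-- Hölder continuity of all the derivatives of order `k` in coordinate directions. -/
def HB (γ A : ℝ) : ℕ → (ES N → ℝ) → Prop
  | 0, F => ∀ x y, |F x - F y| ≤ A * ‖x - y‖ ^ γ
  | k + 1, F => ∀ i : Fin N, HB γ A k (dd (bs i) F)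

lemma DBu.of_iteratedFDeriv {j : ℕ} {f : ES N → ℝ} {A : ℝ} (hf : ContDiff ℝ j f)
    (h : ∀ k ≤ j, ∀ x, ‖iteratedFDeriv ℝ k f x‖ ≤ A) : DBu j A f := by
  induction j generalizing f with
  | zero => exact fun x _ => by simpa using h 0 le_rfl x
  | succ j ih =>
    refine ⟨fun x _ => by simpa using h 0 (by omega) x, fun i => ih (contDiff_dd hf _) ?_⟩
    intro k hk x
    exact (norm_le_of_snoc fun m =>
      iteratedFDeriv_dd (hf.of_le (by norm_cast; omega)) _ x m).trans (h (k + 1) (by omega) x)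

lemma HB.of_iteratedFDeriv {j : ℕ} {f : ES N → ℝ} {γ A : ℝ} (hf : ContDiff ℝ j f)
    (h : ∀ x y, ‖iteratedFDeriv ℝ j f x - iteratedFDeriv ℝ j f y‖ ≤ A * ‖x - y‖ ^ γ) :
    HB γ A j f := by
  induction j generalizing f with
  | zero =>
    intro x y
    refine le_trans (le_of_eq ?_) (h x y)
    rw [iteratedFDeriv_zero_eq_comp, Function.comp_apply, Function.comp_apply, ← map_sub,
      LinearIsometryEquiv.norm_map, Real.norm_eq_abs]
  | succ j ih =>
    intro i
    refine ih (contDiff_dd hf _) fun x y => (norm_le_of_snoc (i := i) fun m => ?_).trans (h x y)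
    rw [sub_apply, sub_apply,
      iteratedFDeriv_dd hf, iteratedFDeriv_dd hf]

/-! ### Splitting of Hölder continuous data -/

lemma norm_sub_smul_sub {x y : ES N} {ε : ℝ} (hε : 0 ≤ ε) (hy : ‖y‖ ≤ 1) :
    ‖x - ε • y - x‖ ≤ ε := by
  rw [sub_sub_cancel_left, norm_neg, norm_smul, Real.norm_of_nonneg hε]
  exact mul_le_of_le_one_right hε hy

lemma lipschitz_of_DBu {f : ES N → ℝ} (hf : Differentiable ℝ f) {F : ℝ} (h : DBu 1 F f)
    (x y : ES N) : |f x - f y| ≤ N * F * ‖x - y‖ := by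
  have hF : 0 ≤ F := (abs_nonneg _).trans (h.bound 0 (mem_univ _))
  refine (convex_univ (𝕜 := ℝ)).norm_image_sub_le_of_norm_fderiv_le (𝕜 := ℝ)
    (fun z _ => hf z) (fun z _ => ?_) (mem_univ y) (mem_univ x)
  refine ContinuousLinearMap.opNorm_le_bound _ (by positivity) fun v => ?_
  rw [fderiv_eq_sum]
  refine (Finset.abs_sum_le_sum_abs _ _).trans ?_
  calc ∑ j, |v j * dd (bs j) f z| ≤ ∑ _j : Fin N, ‖v‖ * F := by
        refine Finset.sum_le_sum fun j _ => ?_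
        rw [abs_mul]
        exact mul_le_mul (PiLp.norm_apply_le v j) ((h.2 j).bound z (mem_univ z))
          (abs_nonneg _) (norm_nonneg _)
    _ = _ := by simp; ring

lemma mol_split {j : ℕ} {f : ES N → ℝ} {F γ ε : ℝ} (hf : ContDiff ℝ j f) (hb : DBu j F f)
    (hh : HB γ F j f) (hγ0 : 0 < γ) (hγ1 : γ < 1) (hε : 0 < ε) (hε1 : ε ≤ 1) :
    DBu j ((N + 1) * F * ε ^ γ) (fun x => f x - mol ε f x) ∧
      DBu (j + 1) ((1 + mkd N) * F * ε ^ (γ - 1)) (mol ε f) := by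
  have hF : 0 ≤ F := (abs_nonneg _).trans (hb.bound 0 (mem_univ _))
  have hpow : 1 ≤ ε ^ (γ - 1) := Real.one_le_rpow_of_pos_of_le_one_of_nonpos hε hε1 (by linarith)
  have hmk := mkd_nonneg (N := N)
  have hsup : ∀ {f : ES N → ℝ}, Continuous f → (∀ x, |f x| ≤ F) →
      ∀ x, |mol ε f x| ≤ (1 + mkd N) * F * ε ^ (γ - 1) := by
    intro f hf hb x
    have h1 := mol_close (ε := ε) (x := x) (a := 0) hf (fun y _ => by simpa using hb (x - ε • y))
    rw [sub_zero] at h1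
    calc _ ≤ F := h1
      _ ≤ (1 + mkd N) * F := le_mul_of_one_le_left hF (by linarith)
      _ ≤ _ := le_mul_of_one_le_right (by positivity) hpow
  induction j generalizing f with
  | zero =>
    have hc : Continuous f := hf.continuous
    have hosc : ∀ x y : ES N, ‖y‖ ≤ 1 → |f (x - ε • y) - f x| ≤ F * ε ^ γ := fun x y hy =>
      (hh _ _).trans (mul_le_mul_of_nonneg_left
        (Real.rpow_le_rpow (norm_nonneg _) (norm_sub_smul_sub hε.le hy) hγ0.le) hF)
    refine ⟨fun x _ => ?_, fun x _ => hsup hc (fun x => hb x (mem_univ x)) x, fun i x _ => ?_⟩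
    · rw [abs_sub_comm]
      refine (mol_close hc (hosc x)).trans ?_
      rw [mul_assoc]
      exact le_mul_of_one_le_left (by positivity) (by linarith [(Nat.cast_nonneg N : (0 : ℝ) ≤ N)])
    · refine (dd_mol_le hc hε (hosc x) i).trans ?_
      rw [Real.rpow_sub_one hε.ne']
      have : 0 ≤ F * (ε ^ γ / ε) := by positivity
      calc _ = mkd N * (F * (ε ^ γ / ε)) := by ring
        _ ≤ _ := by linarith
  | succ j ih =>
    have h1 : ContDiff ℝ 1 f := hf.of_le (by norm_cast; omega)
    have hi := fun i => ih (contDiff_dd hf (bs i)) (hb.2 i) (hh i)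
    have hb1 : DBu 1 F f := hb.of_le (by omega)
    refine ⟨⟨fun x _ => ?_, fun i => ?_⟩, fun x _ => hsup hf.continuous (fun x => hb.1 x (mem_univ x)) x,
      fun i => ?_⟩
    · rw [abs_sub_comm]
      refine (mol_close hf.continuous (η := N * F * ε) fun y hy => ?_).trans ?_
      · exact (lipschitz_of_DBu (h1.differentiable (by simp)) hb1 _ _).trans
          (mul_le_mul_of_nonneg_left (norm_sub_smul_sub hε.le hy) (by positivity))
      · have : ε ≤ ε ^ γ := Real.self_le_rpow_of_le_one hε.le hε1 hγ1.le
        exact mul_le_mul (by linarith) this hε.le (by positivity)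
    · rw [dd_sub_of (h1.differentiable (by simp)) (mol_smooth hf.continuous hε).diff, dd_mol h1 hε]
      exact (hi i).1
    · rw [dd_mol h1 hε]
      exact (hi i).2

lemma exists_split (N j : ℕ) {γ : ℝ} (hγ0 : 0 < γ) (hγ1 : γ < 1) :
    ∃ K : ℝ, 0 ≤ K ∧ ∀ (f : ES N → ℝ) (F : ℝ), ContDiff ℝ j f → DBu j F f → HB γ F j f →
      ∀ ε, 0 < ε → ε ≤ 1 → ∃ g h : ES N → ℝ, (∀ x, f x = g x + h x) ∧
        Apx j (K * F * ε ^ γ) g ∧ Apx (j + 1) (K * F * ε ^ (γ - 1)) h := by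
  obtain ⟨C₁, hC₁, h₁⟩ := exists_apx N j
  obtain ⟨C₂, hC₂, h₂⟩ := exists_apx N (j + 1)
  have hmk := mkd_nonneg (N := N)
  refine ⟨C₁ * (N + 1) + C₂ * (1 + mkd N), by positivity, fun f F hf hb hh ε hε hε1 => ?_⟩
  have hF : 0 ≤ F := (abs_nonneg _).trans (hb.bound 0 (mem_univ _))
  obtain ⟨k₁, k₂⟩ := mol_split hf hb hh hγ0 hγ1 hε hε1
  have hm : Sm (mol ε f) := mol_smooth hf.continuous hε
  have hmono : ∀ {k : ℕ} {A A' : ℝ} {w : ES N → ℝ}, A ≤ A' → Apx k A w → Apx k A' w :=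
    fun hA h ε hε R => by
      obtain ⟨w, h1, h2, h3⟩ := h ε hε R
      exact ⟨w, h1, h2, h3.mono hA⟩
  refine ⟨fun x => f x - mol ε f x, mol ε f, fun x => by ring, hmono ?_ (h₁ _ _ (hf.sub
    (hm.of_le (by exact_mod_cast le_top))) k₁), hmono ?_ (h₂ _ _ (hm.of_le (by exact_mod_cast le_top)) k₂)⟩
  · have : 0 ≤ C₂ * (1 + mkd N) * F * ε ^ γ := by positivity
    linarith
  · have : 0 ≤ C₁ * (N + 1) * F * ε ^ (γ - 1) := by positivity
    linarith

end coordinates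

section decomposition
variable {N : ℕ}

lemma inv_pow_eq_rpow {r : ℝ} (hr : 0 < r) (n : ℕ) : r⁻¹ ^ n = r ^ (-(n : ℝ)) := by
  rw [Real.rpow_neg hr.le, Real.rpow_natCast, inv_pow]

/-- Quantitative membership in `C^α_b`. -/
def CbLe (α F : ℝ) (f : ES N → ℝ) : Prop :=
  ContDiff ℝ ⌊α⌋₊ f ∧ DBu ⌊α⌋₊ F f ∧ ((⌊α⌋₊ : ℝ) ≠ α → HB (α - ⌊α⌋₊) F ⌊α⌋₊ f)

lemma CbLe.nonneg {α F : ℝ} {f : ES N → ℝ} (h : CbLe α F f) : 0 ≤ F :=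
  (abs_nonneg _).trans (h.2.1.bound 0 (mem_univ _))

lemma floor_gap {α : ℝ} (hα : 0 ≤ α) (h : (⌊α⌋₊ : ℝ) ≠ α) :
    0 < α - ⌊α⌋₊ ∧ α - ⌊α⌋₊ < 1 :=
  ⟨sub_pos.2 (lt_of_le_of_ne (Nat.floor_le hα) h), by linarith [Nat.lt_floor_add_one α]⟩

lemma exists_decomp (N : ℕ) {α S : ℝ} (hα : 0 ≤ α) (hS : 1 ≤ S) : ∃ K : ℝ, 0 ≤ K ∧
    ∀ (f : ES N → ℝ) (F : ℝ), CbLe α F f → ∀ r, 0 < r → r ≤ S → ∀ m : ℕ,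
      ∃ (j l : ℕ) (g h : ES N → ℝ) (A B : ℝ), 0 ≤ A ∧ 0 ≤ B ∧ (∀ x, f x = g x + h x) ∧
        Apx j A g ∧ Apx l B h ∧
        A * r⁻¹ ^ (m - j) + B * r⁻¹ ^ (m - l) ≤ K * F * r ^ (-max 0 ((m : ℝ) - α)) := by
  obtain ⟨C₁, hC₁, h₁⟩ := exists_apx N ⌊α⌋₊
  have hdir : ∀ (f : ES N → ℝ) (F : ℝ), CbLe α F f → ∀ r, 0 < r → ∀ m : ℕ,
      (m ≤ ⌊α⌋₊ ∨ (⌊α⌋₊ : ℝ) = α) →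
      ∃ (j l : ℕ) (g h : ES N → ℝ) (A B : ℝ), 0 ≤ A ∧ 0 ≤ B ∧ (∀ x, f x = g x + h x) ∧
        Apx j A g ∧ Apx l B h ∧
        A * r⁻¹ ^ (m - j) + B * r⁻¹ ^ (m - l) ≤ C₁ * F * r ^ (-max 0 ((m : ℝ) - α)) := by
    intro f F hf r hr m hm
    have hF := hf.nonneg
    refine ⟨⌊α⌋₊, ⌊α⌋₊, f, fun _ => 0, C₁ * F, 0, by positivity, le_rfl, fun x => by simp,
      h₁ _ _ hf.1 hf.2.1, ?_, le_of_eq ?_⟩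
    · have := h₁ (fun _ => 0) 0 contDiff_const (DB.zero _)
      rwa [mul_zero] at this
    rw [zero_mul, add_zero]
    congr 1
    rcases le_or_gt m ⌊α⌋₊ with h | h
    · have : (m : ℝ) ≤ α := (Nat.cast_le.2 h).trans (Nat.floor_le hα)
      rw [Nat.sub_eq_zero_of_le h, pow_zero, max_eq_left (by linarith), neg_zero, Real.rpow_zero]
    · have h2 := hm.resolve_left (by omega)
      have h3 : (⌊α⌋₊ : ℝ) < m := Nat.cast_lt.2 h
      rw [inv_pow_eq_rpow hr, Nat.cast_sub h.le, max_eq_right (by linarith), h2]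
  by_cases hint : (⌊α⌋₊ : ℝ) = α
  · exact ⟨C₁, hC₁, fun f F hf r hr _ m => hdir f F hf r hr m (Or.inr hint)⟩
  obtain ⟨hγ0, hγ1⟩ := floor_gap hα hint
  set γ := α - ⌊α⌋₊ with hγ
  obtain ⟨K, hK, hs⟩ := exists_split N ⌊α⌋₊ hγ0 hγ1
  have hS0 : 0 < S := by linarith
  refine ⟨C₁ + K * (1 + S⁻¹ ^ (γ - 1)), by positivity, fun f F hf r hr hrS m => ?_⟩
  have hF := hf.nonneg
  rcases le_or_gt m ⌊α⌋₊ with hm | hm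
  · obtain ⟨j, l, g, h, A, B, hA, hB, hfg, hg, hh, hle⟩ := hdir f F hf r hr m (Or.inl hm)
    refine ⟨j, l, g, h, A, B, hA, hB, hfg, hg, hh, hle.trans ?_⟩
    have : 0 ≤ K * (1 + S⁻¹ ^ (γ - 1)) * F * r ^ (-max 0 ((m : ℝ) - α)) := by positivity
    linarith
  · obtain ⟨g, h, hfg, hg, hh⟩ := hs f F hf.1 hf.2.1 (hf.2.2 hint) (S⁻¹ * r) (by positivity)
      (by rwa [inv_mul_le_iff₀ hS0, mul_one])
    refine ⟨_, _, g, h, _, _, by positivity, by positivity, hfg, hg, hh, ?_⟩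
    have h3 : ((⌊α⌋₊ + 1 : ℕ) : ℝ) ≤ m := Nat.cast_le.2 hm
    have h4 : α ≤ m := by push_cast at h3; linarith
    rw [max_eq_right (by linarith), inv_pow_eq_rpow hr, inv_pow_eq_rpow hr, Nat.cast_sub hm.le,
      Nat.cast_sub hm, Real.mul_rpow (by positivity) hr.le, Real.mul_rpow (by positivity) hr.le]
    have e1 : r ^ γ * r ^ (-((m : ℝ) - ⌊α⌋₊)) = r ^ (-((m : ℝ) - α)) := by
      rw [← Real.rpow_add hr]; congr 1; rw [hγ]; ring
    have e2 : r ^ (γ - 1) * r ^ (-((m : ℝ) - (⌊α⌋₊ + 1 : ℕ))) = r ^ (-((m : ℝ) - α)) := by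
      rw [← Real.rpow_add hr]; congr 1; rw [hγ]; push_cast; ring
    have e3 : S⁻¹ ^ γ ≤ 1 := Real.rpow_le_one (by positivity) (inv_le_one_of_one_le₀ hS) hγ0.le
    have e4 : 0 ≤ K * F * r ^ (-((m : ℝ) - α)) := by positivity
    calc _ = K * F * (S⁻¹ ^ γ * (r ^ γ * r ^ (-((m : ℝ) - ⌊α⌋₊)))
          + S⁻¹ ^ (γ - 1) * (r ^ (γ - 1) * r ^ (-((m : ℝ) - (⌊α⌋₊ + 1 : ℕ))))) := by ring
      _ = (S⁻¹ ^ γ + S⁻¹ ^ (γ - 1)) * (K * F * r ^ (-((m : ℝ) - α))) := by rw [e1, e2]; ring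
      _ ≤ (1 + S⁻¹ ^ (γ - 1)) * (K * F * r ^ (-((m : ℝ) - α))) :=
          mul_le_mul_of_nonneg_right (by linarith) e4
      _ ≤ _ := by
          have : 0 ≤ C₁ * F * r ^ (-((m : ℝ) - α)) := by positivity
          linarith

variable {T : ℝ} {q : ℝ → ES N → Fin N → Fin N → ℝ} {b : ℝ → ES N → Fin N → ℝ}
  {c : ℝ → ES N → ℝ}

lemma Hyp.coordinate_estimates (H : Hyp N T q b c) {α : ℝ} (hα : 0 ≤ α) :
    ∃ C : ℝ, 0 ≤ C ∧ ∀ s f u, IsBCSol q b c s T f u → 0 ≤ s →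
    ∀ t, s < t → t ≤ T → ∀ F, CbLe α F f → ∀ k ≤ 2, ∀ I : IX N k,
      (∀ x, |DI k I (u t) x| ≤ C * F * √(t - s) ^ (-max 0 ((k : ℝ) - α))) ∧
      ∀ x y, |DI k I (u t) x - DI k I (u t) y| ≤
          C * F * √(t - s) ^ (-max 0 ((k : ℝ) + 1 - α)) * ‖x - y‖ ∧
        (⌊α⌋₊ = k → (k : ℝ) < α → |DI k I (u t) x - DI k I (u t) y| ≤ C * F * ‖x - y‖ ^ (α - k)) := by
  obtain ⟨C, hC, hest⟩ := H.estimates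
  set S : ℝ := 1 + √T with hS
  have hS1 : 1 ≤ S := by linarith [Real.sqrt_nonneg T]
  obtain ⟨K, hK, hdec⟩ := exists_decomp N hα hS1
  obtain ⟨K', hK', hhol⟩ : ∃ K' : ℝ, 0 ≤ K' ∧ ((⌊α⌋₊ : ℝ) ≠ α → ∀ (f : ES N → ℝ) (F : ℝ),
      CbLe α F f → ∀ ε, 0 < ε → ε ≤ 1 → ∃ g h : ES N → ℝ, (∀ x, f x = g x + h x) ∧
        Apx ⌊α⌋₊ (K' * F * ε ^ (α - ⌊α⌋₊)) g ∧
        Apx (⌊α⌋₊ + 1) (K' * F * ε ^ (α - ⌊α⌋₊ - 1)) h) := by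
    by_cases hint : (⌊α⌋₊ : ℝ) = α
    · exact ⟨0, le_rfl, fun h => absurd hint h⟩
    · obtain ⟨hγ0, hγ1⟩ := floor_gap hα hint
      obtain ⟨K', hK', hs⟩ := exists_split N ⌊α⌋₊ hγ0 hγ1
      exact ⟨K', hK', fun _ f F hf => hs f F hf.1 hf.2.1 (hf.2.2 hint)⟩
  refine ⟨2 * (C * K) + 2 * (C * K'), by positivity, ?_⟩
  intro s f u hu hs t hst htT F hf k hk I
  have hF := hf.nonneg
  have hr : 0 < √(t - s) := Real.sqrt_pos.2 (sub_pos.2 hst)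
  have hrS : √(t - s) ≤ S := by
    have : √(t - s) ≤ √T := Real.sqrt_le_sqrt (by linarith)
    linarith
  set r := √(t - s) with hrdef
  have hP1 : ∀ x, |DI k I (u t) x| ≤ C * K * F * r ^ (-max 0 ((k : ℝ) - α)) := by
    intro x
    obtain ⟨j, l, g, h, A, B, hA, hB, hfg, hg, hh, hle⟩ := hdec f F hf r hr hrS k
    refine ((hest s f u hu hs t hst htT j l g h A B hA hB hfg hg hh k hk I).1 x).trans ?_
    refine (mul_le_mul_of_nonneg_left hle hC).trans (le_of_eq ?_)
    ring
  refine ⟨fun x => (hP1 x).trans ?_, fun x y => ⟨?_, fun hfl hkα => ?_⟩⟩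
  · have h1 : 0 ≤ (C * K + 2 * (C * K')) * F * r ^ (-max 0 ((k : ℝ) - α)) := by positivity
    linarith
  · obtain ⟨j, l, g, h, A, B, hA, hB, hfg, hg, hh, hle⟩ := hdec f F hf r hr hrS (k + 1)
    refine ((hest s f u hu hs t hst htT j l g h A B hA hB hfg hg hh k hk I).2 x y).trans ?_
    push_cast at hle
    have e1 : A * min (r⁻¹ ^ (k - j)) (r⁻¹ ^ (k + 1 - j) * ‖x - y‖)
          + B * min (r⁻¹ ^ (k - l)) (r⁻¹ ^ (k + 1 - l) * ‖x - y‖)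
        ≤ K * F * r ^ (-max 0 ((k : ℝ) + 1 - α)) * ‖x - y‖ := by
      refine (add_le_add (mul_le_mul_of_nonneg_left (min_le_right _ _) hA)
        (mul_le_mul_of_nonneg_left (min_le_right _ _) hB)).trans ?_
      have := mul_le_mul_of_nonneg_right hle (norm_nonneg (x - y))
      linarith
    refine (mul_le_mul_of_nonneg_left e1 hC).trans ?_
    have h1 : 0 ≤ (C * K + 2 * (C * K')) * F * r ^ (-max 0 ((k : ℝ) + 1 - α)) * ‖x - y‖ := by
      positivity
    linarith
  · rcases eq_or_ne x y with rfl | hxy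
    · rw [sub_self, abs_zero]; positivity
    have hd : 0 < ‖x - y‖ := norm_pos_iff.2 (sub_ne_zero.2 hxy)
    rcases le_or_gt ‖x - y‖ 1 with h1 | h1
    · obtain ⟨g, h, hfg, hg, hh⟩ := hhol (by rw [hfl]; exact hkα.ne) f F hf ‖x - y‖ hd h1
      rw [hfl] at hg hh
      refine ((hest s f u hu hs t hst htT k (k + 1) g h _ _ (by positivity) (by positivity) hfg hg
        hh k hk I).2 x y).trans ?_
      have e1 : ‖x - y‖ ^ (α - k - 1) * ‖x - y‖ = ‖x - y‖ ^ (α - k) := by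
        rw [Real.rpow_sub_one hd.ne', div_mul_cancel₀ _ hd.ne']
      have e2 : K' * F * ‖x - y‖ ^ (α - k) * min (r⁻¹ ^ (k - k)) (r⁻¹ ^ (k + 1 - k) * ‖x - y‖)
          ≤ K' * F * ‖x - y‖ ^ (α - k) * 1 :=
        mul_le_mul_of_nonneg_left (by simp) (by positivity)
      have e3 : K' * F * ‖x - y‖ ^ (α - k - 1)
            * min (r⁻¹ ^ (k - (k + 1))) (r⁻¹ ^ (k + 1 - (k + 1)) * ‖x - y‖)
          ≤ K' * F * ‖x - y‖ ^ (α - k - 1) * ‖x - y‖ :=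
        mul_le_mul_of_nonneg_left (by simp) (by positivity)
      rw [mul_assoc (K' * F) (‖x - y‖ ^ (α - k - 1)) ‖x - y‖, e1] at e3
      refine (mul_le_mul_of_nonneg_left (add_le_add e2 e3) hC).trans ?_
      have : 0 ≤ 2 * (C * K) * F * ‖x - y‖ ^ (α - k) := by positivity
      linarith
    · have e0 : max 0 ((k : ℝ) - α) = 0 := max_eq_left (by linarith)
      have e1 := (abs_sub _ _).trans (add_le_add (hP1 x) (hP1 y))
      rw [e0, neg_zero, Real.rpow_zero, mul_one] at e1
      have e2 : 1 ≤ ‖x - y‖ ^ (α - k) := Real.one_le_rpow h1.le (by linarith)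
      calc _ ≤ 2 * (C * K) * F * 1 := by linarith
        _ ≤ 2 * (C * K) * F * ‖x - y‖ ^ (α - k) := mul_le_mul_of_nonneg_left e2 (by positivity)
        _ ≤ _ := by
          have : 0 ≤ 2 * (C * K') * F * ‖x - y‖ ^ (α - k) := by positivity
          linarith

end decomposition

/-! ### The final estimate -/

section final
variable {N : ℕ} {T : ℝ} {q : ℝ → ES N → Fin N → Fin N → ℝ} {b : ℝ → ES N → Fin N → ℝ}
  {c : ℝ → ES N → ℝ}

lemma rpow_neg_le {r S p p' : ℝ} (hr : 0 < r) (hrS : r ≤ S) (hS : 1 ≤ S) (hp : 0 ≤ p)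
    (hpp : p ≤ p') (hp' : p' ≤ 3) : r ^ (-p) ≤ S ^ (3 : ℝ) * r ^ (-p') := by
  have h1 : r ^ (-p) = r ^ (p' - p) * r ^ (-p') := by
    rw [← Real.rpow_add hr]; congr 1; ring
  rw [h1]
  refine mul_le_mul_of_nonneg_right ?_ (by positivity)
  exact (Real.rpow_le_rpow hr.le hrS (by linarith)).trans
    (Real.rpow_le_rpow_of_exponent_le hS (by linarith))

lemma MemCb.cbLe {α : ℝ} {f : ES N → ℝ} (h : MemCb α f) : CbLe α (CbNorm α f).toReal f := by
  have hsup : ∀ k ≤ ⌊α⌋₊, ∀ x, ‖iteratedFDeriv ℝ k f x‖ ≤ (CbNorm α f).toReal := by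
    intro k hk x
    refine (ENNReal.ofReal_le_iff_le_toReal h.2).1 ?_
    refine (le_iSup (fun x => ENNReal.ofReal ‖iteratedFDeriv ℝ k f x‖) x).trans ?_
    exact (Finset.single_le_sum (f := fun k => supNormE k f) (fun _ _ => zero_le)
      (Finset.mem_range.2 (by omega))).trans le_self_add
  refine ⟨h.1, DBu.of_iteratedFDeriv h.1 hsup, fun hα => HB.of_iteratedFDeriv h.1 fun x y => ?_⟩
  rcases eq_or_ne x y with rfl | hxy
  · rw [sub_self, norm_zero]; positivity
  have hd : 0 < ‖x - y‖ := norm_pos_iff.2 (sub_ne_zero.2 hxy)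
  rw [← div_le_iff₀ (by positivity)]
  refine (ENNReal.ofReal_le_iff_le_toReal h.2).1 ?_
  refine le_trans ?_ (le_add_self : _ ≤ CbNorm α f)
  rw [if_neg hα]
  exact le_iSup_of_le x (le_iSup_of_le y (le_iSup_of_le hxy le_rfl))

lemma CbNorm_le {β Λ : ℝ} {v : ES N → ℝ} (hβ : β ≤ 3)
    (h1 : ∀ k ≤ ⌊β⌋₊, ∀ x, ‖iteratedFDeriv ℝ k v x‖ ≤ Λ)
    (h2 : (⌊β⌋₊ : ℝ) ≠ β → ∀ x y, ‖iteratedFDeriv ℝ ⌊β⌋₊ v x - iteratedFDeriv ℝ ⌊β⌋₊ v y‖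
      ≤ Λ * ‖x - y‖ ^ (β - ⌊β⌋₊)) : CbNorm β v ≤ ENNReal.ofReal (5 * Λ) := by
  have hfl : ⌊β⌋₊ ≤ 3 := Nat.floor_le_of_le (by exact_mod_cast hβ)
  have e1 : ∑ k ∈ Finset.range (⌊β⌋₊ + 1), supNormE k v ≤ 4 * ENNReal.ofReal Λ := by
    refine (Finset.sum_le_card_nsmul _ _ (ENNReal.ofReal Λ) fun k hk => iSup_le fun x =>
      ENNReal.ofReal_le_ofReal (h1 k (by have := Finset.mem_range.1 hk; omega) x)).trans ?_
    rw [Finset.card_range, nsmul_eq_mul]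
    gcongr
    exact_mod_cast (by omega : ⌊β⌋₊ + 1 ≤ 4)
  have e2 : (if (⌊β⌋₊ : ℝ) = β then 0 else holderSemiE ⌊β⌋₊ (β - ⌊β⌋₊) v) ≤ ENNReal.ofReal Λ := by
    split_ifs with hβ
    · exact zero_le
    · refine iSup_le fun x => iSup_le fun y => iSup_le fun hxy => ENNReal.ofReal_le_ofReal ?_
      have hd : 0 < ‖x - y‖ := norm_pos_iff.2 (sub_ne_zero.2 hxy)
      rw [div_le_iff₀ (by positivity)]
      exact h2 hβ x y
  refine (add_le_add e1 e2).trans (le_of_eq ?_)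
  rw [ENNReal.ofReal_mul (by norm_num), ENNReal.ofReal_ofNat]
  ring

lemma Hyp.cb_estimate (H : Hyp N T q b c) {α β : ℝ} (hα : 0 ≤ α) (hβ : β ≤ 3) (hαβ : α ≤ β) :
    ∃ C : ℝ, 0 ≤ C ∧ ∀ s f u, IsBCSol q b c s T f u → 0 ≤ s →
    ∀ t, s < t → t ≤ T → ∀ F, CbLe α F f →
      CbNorm β (u t) ≤ ENNReal.ofReal (5 * (C * F * √(t - s) ^ (-(β - α)))) := by
  obtain ⟨C, hC, hest⟩ := H.coordinate_estimates hα
  set S : ℝ := 1 + √T with hS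
  have hS1 : 1 ≤ S := by linarith [Real.sqrt_nonneg T]
  have hS3 : 1 ≤ S ^ (3 : ℝ) := Real.one_le_rpow hS1 (by norm_num)
  have hN1 : (1 : ℝ) ≤ N := by exact_mod_cast H.N_pos
  refine ⟨N ^ 3 * (2 * (C * S ^ (3 : ℝ))), by positivity, ?_⟩
  intro s f u hu hs t hst htT F hf
  have hF := hf.nonneg
  have hr : 0 < √(t - s) := Real.sqrt_pos.2 (sub_pos.2 hst)
  have hrS : √(t - s) ≤ S := by
    have : √(t - s) ≤ √T := Real.sqrt_le_sqrt (by linarith)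
    linarith
  have hut : ContDiff ℝ 2 (u t) := hu.2.2.1 t ⟨hst, htT⟩
  have hcd : ∀ k : ℕ, k ≤ 2 → ContDiff ℝ k (u t) := fun k hk => hut.of_le (by exact_mod_cast hk)
  have hfl : (⌊β⌋₊ : ℝ) ≤ β := Nat.floor_le (hα.trans hαβ)
  have hfl3 : ⌊β⌋₊ ≤ 3 := Nat.floor_le_of_le (by exact_mod_cast hβ)
  have hkey := hest s f u hu hs t hst htT F hf
  set r := √(t - s) with hrdef
  set E : ℝ := C * F * r ^ (-(β - α)) with hE
  have hE0 : 0 ≤ E := by positivity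
  have hNk : ∀ k : ℕ, k ≤ 3 → ∀ X Y : ℝ, 0 ≤ X → X ≤ Y → (N : ℝ) ^ k * X ≤ N ^ 3 * Y :=
    fun k hk X Y hX hXY => mul_le_mul (pow_le_pow_right₀ hN1 hk) hXY hX (by positivity)
  have hΛ : (N : ℝ) ^ 3 * (2 * (C * S ^ (3 : ℝ))) * F * r ^ (-(β - α))
      = N ^ 3 * (2 * (S ^ (3 : ℝ) * E)) := by rw [hE]; ring
  have hES : E ≤ S ^ (3 : ℝ) * E := le_mul_of_one_le_left hE0 hS3
  rw [hΛ]
  refine CbNorm_le hβ (fun k hk x => ?_) fun hβn x y => ?_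
  · have hkβ : (k : ℝ) ≤ β := (Nat.cast_le.2 hk).trans hfl
    rcases Nat.lt_or_ge 2 k with hk2 | hk2
    · obtain rfl : k = 3 := by omega
      have hβ3 : β = 3 := le_antisymm hβ (by exact_mod_cast hkβ)
      rw [← norm_fderiv_iteratedFDeriv]
      refine norm_fderiv_le_of_lip' ℝ (by positivity) (Eventually.of_forall fun y => ?_)
      have h1 : ∀ I : IX N 2, |DI 2 I (u t) y - DI 2 I (u t) x| ≤ E * ‖y - x‖ := fun I => by
        have := ((hkey 2 le_rfl I).2 y x).1
        rwa [max_eq_right (by push_cast; linarith), show ((2 : ℕ) : ℝ) + 1 - α = β - α by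
          push_cast; linarith] at this
      refine (norm_iteratedFDeriv_sub_le (hcd 2 le_rfl) (by positivity) h1).trans ?_
      rw [mul_assoc ((N : ℝ) ^ 3)]
      refine hNk 2 (by norm_num) _ _ (by positivity) ?_
      exact mul_le_mul_of_nonneg_right (by linarith) (norm_nonneg _)
    · have h1 : ∀ I : IX N k, |DI k I (u t) x| ≤ S ^ (3 : ℝ) * E := fun I => by
        refine ((hkey k hk2 I).1 x).trans ?_
        have := rpow_neg_le (p := max 0 ((k : ℝ) - α)) (p' := β - α) hr hrS hS1 (le_max_left _ _)
          (max_le (by linarith) (by linarith)) (by linarith)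
        calc _ ≤ C * F * (S ^ (3 : ℝ) * r ^ (-(β - α))) :=
              mul_le_mul_of_nonneg_left this (by positivity)
          _ = _ := by rw [hE]; ring
      exact (norm_iteratedFDeriv_le (hcd k hk2) (by positivity) h1).trans
        (hNk k (by omega) _ _ (by positivity) (by linarith))
  · set m := ⌊β⌋₊ with hm
    have hlt : (m : ℝ) < β := lt_of_le_of_ne hfl hβn
    have hlt1 : β < m + 1 := Nat.lt_floor_add_one β
    have hm2 : m ≤ 2 := by
      have : (m : ℝ) < 3 := by linarith
      have : m < 3 := by exact_mod_cast this
      omega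
    rcases eq_or_ne x y with rfl | hxy
    · rw [sub_self, norm_zero]; positivity
    have hd : 0 < ‖x - y‖ := norm_pos_iff.2 (sub_ne_zero.2 hxy)
    set d := ‖x - y‖ with hddef
    have h1 : ∀ I : IX N m, |DI m I (u t) x - DI m I (u t) y| ≤ 2 * (E * d ^ (β - m)) := by
      intro I
      obtain ⟨k1, k2⟩ := hkey m hm2 I
      have hEd : 0 ≤ E * d ^ (β - m) := by positivity
      rcases le_or_gt d r with hdr | hdr
      · have h3 := (k2 x y).1
        rw [max_eq_right (by linarith)] at h3
        have e1 : d = d ^ (β - m) * d ^ (m + 1 - β) := by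
          rw [← Real.rpow_add hd, sub_add_sub_cancel', add_sub_cancel_left, Real.rpow_one]
        have e2 : d ^ (m + 1 - β) ≤ r ^ (m + 1 - β) :=
          Real.rpow_le_rpow hd.le hdr (by linarith)
        have e3 : r ^ (-((m : ℝ) + 1 - α)) * r ^ ((m : ℝ) + 1 - β) = r ^ (-(β - α)) := by
          rw [← Real.rpow_add hr]; congr 1; ring
        calc _ ≤ C * F * r ^ (-((m : ℝ) + 1 - α)) * d := h3
          _ = C * F * r ^ (-((m : ℝ) + 1 - α)) * (d ^ (β - m) * d ^ (m + 1 - β)) := by rw [← e1]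
          _ ≤ C * F * r ^ (-((m : ℝ) + 1 - α)) * (d ^ (β - m) * r ^ (m + 1 - β)) := by gcongr
          _ = C * F * (r ^ (-((m : ℝ) + 1 - α)) * r ^ ((m : ℝ) + 1 - β)) * d ^ (β - m) := by ring
          _ = E * d ^ (β - m) := by rw [e3]
          _ ≤ _ := by linarith
      · rcases le_or_gt α m with hαm | hαm
        · have h3 := (abs_sub _ _).trans (add_le_add (k1 x) (k1 y))
          rw [max_eq_right (by linarith)] at h3
          have e1 : r ^ (-((m : ℝ) - α)) = r ^ (-(β - α)) * r ^ (β - m) := by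
            rw [← Real.rpow_add hr]; congr 1; ring
          have e2 : r ^ (β - m) ≤ d ^ (β - m) := Real.rpow_le_rpow hr.le hdr.le (by linarith)
          calc _ ≤ 2 * (C * F * r ^ (-((m : ℝ) - α))) := by linarith
            _ = 2 * (E * r ^ (β - m)) := by rw [e1, hE]; ring
            _ ≤ _ := by gcongr
        · have hαfl : ⌊α⌋₊ = m := (Nat.floor_eq_iff hα).2 ⟨hαm.le, by linarith⟩
          have h3 := (k2 x y).2 hαfl hαm
          have e1 : d ^ (α - m) = d ^ (-(β - α)) * d ^ (β - m) := by
            rw [← Real.rpow_add hd]; congr 1; ring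
          have e2 : d ^ (-(β - α)) ≤ r ^ (-(β - α)) :=
            Real.rpow_le_rpow_of_nonpos hr hdr.le (by linarith)
          calc _ ≤ C * F * d ^ (α - m) := h3
            _ = C * F * d ^ (-(β - α)) * d ^ (β - m) := by rw [e1]; ring
            _ ≤ C * F * r ^ (-(β - α)) * d ^ (β - m) := by gcongr
            _ ≤ _ := by linarith
    refine (norm_iteratedFDeriv_sub_le (hcd m hm2) (by positivity) h1).trans ?_
    rw [mul_assoc ((N : ℝ) ^ 3)]
    refine hNk m (by omega) _ _ (by positivity) ?_
    have := mul_le_mul_of_nonneg_right hES (by positivity : 0 ≤ d ^ (β - m))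
    linarith

end final

/-- Theorem `C0-C3`, uniform gradient estimates. Under Hypotheses (H), for all
`α, β ∈ [0,3]` with `α ≤ β` there is `C = C(α,β) > 0` such that, for every `s ∈ [0,T)`, every
`f ∈ C^α_b(ℝ^N)` and the (unique) bounded classical solution `u` of `D_t u = 𝒜 u`, `u(s,·)=f`,
`‖u(t,·)‖_{C^β_b} ≤ C (t-s)^{-(β-α)/2} ‖f‖_{C^α_b}` for all `t ∈ (s,T]`. -/
theorem uniform_derivative_estimates {N : ℕ} {T : ℝ} {q : ℝ → ES N → Fin N → Fin N → ℝ}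
    {b : ℝ → ES N → Fin N → ℝ} {c : ℝ → ES N → ℝ} (H : Hyp N T q b c) :
    ∀ α β : ℝ, α ∈ Icc (0:ℝ) 3 → β ∈ Icc (0:ℝ) 3 → α ≤ β →
      ∃ C > (0:ℝ), ∀ s ∈ Ico (0:ℝ) T, ∀ f : ES N → ℝ, MemCb α f →
        ∀ u : ℝ → ES N → ℝ, IsBCSol q b c s T f u → ∀ t ∈ Ioc s T,
          CbNorm β (u t) ≤ ENNReal.ofReal (C * (t - s) ^ (-(β - α) / 2)) * CbNorm α f := by
  intro α β hα hβ hαβ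
  obtain ⟨C, hC, hest⟩ := H.cb_estimate hα.1 hβ.2 hαβ
  refine ⟨5 * C + 1, by positivity, fun s hs f hf u hu t ht => ?_⟩
  have hτ : 0 < t - s := sub_pos.2 ht.1
  refine (hest s f u hu hs.1 t ht.1 ht.2 _ hf.cbLe).trans ?_
  have hF : CbNorm α f = ENNReal.ofReal (CbNorm α f).toReal := (ENNReal.ofReal_toReal hf.2).symm
  conv_rhs => rw [hF]
  rw [← ENNReal.ofReal_mul (by positivity)]
  refine ENNReal.ofReal_le_ofReal ?_
  have e : √(t - s) ^ (-(β - α)) = (t - s) ^ (-(β - α) / 2) := by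
    rw [Real.sqrt_eq_rpow, ← Real.rpow_mul hτ.le]; congr 1; ring
  rw [e]
  have : 0 ≤ (t - s) ^ (-(β - α) / 2) * (CbNorm α f).toReal := by positivity
  linarith
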